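/- (Maynard–Tao, tuple form used in the paper) For all natural numbers a ≥ 2, b ≥ 0 and m ≥ 1, there exists a natural number s such that there are infinitely many natural numbers n for which at least m of the s numbers a^{b+1}n + 1, a^{b+2}n + 1, ..., a^{b+s}n + 1 are prime. -/

import Mathlib

section

open Finset ArithmeticFunction

/-- Twisting an arithmetic function by a completely multiplicative function. -/
def ArithmeticFunction.twist (a : ArithmeticFunction ℂ) (f : ℕ →* ℂ) : ArithmeticFunction ℂ :=
  ⟨fun n => a n * f n, by simp⟩

lemma ArithmeticFunction.twist_apply (a : ArithmeticFunction ℂ) (f : ℕ →* ℂ) (n : ℕ) :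
    a.twist f n = a n * f n := rfl

lemma ArithmeticFunction.twist_mul (a b : ArithmeticFunction ℂ) (f : ℕ →* ℂ) :
    (a * b).twist f = a.twist f * b.twist f := by
  ext n
  simp only [twist_apply, mul_apply, sum_mul]
  refine sum_congr rfl fun x hx => ?_
  rw [← (Nat.mem_divisorsAntidiagonal.1 hx).1, map_mul]
  ring

lemma sum_Ioc_mul_twist (a b : ArithmeticFunction ℂ) (f : ℕ →* ℂ) (x : ℕ) :
    ∑ n ∈ Ioc 0 x, (a * b) n * f n =
      ∑ m ∈ Ioc 0 x, a m * f m * ∑ n ∈ Ioc 0 (x / m), b n * f n := by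
  have := sum_Ioc_mul_eq_sum_sum (a.twist f) (b.twist f) x
  rw [← twist_mul] at this
  exact this

lemma norm_abel_aux (w : ℕ → ℝ) (hw : Monotone w) (g : ℕ → ℂ) (u : ℕ) (B : ℝ)
    (hB : ∀ y, ‖∑ n ∈ Ioc u y, g n‖ ≤ B) (M : ℕ) (hM : u ≤ M) :
    ‖(w M : ℂ) * ∑ n ∈ Ioc u M, g n - ∑ n ∈ Ioc u M, (w n : ℂ) * g n‖ ≤ B * (w M - w u) := by
  induction M, hM using Nat.le_induction with
  | base => simp
  | succ M hM ih =>
    rw [sum_Ioc_succ_top (by omega), sum_Ioc_succ_top (by omega)]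
    have e : (w (M + 1) : ℂ) * (∑ n ∈ Ioc u M, g n + g (M + 1)) -
        (∑ n ∈ Ioc u M, (w n : ℂ) * g n + w (M + 1) * g (M + 1)) =
        ((w M : ℂ) * ∑ n ∈ Ioc u M, g n - ∑ n ∈ Ioc u M, (w n : ℂ) * g n) +
        ((w (M + 1) - w M : ℝ) : ℂ) * ∑ n ∈ Ioc u M, g n := by
      push_cast; ring
    rw [e]
    refine (norm_add_le _ _).trans ?_
    rw [norm_mul, Complex.norm_real, Real.norm_of_nonneg (sub_nonneg.2 (hw (Nat.le_succ M)))]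
    have h1 := hB M
    have h2 := sub_nonneg.2 (hw (Nat.le_succ M))
    have := mul_le_mul_of_nonneg_left h1 h2
    simp only [Nat.succ_eq_add_one] at *
    linarith

/-- Partial summation against a monotone nonnegative weight. -/
lemma norm_sum_monotone_mul_le (w : ℕ → ℝ) (hw : Monotone w) (hw0 : ∀ n, 0 ≤ w n) (g : ℕ → ℂ)
    (u : ℕ) (B : ℝ) (hB : ∀ y, ‖∑ n ∈ Ioc u y, g n‖ ≤ B) (M : ℕ) :
    ‖∑ n ∈ Ioc u M, (w n : ℂ) * g n‖ ≤ 2 * B * w M := by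
  have hB0 : 0 ≤ B := (norm_nonneg _).trans (hB 0)
  rcases le_total u M with h | h
  · have h1 := norm_abel_aux w hw g u B hB M h
    have h2 : ‖(w M : ℂ) * ∑ n ∈ Ioc u M, g n‖ ≤ w M * B := by
      rw [norm_mul, Complex.norm_real, Real.norm_of_nonneg (hw0 M)]
      exact mul_le_mul_of_nonneg_left (hB M) (hw0 M)
    have h3 := norm_sub_norm_le (∑ n ∈ Ioc u M, (w n : ℂ) * g n) ((w M : ℂ) * ∑ n ∈ Ioc u M, g n)
    rw [norm_sub_rev] at h3
    nlinarith [mul_nonneg hB0 (hw0 u)]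
  · rw [Ioc_eq_empty_of_le h]
    simp only [sum_empty, norm_zero]
    have := hw0 M
    positivity

/-- Large sieve for a family of nearly orthogonal functions, by duality. -/
lemma large_sieve {ι : Type*} [Fintype ι] (f : ι → ℕ → ℂ) (hf1 : ∀ i n, ‖f i n‖ ≤ 1) (D : ℝ)
    (y : ℕ) (hD : ∀ i j, i ≠ j → ‖∑ n ∈ Ioc 0 y, f i n * starRingEnd ℂ (f j n)‖ ≤ D)
    (hD0 : 0 ≤ D) (β : ℕ → ℂ) :
    ∑ i, ‖∑ n ∈ Ioc 0 y, β n * f i n‖ ^ 2 ≤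
      (y + Fintype.card ι * D) * ∑ n ∈ Ioc 0 y, ‖β n‖ ^ 2 := by
  classical
  set c : ι → ℂ := fun i => ∑ n ∈ Ioc 0 y, β n * f i n with hc
  set S : ℝ := ∑ i, ‖c i‖ ^ 2 with hS
  set N : ℝ := ∑ n ∈ Ioc 0 y, ‖β n‖ ^ 2 with hN
  have hS0 : 0 ≤ S := sum_nonneg fun i _ => by positivity
  have hN0 : 0 ≤ N := sum_nonneg fun i _ => by positivity
  set h : ℕ → ℂ := fun n => ∑ i, starRingEnd ℂ (c i) * f i n with hh
  have e1 : (S : ℂ) = ∑ n ∈ Ioc 0 y, β n * h n := by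
    rw [hS, hh]
    push_cast
    simp_rw [mul_sum]
    rw [sum_comm]
    refine sum_congr rfl fun i _ => ?_
    rw [← Complex.conj_mul', hc]
    simp only
    rw [mul_sum]
    exact sum_congr rfl fun n _ => by ring
  have e2 : S ≤ ∑ n ∈ Ioc 0 y, ‖β n‖ * ‖h n‖ := by
    have : ‖(S : ℂ)‖ ≤ ∑ n ∈ Ioc 0 y, ‖β n‖ * ‖h n‖ := by
      rw [e1]
      refine (norm_sum_le _ _).trans (sum_le_sum fun n _ => (norm_mul _ _).le)
    rwa [Complex.norm_real, Real.norm_of_nonneg hS0] at this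
  have e3 : S ^ 2 ≤ N * ∑ n ∈ Ioc 0 y, ‖h n‖ ^ 2 :=
    (pow_le_pow_left₀ hS0 e2 2).trans (sum_mul_sq_le_sq_mul_sq _ _ _)
  have e4 : ∑ n ∈ Ioc 0 y, ‖h n‖ ^ 2 ≤ (y + Fintype.card ι * D) * S := by
    have e5 : ((∑ n ∈ Ioc 0 y, ‖h n‖ ^ 2 : ℝ) : ℂ) =
        ∑ i, ∑ j, starRingEnd ℂ (c i) * c j *
          ∑ n ∈ Ioc 0 y, f i n * starRingEnd ℂ (f j n) := by
      push_cast
      simp_rw [← Complex.mul_conj', hh, map_sum, map_mul, Complex.conj_conj, sum_mul_sum, mul_sum]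
      rw [sum_comm]
      refine sum_congr rfl fun i _ => ?_
      rw [sum_comm]
      refine sum_congr rfl fun j _ => sum_congr rfl fun n _ => by ring
    have e6 : ∑ n ∈ Ioc 0 y, ‖h n‖ ^ 2 ≤ ∑ i, ∑ j, ‖c i‖ * ‖c j‖ * (if i = j then (y : ℝ) else D) := by
      have : ‖((∑ n ∈ Ioc 0 y, ‖h n‖ ^ 2 : ℝ) : ℂ)‖ ≤
          ∑ i, ∑ j, ‖c i‖ * ‖c j‖ * (if i = j then (y : ℝ) else D) := by
        rw [e5]
        refine (norm_sum_le _ _).trans (sum_le_sum fun i _ => (norm_sum_le _ _).trans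
          (sum_le_sum fun j _ => ?_))
        rw [norm_mul, norm_mul, RCLike.norm_conj]
        refine mul_le_mul_of_nonneg_left ?_ (by positivity)
        split_ifs with hij
        · subst hij
          refine (norm_sum_le _ _).trans ?_
          refine (sum_le_sum (g := fun _ => (1 : ℝ)) fun n _ => ?_).trans (by simp)
          rw [norm_mul, RCLike.norm_conj]
          exact mul_le_one₀ (hf1 _ _) (norm_nonneg _) (hf1 _ _)
        · exact hD i j hij
      rwa [Complex.norm_real, Real.norm_of_nonneg (sum_nonneg fun i _ => by positivity)] at this
    refine e6.trans ?_
    have e7 : ∀ i j, ‖c i‖ * ‖c j‖ * (if i = j then (y : ℝ) else D) ≤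
        (if i = j then (y : ℝ) * ‖c i‖ ^ 2 else 0) + D * ((‖c i‖ ^ 2 + ‖c j‖ ^ 2) / 2) := by
      intro i j
      split_ifs with hij
      · subst hij
        nlinarith [mul_nonneg hD0 (sq_nonneg ‖c i‖)]
      · nlinarith [mul_nonneg hD0 (sq_nonneg (‖c i‖ - ‖c j‖))]
    refine (sum_le_sum fun i _ => sum_le_sum fun j _ => e7 i j).trans (le_of_eq ?_)
    simp_rw [sum_add_distrib, ← mul_sum, ← sum_div, sum_add_distrib]
    simp only [sum_ite_eq, mem_univ, if_true, sum_const, card_univ, nsmul_eq_mul, ← mul_sum]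
    rw [← hS]
    ring
  have e8 : S ^ 2 ≤ N * ((y + Fintype.card ι * D) * S) := e3.trans (mul_le_mul_of_nonneg_left e4 hN0)
  rcases hS0.eq_or_lt with h0 | h0
  · rw [← h0]; positivity
  · nlinarith

lemma harmonic_le (y : ℕ) : ∑ n ∈ Ioc 0 y, (1 : ℝ) / n ≤ 1 + Real.log y := by
  have := harmonic_le_one_add_log y
  rw [harmonic_eq_sum_Icc] at this
  push_cast at this
  have e : Icc 1 y = Ioc 0 y := rfl
  rw [e] at this
  simpa using this

lemma sum_sq_card_divisors_le (y : ℕ) :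
    ∑ n ∈ Ioc 0 y, ((n.divisors.card : ℝ)) ^ 2 ≤ y * (1 + Real.log y) ^ 3 := by
  set H := ∑ n ∈ Ioc 0 y, (1 : ℝ) / n
  have hH : 0 ≤ H := sum_nonneg fun i _ => by positivity
  have step : ∑ n ∈ Ioc 0 y, ((n.divisors.card : ℝ)) ^ 2 ≤ y * H ^ 3 := by
    have e1 : ∀ n ∈ Ioc 0 y, ((n.divisors.card : ℝ)) ^ 2 =
        ∑ d ∈ Ioc 0 y, ∑ e ∈ Ioc 0 y, if d ∣ n ∧ e ∣ n then (1 : ℝ) else 0 := by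
      intro n hn
      rw [mem_Ioc] at hn
      have : (n.divisors.card : ℝ) = ∑ d ∈ Ioc 0 y, if d ∣ n then (1 : ℝ) else 0 := by
        rw [sum_ite, sum_const_zero, add_zero, sum_const, nsmul_eq_mul, mul_one]
        congr 2
        ext d
        simp only [Nat.mem_divisors, mem_filter, mem_Ioc]
        constructor
        · rintro ⟨h1, h2⟩
          exact ⟨⟨Nat.pos_of_dvd_of_pos h1 hn.1, (Nat.le_of_dvd hn.1 h1).trans hn.2⟩, h1⟩
        · rintro ⟨-, h⟩
          exact ⟨h, by omega⟩
      rw [this, sq, sum_mul_sum]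
      refine sum_congr rfl fun d _ => sum_congr rfl fun e _ => ?_
      by_cases h1 : d ∣ n <;> by_cases h2 : e ∣ n <;> simp [h1, h2]
    rw [sum_congr rfl e1, sum_comm]
    have e2 : ∀ d ∈ Ioc 0 y, ∀ e ∈ Ioc 0 y, ∑ n ∈ Ioc 0 y, (if d ∣ n ∧ e ∣ n then (1 : ℝ) else 0) ≤
        y * ∑ g ∈ Ioc 0 y, if g ∣ d ∧ g ∣ e then (g : ℝ) / (d * e) else 0 := by
      intro d hd e he
      rw [mem_Ioc] at hd he
      have hl : 0 < Nat.lcm d e := Nat.lcm_pos hd.1 he.1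
      have : ∑ n ∈ Ioc 0 y, (if d ∣ n ∧ e ∣ n then (1 : ℝ) else 0) ≤ y / Nat.lcm d e := by
        rw [sum_ite, sum_const_zero, add_zero, sum_const, nsmul_eq_mul, mul_one]
        simp_rw [← Nat.lcm_dvd_iff]
        rw [Nat.Ioc_filter_dvd_card_eq_div]
        exact Nat.cast_div_le
      refine this.trans ?_
      rw [div_eq_mul_inv]
      refine mul_le_mul_of_nonneg_left ?_ (Nat.cast_nonneg y)
      have hg : Nat.gcd d e ∈ Ioc 0 y := by
        rw [mem_Ioc]
        exact ⟨Nat.gcd_pos_of_pos_left _ hd.1, (Nat.gcd_le_left _ hd.1).trans hd.2⟩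
      refine le_trans (le_of_eq ?_) (single_le_sum (f := fun g => if g ∣ d ∧ g ∣ e then (g : ℝ) / (d * e) else 0)
        (fun g _ => by split_ifs <;> positivity) hg)
      simp only [Nat.gcd_dvd_left, Nat.gcd_dvd_right, and_self, if_true]
      have := Nat.gcd_mul_lcm d e
      have h' : ((Nat.gcd d e : ℝ)) * Nat.lcm d e = d * e := by exact_mod_cast this
      have hd' : (d : ℝ) ≠ 0 := by exact_mod_cast hd.1.ne'
      have he' : (e : ℝ) ≠ 0 := by exact_mod_cast he.1.ne'
      have hl' : (Nat.lcm d e : ℝ) ≠ 0 := by exact_mod_cast hl.ne'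
      rw [← h']
      have : (Nat.gcd d e : ℝ) ≠ 0 := by
        intro h0; rw [h0, zero_mul] at h'; exact mul_ne_zero hd' he' h'.symm
      field_simp
    have e3 : ∀ g ∈ Ioc 0 y, ∑ d ∈ Ioc 0 y, (if g ∣ d then (1 : ℝ) / d else 0) ≤ H / g := by
      intro g hg
      rw [mem_Ioc] at hg
      rw [← sum_filter]
      have hg' : (g : ℝ) ≠ 0 := by exact_mod_cast hg.1.ne'
      calc ∑ d ∈ (Ioc 0 y).filter (g ∣ ·), (1 : ℝ) / d
          ≤ ∑ d ∈ (Ioc 0 y).image (g * ·), (1 : ℝ) / d := by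
            refine sum_le_sum_of_subset_of_nonneg ?_ fun _ _ _ => by positivity
            intro d hd
            rw [mem_filter, mem_Ioc] at hd
            obtain ⟨⟨h1, h2⟩, c, rfl⟩ := hd
            rw [mem_image]
            refine ⟨c, mem_Ioc.2 ⟨Nat.pos_of_mul_pos_left h1, ?_⟩, rfl⟩
            nlinarith [hg.1]
        _ = ∑ c ∈ Ioc 0 y, (1 : ℝ) / ((g * c : ℕ) : ℝ) := by
            rw [sum_image]
            intro a _ b _ h
            exact Nat.eq_of_mul_eq_mul_left hg.1 h
        _ = H / g := by
            rw [sum_div]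
            refine sum_congr rfl fun c _ => ?_
            push_cast
            rw [div_div, mul_comm]
    calc ∑ d ∈ Ioc 0 y, ∑ n ∈ Ioc 0 y, ∑ e ∈ Ioc 0 y, (if d ∣ n ∧ e ∣ n then (1 : ℝ) else 0)
        = ∑ d ∈ Ioc 0 y, ∑ e ∈ Ioc 0 y, ∑ n ∈ Ioc 0 y, (if d ∣ n ∧ e ∣ n then (1 : ℝ) else 0) :=
          sum_congr rfl fun d _ => sum_comm
      _ ≤ ∑ d ∈ Ioc 0 y, ∑ e ∈ Ioc 0 y, y * ∑ g ∈ Ioc 0 y,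
            (if g ∣ d ∧ g ∣ e then (g : ℝ) / (d * e) else 0) :=
          sum_le_sum fun d hd => sum_le_sum fun e he => e2 d hd e he
      _ = y * ∑ g ∈ Ioc 0 y, (g : ℝ) * (∑ d ∈ Ioc 0 y, (if g ∣ d then (1 : ℝ) / d else 0)) ^ 2 := by
          simp_rw [← mul_sum]
          congr 1
          simp_rw [sq, sum_mul_sum, mul_sum]
          rw [sum_comm, sum_comm' (t' := Ioc 0 y) (s' := fun _ => Ioc 0 y) (by simp)]
          rw [sum_comm]
          conv_rhs => rw [sum_comm]
          refine sum_congr rfl fun d _ => ?_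
          rw [sum_comm]
          refine sum_congr rfl fun g _ => sum_congr rfl fun e _ => ?_
          by_cases h1 : g ∣ d <;> by_cases h2 : g ∣ e <;> simp [h1, h2]
          field_simp
      _ ≤ y * ∑ g ∈ Ioc 0 y, (g : ℝ) * (H / g) ^ 2 := by
          refine mul_le_mul_of_nonneg_left (sum_le_sum fun g hg => ?_) (Nat.cast_nonneg y)
          refine mul_le_mul_of_nonneg_left (pow_le_pow_left₀ ?_ (e3 g hg) 2) (Nat.cast_nonneg g)
          exact sum_nonneg fun d _ => by split_ifs <;> positivity
      _ = y * H ^ 3 := by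
          congr 1
          rw [pow_succ H 2]
          simp only [H]
          rw [mul_sum]
          refine sum_congr rfl fun g hg => ?_
          have hg' : (g : ℝ) ≠ 0 := by
            rw [mem_Ioc] at hg; exact_mod_cast hg.1.ne'
          field_simp
  refine step.trans ?_
  exact mul_le_mul_of_nonneg_left (pow_le_pow_left₀ hH (harmonic_le y) 3) (Nat.cast_nonneg y)

end

section

open Finset ArithmeticFunction
open scoped ArithmeticFunction.zeta ArithmeticFunction.Moebius

lemma one_add_log_mono {y x : ℕ} (h : y ≤ x) : 1 + Real.log y ≤ 1 + Real.log x := by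
  rcases Nat.eq_zero_or_pos y with rfl | h0
  · simp [Real.log_natCast_nonneg]
  · have : Real.log y ≤ Real.log x := Real.log_le_log (by exact_mod_cast h0) (by exact_mod_cast h)
    linarith

lemma sum_sq_le_of_norm_le_card_divisors {β : ℕ → ℂ} (hβ : ∀ n, ‖β n‖ ≤ n.divisors.card)
    {x y : ℕ} (hyx : y ≤ x) :
    ∑ n ∈ Ioc 0 y, ‖β n‖ ^ 2 ≤ y * (1 + Real.log x) ^ 3 := by
  refine (sum_le_sum fun n _ => pow_le_pow_left₀ (norm_nonneg _) (hβ n) 2).trans ?_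
  refine (sum_sq_card_divisors_le y).trans ?_
  have := one_add_log_mono hyx
  have h0 := Real.log_natCast_nonneg y
  gcongr

lemma bilinear_off_diagonal (g : ℕ → ℂ) (B : ℝ) (U x : ℕ) (hU : 0 < U)
    (hg : ∀ y, ‖∑ n ∈ Ioc U y, g n‖ ≤ B) (b b' : ℕ → ℂ)
    (hb : ∀ n, ‖b n‖ ≤ n.divisors.card) (hb' : ∀ n, ‖b' n‖ ≤ n.divisors.card) :
    ‖∑ m ∈ Ioc U (x / U), (m : ℂ) * g m *
      ((∑ n ∈ Ioc 0 (x / m), b n) * ∑ n ∈ Ioc 0 (x / m), b' n)‖ ≤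
      2 * B * x * ((x / U : ℕ) * (1 + Real.log x) ^ 4) := by
  set Y := x / U with hY
  have hYx : Y ≤ x := Nat.div_le_self _ _
  have hB0 : 0 ≤ B := (norm_nonneg _).trans (hg 0)
  have key : ∀ n n', 0 < n → 0 < n' → ‖∑ m ∈ (Ioc U Y).filter (fun m => n * m ≤ x ∧ n' * m ≤ x), (m : ℂ) * g m‖ ≤
      2 * B * (x / (max n n' : ℕ)) := by
    intro n n' hn hn'
    have e : (Ioc U Y).filter (fun m => n * m ≤ x ∧ n' * m ≤ x) =
        Ioc U (min Y (x / max n n')) := by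
      ext m
      simp only [mem_filter, mem_Ioc, le_min_iff]
      rw [Nat.le_div_iff_mul_le (show 0 < max n n' by omega)]
      rcases le_total n n' with h | h
      · rw [max_eq_right h]
        constructor
        · rintro ⟨⟨h1, h2⟩, h3, h4⟩; exact ⟨h1, h2, by linarith⟩
        · rintro ⟨h1, h2, h3⟩; exact ⟨⟨h1, h2⟩, by nlinarith, by linarith⟩
      · rw [max_eq_left h]
        constructor
        · rintro ⟨⟨h1, h2⟩, h3, h4⟩; exact ⟨h1, h2, by linarith⟩
        · rintro ⟨h1, h2, h3⟩; exact ⟨⟨h1, h2⟩, by linarith, by nlinarith⟩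
    rw [e]
    have := norm_sum_monotone_mul_le (fun n => (n : ℝ)) Nat.mono_cast (fun n => Nat.cast_nonneg n)
      g U B hg (min Y (x / max n n'))
    simp only [Complex.ofReal_natCast] at this
    refine this.trans (mul_le_mul_of_nonneg_left ?_ (by positivity))
    refine le_trans ?_ Nat.cast_div_le
    exact_mod_cast min_le_right _ _
  have e1 : ∑ m ∈ Ioc U Y, (m : ℂ) * g m * ((∑ n ∈ Ioc 0 (x / m), b n) * ∑ n ∈ Ioc 0 (x / m), b' n)
      = ∑ n ∈ Ioc 0 Y, ∑ n' ∈ Ioc 0 Y, b n * b' n' *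
        ∑ m ∈ (Ioc U Y).filter (fun m => n * m ≤ x ∧ n' * m ≤ x), (m : ℂ) * g m := by
    have e2 : ∀ m ∈ Ioc U Y, Ioc 0 (x / m) = (Ioc 0 Y).filter (fun n => n * m ≤ x) := by
      intro m hm
      rw [mem_Ioc] at hm
      ext n
      simp only [mem_filter, mem_Ioc]
      rw [Nat.le_div_iff_mul_le (by omega)]
      constructor
      · rintro ⟨h1, h2⟩
        refine ⟨⟨h1, ?_⟩, h2⟩
        rw [hY, Nat.le_div_iff_mul_le hU]
        nlinarith
      · rintro ⟨⟨h1, -⟩, h2⟩; exact ⟨h1, h2⟩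
    rw [sum_congr rfl fun m hm => by rw [e2 m hm]]
    simp_rw [sum_filter, sum_mul_sum, mul_sum]
    rw [sum_comm]
    refine sum_congr rfl fun n _ => ?_
    rw [sum_comm]
    refine sum_congr rfl fun n' _ => sum_congr rfl fun m _ => ?_
    by_cases h1 : n * m ≤ x <;> by_cases h2 : n' * m ≤ x <;> simp [h1, h2]
    ring
  rw [e1]
  have hb2 := sum_sq_le_of_norm_le_card_divisors hb hYx
  have hb2' := sum_sq_le_of_norm_le_card_divisors hb' hYx
  have hH : ∑ n ∈ Ioc 0 Y, (1 : ℝ) / n ≤ 1 + Real.log x := (harmonic_le Y).trans (one_add_log_mono hYx)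
  have hH0 : 0 ≤ ∑ n ∈ Ioc 0 Y, (1 : ℝ) / n := sum_nonneg fun i _ => by positivity
  have hL : 0 ≤ Real.log x := Real.log_natCast_nonneg x
  calc _ ≤ ∑ n ∈ Ioc 0 Y, ∑ n' ∈ Ioc 0 Y, 2 * B * x * ((‖b n‖ ^ 2 * (1 / n') + (1 / n) * ‖b' n'‖ ^ 2) / 2) := by
        refine (norm_sum_le _ _).trans (sum_le_sum fun n hn => (norm_sum_le _ _).trans
          (sum_le_sum fun n' hn' => ?_))
        rw [mem_Ioc] at hn hn'
        rw [norm_mul, norm_mul]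
        refine (mul_le_mul_of_nonneg_left (key n n' hn.1 hn'.1) (by positivity)).trans ?_
        have h1 : (1 : ℝ) / (max n n' : ℕ) ≤ 1 / n := by
          have : (n : ℝ) ≤ (max n n' : ℕ) := by exact_mod_cast le_max_left _ _
          have h0 : (0 : ℝ) < n := by exact_mod_cast hn.1
          exact one_div_le_one_div_of_le h0 this
        have h2 : (1 : ℝ) / (max n n' : ℕ) ≤ 1 / n' := by
          have : (n' : ℝ) ≤ (max n n' : ℕ) := by exact_mod_cast le_max_right _ _
          have h0 : (0 : ℝ) < n' := by exact_mod_cast hn'.1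
          exact one_div_le_one_div_of_le h0 this
        have h3 : (0 : ℝ) ≤ 1 / (max n n' : ℕ) := by positivity
        set t : ℝ := 1 / (max n n' : ℕ)
        have e : (x : ℝ) / (max n n' : ℕ) = x * t := by rw [div_eq_mul_one_div]
        rw [e]
        have h4 : ‖b n‖ * ‖b' n'‖ * t ≤ (‖b n‖ ^ 2 * (1 / n') + (1 / n) * ‖b' n'‖ ^ 2) / 2 := by
          have a1 : ‖b n‖ ^ 2 * t ≤ ‖b n‖ ^ 2 * (1 / n') := mul_le_mul_of_nonneg_left h2 (sq_nonneg _)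
          have a2 : t * ‖b' n'‖ ^ 2 ≤ (1 / n) * ‖b' n'‖ ^ 2 := mul_le_mul_of_nonneg_right h1 (sq_nonneg _)
          nlinarith [mul_nonneg h3 (sq_nonneg (‖b n‖ - ‖b' n'‖))]
        have h5 : 0 ≤ 2 * B * x := by positivity
        calc ‖b n‖ * ‖b' n'‖ * (2 * B * (x * t)) = 2 * B * x * (‖b n‖ * ‖b' n'‖ * t) := by ring
          _ ≤ _ := mul_le_mul_of_nonneg_left h4 h5
    _ = 2 * B * x * (((∑ n ∈ Ioc 0 Y, ‖b n‖ ^ 2) * (∑ n ∈ Ioc 0 Y, (1 : ℝ) / n) +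
          (∑ n ∈ Ioc 0 Y, (1 : ℝ) / n) * ∑ n ∈ Ioc 0 Y, ‖b' n‖ ^ 2) / 2) := by
        rw [sum_mul_sum, sum_mul_sum, ← sum_add_distrib]
        simp_rw [← sum_add_distrib]
        rw [sum_div]
        simp_rw [sum_div]
        rw [mul_sum]
        simp_rw [mul_sum]
    _ ≤ _ := by
        refine mul_le_mul_of_nonneg_left ?_ (by positivity)
        have h1 := mul_le_mul hb2 hH hH0 (by positivity)
        have h2 := mul_le_mul hH hb2' (sum_nonneg fun i _ => by positivity) (by positivity)
        nlinarith

lemma exists_phase (z : ℂ) : ∃ e : ℂ, ‖e‖ ≤ 1 ∧ e * z = ‖z‖ := by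
  rcases eq_or_ne z 0 with rfl | h
  · exact ⟨0, by simp, by simp⟩
  · refine ⟨starRingEnd ℂ z / ‖z‖, ?_, ?_⟩
    · rw [norm_div, RCLike.norm_conj, Complex.norm_real, norm_norm]
      exact div_self_le_one _
    · rw [div_mul_eq_mul_div, Complex.conj_mul']
      have : (‖z‖ : ℂ) ≠ 0 := by exact_mod_cast norm_ne_zero_iff.2 h
      field_simp

lemma bilinear_sum_le {ι : Type*} [Fintype ι] (f : ι → ℕ →* ℂ) (hf1 : ∀ i n, ‖f i n‖ ≤ 1) (D : ℕ)
    (hD1 : 1 ≤ D) (hcard : Fintype.card ι ≤ D)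
    (h2 : ∀ i j, i ≠ j → ∀ y, ‖∑ n ∈ Ioc 0 y, f i n * starRingEnd ℂ (f j n)‖ ≤ D)
    (x : ℕ) (α β : ℕ → ℂ) (hα0 : ∀ n ≤ D ^ 3, α n = 0) (hβ0 : ∀ n ≤ D ^ 3, β n = 0)
    (hα : ∀ n, ‖α n‖ ≤ Real.log n) (hβ : ∀ n, ‖β n‖ ≤ n.divisors.card) :
    ∑ i, ‖∑ m ∈ Ioc 0 x, α m * f i m * ∑ n ∈ Ioc 0 (x / m), β n * f i n‖ ≤
      3 * x * (1 + Real.log x) ^ 4 := by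
  classical
  set U := D ^ 3 with hU
  have hU0 : 0 < U := by positivity
  set Y := x / U with hY
  have hYx : Y ≤ x := Nat.div_le_self _ _
  have hL : 0 ≤ Real.log x := Real.log_natCast_nonneg x
  set L := 1 + Real.log x with hLdef
  have hL1 : 1 ≤ L := by linarith
  set z : ι → ℂ := fun i => ∑ m ∈ Ioc 0 x, α m * f i m * ∑ n ∈ Ioc 0 (x / m), β n * f i n with hz
  choose ε hε1 hε using fun i => exists_phase (z i)
  set Bf : ι → ℕ → ℂ := fun i y => ∑ n ∈ Ioc 0 y, β n * f i n with hBf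
  have hBf0 : ∀ i, ∀ y ≤ U, Bf i y = 0 := by
    intro i y hy
    refine sum_eq_zero fun n hn => ?_
    rw [mem_Ioc] at hn
    rw [hβ0 n (by omega), zero_mul]
  set h : ℕ → ℂ := fun m => ∑ i, ε i * (f i m * Bf i (x / m)) with hh
  set S := ∑ i, ‖z i‖ with hS
  have hS0 : 0 ≤ S := sum_nonneg fun i _ => norm_nonneg _
  have hSub : Ioc U Y ⊆ Ioc 0 x := by
    intro m hm; rw [mem_Ioc] at *; omega
  have hSeq : (S : ℂ) = ∑ m ∈ Ioc U Y, α m * h m := by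
    rw [hS]
    push_cast
    rw [sum_congr rfl fun i _ => (hε i).symm]
    have : ∀ i, z i = ∑ m ∈ Ioc U Y, α m * f i m * Bf i (x / m) := by
      intro i
      refine (sum_subset hSub fun m hm hm' => ?_).symm
      rw [mem_Ioc] at hm hm'
      by_cases hmU : m ≤ U
      · rw [hα0 m hmU]; ring
      · have : x / m ≤ U := by
          have h1 : Y < m := by omega
          rw [hY, Nat.div_lt_iff_lt_mul hU0] at h1
          rw [mul_comm] at h1
          exact ((Nat.div_lt_iff_lt_mul hm.1).2 h1).le
        have := hBf0 i _ this
        simp only [hBf] at this ⊢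
        rw [this, mul_zero]
    simp_rw [this, hh, mul_sum]
    rw [sum_comm]
    exact sum_congr rfl fun m _ => sum_congr rfl fun i _ => by ring
  have hSle : S ≤ ∑ m ∈ Ioc U Y, (‖α m‖ / Real.sqrt m) * (Real.sqrt m * ‖h m‖) := by
    have : ‖(S : ℂ)‖ ≤ ∑ m ∈ Ioc U Y, (‖α m‖ / Real.sqrt m) * (Real.sqrt m * ‖h m‖) := by
      rw [hSeq]
      refine (norm_sum_le _ _).trans (sum_le_sum fun m hm => ?_)
      rw [mem_Ioc] at hm
      have : 0 < Real.sqrt m := Real.sqrt_pos.2 (by exact_mod_cast (by omega : 0 < m))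
      rw [norm_mul]
      apply le_of_eq
      field_simp
    rwa [Complex.norm_real, Real.norm_of_nonneg hS0] at this
  have hS2 : S ^ 2 ≤ (∑ m ∈ Ioc U Y, (‖α m‖ / Real.sqrt m) ^ 2) *
      ∑ m ∈ Ioc U Y, (Real.sqrt m * ‖h m‖) ^ 2 :=
    (pow_le_pow_left₀ hS0 hSle 2).trans (sum_mul_sq_le_sq_mul_sq _ _ _)
  have hharm : ∑ m ∈ Ioc U Y, (1 : ℝ) / m ≤ L := by
    refine (sum_le_sum_of_subset_of_nonneg hSub fun _ _ _ => by positivity).trans (harmonic_le x)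
  have hA : ∑ m ∈ Ioc U Y, (‖α m‖ / Real.sqrt m) ^ 2 ≤ L ^ 3 := by
    calc _ ≤ ∑ m ∈ Ioc U Y, L ^ 2 * ((1 : ℝ) / m) := by
          refine sum_le_sum fun m hm => ?_
          rw [mem_Ioc] at hm
          rw [div_pow, Real.sq_sqrt (Nat.cast_nonneg m), div_eq_mul_one_div]
          refine mul_le_mul_of_nonneg_right (pow_le_pow_left₀ (norm_nonneg _) ((hα m).trans ?_) 2)
            (by positivity)
          have := one_add_log_mono (show m ≤ x by omega)
          linarith
      _ = L ^ 2 * ∑ m ∈ Ioc U Y, (1 : ℝ) / m := by rw [mul_sum]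
      _ ≤ L ^ 2 * L := by gcongr
      _ = L ^ 3 := by ring
  have hHexp : ((∑ m ∈ Ioc U Y, (Real.sqrt m * ‖h m‖) ^ 2 : ℝ) : ℂ) =
      ∑ i, ∑ j, ε i * starRingEnd ℂ (ε j) * ∑ m ∈ Ioc U Y, (m : ℂ) * (f i m * starRingEnd ℂ (f j m)) *
        (Bf i (x / m) * starRingEnd ℂ (Bf j (x / m))) := by
    push_cast
    simp_rw [mul_pow]
    have : ∀ m : ℕ, ((Real.sqrt m : ℂ)) ^ 2 = m := by
      intro m
      rw [← Complex.ofReal_pow, Real.sq_sqrt (Nat.cast_nonneg m), Complex.ofReal_natCast]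
    simp_rw [this, ← Complex.mul_conj', hh, map_sum, map_mul, sum_mul_sum, mul_sum]
    rw [sum_comm]
    refine sum_congr rfl fun i _ => ?_
    rw [sum_comm]
    exact sum_congr rfl fun j _ => sum_congr rfl fun m _ => by ring
  have hoff : ∀ i j, i ≠ j → ‖∑ m ∈ Ioc U Y, (m : ℂ) * (f i m * starRingEnd ℂ (f j m)) *
        (Bf i (x / m) * starRingEnd ℂ (Bf j (x / m)))‖ ≤ 4 * D * x * (Y * L ^ 4) := by
    intro i j hij
    have hg : ∀ y, ‖∑ n ∈ Ioc U y, f i n * starRingEnd ℂ (f j n)‖ ≤ 2 * (D : ℝ) := by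
      intro y
      rcases le_total U y with h | h
      · have e : ∑ n ∈ Ioc U y, f i n * starRingEnd ℂ (f j n) =
            ∑ n ∈ Ioc 0 y, f i n * starRingEnd ℂ (f j n) - ∑ n ∈ Ioc 0 U, f i n * starRingEnd ℂ (f j n) := by
          rw [eq_sub_iff_add_eq', sum_Ioc_consecutive _ (Nat.zero_le U) h]
        rw [e]
        refine (norm_sub_le _ _).trans ?_
        linarith [h2 i j hij y, h2 i j hij U]
      · rw [Ioc_eq_empty_of_le h]; simp
    have := bilinear_off_diagonal (fun n => f i n * starRingEnd ℂ (f j n)) (2 * D) U x hU0 hg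
      (fun n => β n * f i n) (fun n => starRingEnd ℂ (β n * f j n)) ?_ ?_
    · simp only [hBf, map_sum]
      refine this.trans (le_of_eq ?_)
      ring
    · intro n
      rw [norm_mul]
      exact (mul_le_of_le_one_right (norm_nonneg _) (hf1 i n)).trans (hβ n)
    · intro n
      rw [RCLike.norm_conj, norm_mul]
      exact (mul_le_of_le_one_right (norm_nonneg _) (hf1 j n)).trans (hβ n)
  have hdiag : ∑ i, ‖∑ m ∈ Ioc U Y, (m : ℂ) * (f i m * starRingEnd ℂ (f i m)) *
        (Bf i (x / m) * starRingEnd ℂ (Bf i (x / m)))‖ ≤ 2 * x ^ 2 * L ^ 4 := by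
    calc _ ≤ ∑ i, ∑ m ∈ Ioc U Y, (m : ℝ) * ‖Bf i (x / m)‖ ^ 2 := by
          refine sum_le_sum fun i _ => (norm_sum_le _ _).trans (sum_le_sum fun m _ => ?_)
          rw [norm_mul, norm_mul, norm_mul, norm_mul, RCLike.norm_conj, RCLike.norm_conj, Complex.norm_natCast, ← sq ‖Bf i (x / m)‖]
          refine mul_le_mul_of_nonneg_right ?_ (sq_nonneg _)
          exact mul_le_of_le_one_right (Nat.cast_nonneg m) (mul_le_one₀ (hf1 i m) (norm_nonneg _) (hf1 i m))
      _ = ∑ m ∈ Ioc U Y, (m : ℝ) * ∑ i, ‖Bf i (x / m)‖ ^ 2 := by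
          rw [sum_comm]; simp_rw [mul_sum]
      _ ≤ ∑ m ∈ Ioc U Y, 2 * x ^ 2 * L ^ 3 * ((1 : ℝ) / m) := by
          refine sum_le_sum fun m hm => ?_
          rw [mem_Ioc] at hm
          have hm0 : 0 < m := by omega
          have ls := large_sieve (fun i n => f i n) hf1 D (x / m) (fun i j hij => h2 i j hij _)
            (Nat.cast_nonneg D) β
          have hb := sum_sq_le_of_norm_le_card_divisors hβ (Nat.div_le_self x m)
          have hq : ((x / m : ℕ) : ℝ) ≤ x / m := Nat.cast_div_le
          have hDD : (Fintype.card ι : ℝ) * D ≤ (x / m : ℕ) := by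
            have h1 : Fintype.card ι * D ≤ U := by
              calc Fintype.card ι * D ≤ D * D := Nat.mul_le_mul_right _ hcard
                _ = D * D * 1 := by ring
                _ ≤ D * D * D := Nat.mul_le_mul_left _ hD1
                _ = U := by rw [hU]; ring
            have h2' : U ≤ x / m := by
              rw [Nat.le_div_iff_mul_le hm0]
              have := hm.2
              rw [hY, Nat.le_div_iff_mul_le hU0] at this
              linarith
            exact_mod_cast h1.trans h2'
          have hm0' : (0 : ℝ) < m := by exact_mod_cast hm0
          have hx0 : (0 : ℝ) ≤ x / m := by positivity
          have : ∑ i, ‖Bf i (x / m)‖ ^ 2 ≤ 2 * (x / m) * ((x / m) * L ^ 3) := by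
            refine ls.trans ?_
            refine mul_le_mul (by linarith) (hb.trans ?_) (sum_nonneg fun i _ => by positivity) (by positivity)
            exact mul_le_mul_of_nonneg_right hq (by positivity)
          refine (mul_le_mul_of_nonneg_left this hm0'.le).trans (le_of_eq ?_)
          field_simp
      _ = 2 * x ^ 2 * L ^ 3 * ∑ m ∈ Ioc U Y, ((1 : ℝ) / m) := by rw [mul_sum]
      _ ≤ 2 * x ^ 2 * L ^ 3 * L := by gcongr
      _ = _ := by ring
  have hYU : (Y : ℝ) * D ^ 3 ≤ x := by
    have : Y * D ^ 3 ≤ x := Nat.div_mul_le_self x U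
    exact_mod_cast this
  have hB : ∑ m ∈ Ioc U Y, (Real.sqrt m * ‖h m‖) ^ 2 ≤ 6 * x ^ 2 * L ^ 4 := by
    have h0 : 0 ≤ ∑ m ∈ Ioc U Y, (Real.sqrt m * ‖h m‖) ^ 2 := sum_nonneg fun i _ => by positivity
    have : ‖((∑ m ∈ Ioc U Y, (Real.sqrt m * ‖h m‖) ^ 2 : ℝ) : ℂ)‖ ≤ 6 * x ^ 2 * L ^ 4 := by
      rw [hHexp]
      calc _ ≤ ∑ i, ∑ j, ((if i = j then ‖∑ m ∈ Ioc U Y, (m : ℂ) * (f i m * starRingEnd ℂ (f i m)) *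
            (Bf i (x / m) * starRingEnd ℂ (Bf i (x / m)))‖ else 0) + 4 * D * x * (Y * L ^ 4)) := by
            refine (norm_sum_le _ _).trans (sum_le_sum fun i _ => (norm_sum_le _ _).trans
              (sum_le_sum fun j _ => ?_))
            rw [norm_mul, norm_mul, RCLike.norm_conj]
            have h1 : ‖ε i‖ * ‖ε j‖ ≤ 1 := mul_le_one₀ (hε1 i) (norm_nonneg _) (hε1 j)
            refine (mul_le_of_le_one_left (norm_nonneg _) h1).trans ?_
            split_ifs with hij
            · subst hij
              have : 0 ≤ 4 * D * x * (Y * L ^ 4) := by positivity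
              linarith
            · rw [zero_add]; exact hoff i j hij
        _ = ∑ i, ‖∑ m ∈ Ioc U Y, (m : ℂ) * (f i m * starRingEnd ℂ (f i m)) *
            (Bf i (x / m) * starRingEnd ℂ (Bf i (x / m)))‖ +
              (Fintype.card ι : ℝ) * Fintype.card ι * (4 * D * x * (Y * L ^ 4)) := by
            simp_rw [sum_add_distrib]
            simp only [sum_ite_eq, mem_univ, if_true, sum_const, card_univ, nsmul_eq_mul]
            ring
        _ ≤ 2 * x ^ 2 * L ^ 4 + D * D * (4 * D * x * (Y * L ^ 4)) := by
            have : (Fintype.card ι : ℝ) ≤ D := by exact_mod_cast hcard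
            gcongr
        _ = 2 * x ^ 2 * L ^ 4 + 4 * x * L ^ 4 * (Y * D ^ 3) := by ring
        _ ≤ 2 * x ^ 2 * L ^ 4 + 4 * x * L ^ 4 * x := by gcongr
        _ = _ := by ring
    rwa [Complex.norm_real, Real.norm_of_nonneg h0] at this
  have hfin : S ^ 2 ≤ (3 * x * L ^ 4) ^ 2 := by
    calc S ^ 2 ≤ L ^ 3 * (6 * x ^ 2 * L ^ 4) := hS2.trans
          (mul_le_mul hA hB (sum_nonneg fun i _ => by positivity) (by positivity))
      _ = 6 * x ^ 2 * L ^ 7 * 1 := by ring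
      _ ≤ 6 * x ^ 2 * L ^ 7 * L := by gcongr
      _ = 6 * (x ^ 2 * L ^ 8) := by ring
      _ ≤ 9 * (x ^ 2 * L ^ 8) := by
          have : 0 ≤ (x : ℝ) ^ 2 * L ^ 8 := by positivity
          linarith
      _ = _ := by ring
  exact (pow_le_pow_iff_left₀ hS0 (by positivity) two_ne_zero).1 hfin

/-- Truncation of an arithmetic function to arguments at most `U`. -/
def ArithmeticFunction.trunc (a : ArithmeticFunction ℂ) (U : ℕ) : ArithmeticFunction ℂ :=
  ⟨fun n => if n ≤ U then a n else 0, by simp⟩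

lemma ArithmeticFunction.trunc_apply (a : ArithmeticFunction ℂ) (U n : ℕ) :
    a.trunc U n = if n ≤ U then a n else 0 := rfl

/-- The complex-valued von Mangoldt function. -/
noncomputable def vonMangoldtC : ArithmeticFunction ℂ := ⟨fun n => (Λ n : ℂ), by simp⟩

/-- The complex-valued logarithm as an arithmetic function. -/
noncomputable def logC : ArithmeticFunction ℂ := ⟨fun n => (Real.log n : ℂ), by simp⟩

lemma ArithmeticFunction.sub_eval (a b : ArithmeticFunction ℂ) (n : ℕ) :
    (a - b) n = a n - b n := by
  rw [sub_eq_add_neg (a n)]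
  rfl

lemma vonMangoldtC_apply (n : ℕ) : vonMangoldtC n = (Λ n : ℂ) := rfl

lemma logC_apply (n : ℕ) : logC n = (Real.log n : ℂ) := rfl

lemma vonMangoldtC_mul_zeta : vonMangoldtC * (ζ : ArithmeticFunction ℂ) = logC := by
  ext n
  rw [coe_mul_zeta_apply, logC_apply, ← vonMangoldt_sum]
  push_cast
  rfl

lemma vaughan_identity (U : ℕ) :
    vonMangoldtC = vonMangoldtC.trunc U + (μ : ArithmeticFunction ℂ).trunc U * logC
      - (vonMangoldtC.trunc U * (μ : ArithmeticFunction ℂ).trunc U) * (ζ : ArithmeticFunction ℂ)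
      + (vonMangoldtC - vonMangoldtC.trunc U) *
        (((μ : ArithmeticFunction ℂ) - (μ : ArithmeticFunction ℂ).trunc U) * (ζ : ArithmeticFunction ℂ)) := by
  have h1 : (μ : ArithmeticFunction ℂ) * (ζ : ArithmeticFunction ℂ) = 1 := coe_moebius_mul_coe_zeta
  have h2 := vonMangoldtC_mul_zeta
  generalize (μ : ArithmeticFunction ℂ).trunc U = m at *
  generalize vonMangoldtC.trunc U = l at *
  rw [← h2]
  linear_combination (-(vonMangoldtC - l)) * h1

lemma sum_divisors_norm_le (a : ArithmeticFunction ℂ) (b : ArithmeticFunction ℂ) (hb : ∀ n, ‖b n‖ ≤ 1)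
    (n : ℕ) : ‖(a * b) n‖ ≤ ∑ d ∈ n.divisors, ‖a d‖ := by
  rw [mul_apply, ← Nat.sum_divisorsAntidiagonal (f := fun d _ => ‖a d‖)]
  refine (norm_sum_le _ _).trans (sum_le_sum fun p _ => ?_)
  rw [norm_mul]
  exact mul_le_of_le_one_right (norm_nonneg _) (hb _)

lemma norm_moebius_le_one (n : ℕ) : ‖(μ : ArithmeticFunction ℂ) n‖ ≤ 1 := by
  rw [intCoe_apply, Complex.norm_intCast]
  exact_mod_cast abs_moebius_le_one

/-- A mean value theorem of Bombieri–Vinogradov type: for a finite family of completely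
multiplicative functions with small partial sums and small mutual correlations, the sums against the
von Mangoldt function are small on average. -/
theorem sum_norm_sum_vonMangoldt_le {ι : Type*} [Fintype ι] (f : ι → ℕ →* ℂ)
    (hf1 : ∀ i n, ‖f i n‖ ≤ 1) (D : ℕ) (hD1 : 1 ≤ D) (hcard : Fintype.card ι ≤ D)
    (h1 : ∀ i y, ‖∑ n ∈ Ioc 0 y, f i n‖ ≤ D)
    (h2 : ∀ i j, i ≠ j → ∀ y, ‖∑ n ∈ Ioc 0 y, f i n * starRingEnd ℂ (f j n)‖ ≤ D)
    (x : ℕ) (hx : D ^ 8 ≤ x) :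
    ∑ i, ‖∑ n ∈ Ioc 0 x, (Λ n : ℂ) * f i n‖ ≤ 7 * x * (1 + Real.log x) ^ 4 := by
  set U := D ^ 3 with hU
  have hL : 0 ≤ Real.log x := Real.log_natCast_nonneg x
  set L := 1 + Real.log x with hLdef
  have hL1 : 1 ≤ L := by linarith
  have hlog : ∀ n ≤ x, Real.log n ≤ L := fun n hn => by
    have := one_add_log_mono hn
    linarith
  have hDr : (1 : ℝ) ≤ D := by exact_mod_cast hD1
  have hxr : (D : ℝ) ^ 8 ≤ x := by exact_mod_cast hx
  set a := vonMangoldtC - vonMangoldtC.trunc U with ha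
  set b := ((μ : ArithmeticFunction ℂ) - (μ : ArithmeticFunction ℂ).trunc U) *
    (ζ : ArithmeticFunction ℂ) with hb
  set m := (μ : ArithmeticFunction ℂ).trunc U with hm
  set l := vonMangoldtC.trunc U with hl
  have hl1 : ∀ n, ‖l n‖ ≤ if n ≤ U then Λ n else 0 := by
    intro n
    rw [hl, trunc_apply, vonMangoldtC_apply]
    split_ifs
    · rw [Complex.norm_real, Real.norm_of_nonneg vonMangoldt_nonneg]
    · simp
  have hm1 : ∀ n, ‖m n‖ ≤ if n ≤ U then 1 else 0 := by
    intro n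
    rw [hm, trunc_apply]
    split_ifs
    · exact norm_moebius_le_one n
    · simp
  have T1 : ∀ i, ‖∑ n ∈ Ioc 0 x, l n * f i n‖ ≤ U * L := by
    intro i
    calc _ ≤ ∑ n ∈ Ioc 0 x, if n ∈ Ioc 0 U then L else 0 := by
          refine (norm_sum_le _ _).trans (sum_le_sum fun n hn => ?_)
          rw [norm_mul]
          refine (mul_le_of_le_one_right (norm_nonneg _) (hf1 i n)).trans ((hl1 n).trans ?_)
          rw [mem_Ioc] at hn
          by_cases h : n ≤ U
          · rw [if_pos h, if_pos (mem_Ioc.2 ⟨hn.1, h⟩)]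
            exact vonMangoldt_le_log.trans (hlog n hn.2)
          · rw [if_neg h, if_neg (by rw [mem_Ioc]; tauto)]
      _ ≤ _ := by
          rw [← sum_filter, sum_const, nsmul_eq_mul]
          refine mul_le_mul_of_nonneg_right ?_ (by linarith)
          rw [filter_mem_eq_inter]
          have := card_le_card (inter_subset_right (s₁ := Ioc 0 x) (s₂ := Ioc 0 U))
          rw [Nat.card_Ioc] at this
          exact_mod_cast this
  have T2 : ∀ i, ‖∑ n ∈ Ioc 0 x, (m * logC) n * f i n‖ ≤ U * (2 * D * L) := by
    intro i
    rw [sum_Ioc_mul_twist]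
    calc _ ≤ ∑ n ∈ Ioc 0 x, if n ∈ Ioc 0 U then 2 * D * L else 0 := by
          refine (norm_sum_le _ _).trans (sum_le_sum fun n hn => ?_)
          rw [mem_Ioc] at hn
          rw [norm_mul, norm_mul]
          have e := norm_sum_monotone_mul_le (fun n : ℕ => 1 + Real.log n) (fun _ _ h => one_add_log_mono h)
            (fun n => by have := Real.log_natCast_nonneg n; positivity) (f i) 0 D (h1 i) (x / n)
          have e1 := norm_abel_aux (fun n : ℕ => 1 + Real.log n) (fun _ _ h => one_add_log_mono h)
            (f i) 0 D (h1 i) (x / n) (Nat.zero_le _)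
          have e2 : ∑ k ∈ Ioc 0 (x / n), logC k * f i k =
            (Real.log (x / n : ℕ) : ℂ) * ∑ n ∈ Ioc 0 (x / n), f i n -
             (((1 + Real.log (x / n : ℕ) : ℝ) : ℂ) * ∑ n ∈ Ioc 0 (x / n), f i n - ∑ n ∈ Ioc 0 (x / n), ((1 + Real.log n : ℝ) : ℂ) * f i n) := by
            have : ∑ n ∈ Ioc 0 (x / n), ((1 + Real.log n : ℝ) : ℂ) * f i n =
              ∑ n ∈ Ioc 0 (x / n), f i n + ∑ k ∈ Ioc 0 (x / n), logC k * f i k := by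
              rw [← sum_add_distrib]
              refine sum_congr rfl fun k _ => ?_
              rw [logC_apply]; push_cast; ring
            rw [this]; push_cast; ring
          have hlx := hlog _ (Nat.div_le_self x n)
          have hlx' := one_add_log_mono (Nat.div_le_self x n)
          have h0 := Real.log_natCast_nonneg (x / n)
          have e3 : ‖∑ k ∈ Ioc 0 (x / n), logC k * f i k‖ ≤ 2 * D * L := by
            rw [e2]
            refine (norm_sub_le _ _).trans ?_
            rw [norm_mul, Complex.norm_real, Real.norm_of_nonneg h0]
            have := mul_le_mul_of_nonneg_left (h1 i (x / n)) h0
            simp only [Nat.cast_zero, Real.log_zero, add_zero] at e1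
            nlinarith
          have hmn := hm1 n
          have e4 : ‖m n‖ * ‖f i n‖ ≤ ‖m n‖ := mul_le_of_le_one_right (norm_nonneg _) (hf1 i n)
          by_cases h : n ≤ U
          · rw [if_pos (mem_Ioc.2 ⟨hn.1, h⟩)]
            rw [if_pos h] at hmn
            calc _ ≤ 1 * (2 * D * L) := mul_le_mul (e4.trans hmn) e3 (norm_nonneg _) zero_le_one
              _ = _ := one_mul _
          · rw [if_neg (by rw [mem_Ioc]; tauto)]
            rw [if_neg h] at hmn
            have : ‖m n‖ * ‖f i n‖ = 0 := le_antisymm (e4.trans hmn) (by positivity)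
            rw [this, zero_mul]
      _ ≤ _ := by
          rw [← sum_filter, sum_const, nsmul_eq_mul]
          refine mul_le_mul_of_nonneg_right ?_ (by positivity)
          rw [filter_mem_eq_inter]
          have := card_le_card (inter_subset_right (s₁ := Ioc 0 x) (s₂ := Ioc 0 U))
          rw [Nat.card_Ioc] at this
          exact_mod_cast this
  have T3 : ∀ i, ‖∑ n ∈ Ioc 0 x, ((l * m) * (ζ : ArithmeticFunction ℂ)) n * f i n‖ ≤ U ^ 2 * (L * D) := by
    intro i
    rw [sum_Ioc_mul_twist]
    calc _ ≤ ∑ n ∈ Ioc 0 x, if n ∈ Ioc 0 (U ^ 2) then L * D else 0 := by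
          refine (norm_sum_le _ _).trans (sum_le_sum fun n hn => ?_)
          rw [mem_Ioc] at hn
          rw [norm_mul, norm_mul]
          have e3 : ‖∑ k ∈ Ioc 0 (x / n), (ζ : ArithmeticFunction ℂ) k * f i k‖ ≤ D := by
            have : ∑ k ∈ Ioc 0 (x / n), (ζ : ArithmeticFunction ℂ) k * f i k = ∑ k ∈ Ioc 0 (x / n), f i k := by
              refine sum_congr rfl fun k hk => ?_
              rw [mem_Ioc] at hk
              rw [natCoe_apply, zeta_apply, if_neg (by omega), Nat.cast_one, one_mul]
            rw [this]
            exact h1 i _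
          have e4 : ‖(l * m) n‖ * ‖f i n‖ ≤ ‖(l * m) n‖ := mul_le_of_le_one_right (norm_nonneg _) (hf1 i n)
          by_cases h : n ≤ U ^ 2
          · rw [if_pos (mem_Ioc.2 ⟨hn.1, h⟩)]
            refine mul_le_mul (e4.trans ?_) e3 (norm_nonneg _) (by linarith)
            refine (sum_divisors_norm_le l m (fun k => (hm1 k).trans (by split_ifs <;> norm_num)) n).trans ?_
            refine le_trans ?_ ((vonMangoldt_sum (n := n)).le.trans (hlog n hn.2))
            refine sum_le_sum fun k _ => (hl1 k).trans ?_
            split_ifs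
            · exact le_rfl
            · exact vonMangoldt_nonneg
          · rw [if_neg (by rw [mem_Ioc]; tauto)]
            have : (l * m) n = 0 := by
              rw [mul_apply]
              refine sum_eq_zero fun p hp => ?_
              have hp' := (Nat.mem_divisorsAntidiagonal.1 hp).1
              have : U < p.1 ∨ U < p.2 := by
                by_contra! hh
                exact h (by nlinarith)
              rcases this with h' | h'
              · have := hl1 p.1
                rw [if_neg (by omega)] at this
                rw [norm_le_zero_iff.1 this, zero_mul]
              · have := hm1 p.2
                rw [if_neg (by omega)] at this
                rw [norm_le_zero_iff.1 this, mul_zero]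
            rw [this]; simp
      _ ≤ _ := by
          rw [← sum_filter, sum_const, nsmul_eq_mul]
          refine mul_le_mul_of_nonneg_right ?_ (by positivity)
          rw [filter_mem_eq_inter]
          have := card_le_card (inter_subset_right (s₁ := Ioc 0 x) (s₂ := Ioc 0 (U ^ 2)))
          rw [Nat.card_Ioc] at this
          exact_mod_cast this
  have hmu : ∀ n, ‖((μ : ArithmeticFunction ℂ) - m) n‖ ≤ 1 ∧ (n ≤ U → ((μ : ArithmeticFunction ℂ) - m) n = 0) := by
    intro n
    rw [sub_eval, hm, trunc_apply]
    by_cases h : n ≤ U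
    · simp [h]
    · simp only [h, if_false, sub_zero]
      exact ⟨norm_moebius_le_one n, fun h' => h'.elim⟩
  have T4 : ∑ i, ‖∑ n ∈ Ioc 0 x, (a * b) n * f i n‖ ≤ 3 * x * L ^ 4 := by
    have := bilinear_sum_le f hf1 D hD1 hcard h2 x (fun n => a n) (fun n => b n) ?_ ?_ ?_ ?_
    · refine le_trans (le_of_eq ?_) this
      exact sum_congr rfl fun i _ => by rw [sum_Ioc_mul_twist]
    · intro n hn
      simp only [ha, sub_eval, hl, trunc_apply]
      rw [if_pos hn, sub_self]
    · intro n hn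
      simp only [hb]
      rw [coe_mul_zeta_apply]
      refine sum_eq_zero fun d hd => (hmu d).2 ?_
      rcases Nat.eq_zero_or_pos n with rfl | h0
      · simp at hd
      · exact (Nat.le_of_dvd h0 (Nat.dvd_of_mem_divisors hd)).trans hn
    · intro n
      simp only [ha, sub_eval, hl, trunc_apply]
      split_ifs
      · rw [sub_self, norm_zero]; exact Real.log_natCast_nonneg n
      · rw [sub_zero, vonMangoldtC_apply, Complex.norm_real, Real.norm_of_nonneg vonMangoldt_nonneg]
        exact vonMangoldt_le_log
    · intro n
      simp only [hb]
      rw [coe_mul_zeta_apply]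
      refine (norm_sum_le _ _).trans ((sum_le_sum fun d _ => (hmu d).1).trans ?_)
      simp
  have split : ∀ i, ‖∑ n ∈ Ioc 0 x, (Λ n : ℂ) * f i n‖ ≤
      4 * D ^ 7 * L + ‖∑ n ∈ Ioc 0 x, (a * b) n * f i n‖ := by
    intro i
    have e : ∑ n ∈ Ioc 0 x, (Λ n : ℂ) * f i n = ∑ n ∈ Ioc 0 x, l n * f i n +
        ∑ n ∈ Ioc 0 x, (m * logC) n * f i n
        - ∑ n ∈ Ioc 0 x, ((l * m) * (ζ : ArithmeticFunction ℂ)) n * f i n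
        + ∑ n ∈ Ioc 0 x, (a * b) n * f i n := by
      rw [← sum_add_distrib, ← sum_sub_distrib, ← sum_add_distrib]
      refine sum_congr rfl fun n _ => ?_
      have hv := congrArg (fun g : ArithmeticFunction ℂ => g n) (vaughan_identity U)
      simp only [ArithmeticFunction.add_apply, sub_eval] at hv
      rw [← vonMangoldtC_apply, hv]
      ring
    rw [e]
    refine (norm_add_le _ _).trans (add_le_add_left ?_ _)
    refine (norm_sub_le _ _).trans ?_
    refine (add_le_add ((norm_add_le _ _).trans (add_le_add (T1 i) (T2 i))) (T3 i)).trans ?_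
    rw [hU]
    push_cast
    have p3 : (D : ℝ) ^ 3 ≤ D ^ 7 := pow_le_pow_right₀ hDr (by norm_num)
    have p4 : (D : ℝ) ^ 4 ≤ D ^ 7 := pow_le_pow_right₀ hDr (by norm_num)
    have : (D : ℝ) ^ 3 * L + D ^ 3 * (2 * D * L) + (D ^ 3) ^ 2 * (L * D) =
      (D ^ 3 + 2 * D ^ 4 + D ^ 7) * L := by ring
    rw [this]
    refine mul_le_mul_of_nonneg_right ?_ (by linarith)
    linarith
  calc _ ≤ ∑ i : ι, (4 * D ^ 7 * L + ‖∑ n ∈ Ioc 0 x, (a * b) n * f i n‖) := sum_le_sum fun i _ => split i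
    _ ≤ D * (4 * D ^ 7 * L) + 3 * x * L ^ 4 := by
        rw [sum_add_distrib, sum_const, card_univ, nsmul_eq_mul]
        have : (Fintype.card ι : ℝ) ≤ D := by exact_mod_cast hcard
        gcongr
    _ = 4 * D ^ 8 * L + 3 * x * L ^ 4 := by ring
    _ ≤ 4 * x * L ^ 4 + 3 * x * L ^ 4 := by
        have : L ≤ L ^ 4 := le_self_pow₀ hL1 (by norm_num)
        gcongr
    _ = _ := by ring

end

section

open Complex

lemma three_two_two_one_nonneg {z w : ℂ} (hz : ‖z‖ ≤ 1) (hw : ‖w‖ ≤ 1) :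
    0 ≤ 3 + 2 * z.re + 2 * w.re + (z * w).re := by
  have h1 : -‖w * (2 + z)‖ ≤ (w * (2 + z)).re := (abs_le.1 (abs_re_le_norm _)).1
  have h2 : ‖w * (2 + z)‖ ≤ ‖2 + z‖ := by
    rw [norm_mul]; exact mul_le_of_le_one_left (norm_nonneg _) hw
  have hx := (abs_le.1 ((abs_re_le_norm z).trans hz)).1
  have h3 : ‖2 + z‖ ≤ 3 + 2 * z.re := by
    refine (sq_le_sq₀ (norm_nonneg _) (by linarith)).1 ?_
    rw [← normSq_eq_norm_sq, normSq_apply]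
    have h4 : z.re * z.re + z.im * z.im ≤ 1 := by
      rw [← normSq_apply, normSq_eq_norm_sq]
      exact pow_le_one₀ (norm_nonneg _) hz
    simp only [add_re, re_ofNat, add_im, im_ofNat, zero_add]
    nlinarith [sq_nonneg (1 + z.re)]
  have h5 : (w * (2 + z)).re = 2 * w.re + (z * w).re := by
    simp [mul_re]; ring
  linarith

lemma re_log_three_two_two_one_nonneg {a : ℝ} (ha0 : 0 ≤ a) (ha1 : a < 1) {z w : ℂ}
    (hz : ‖z‖ ≤ 1) (hw : ‖w‖ ≤ 1) :
    0 ≤ 3 * (-log (1 - a)).re + 2 * (-log (1 - z * a)).re + 2 * (-log (1 - w * a)).re +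
      (-log (1 - z * w * a)).re := by
  have hn : ∀ u : ℂ, ‖u‖ ≤ 1 → ‖u * a‖ < 1 := fun u hu => by
    rw [norm_mul, Complex.norm_real, Real.norm_of_nonneg ha0]
    exact (mul_le_of_le_one_left ha0 hu).trans_lt ha1
  have h0 : ‖(a : ℂ)‖ < 1 := by rwa [Complex.norm_real, Real.norm_of_nonneg ha0]
  have hzw : ‖z * w‖ ≤ 1 := by
    rw [norm_mul]; exact mul_le_one₀ hz (norm_nonneg _) hw
  rw [← ((((hasSum_re <| hasSum_taylorSeries_neg_log h0).mul_left 3).add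
    ((hasSum_re <| hasSum_taylorSeries_neg_log (hn z hz)).mul_left 2)).add
    ((hasSum_re <| hasSum_taylorSeries_neg_log (hn w hw)).mul_left 2)).add
    (hasSum_re <| hasSum_taylorSeries_neg_log (hn _ hzw)) |>.tsum_eq]
  refine tsum_nonneg fun n => ?_
  have e : ∀ u : ℂ, ((u * a) ^ n / n).re = (u ^ n).re * (a ^ n / n) := by
    intro u
    rw [mul_pow, mul_div_assoc]
    have : (a : ℂ) ^ n / n = ((a ^ n / n : ℝ) : ℂ) := by push_cast; rfl
    rw [this, re_mul_ofReal]
  have e1 : ((a : ℂ) ^ n / n).re = a ^ n / n := by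
    have : (a : ℂ) ^ n / n = ((a ^ n / n : ℝ) : ℂ) := by push_cast; rfl
    rw [this, ofReal_re]
  rw [e, e, e, e1, mul_pow]
  have h := three_two_two_one_nonneg (z := z ^ n) (w := w ^ n)
    (by rw [norm_pow]; exact pow_le_one₀ (norm_nonneg _) hz)
    (by rw [norm_pow]; exact pow_le_one₀ (norm_nonneg _) hw)
  have h' : 0 ≤ a ^ n / n := by positivity
  nlinarith

/-- The completely multiplicative summand `n ↦ f n * n ^ (-s)`. -/
noncomputable def dirichletTwist (f : ℕ →*₀ ℂ) {s : ℂ} (hs : s ≠ 0) : ℕ →*₀ ℂ :=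
  f * riemannZetaSummandHom hs

lemma dirichletTwist_apply (f : ℕ →*₀ ℂ) {s : ℂ} (hs : s ≠ 0) (n : ℕ) :
    dirichletTwist f hs n = f n * (n : ℂ) ^ (-s) := rfl

lemma term_eq_dirichletTwist (f : ℕ →*₀ ℂ) {s : ℂ} (hs : s ≠ 0) (n : ℕ) :
    LSeries.term (fun n => f n) s n = dirichletTwist f hs n := by
  rw [dirichletTwist_apply, LSeries.term_def]
  split_ifs with h
  · simp [h]
  · rw [cpow_neg, div_eq_mul_inv]

lemma summable_dirichletTwist (f : ℕ →*₀ ℂ) (hf : ∀ n, ‖f n‖ ≤ 1) {σ : ℝ} (hσ : 1 < σ)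
    (hs : (σ : ℂ) ≠ 0) : Summable fun n => ‖dirichletTwist f hs n‖ := by
  have := LSeriesSummable_of_bounded_of_one_lt_real (f := fun n => f n) (m := 1)
    (fun n _ => hf n) hσ
  refine this.norm.congr fun n => ?_
  rw [term_eq_dirichletTwist f hs]

lemma norm_LSeries_eq_exp (f : ℕ →*₀ ℂ) (hf : ∀ n, ‖f n‖ ≤ 1) {σ : ℝ} (hσ : 1 < σ) :
    ∃ u : Nat.Primes → ℝ, Summable u ∧ (∀ p, u p = (-log (1 - f p * ((p : ℝ) ^ (-σ) : ℝ))).re) ∧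
      ‖LSeries (fun n => f n) σ‖ = Real.exp (∑' p, u p) := by
  have hs : (σ : ℂ) ≠ 0 := by exact_mod_cast (by linarith : σ ≠ 0)
  have hsum := summable_dirichletTwist f hf hσ hs
  have hlog : Summable fun p : Nat.Primes => -log (1 - dirichletTwist f hs p) :=
    hsum.of_norm.clog_one_sub.neg.subtype Nat.Prime
  refine ⟨fun p => (-log (1 - dirichletTwist f hs p)).re, (hasSum_re hlog.hasSum).summable, ?_, ?_⟩
  · intro p
    simp only [dirichletTwist_apply]
    rw [ofReal_cpow (Nat.cast_nonneg _)]
    push_cast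
    rfl
  · rw [LSeries]
    simp_rw [term_eq_dirichletTwist f hs]
    rw [← EulerProduct.exp_tsum_primes_log_eq_tsum hsum, norm_exp, re_tsum hlog]

lemma one_le_norm_LSeries_product (f g : ℕ →*₀ ℂ) (hf : ∀ n, ‖f n‖ ≤ 1) (hg : ∀ n, ‖g n‖ ≤ 1)
    {σ : ℝ} (hσ : 1 < σ) (one' : ℕ →*₀ ℂ) (h1 : ∀ n ≠ 0, one' n = 1) :
    1 ≤ ‖LSeries (fun n => one' n) σ‖ ^ 3 * ‖LSeries (fun n => f n) σ‖ ^ 2 *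
      ‖LSeries (fun n => g n) σ‖ ^ 2 * ‖LSeries (fun n => (f * g) n) σ‖ := by
  have h1' : ∀ n, ‖one' n‖ ≤ 1 := fun n => by
    rcases eq_or_ne n 0 with rfl | h
    · simp
    · simp [h1 n h]
  have hfg : ∀ n, ‖(f * g) n‖ ≤ 1 := fun n => by
    rw [show (f * g) n = f n * g n from rfl, norm_mul]
    exact mul_le_one₀ (hf n) (norm_nonneg _) (hg n)
  obtain ⟨u0, s0, e0, n0⟩ := norm_LSeries_eq_exp one' h1' hσ
  obtain ⟨u1, s1, e1, n1⟩ := norm_LSeries_eq_exp f hf hσ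
  obtain ⟨u2, s2, e2, n2⟩ := norm_LSeries_eq_exp g hg hσ
  obtain ⟨u3, s3, e3, n3⟩ := norm_LSeries_eq_exp (f * g) hfg hσ
  rw [n0, n1, n2, n3, ← Real.exp_nat_mul, ← Real.exp_nat_mul, ← Real.exp_nat_mul, ← Real.exp_add,
    ← Real.exp_add, ← Real.exp_add]
  apply Real.one_le_exp
  rw [← tsum_mul_left, ← tsum_mul_left, ← tsum_mul_left,
    ← (s0.mul_left _).tsum_add (s1.mul_left _),
    ← ((s0.mul_left _).add (s1.mul_left _)).tsum_add (s2.mul_left _),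
    ← (((s0.mul_left _).add (s1.mul_left _)).add (s2.mul_left _)).tsum_add s3]
  refine tsum_nonneg fun p => ?_
  rw [e0, e1, e2, e3, h1 p p.prop.ne_zero, one_mul]
  have hp0 : (0 : ℝ) ≤ (p : ℝ) ^ (-σ) := by positivity
  have hp1 : ((p : ℕ) : ℝ) ^ (-σ) < 1 :=
    Real.rpow_lt_one_of_one_lt_of_neg (by exact_mod_cast p.prop.one_lt) (by linarith)
  have := re_log_three_two_two_one_nonneg hp0 hp1 (hf p) (hg p)
  rw [show (f * g) p = f p * g p from rfl]
  push_cast at this ⊢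
  linarith

end

section

open Complex Finset Filter Topology

lemma norm_natCast_cpow_sub_le {n : ℕ} (hn : n ≠ 0) {s : ℂ} (hs : 0 < s.re) :
    ‖(n : ℂ) ^ (-s) - ((n + 1 : ℕ) : ℂ) ^ (-s)‖ ≤ ‖s‖ * (n : ℝ) ^ (-s.re - 1) := by
  have hn0 : (0 : ℝ) < n := by exact_mod_cast Nat.pos_of_ne_zero hn
  have hs0 : s ≠ 0 := by rintro rfl; simp at hs
  have key := Convex.norm_image_sub_le_of_norm_hasDerivWithin_le (𝕜 := ℝ) (G := ℂ)
    (f := fun t : ℝ => (t : ℂ) ^ (-s)) (f' := fun t : ℝ => -s * (t : ℂ) ^ (-s - 1))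
    (s := Set.Icc (n : ℝ) (n + 1)) (x := (n + 1 : ℝ)) (y := (n : ℝ))
    (C := ‖s‖ * (n : ℝ) ^ (-s.re - 1)) ?_ ?_ (convex_Icc _ _) ?_ ?_
  · simpa using key
  · intro t ht
    have ht0 : t ≠ 0 := by have := ht.1; linarith
    exact (hasDerivAt_ofReal_cpow_const ht0 (neg_ne_zero.2 hs0)).hasDerivWithinAt
  · intro t ht
    have ht0 : 0 < t := hn0.trans_le ht.1
    rw [norm_mul, norm_neg, norm_cpow_eq_rpow_re_of_pos ht0]
    refine mul_le_mul_of_nonneg_left ?_ (norm_nonneg _)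
    simp only [sub_re, neg_re, one_re]
    exact Real.rpow_le_rpow_of_nonpos hn0 ht.1 (by linarith)
  · constructor <;> linarith
  · constructor <;> linarith

/-- The Dirichlet series of `f` after summation by parts; it continues the series to the right half
plane when the partial sums of `f` are bounded. -/
noncomputable def abelLSeries (f : ℕ → ℂ) (s : ℂ) : ℂ :=
  ∑' n : ℕ, (∑ i ∈ Ioc 0 n, f i) * ((n : ℂ) ^ (-s) - ((n + 1 : ℕ) : ℂ) ^ (-s))

lemma norm_abelLSeries_term_le {f : ℕ → ℂ} {B : ℝ} (n : ℕ)
    (hB : ‖∑ i ∈ Ioc 0 n, f i‖ ≤ B) {s : ℂ} (hs : 0 < s.re) :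
    ‖(∑ i ∈ Ioc 0 n, f i) * ((n : ℂ) ^ (-s) - ((n + 1 : ℕ) : ℂ) ^ (-s))‖ ≤
      B * (‖s‖ * (n : ℝ) ^ (-s.re - 1)) := by
  rcases eq_or_ne n 0 with rfl | hn
  · have : (0 : ℝ) ≤ B := (norm_nonneg _).trans hB
    simp only [Ioc_self, sum_empty, zero_mul, norm_zero]
    positivity
  · rw [norm_mul]
    exact mul_le_mul hB (norm_natCast_cpow_sub_le hn hs) (norm_nonneg _) ((norm_nonneg _).trans hB)

lemma differentiableOn_abelLSeries {f : ℕ → ℂ} {B : ℝ} (hB : ∀ n, ‖∑ i ∈ Ioc 0 n, f i‖ ≤ B) :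
    DifferentiableOn ℂ (abelLSeries f) ({s | 1 / 4 < s.re} ∩ Metric.ball 0 3) := by
  have hB0 : 0 ≤ B := (norm_nonneg _).trans (hB 0)
  refine differentiableOn_tsum_of_summable_norm
    (u := fun n : ℕ => B * (3 * (n : ℝ) ^ (-(1 / 4 : ℝ) - 1))) ?_ ?_ ?_ ?_
  · exact ((Real.summable_nat_rpow.2 (by norm_num)).mul_left 3).mul_left B
  · intro n s hs
    have hs1 : 1 / 4 < s.re := hs.1
    have hs0 : s ≠ 0 := by rintro rfl; norm_num at hs1
    rcases eq_or_ne n 0 with rfl | hn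
    · simp only [Ioc_self, sum_empty, zero_mul]
      exact differentiableWithinAt_const _
    · refine DifferentiableAt.differentiableWithinAt ?_
      have h : ∀ m : ℕ, m ≠ 0 → DifferentiableAt ℂ (fun s => (m : ℂ) ^ (-s)) s := fun m hm =>
        (differentiableAt_id.neg).const_cpow (Or.inl (Nat.cast_ne_zero.2 hm))
      exact ((h n hn).sub (h (n + 1) n.succ_ne_zero)).const_mul _
  · exact (isOpen_lt continuous_const continuous_re).inter Metric.isOpen_ball
  · intro n s hs
    have hs1 : 1 / 4 < s.re := hs.1
    have hs2 : ‖s‖ < 3 := by simpa using hs.2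
    refine (norm_abelLSeries_term_le n (hB n) (by linarith)).trans ?_
    refine mul_le_mul_of_nonneg_left ?_ hB0
    rcases Nat.eq_zero_or_pos n with rfl | hn
    · simp [Real.zero_rpow (by linarith : -s.re - 1 ≠ 0), Real.zero_rpow (by norm_num : (-4⁻¹ - 1:ℝ) ≠ 0)]
    · refine mul_le_mul hs2.le ?_ (by positivity) (by norm_num)
      exact Real.rpow_le_rpow_of_exponent_le (by exact_mod_cast hn) (by linarith)

lemma sum_Ioc_mul_cpow_eq (f : ℕ → ℂ) (s : ℂ) (M : ℕ) :
    ∑ n ∈ range (M + 1), LSeries.term f s n =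
      (∑ i ∈ Ioc 0 M, f i) * ((M + 1 : ℕ) : ℂ) ^ (-s) + ∑ n ∈ range (M + 1),
        (∑ i ∈ Ioc 0 n, f i) * ((n : ℂ) ^ (-s) - ((n + 1 : ℕ) : ℂ) ^ (-s)) := by
  induction M with
  | zero => simp
  | succ M ih =>
    rw [sum_range_succ, ih, sum_range_succ _ (M + 1), ← Nat.succ_eq_add_one,
      Finset.sum_Ioc_succ_top (Nat.zero_le M), LSeries.term_of_ne_zero (Nat.succ_ne_zero M),
      cpow_neg (((M.succ : ℕ)) : ℂ)]
    simp only [Nat.succ_eq_add_one, div_eq_mul_inv]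
    ring

lemma abelLSeries_eq_LSeries {f : ℕ → ℂ} {B : ℝ} (hB : ∀ n, ‖∑ i ∈ Ioc 0 n, f i‖ ≤ B)
    (hf : ∀ n, ‖f n‖ ≤ 1) {s : ℂ} (hs : 1 < s.re) : abelLSeries f s = LSeries f s := by
  have hB0 : 0 ≤ B := (norm_nonneg _).trans (hB 0)
  have h1 : Summable (LSeries.term f s) :=
    LSeriesSummable_of_bounded_of_one_lt_re (m := 1) (fun n _ => hf n) hs
  have h2 : Summable fun n : ℕ =>
      (∑ i ∈ Ioc 0 n, f i) * ((n : ℂ) ^ (-s) - ((n + 1 : ℕ) : ℂ) ^ (-s)) := by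
    refine Summable.of_norm_bounded ?_ fun n => norm_abelLSeries_term_le n (hB n) (by linarith)
    exact ((Real.summable_nat_rpow.2 (by linarith)).mul_left _).mul_left B
  have t1 := h1.hasSum.tendsto_sum_nat.comp (tendsto_add_atTop_nat 1)
  have t2 := h2.hasSum.tendsto_sum_nat.comp (tendsto_add_atTop_nat 1)
  have t3 : Tendsto (fun M : ℕ => (∑ i ∈ Ioc 0 M, f i) * ((M + 1 : ℕ) : ℂ) ^ (-s)) atTop (𝓝 0) := by
    have h0 : Tendsto (fun M : ℕ => B * ((M + 1 : ℕ) : ℝ) ^ (-s.re)) atTop (𝓝 0) := by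
      have := (tendsto_rpow_neg_atTop (by linarith : 0 < s.re)).comp
        (tendsto_natCast_atTop_atTop.comp (tendsto_add_atTop_nat 1))
      simpa using this.const_mul B
    refine squeeze_zero_norm (fun M => ?_) h0
    rw [norm_mul, norm_natCast_cpow_of_pos M.succ_pos, neg_re]
    exact mul_le_mul_of_nonneg_right (hB M) (by positivity)
  have t4 := t3.add t2
  rw [zero_add] at t4
  refine tendsto_nhds_unique t4 (t1.congr fun M => ?_)
  exact sum_Ioc_mul_cpow_eq f s M

lemma norm_abelLSeries_near_one_le : ∃ C : ℝ, 1 ≤ C ∧ ∀ (f : ℕ → ℂ) (N : ℝ), (∀ n, ‖f n‖ ≤ 1) →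
    2 ≤ Real.log N → (∀ n, ‖∑ i ∈ Ioc 0 n, f i‖ ≤ N) → ∀ s : ℂ, ‖s - 1‖ ≤ 1 / Real.log N →
    ‖abelLSeries f s‖ ≤ C * Real.log N := by
  have hsum : Summable fun n : ℕ => (n : ℝ) ^ (-(7 / 6) : ℝ) :=
    Real.summable_nat_rpow.2 (by norm_num)
  set Z := ∑' n : ℕ, (n : ℝ) ^ (-(7 / 6) : ℝ) with hZ
  have hZ0 : 0 ≤ Z := tsum_nonneg fun n => by positivity
  refine ⟨2 * (4 * Real.exp 3 + Z), by linarith [Real.add_one_le_exp 3], ?_⟩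
  intro f N hf hN hB s hs
  set lg := Real.log N with hlg
  have hlg0 : 0 < lg := by linarith
  have hN0 : 0 ≤ N := (norm_nonneg _).trans (hB 0)
  have hNpos : 0 < N := by
    rcases hN0.lt_or_eq with h | h
    · exact h
    · rw [hlg, ← h, Real.log_zero] at hN; norm_num at hN
  have hinv : 1 / lg ≤ 1 / 2 := one_div_le_one_div_of_le (by norm_num) hN
  have hre : 1 - 1 / lg ≤ s.re := by
    have := (abs_le.1 ((abs_re_le_norm (s - 1)).trans hs)).1
    simp only [sub_re, one_re] at this
    linarith
  have hs2 : ‖s‖ ≤ 2 := by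
    have : ‖s‖ ≤ ‖s - 1‖ + ‖(1 : ℂ)‖ := by simpa using norm_add_le (s - 1) 1
    rw [norm_one] at this
    linarith
  have hsre : 0 < s.re := by linarith
  set M := ⌊N ^ 3⌋₊ with hM
  have hlin : ∀ n, ‖∑ i ∈ Ioc 0 n, f i‖ ≤ n := fun n => by
    refine (norm_sum_le_of_le _ fun i _ => hf i).trans ?_
    simp
  have hind : HasSum (fun n : ℕ => if n ∈ Ioc 0 M then Real.exp 3 / n else 0)
      (∑ n ∈ Ioc 0 M, Real.exp 3 / n) := by
    have := hasSum_sum_of_ne_finset_zero (L := .unconditional ℕ) (f := fun n : ℕ => if n ∈ Ioc 0 M then Real.exp 3 / n else 0)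
      (s := Ioc 0 M) (fun b hb => if_neg hb)
    rwa [Finset.sum_congr rfl fun x hx => if_pos hx] at this
  have hmaj := (hind.add hsum.hasSum).mul_left 2
  have hterm : ∀ n : ℕ, ‖(∑ i ∈ Ioc 0 n, f i) * ((n : ℂ) ^ (-s) - ((n + 1 : ℕ) : ℂ) ^ (-s))‖ ≤
      2 * ((if n ∈ Ioc 0 M then Real.exp 3 / n else 0) + (n : ℝ) ^ (-(7 / 6) : ℝ)) := by
    intro n
    rcases Nat.eq_zero_or_pos n with rfl | hn
    · simp only [Ioc_self, sum_empty, zero_mul, norm_zero]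
      positivity
    have hn0 : (0 : ℝ) < n := by exact_mod_cast hn
    have hn1 : (1 : ℝ) ≤ n := by exact_mod_cast hn
    by_cases hnM : n ∈ Ioc 0 M
    · rw [if_pos hnM]
      refine (norm_abelLSeries_term_le n (hlin n) hsre).trans ?_
      have hnN : (n : ℝ) ≤ N ^ 3 := (Nat.le_floor_iff (by positivity)).1 (mem_Ioc.1 hnM).2
      have h1 : (n : ℝ) ^ (1 / lg) ≤ Real.exp 3 := by
        rw [Real.rpow_def_of_pos hn0]
        apply Real.exp_le_exp.2
        have : Real.log n ≤ 3 * lg := by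
          have := Real.log_le_log hn0 hnN
          rwa [Real.log_pow] at this
        rw [mul_one_div, div_le_iff₀ hlg0]
        exact this
      have h2 : (n : ℝ) * (n : ℝ) ^ (-s.re - 1) ≤ Real.exp 3 / n := by
        calc (n : ℝ) * (n : ℝ) ^ (-s.re - 1) ≤ n * (n : ℝ) ^ (1 / lg + (-1) + (-1)) :=
              mul_le_mul_of_nonneg_left
                (Real.rpow_le_rpow_of_exponent_le hn1 (by linarith)) hn0.le
          _ = (n : ℝ) ^ (1 / lg) / n := by
              rw [Real.rpow_add hn0, Real.rpow_add hn0, Real.rpow_neg_one]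
              field_simp
          _ ≤ _ := by gcongr
      have h3 : 0 ≤ (n : ℝ) ^ (-(7 / 6) : ℝ) := by positivity
      calc (n : ℝ) * (‖s‖ * (n : ℝ) ^ (-s.re - 1)) = ‖s‖ * (n * (n : ℝ) ^ (-s.re - 1)) := by ring
        _ ≤ 2 * (Real.exp 3 / n) := mul_le_mul hs2 h2 (by positivity) (by norm_num)
        _ ≤ _ := by linarith
    · rw [if_neg hnM, zero_add]
      refine (norm_abelLSeries_term_le n (hB n) hsre).trans ?_
      have hnN : N ^ 3 ≤ n := by
        have : M < n := by simp only [mem_Ioc, not_and, not_le] at hnM; exact hnM hn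
        exact ((Nat.floor_lt (by positivity)).1 this).le
      have h1 : N ≤ (n : ℝ) ^ (1 / 3 : ℝ) := by
        have := Real.rpow_le_rpow (by positivity) hnN (by norm_num : (0 : ℝ) ≤ 1 / 3)
        rwa [← Real.rpow_natCast, ← Real.rpow_mul hN0, show ((3 : ℕ) : ℝ) * (1 / 3) = 1 by norm_num,
          Real.rpow_one] at this
      have h2 : (n : ℝ) ^ (-s.re - 1) ≤ (n : ℝ) ^ (-(3 / 2) : ℝ) :=
        Real.rpow_le_rpow_of_exponent_le hn1 (by linarith)
      calc N * (‖s‖ * (n : ℝ) ^ (-s.re - 1)) = ‖s‖ * (N * (n : ℝ) ^ (-s.re - 1)) := by ring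
        _ ≤ 2 * ((n : ℝ) ^ (1 / 3 : ℝ) * (n : ℝ) ^ (-(3 / 2) : ℝ)) := by gcongr
        _ = _ := by rw [← Real.rpow_add hn0]; norm_num
  refine (tsum_of_norm_bounded hmaj hterm).trans ?_
  have hh : ∑ n ∈ Ioc 0 M, Real.exp 3 / (n : ℝ) ≤ Real.exp 3 * (1 + 3 * lg) := by
    have h1 := harmonic_le M
    have h2 : Real.log M ≤ 3 * lg := by
      rcases Nat.eq_zero_or_pos M with h | h
      · rw [h]; simp; linarith
      · have := Real.log_le_log (by exact_mod_cast h) (Nat.floor_le (by positivity : 0 ≤ N ^ 3))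
        rwa [Real.log_pow] at this
    simp_rw [div_eq_mul_one_div (Real.exp 3), ← mul_sum]
    refine mul_le_mul_of_nonneg_left ?_ (Real.exp_nonneg _)
    linarith
  have he := Real.exp_pos 3
  have : Real.exp 3 * (1 + 3 * lg) ≤ 4 * Real.exp 3 * lg - Real.exp 3 := by nlinarith
  nlinarith

end

section

open Complex Finset Filter Topology
open scoped ArithmeticFunction.zeta ArithmeticFunction.vonMangoldt

/-- Cauchy bounds for the logarithmic derivative of a zero-free function on a disc, through the
Borel–Carathéodory theorem. -/
lemma norm_iteratedDeriv_logDeriv_le {F : ℂ → ℂ} {c : ℂ} {R M : ℝ} (hR : 0 < R) (hM : 0 < M)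
    (hF : DifferentiableOn ℂ F (Metric.ball c R)) (h0 : ∀ z ∈ Metric.ball c R, F z ≠ 0)
    (hb : ∀ z ∈ Metric.ball c R, ‖F z‖ ≤ Real.exp M * ‖F c‖) (n : ℕ) :
    ‖iteratedDeriv n (fun z => deriv F z / F z) c‖ ≤
      (n + 1).factorial * (2 * M) / (R / 2) ^ (n + 1) := by
  have hc : c ∈ Metric.ball c R := Metric.mem_ball_self hR
  have hd : DifferentiableOn ℂ (fun z => deriv F z / F z) (Metric.ball c R) :=
    (hF.deriv Metric.isOpen_ball).div hF h0
  obtain ⟨g₁, hg₁⟩ := hd.isExactOn_ball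
  set g : ℂ → ℂ := fun z => g₁ z - g₁ c with hg
  have hgd : ∀ z ∈ Metric.ball c R, HasDerivAt g (deriv F z / F z) z := fun z hz =>
    (hg₁ z hz).sub_const _
  have hgc : g c = 0 := by simp [hg]
  have hFd : ∀ z ∈ Metric.ball c R, HasDerivAt F (deriv F z) z := fun z hz =>
    (hF.differentiableAt (Metric.isOpen_ball.mem_nhds hz)).hasDerivAt
  have hconst : ∀ z ∈ Metric.ball c R, F z * exp (-g z) = F c := by
    intro z hz
    have hder : ∀ z ∈ Metric.ball c R, HasDerivAt (fun z => F z * exp (-g z)) 0 z := by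
      intro z hz
      have := (hFd z hz).mul (hgd z hz).neg.cexp
      refine this.congr_deriv ?_
      have hz0 := h0 z hz
      field_simp
      ring
    have := Metric.isOpen_ball.is_const_of_deriv_eq_zero
      (f := fun z => F z * exp (-g z)) (convex_ball c R).isPreconnected
      (fun z hz => (hder z hz).differentiableAt.differentiableWithinAt)
      (fun z hz => (hder z hz).deriv) hz hc
    simpa [hgc] using this
  have hre : ∀ z ∈ Metric.ball c R, (g z).re ≤ M := by
    intro z hz
    have h1 : F z = F c * exp (g z) := by
      rw [← hconst z hz, mul_assoc, ← exp_add, neg_add_cancel, exp_zero, mul_one]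
    have h2 := hb z hz
    rw [h1, norm_mul, norm_exp, mul_comm] at h2
    exact Real.exp_le_exp.1 (le_of_mul_le_mul_right h2 (norm_pos_iff.2 (h0 c hc)))
  have hshift : ∀ w ∈ Metric.ball (0 : ℂ) R, c + w ∈ Metric.ball c R := fun w hw => by
    simpa [Metric.mem_ball, dist_eq_norm] using hw
  have hgdiff : DifferentiableOn ℂ g (Metric.ball c R) := fun z hz =>
    (hgd z hz).differentiableAt.differentiableWithinAt
  have hBC : ∀ z ∈ Metric.sphere c (R / 2), ‖g z‖ ≤ 2 * M := by
    intro z hz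
    have hz' : ‖z - c‖ = R / 2 := by simpa [dist_eq_norm] using hz
    have := Complex.borelCaratheodory_zero (f := fun w => g (c + w)) (M := M) (R := R)
      (z := z - c) hM
      (hgdiff.comp ((differentiable_const c).add differentiable_id).differentiableOn hshift)
      (fun w hw => hre _ (hshift w hw)) hR (by rw [mem_ball_zero_iff, hz']; linarith)
      (by simp [hgc])
    rw [add_sub_cancel, hz'] at this
    refine this.trans (le_of_eq ?_)
    field_simp
    ring
  have hcl : Metric.closedBall c (R / 2) ⊆ Metric.ball c R :=
    Metric.closedBall_subset_ball (by linarith)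
  have hmain := Complex.norm_iteratedDeriv_le_of_forall_mem_sphere_norm_le (n + 1)
    (half_pos hR) ((hgdiff.mono hcl).diffContOnCl_ball subset_rfl) hBC
  rw [iteratedDeriv_succ'] at hmain
  have hev : deriv g =ᶠ[𝓝 c] fun z => deriv F z / F z := by
    filter_upwards [Metric.isOpen_ball.mem_nhds hc] with z hz using (hgd z hz).deriv
  rwa [hev.iteratedDeriv_eq] at hmain

/-- The completely multiplicative function equal to one on nonzero naturals. -/
def oneHom : ℕ →*₀ ℂ where
  toFun n := if n = 0 then 0 else 1
  map_zero' := by simp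
  map_one' := by simp
  map_mul' x y := by
    rcases eq_or_ne x 0 with rfl | hx
    · simp
    rcases eq_or_ne y 0 with rfl | hy
    · simp
    simp [hx, hy]

lemma oneHom_apply {n : ℕ} (hn : n ≠ 0) : oneHom n = 1 := if_neg hn

lemma norm_oneHom_le (n : ℕ) : ‖oneHom n‖ ≤ 1 := by
  rcases eq_or_ne n 0 with rfl | h
  · simp
  · simp [oneHom_apply h]

lemma mul_oneHom (f : ℕ →*₀ ℂ) : f * oneHom = f := by
  ext n
  rcases eq_or_ne n 0 with rfl | h
  · simp
  · rw [show (f * oneHom) n = f n * oneHom n from rfl, oneHom_apply h, mul_one]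

lemma norm_LSeries_oneHom_le {σ : ℝ} (hσ : 1 < σ) :
    ‖LSeries (fun n => oneHom n) σ‖ ≤ 1 + 1 / (σ - 1) := by
  have h1 := ZetaAsymptotics.zeta_limit_aux1 hσ
  have h2 : 0 ≤ ZetaAsymptotics.termTSum σ :=
    tsum_nonneg fun n => ZetaAsymptotics.term_nonneg _ _
  have h3 : ∑' n : ℕ, 1 / (n + 1 : ℝ) ^ σ ≤ 1 + 1 / (σ - 1) := by nlinarith
  have hs : Summable fun n : ℕ => 1 / (n + 1 : ℝ) ^ σ := by
    have := (summable_nat_add_iff 1).2 (Real.summable_one_div_nat_rpow.2 hσ)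
    simpa using this
  refine le_trans ?_ h3
  have hsum : Summable (LSeries.term (fun n => oneHom n) σ) :=
    LSeriesSummable_of_bounded_of_one_lt_real (m := 1) (fun n _ => norm_oneHom_le n) hσ
  rw [LSeries, hsum.tsum_eq_zero_add, LSeries.term_zero, zero_add]
  refine tsum_of_norm_bounded hs.hasSum fun n => ?_
  rw [LSeries.term_of_ne_zero n.succ_ne_zero, oneHom_apply n.succ_ne_zero, norm_div, norm_one,
    norm_natCast_cpow_of_pos n.succ_pos, ofReal_re]
  push_cast
  exact le_rfl

lemma abscissaOfAbsConv_le_one {f : ℕ → ℂ} (hf : ∀ n, ‖f n‖ ≤ 1) :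
    LSeries.abscissaOfAbsConv f ≤ 1 :=
  LSeries.abscissaOfAbsConv_le_of_forall_lt_LSeriesSummable' fun _ hy =>
    LSeriesSummable_of_bounded_of_one_lt_real (m := 1) (fun n _ => hf n) (by exact_mod_cast hy)

lemma abscissaOfAbsConv_vonMangoldt_mul_le_one {f : ℕ → ℂ} (hf : ∀ n, ‖f n‖ ≤ 1) :
    LSeries.abscissaOfAbsConv (fun n => (Λ n : ℂ) * f n) ≤ 1 := by
  refine LSeries.abscissaOfAbsConv_le_of_forall_lt_LSeriesSummable' fun y hy => ?_
  have h := (ArithmeticFunction.LSeriesSummable_vonMangoldt (s := y)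
    (by rw [ofReal_re]; exact_mod_cast hy)).norm
  refine Summable.of_norm_bounded h fun n => LSeries.norm_term_le _ ?_
  rw [norm_mul]
  exact mul_le_of_le_one_right (norm_nonneg _) (hf n)

lemma neg_deriv_LSeries_eq (f : ℕ →*₀ ℂ) (hf : ∀ n, ‖f n‖ ≤ 1) {s : ℂ} (hs : 1 < s.re) :
    deriv (LSeries fun n => f n) s =
      -(LSeries (fun n => (Λ n : ℂ) * f n) s * LSeries (fun n => f n) s) := by
  have a1 : LSeries.abscissaOfAbsConv (fun n => f n) < s.re :=
    (abscissaOfAbsConv_le_one hf).trans_lt (by exact_mod_cast hs)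
  have a2 : LSeries.abscissaOfAbsConv (fun n => (Λ n : ℂ) * f n) < s.re :=
    (abscissaOfAbsConv_vonMangoldt_mul_le_one hf).trans_lt (by exact_mod_cast hs)
  rw [LSeries_deriv a1]
  have hz : (fun n => ((ζ : ArithmeticFunction ℂ).twist (f : ℕ →* ℂ)) n) = fun n => f n := by
    funext n
    rcases eq_or_ne n 0 with rfl | h
    · simp
    · simp [ArithmeticFunction.twist_apply, ArithmeticFunction.natCoe_apply,
        ArithmeticFunction.zeta_apply, h]
  have hL : (fun n => (vonMangoldtC.twist (f : ℕ →* ℂ)) n) = fun n => (Λ n : ℂ) * f n := rfl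
  have := ArithmeticFunction.LSeries_mul (f := vonMangoldtC.twist (f : ℕ →* ℂ))
    (g := (ζ : ArithmeticFunction ℂ).twist (f : ℕ →* ℂ)) (s := s) (by rw [hL]; exact a2)
    (by rw [hz]; exact a1)
  rw [← ArithmeticFunction.twist_mul, vonMangoldtC_mul_zeta, hz, hL] at this
  rw [← this]
  congr 1
  refine LSeries_congr (fun {n} hn => ?_) s
  rw [ArithmeticFunction.twist_apply, LSeries.logMul, logC_apply, ← natCast_log]
  rfl

end

section

open Complex Finset Filter Topology
open scoped ArithmeticFunction.zeta ArithmeticFunction.vonMangoldt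

/-- The absolute constant bounding `L`-series near one. -/
noncomputable def lConst : ℝ := norm_abelLSeries_near_one_le.choose

lemma one_le_lConst : 1 ≤ lConst := norm_abelLSeries_near_one_le.choose_spec.1

/-- The `L`-series of `f` has a zero close to one. -/
def HasNearZero (f : ℕ → ℂ) (η : ℝ) : Prop :=
  ∃ ρ ∈ Metric.ball ((1 + η : ℝ) : ℂ) (6 * η), abelLSeries f ρ = 0

section

variable {f : ℕ → ℂ} {N η : ℝ}

lemma norm_sub_one_le_of_mem_ball (hη : 0 < η) {r : ℝ} {z : ℂ}
    (hz : z ∈ Metric.ball ((1 + η : ℝ) : ℂ) r) :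
    ‖z - 1‖ ≤ η + r := by
  have h1 : ‖z - ((1 + η : ℝ) : ℂ)‖ < r := by simpa [dist_eq_norm] using hz
  have h2 : z - 1 = (z - ((1 + η : ℝ) : ℂ)) + ((η : ℝ) : ℂ) := by push_cast; ring
  rw [h2]
  refine (norm_add_le _ _).trans ?_
  rw [norm_real, Real.norm_of_nonneg hη.le]
  linarith

lemma differentiableOn_abelLSeries_ball (hN : 2 ≤ Real.log N)
    (hB : ∀ n, ‖∑ i ∈ Ioc 0 n, f i‖ ≤ N) (hη : 0 < η) (hηN : 7 * η ≤ 1 / (2 * Real.log N)) :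
    DifferentiableOn ℂ (abelLSeries f) (Metric.ball ((1 + η : ℝ) : ℂ) (1 / (2 * Real.log N))) := by
  refine (differentiableOn_abelLSeries hB).mono fun z hz => ?_
  have h1 := norm_sub_one_le_of_mem_ball hη hz
  have h2 : 1 / (2 * Real.log N) ≤ 1 / 4 := one_div_le_one_div_of_le (by norm_num) (by linarith)
  have h3 : ‖z - 1‖ ≤ 1 / 2 := by linarith
  constructor
  · have := (abs_le.1 ((abs_re_le_norm (z - 1)).trans h3)).1
    simp only [sub_re, one_re] at this
    show 1 / 4 < z.re
    linarith
  · rw [mem_ball_zero_iff]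
    have : ‖z‖ ≤ ‖z - 1‖ + ‖(1 : ℂ)‖ := by simpa using norm_add_le (z - 1) 1
    rw [norm_one] at this
    linarith

lemma norm_abelLSeries_le_of_mem_ball (hf : ∀ n, ‖f n‖ ≤ 1) (hN : 2 ≤ Real.log N)
    (hB : ∀ n, ‖∑ i ∈ Ioc 0 n, f i‖ ≤ N) (hη : 0 < η) (hηN : 7 * η ≤ 1 / (2 * Real.log N)) {z : ℂ}
    (hz : z ∈ Metric.ball ((1 + η : ℝ) : ℂ) (1 / (2 * Real.log N))) :
    ‖abelLSeries f z‖ ≤ lConst * Real.log N := by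
  refine norm_abelLSeries_near_one_le.choose_spec.2 f N hf hN hB z ?_
  have h1 := norm_sub_one_le_of_mem_ball hη hz
  have h2 : 1 / (2 * Real.log N) = 1 / Real.log N / 2 := by field_simp
  linarith

lemma ball_six_subset (hη : 0 < η) (hηN : 7 * η ≤ 1 / (2 * Real.log N)) :
    Metric.ball ((1 + η : ℝ) : ℂ) (6 * η) ⊆
    Metric.ball ((1 + η : ℝ) : ℂ) (1 / (2 * Real.log N)) :=
  Metric.ball_subset_ball (by linarith)

lemma HasNearZero.norm_le (hf : ∀ n, ‖f n‖ ≤ 1) (hN : 2 ≤ Real.log N)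
    (hB : ∀ n, ‖∑ i ∈ Ioc 0 n, f i‖ ≤ N) (hη : 0 < η) (hηN : 7 * η ≤ 1 / (2 * Real.log N)) (hz : HasNearZero f η) :
    ‖abelLSeries f ((1 + η : ℝ) : ℂ)‖ ≤ 24 * lConst * Real.log N ^ 2 * η := by
  obtain ⟨ρ, hρ, h0⟩ := hz
  have hlg : 0 < Real.log N := by linarith
  have hC := one_le_lConst
  have hr : 0 < 1 / (2 * Real.log N) := by positivity
  have hmaps : Set.MapsTo (abelLSeries f) (Metric.ball ((1 + η : ℝ) : ℂ) (1 / (2 * Real.log N)))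
      (Metric.closedBall (abelLSeries f ((1 + η : ℝ) : ℂ)) (2 * (lConst * Real.log N))) := by
    intro z hz
    rw [Metric.mem_closedBall, dist_eq_norm]
    have h1 := norm_abelLSeries_le_of_mem_ball hf hN hB hη hηN hz
    have h2 := norm_abelLSeries_le_of_mem_ball hf hN hB hη hηN (Metric.mem_ball_self hr)
    exact (norm_sub_le _ _).trans (by linarith)
  have := Complex.dist_le_div_mul_dist_of_mapsTo_ball
    (differentiableOn_abelLSeries_ball hN hB hη hηN) hmaps (ball_six_subset hη hηN hρ)
  rw [h0, dist_zero_left] at this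
  refine this.trans ?_
  have h3 : dist ρ ((1 + η : ℝ) : ℂ) ≤ 6 * η := (Metric.mem_ball.1 hρ).le
  calc 2 * (lConst * Real.log N) / (1 / (2 * Real.log N)) * dist ρ ((1 + η : ℝ) : ℂ)
      ≤ 2 * (lConst * Real.log N) / (1 / (2 * Real.log N)) * (6 * η) := by gcongr
    _ = _ := by field_simp; ring

end

lemma norm_LSeries_oneHom_le_two_div {η : ℝ} (hη : 0 < η) (hη1 : η ≤ 1) :
    ‖LSeries (fun n => oneHom n) ((1 + η : ℝ) : ℂ)‖ ≤ 2 / η := by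
  refine (norm_LSeries_oneHom_le (by linarith)).trans ?_
  rw [add_sub_cancel_left, le_div_iff₀ hη, add_mul, one_div_mul_cancel hη.ne']
  linarith

/-- Two multiplicative functions cannot both have a zero close to one if their product oscillates. -/
theorem not_hasNearZero_pair {f g : ℕ →*₀ ℂ} {N η : ℝ} (hf : ∀ n, ‖f n‖ ≤ 1) (hg : ∀ n, ‖g n‖ ≤ 1)
    (hN : 2 ≤ Real.log N) (hB : ∀ n, ‖∑ i ∈ Ioc 0 n, f i‖ ≤ N)
    (hB' : ∀ n, ‖∑ i ∈ Ioc 0 n, g i‖ ≤ N) (hB'' : ∀ n, ‖∑ i ∈ Ioc 0 n, f i * g i‖ ≤ N)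
    (hη : 0 < η) (hηN : 7 * η ≤ 1 / (2 * Real.log N)) (hzf : HasNearZero (fun n => f n) η)
    (hzg : HasNearZero (fun n => g n) η) :
    1 ≤ 8 * 24 ^ 4 * lConst ^ 5 * Real.log N ^ 9 * η := by
  have hlg : 0 < Real.log N := by linarith
  have hC := one_le_lConst
  have hr : 0 < 1 / (2 * Real.log N) := by positivity
  have hη1 : η ≤ 1 := by
    have : 1 / (2 * Real.log N) ≤ 1 / 4 := one_div_le_one_div_of_le (by norm_num) (by linarith)
    linarith
  have hfg : ∀ n, ‖(f * g) n‖ ≤ 1 := fun n => by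
    rw [show (f * g) n = f n * g n from rfl, norm_mul]
    exact mul_le_one₀ (hf n) (norm_nonneg _) (hg n)
  have hσ : (1 : ℝ) < 1 + η := by linarith
  have hσ' : 1 < (((1 + η : ℝ) : ℂ)).re := by rw [ofReal_re]; exact hσ
  have h := one_le_norm_LSeries_product f g hf hg hσ oneHom fun n hn => oneHom_apply hn
  have h0 := norm_LSeries_oneHom_le_two_div hη hη1
  have h1 := hzf.norm_le hf hN hB hη hηN
  have h2 := hzg.norm_le hg hN hB' hη hηN
  have h3 := norm_abelLSeries_le_of_mem_ball (f := fun n => (f * g) n) hfg hN hB'' hη hηN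
    (Metric.mem_ball_self hr)
  rw [abelLSeries_eq_LSeries hB hf hσ'] at h1
  rw [abelLSeries_eq_LSeries hB' hg hσ'] at h2
  rw [abelLSeries_eq_LSeries (f := fun n => (f * g) n) hB'' hfg hσ'] at h3
  refine h.trans ?_
  calc _ ≤ (2 / η) ^ 3 * (24 * lConst * Real.log N ^ 2 * η) ^ 2 *
        (24 * lConst * Real.log N ^ 2 * η) ^ 2 * (lConst * Real.log N) := by gcongr
    _ = _ := by field_simp; ring

/-- Prime sums twisted by a function without zeros close to one are small. -/
theorem norm_LSeries_log_pow_vonMangoldt_le {f : ℕ →*₀ ℂ} {N η : ℝ} (hf : ∀ n, ‖f n‖ ≤ 1)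
    (hN : 2 ≤ Real.log N) (hB : ∀ n, ‖∑ i ∈ Ioc 0 n, f i‖ ≤ N)
    (hη : 0 < η) (hηN : 7 * η ≤ 1 / (2 * Real.log N)) (hz : ¬ HasNearZero (fun n => f n) η) (n : ℕ) :
    ‖LSeries (fun m => (Real.log m : ℂ) ^ n * ((Λ m : ℂ) * f m)) ((1 + η : ℝ) : ℂ)‖ ≤
      (n + 1).factorial * (2 * Real.log (4 * lConst * Real.log N / η ^ 2)) / (3 * η) ^ (n + 1) := by
  have hlg : 0 < Real.log N := by linarith
  have hC := one_le_lConst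
  have hr : 0 < 1 / (2 * Real.log N) := by positivity
  have hη1 : η ≤ 1 := by
    have : 1 / (2 * Real.log N) ≤ 1 / 4 := one_div_le_one_div_of_le (by norm_num) (by linarith)
    linarith
  have hσ : (1 : ℝ) < 1 + η := by linarith
  have hσ' : 1 < (((1 + η : ℝ) : ℂ)).re := by rw [ofReal_re]; exact hσ
  set s₀ : ℂ := ((1 + η : ℝ) : ℂ) with hs₀
  set F := abelLSeries fun n => f n with hFdef
  have hFlow : η ^ 2 / 4 ≤ ‖F s₀‖ := by
    have h := one_le_norm_LSeries_product f oneHom hf norm_oneHom_le hσ oneHom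
      fun n hn => oneHom_apply hn
    have h0 := norm_LSeries_oneHom_le_two_div hη hη1
    rw [mul_oneHom, ← hs₀, ← abelLSeries_eq_LSeries hB hf hσ', ← hFdef] at h
    have h4 : 1 ≤ (2 / η) ^ 5 * ‖F s₀‖ ^ 3 := by
      refine h.trans ?_
      calc _ ≤ (2 / η) ^ 3 * ‖F s₀‖ ^ 2 * (2 / η) ^ 2 * ‖F s₀‖ := by gcongr
        _ = _ := by ring
    have h5 : (η ^ 2 / 4) ^ 3 ≤ ‖F s₀‖ ^ 3 := by
      have h6 : (2 / η) ^ 5 * (η / 2) ^ 5 = 1 := by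
        rw [← mul_pow]
        field_simp
      have h7 : (η / 2) ^ 5 ≤ ‖F s₀‖ ^ 3 := by
        have : 0 < (η / 2) ^ 5 := by positivity
        nlinarith
      calc (η ^ 2 / 4) ^ 3 = (η / 2) ^ 5 * (η / 2) := by ring
        _ ≤ (η / 2) ^ 5 * 1 := by gcongr; linarith
        _ ≤ _ := by rwa [mul_one]
    exact le_of_pow_le_pow_left₀ (by norm_num) (norm_nonneg _) h5
  have hM : 1 < 4 * lConst * Real.log N / η ^ 2 := by
    rw [lt_div_iff₀ (by positivity)]
    nlinarith [mul_le_mul hC hN (by norm_num) (by linarith)]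
  have hsub := ball_six_subset (N := N) hη hηN
  have key := norm_iteratedDeriv_logDeriv_le (F := F) (c := s₀) (R := 6 * η)
    (M := Real.log (4 * lConst * Real.log N / η ^ 2)) (by positivity) (Real.log_pos hM)
    ((differentiableOn_abelLSeries_ball hN hB hη hηN).mono hsub)
    (fun z hzb h0 => hz ⟨z, hzb, h0⟩) (fun z hzb => ?_) n
  · rw [show 6 * η / 2 = 3 * η by ring] at key
    have hev : (fun z => deriv F z / F z) =ᶠ[𝓝 s₀]
        fun z => -LSeries (fun m => (Λ m : ℂ) * f m) z := by
      have hopen : IsOpen {s : ℂ | 1 < s.re} := isOpen_lt continuous_const continuous_re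
      have hball : Metric.ball s₀ (6 * η) ∈ 𝓝 s₀ := Metric.ball_mem_nhds _ (by positivity)
      filter_upwards [hopen.mem_nhds hσ', hball] with z hz1 hz2
      have hFz : F z ≠ 0 := fun h0 => hz ⟨z, hz2, h0⟩
      have hFe : F =ᶠ[𝓝 z] LSeries fun n => f n := by
        filter_upwards [hopen.mem_nhds hz1] with w hw using abelLSeries_eq_LSeries hB hf hw
      rw [hFe.deriv_eq, neg_deriv_LSeries_eq f hf hz1, ← hFe.self_of_nhds]
      field_simp
    rw [hev.iteratedDeriv_eq, iteratedDeriv_fun_neg, norm_neg, LSeries_iteratedDeriv, norm_mul,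
      norm_pow, norm_neg, norm_one, one_pow, one_mul] at key
    · refine le_trans (le_of_eq ?_) key
      congr 1
      refine LSeries_congr (fun {m} hm => ?_) s₀
      clear key
      induction n with
      | zero => simp
      | succ n ih =>
        rw [Function.iterate_succ_apply', LSeries.logMul, ← ih, pow_succ', natCast_log]
        ring
    · exact (abscissaOfAbsConv_vonMangoldt_mul_le_one hf).trans_lt (by exact_mod_cast hσ')
  · rw [Real.exp_log (by linarith)]
    refine (norm_abelLSeries_le_of_mem_ball hf hN hB hη hηN (hsub hzb)).trans ?_
    calc lConst * Real.log N = 4 * lConst * Real.log N / η ^ 2 * (η ^ 2 / 4) := by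
          field_simp
      _ ≤ _ := by gcongr

end

section

open Finset

section abstractSieve

variable {ι : Type*} [Fintype ι] [DecidableEq ι] {κ : Type*} [Fintype κ]
  {Ω : ι → Type*} [∀ i, Fintype (Ω i)]

/-- Schur's test for a tensor product of symmetric matrices. -/
lemma schur_prod_le (G : ι → κ → κ → ℝ) (hG : ∀ i c d, G i c d = G i d c) (α B : ι → κ → ℝ)
    (hα : ∀ i c, 0 ≤ α i c) (hB : ∀ i c, α i c * ∑ d, α i d * |G i c d| ≤ B i c)
    (y : (ι → κ) → ℝ) :
    ∑ ρ, ∑ σ, (y ρ * ∏ i, α i (ρ i)) * (y σ * ∏ i, α i (σ i)) * ∏ i, G i (ρ i) (σ i) ≤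
      ∑ ρ, y ρ ^ 2 * ∏ i, B i (ρ i) := by
  set w : (ι → κ) → (ι → κ) → ℝ := fun ρ σ => ∏ i, (α i (ρ i) * (α i (σ i) * |G i (ρ i) (σ i)|))
    with hw
  have hw0 : ∀ ρ σ, 0 ≤ w ρ σ := fun ρ σ => prod_nonneg fun i _ =>
    mul_nonneg (hα _ _) (mul_nonneg (hα _ _) (abs_nonneg _))
  have hws : ∀ ρ σ, w ρ σ = w σ ρ := fun ρ σ => prod_congr rfl fun i _ => by
    rw [hG i (ρ i)]; ring
  have hterm : ∀ ρ σ, (y ρ * ∏ i, α i (ρ i)) * (y σ * ∏ i, α i (σ i)) * ∏ i, G i (ρ i) (σ i) ≤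
      y ρ ^ 2 * w ρ σ / 2 + y σ ^ 2 * w ρ σ / 2 := by
    intro ρ σ
    have h1 : |(∏ i, α i (ρ i)) * (∏ i, α i (σ i)) * ∏ i, G i (ρ i) (σ i)| = w ρ σ := by
      rw [abs_mul, abs_mul, abs_prod, abs_prod, abs_prod, ← prod_mul_distrib, ← prod_mul_distrib]
      refine prod_congr rfl fun i _ => ?_
      rw [abs_of_nonneg (hα _ _), abs_of_nonneg (hα _ _), mul_assoc]
    calc _ = (y ρ * y σ) * ((∏ i, α i (ρ i)) * (∏ i, α i (σ i)) * ∏ i, G i (ρ i) (σ i)) := by ring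
      _ ≤ |y ρ * y σ| * |(∏ i, α i (ρ i)) * (∏ i, α i (σ i)) * ∏ i, G i (ρ i) (σ i)| := by
          rw [← abs_mul]; exact le_abs_self _
      _ = |y ρ| * |y σ| * w ρ σ := by rw [← h1, abs_mul]
      _ ≤ _ := by
          have h2 := two_mul_le_add_sq |y ρ| |y σ|
          rw [sq_abs, sq_abs] at h2
          nlinarith [hw0 ρ σ]
  have hrow : ∀ ρ, ∑ σ, w ρ σ ≤ ∏ i, B i (ρ i) := by
    intro ρ
    have : ∑ σ, w ρ σ = ∏ i, ∑ d, (α i (ρ i) * (α i d * |G i (ρ i) d|)) := by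
      rw [Finset.prod_univ_sum, Fintype.piFinset_univ]
    rw [this]
    refine prod_le_prod (fun i _ => sum_nonneg fun d _ =>
      mul_nonneg (hα _ _) (mul_nonneg (hα _ _) (abs_nonneg _))) fun i _ => ?_
    rw [← mul_sum]
    exact hB i (ρ i)
  calc _ ≤ ∑ ρ, ∑ σ, (y ρ ^ 2 * w ρ σ / 2 + y σ ^ 2 * w ρ σ / 2) :=
        sum_le_sum fun ρ _ => sum_le_sum fun σ _ => hterm ρ σ
    _ = ∑ ρ, ∑ σ, y ρ ^ 2 * w ρ σ / 2 + ∑ ρ, ∑ σ, y σ ^ 2 * w ρ σ / 2 := by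
        simp_rw [sum_add_distrib]
    _ = ∑ ρ, ∑ σ, y ρ ^ 2 * w ρ σ / 2 + ∑ ρ, ∑ σ, y ρ ^ 2 * w ρ σ / 2 := by
        congr 1
        rw [sum_comm]
        exact sum_congr rfl fun ρ _ => sum_congr rfl fun σ _ => by rw [hws]
    _ = ∑ ρ, y ρ ^ 2 * ∑ σ, w ρ σ := by
        rw [← sum_add_distrib]
        refine sum_congr rfl fun ρ _ => ?_
        rw [← sum_add_distrib, mul_sum]
        exact sum_congr rfl fun σ _ => by ring
    _ ≤ _ := sum_le_sum fun ρ _ => mul_le_mul_of_nonneg_left (hrow ρ) (sq_nonneg _)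

/-- A linear combination of products of local functions. -/
def localSum {𝕜 : Type*} [CommSemiring 𝕜] (Y : ∀ i, κ → Ω i → 𝕜) (a : (ι → κ) → 𝕜) (x : ∀ i, Ω i) :
    𝕜 := ∑ ρ, a ρ * ∏ i, Y i (ρ i) (x i)

/-- Integration against a product of local weights. -/
def prodExpect (ν : ∀ i, Ω i → ℝ) (F : (∀ i, Ω i) → ℝ) : ℝ := ∑ x, (∏ i, ν i (x i)) * F x

lemma prodExpect_localSum_mul [∀ i, DecidableEq (Ω i)] {μ : Type*} [Fintype μ]
    (ν : ∀ i, Ω i → ℝ) (Y : ∀ i, κ → Ω i → ℝ) (Z : ∀ i, μ → Ω i → ℝ) (a : (ι → κ) → ℝ)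
    (b : (ι → μ) → ℝ) :
    prodExpect ν (fun x => localSum Y a x * localSum Z b x) =
      ∑ ρ, ∑ σ, a ρ * b σ * ∏ i, ∑ t, ν i t * (Y i (ρ i) t * Z i (σ i) t) := by
  simp only [prodExpect, localSum]
  have h : ∀ (ρ : ι → κ) (σ : ι → μ), ∏ i, ∑ t, ν i t * (Y i (ρ i) t * Z i (σ i) t) =
      ∑ x : ∀ i, Ω i, ∏ i, (ν i (x i) * (Y i (ρ i) (x i) * Z i (σ i) (x i))) := by
    intro ρ σ
    rw [Finset.prod_univ_sum, Fintype.piFinset_univ]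
  have h' : ∀ x : ∀ i, Ω i, (∏ i, ν i (x i)) * ((∑ ρ, a ρ * ∏ i, Y i (ρ i) (x i)) *
      ∑ σ, b σ * ∏ i, Z i (σ i) (x i)) = ∑ ρ, ∑ σ, a ρ * b σ *
        ∏ i, (ν i (x i) * (Y i (ρ i) (x i) * Z i (σ i) (x i))) := by
    intro x
    rw [sum_mul_sum, mul_sum]
    refine sum_congr rfl fun ρ _ => ?_
    rw [mul_sum]
    refine sum_congr rfl fun σ _ => ?_
    rw [prod_mul_distrib, prod_mul_distrib]
    ring
  rw [sum_congr rfl fun x _ => h' x, sum_comm]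
  refine sum_congr rfl fun ρ _ => ?_
  rw [sum_comm]
  refine sum_congr rfl fun σ _ => ?_
  rw [h, mul_sum]

lemma sq_prodExpect_mul_le (ν : ∀ i, Ω i → ℝ) (hν : ∀ i t, 0 ≤ ν i t) (F H : (∀ i, Ω i) → ℝ) :
    prodExpect ν (fun x => F x * H x) ^ 2 ≤
      prodExpect ν (fun x => F x * F x) * prodExpect ν (fun x => H x * H x) := by
  have h0 : ∀ x : ∀ i, Ω i, 0 ≤ ∏ i, ν i (x i) := fun x => prod_nonneg fun i _ => hν _ _
  have := sum_sq_le_sum_mul_sum_of_sq_le_mul (univ : Finset (∀ i, Ω i))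
    (r := fun x => (∏ i, ν i (x i)) * (F x * H x)) (f := fun x => (∏ i, ν i (x i)) * (F x * F x))
    (g := fun x => (∏ i, ν i (x i)) * (H x * H x))
    (fun x _ => mul_nonneg (h0 x) (mul_self_nonneg _))
    (fun x _ => mul_nonneg (h0 x) (mul_self_nonneg _))
    (fun x _ => (by ring : _ = _).le)
  exact this

end abstractSieve

end

section

open Finset

section localSieve

variable {k : ℕ} {Ω : Type*} [Fintype Ω] [DecidableEq Ω]

/-- The local sieve functions: the constant one, and for each point the function of mean `1 / |Ω|`
that vanishes on average away from the other points. -/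
def sieveLocal (pt : Fin k → Ω) : Option (Fin k) → Ω → ℝ
  | none, _ => 1
  | some i, t => 1 - ((Fintype.card Ω : ℝ) - 1) * if t = pt i then 1 else 0

/-- The indicator function of the complement of the range of `pt`. -/
def genericLocal (pt : Fin k → Ω) (t : Ω) : ℝ := 1 - ∑ i, if t = pt i then (1 : ℝ) else 0

/-- The local functions dual to `sieveLocal`, relative to the excluded point `pt j`. -/
noncomputable def dualLocal (pt : Fin k → Ω) (j : Fin k) : Option (Fin k) → Ω → ℝ
  | none, _ => 1
  | some i, t => if i = j then 0 else
      genericLocal pt t / ((Fintype.card Ω : ℝ) - k) - if t = pt i then 1 else 0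

/-- The uniform probability weight on the complement of `z`. -/
noncomputable def punctured (z t : Ω) : ℝ := if t = z then 0 else 1 / ((Fintype.card Ω : ℝ) - 1)

lemma punctured_nonneg (z t : Ω) : 0 ≤ punctured z t := by
  unfold punctured
  split_ifs
  · exact le_rfl
  · have : (1 : ℝ) ≤ Fintype.card Ω := by
      exact_mod_cast Fintype.card_pos_iff.2 ⟨z⟩
    exact one_div_nonneg.2 (by linarith)

lemma sum_punctured_mul (z : Ω) (F : Ω → ℝ) :
    ∑ t, punctured z t * F t = (∑ t, F t - F z) / ((Fintype.card Ω : ℝ) - 1) := by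
  rw [← Finset.add_sum_erase univ F (mem_univ z),
    ← Finset.add_sum_erase univ (fun t => punctured z t * F t) (mem_univ z), punctured, if_pos rfl,
    zero_mul, zero_add, add_sub_cancel_left, sum_div]
  refine sum_congr rfl fun t ht => ?_
  rw [punctured, if_neg (ne_of_mem_erase ht)]
  ring

variable (pt : Fin k → Ω)

lemma sum_sieveLocal (i : Fin k) : ∑ t, sieveLocal pt (some i) t = 1 := by
  simp [sieveLocal]

lemma sum_sieveLocal_mul (hpt : Function.Injective pt) (i l : Fin k) :
    ∑ t, sieveLocal pt (some i) t * sieveLocal pt (some l) t =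
      2 - Fintype.card Ω + if i = l then ((Fintype.card Ω : ℝ) - 1) ^ 2 else 0 := by
  set p : ℝ := (Fintype.card Ω : ℝ) with hp
  have : ∀ t, sieveLocal pt (some i) t * sieveLocal pt (some l) t =
      1 - (p - 1) * (if t = pt i then 1 else 0) - (p - 1) * (if t = pt l then 1 else 0) +
        (p - 1) ^ 2 * (if t = pt i then (if i = l then 1 else 0) else 0) := by
    intro t
    simp only [sieveLocal, ← hp]
    by_cases h1 : t = pt i
    · subst h1
      simp only [hpt.eq_iff, if_true]
      split_ifs <;> ring
    · simp only [if_neg h1]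
      ring
  rw [sum_congr rfl fun t _ => this t]
  simp only [sum_add_distrib, sum_sub_distrib, ← mul_sum, sum_ite_eq', mem_univ, if_true, sum_const,
    card_univ, nsmul_eq_mul, mul_one, ← hp]
  split_ifs <;> ring

lemma genericLocal_apply (hpt : Function.Injective pt) (i : Fin k) : genericLocal pt (pt i) = 0 := by
  simp [genericLocal, hpt.eq_iff]

lemma genericLocal_mul_ite (hpt : Function.Injective pt) (i : Fin k) (t : Ω) :
    genericLocal pt t * (if t = pt i then 1 else 0) = 0 := by
  split_ifs with h
  · rw [h, genericLocal_apply pt hpt, zero_mul]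
  · rw [mul_zero]

lemma genericLocal_mul_self (hpt : Function.Injective pt) (t : Ω) :
    genericLocal pt t * genericLocal pt t = genericLocal pt t := by
  by_cases h : ∃ i, t = pt i
  · obtain ⟨i, rfl⟩ := h
    rw [genericLocal_apply pt hpt, zero_mul]
  · push Not at h
    have : genericLocal pt t = 1 := by simp [genericLocal, h]
    rw [this, one_mul]

lemma sum_genericLocal : ∑ t, genericLocal pt t = (Fintype.card Ω : ℝ) - k := by
  simp only [genericLocal, sum_sub_distrib]
  rw [sum_comm]
  simp

lemma dualLocal_apply (hpt : Function.Injective pt) {j i : Fin k} (hij : i ≠ j) (l : Fin k) :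
    dualLocal pt j (some i) (pt l) = -if l = i then 1 else 0 := by
  simp [dualLocal, hij, genericLocal_apply pt hpt, hpt.eq_iff]

lemma sum_dualLocal {j i : Fin k} (hij : i ≠ j) (hk : (k : ℝ) < Fintype.card Ω) :
    ∑ t, dualLocal pt j (some i) t = 0 := by
  have : (Fintype.card Ω : ℝ) - k ≠ 0 := by linarith
  simp [dualLocal, hij, ← sum_div, sum_genericLocal, this]

lemma sum_dualLocal_mul (hpt : Function.Injective pt) {j i l : Fin k} (hij : i ≠ j) (hlj : l ≠ j)
    (hk : (k : ℝ) < Fintype.card Ω) :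
    ∑ t, dualLocal pt j (some i) t * dualLocal pt j (some l) t =
      1 / ((Fintype.card Ω : ℝ) - k) + if i = l then 1 else 0 := by
  set q : ℝ := (Fintype.card Ω : ℝ) - k with hq
  have hq0 : q ≠ 0 := by linarith
  have : ∀ t, dualLocal pt j (some i) t * dualLocal pt j (some l) t =
      genericLocal pt t / q ^ 2 + (if t = pt i then (if i = l then 1 else 0) else 0) := by
    intro t
    simp only [dualLocal, if_neg hij, if_neg hlj, ← hq]
    have h1 := genericLocal_mul_ite pt hpt i t
    have h2 := genericLocal_mul_ite pt hpt l t
    have h3 := genericLocal_mul_self pt hpt t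
    have h4 : (if t = pt i then (1 : ℝ) else 0) * (if t = pt l then 1 else 0) =
        if t = pt i then (if i = l then 1 else 0) else 0 := by
      by_cases h : t = pt i
      · subst h; simp [hpt.eq_iff]
      · simp [h]
    rw [← h4]
    field_simp
    linear_combination h3 - q * h1 - q * h2
  rw [sum_congr rfl fun t _ => this t, sum_add_distrib, ← sum_div, sum_genericLocal, ← hq]
  simp only [sum_ite_eq', mem_univ, if_true]
  field_simp

lemma sum_uniform_sieveLocal_row (hpt : Function.Injective pt) (hk : (k : ℝ) ≤ Fintype.card Ω)
    (hp : 3 ≤ (Fintype.card Ω : ℝ)) (c : Option (Fin k)) :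
    (c.elim 1 fun _ => 1 / ((Fintype.card Ω : ℝ) + k)) * ∑ d : Option (Fin k),
      (d.elim 1 fun _ => 1 / ((Fintype.card Ω : ℝ) + k)) *
        |∑ t, 1 / (Fintype.card Ω : ℝ) * (sieveLocal pt c t * sieveLocal pt d t)| ≤
      c.elim (1 + k / (Fintype.card Ω : ℝ) ^ 2) fun _ => 1 / (Fintype.card Ω : ℝ) := by
  set p : ℝ := (Fintype.card Ω : ℝ) with hpdef
  have hp0 : 0 < p := by linarith
  have hk0 : (0 : ℝ) ≤ k := Nat.cast_nonneg k
  have hnone : ∀ i : Fin k, |∑ t, 1 / p * (1 * sieveLocal pt (some i) t)| = 1 / p := fun i => by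
    simp_rw [one_mul, ← mul_sum, sum_sieveLocal, mul_one]
    exact abs_of_nonneg (by positivity)
  cases c with
  | none =>
    simp only [Option.elim_none, one_mul, Fintype.sum_option, Option.elim_some]
    have h0 : |∑ t : Ω, 1 / p * (sieveLocal pt none t * sieveLocal pt none t)| = 1 := by
      simp [sieveLocal, ← hpdef, hp0.ne']
    have h1 : ∀ i : Fin k, |∑ t : Ω, 1 / p * (sieveLocal pt none t * sieveLocal pt (some i) t)| =
        1 / p := hnone
    rw [h0]
    simp only [h1, sum_const, card_univ, Fintype.card_fin, nsmul_eq_mul]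
    have h2 : (k : ℝ) * (1 / (p + k) * (1 / p)) = k / ((p + k) * p) := by field_simp
    rw [h2]
    gcongr
    nlinarith
  | some i =>
    simp only [Option.elim_none, one_mul, Fintype.sum_option, Option.elim_some]
    have h1 : |∑ t : Ω, 1 / p * (sieveLocal pt (some i) t * sieveLocal pt none t)| = 1 / p := by
      refine Eq.trans (congrArg _ (sum_congr rfl fun t _ => ?_)) (hnone i)
      simp only [sieveLocal]
      ring
    have h2 : ∀ l : Fin k, |∑ t : Ω, 1 / p * (sieveLocal pt (some i) t * sieveLocal pt (some l) t)| ≤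
        1 + if i = l then p - 2 else 0 := by
      intro l
      rw [← mul_sum, sum_sieveLocal_mul pt hpt, ← hpdef, abs_mul, abs_of_nonneg (by positivity : 0 ≤ 1 / p),
        one_div, inv_mul_le_iff₀ hp0]
      split_ifs
      · rw [abs_of_nonneg (by nlinarith)]; nlinarith
      · rw [abs_le]; constructor <;> linarith
    rw [h1]
    have h3 : ∑ l : Fin k, 1 / (p + k) *
        |∑ t : Ω, 1 / p * (sieveLocal pt (some i) t * sieveLocal pt (some l) t)| ≤
        1 / (p + k) * (k + (p - 2)) := by
      rw [← mul_sum]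
      refine mul_le_mul_of_nonneg_left ((sum_le_sum fun l _ => h2 l).trans ?_) (by positivity)
      simp [sum_add_distrib]
    have h4 : 1 / p + 1 / (p + k) * (k + (p - 2)) ≤ 1 := by
      rw [div_add' _ _ _ hp0.ne', div_le_one hp0, one_div, mul_assoc, ← le_sub_iff_add_le',
        inv_mul_le_iff₀ (by positivity)]
      nlinarith
    calc 1 / (p + k) * (1 / p + ∑ l : Fin k, 1 / (p + k) *
        |∑ t : Ω, 1 / p * (sieveLocal pt (some i) t * sieveLocal pt (some l) t)|)
        ≤ 1 / (p + k) * 1 := by gcongr; linarith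
      _ ≤ 1 / p := by rw [mul_one]; gcongr; linarith

lemma sum_punctured_sieveLocal_dualLocal (hpt : Function.Injective pt) (j : Fin k)
    (hk : (k : ℝ) < Fintype.card Ω) (hp : 1 < (Fintype.card Ω : ℝ)) (c d : Option (Fin k))
    (hd : d ≠ some j) :
    ∑ t, punctured (pt j) t * (sieveLocal pt c t * dualLocal pt j d t) =
      if d = (if c = some j then none else c) then 1 else 0 := by
  set p : ℝ := (Fintype.card Ω : ℝ) with hpdef
  have hp0 : p - 1 ≠ 0 := by linarith
  rw [sum_punctured_mul]
  cases d with
  | none =>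
    cases c with
    | none => simp [sieveLocal, dualLocal, ← hpdef, hp0]
    | some l =>
      have e : ∀ t, sieveLocal pt (some l) t * dualLocal pt j none t = sieveLocal pt (some l) t :=
        fun t => by simp [dualLocal]
      simp only [e, sum_sieveLocal]
      by_cases hl : l = j
      · subst hl; simp [sieveLocal, ← hpdef, hp0]
      · have : pt j ≠ pt l := fun h => hl (hpt h).symm
        simp [sieveLocal, hl, this]
  | some i =>
    have hij : i ≠ j := fun h => hd (by rw [h])
    have hz : dualLocal pt j (some i) (pt j) = 0 := by
      rw [dualLocal_apply pt hpt hij, if_neg hij.symm, neg_zero]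
    rw [hz, mul_zero, sub_zero]
    cases c with
    | none => simp [sieveLocal, sum_dualLocal pt hij hk]
    | some l =>
      have e : ∀ t, sieveLocal pt (some l) t * dualLocal pt j (some i) t =
          dualLocal pt j (some i) t - (p - 1) * if t = pt l then dualLocal pt j (some i) (pt l) else 0 := by
        intro t
        simp only [sieveLocal, ← hpdef]
        split_ifs with h
        · rw [h]; ring
        · ring
      rw [sum_congr rfl fun t _ => e t, sum_sub_distrib, sum_dualLocal pt hij hk, ← mul_sum,
        sum_ite_eq' univ, if_pos (mem_univ _), dualLocal_apply pt hpt hij]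
      by_cases hl : l = j
      · subst hl
        simp [hij.symm]
      · simp only [Option.some.injEq, hl, if_false, eq_comm (a := i)]
        split_ifs
        · rw [← hpdef]
          field_simp
          ring
        · simp

lemma sum_punctured_dualLocal_row (hpt : Function.Injective pt) (j : Fin k)
    (hk : (k : ℝ) < Fintype.card Ω) (hp : 1 < (Fintype.card Ω : ℝ)) (c : Option (Fin k)) :
    ∑ d : Option (Fin k), |∑ t, punctured (pt j) t * (dualLocal pt j c t * dualLocal pt j d t)| ≤
      c.elim 1 fun _ => 1 / ((Fintype.card Ω : ℝ) - k) := by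
  set p : ℝ := (Fintype.card Ω : ℝ) with hpdef
  have hp0 : 0 < p - 1 := by linarith
  have hpk : 0 < p - k := by linarith
  have hmean : ∀ i : Fin k, ∑ t, punctured (pt j) t * dualLocal pt j (some i) t = 0 := by
    intro i
    rw [sum_punctured_mul]
    by_cases hij : i = j
    · simp [dualLocal, hij]
    · rw [sum_dualLocal pt hij hk, dualLocal_apply pt hpt hij, if_neg (Ne.symm hij)]
      simp
  rw [Fintype.sum_option]
  cases c with
  | none =>
    have h1 : ∀ i : Fin k, |∑ t, punctured (pt j) t *
        (dualLocal pt j none t * dualLocal pt j (some i) t)| = 0 := by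
      intro i
      rw [abs_eq_zero, ← hmean i]
      exact sum_congr rfl fun t _ => by simp [dualLocal]
    have h0 : ∑ t, punctured (pt j) t * (dualLocal pt j none t * dualLocal pt j none t) = 1 := by
      rw [sum_punctured_mul]
      simp [dualLocal, ← hpdef, hp0.ne']
    rw [h0, sum_congr rfl fun i _ => h1 i]
    simp
  | some i =>
    have h0 : ∑ t, punctured (pt j) t * (dualLocal pt j (some i) t * dualLocal pt j none t) = 0 := by
      rw [← hmean i]
      exact sum_congr rfl fun t _ => by simp [dualLocal]
    rw [h0, abs_zero, zero_add, Option.elim_some]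
    by_cases hij : i = j
    · have : ∀ l : Fin k, |∑ t, punctured (pt j) t *
          (dualLocal pt j (some i) t * dualLocal pt j (some l) t)| = 0 := fun l => by
        simp [dualLocal, hij]
      simp only [this, sum_const_zero]
      positivity
    · have h1 : ∀ l : Fin k, |∑ t, punctured (pt j) t *
          (dualLocal pt j (some i) t * dualLocal pt j (some l) t)| =
          if l = j then 0 else (1 / (p - k) + if i = l then 1 else 0) / (p - 1) := by
        intro l
        split_ifs with hl
        · simp [dualLocal, hl]
        all_goals
          rw [sum_punctured_mul, sum_dualLocal_mul pt hpt hij hl hk,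
            dualLocal_apply pt hpt hij, if_neg (Ne.symm hij), neg_zero, zero_mul, sub_zero,
            abs_of_nonneg]
          · simp_all
          · have : 0 ≤ 1 / (p - k) := by positivity
            split_ifs <;> exact div_nonneg (by linarith) hp0.le
      rw [sum_congr rfl fun l _ => h1 l, ← Finset.add_sum_erase univ _ (mem_univ j), if_pos rfl,
        zero_add, sum_congr rfl fun l hl => if_neg (ne_of_mem_erase hl), ← sum_div, sum_add_distrib,
        sum_const, card_erase_of_mem (mem_univ j), card_univ, Fintype.card_fin, sum_ite_eq,
        if_pos (mem_erase.2 ⟨hij, mem_univ i⟩), nsmul_eq_mul, Nat.cast_sub (Fin.pos j)]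
      refine le_of_eq ?_
      push_cast
      field_simp
      ring

end localSieve

end

section

open Finset

section coloring

variable {ι : Type*} [Fintype ι] [DecidableEq ι] {k : ℕ}

/-- The set of indices of a given colour. -/
def colorClass (ρ : ι → Option (Fin k)) (c : Fin k) : Finset ι := univ.filter fun i => ρ i = some c

lemma mem_colorClass {ρ : ι → Option (Fin k)} {c : Fin k} {i : ι} :
    i ∈ colorClass ρ c ↔ ρ i = some c := by simp [colorClass]

lemma colorClass_injective : Function.Injective (colorClass : (ι → Option (Fin k)) → _) := by
  intro ρ σ h
  funext i
  ext c
  rw [← mem_colorClass, ← mem_colorClass, h]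

lemma disjoint_colorClass (ρ : ι → Option (Fin k)) {c d : Fin k} (hcd : c ≠ d) :
    Disjoint (colorClass ρ c) (colorClass ρ d) := by
  rw [Finset.disjoint_left]
  intro i h1 h2
  rw [mem_colorClass] at h1 h2
  exact hcd (by simpa using h1.symm.trans h2)

lemma exists_colorClass_eq {T : Fin k → Finset ι} (hT : ∀ c d, c ≠ d → Disjoint (T c) (T d)) :
    ∃ ρ : ι → Option (Fin k), colorClass ρ = T := by
  classical
  refine ⟨fun i => if h : ∃ c, i ∈ T c then some h.choose else none, ?_⟩
  funext c
  ext i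
  rw [mem_colorClass]
  constructor
  · intro h
    split_ifs at h with h1
    have := h1.choose_spec
    rwa [Option.some.inj h] at this
  · intro h
    have h1 : ∃ c, i ∈ T c := ⟨c, h⟩
    rw [dif_pos h1]
    by_contra h2
    exact Finset.disjoint_left.1 (hT _ c fun h3 => h2 (by rw [h3])) h1.choose_spec h

lemma prod_elim_eq_prod_colorClass {M : Type*} [CommMonoid M] (ρ : ι → Option (Fin k))
    (x : Fin k → ι → M) :
    ∏ i, (ρ i).elim 1 (fun c => x c i) = ∏ c, ∏ i ∈ colorClass ρ c, x c i := by
  simp only [colorClass, prod_filter]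
  rw [prod_comm]
  refine prod_congr rfl fun i _ => ?_
  cases ρ i with
  | none => simp
  | some d => simp

lemma sum_coloring_eq {M : Type*} [AddCommMonoid M] (F : (Fin k → Finset ι) → M) :
    ∑ ρ, F (colorClass ρ) =
      ∑ T with ∀ c d : Fin k, c ≠ d → Disjoint (T c) (T d), F T := by
  classical
  refine sum_nbij colorClass (fun ρ _ => ?_) (colorClass_injective.injOn) (fun T hT => ?_)
    fun _ _ => rfl
  · simpa using fun c d => disjoint_colorClass ρ
  · obtain ⟨ρ, hρ⟩ := exists_colorClass_eq (T := T) (by simpa using hT)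
    exact ⟨ρ, by simp, hρ⟩

lemma sum_prod_eq_prod_sum (w : Fin k → Finset ι → ℝ) :
    ∑ T : Fin k → Finset ι, ∏ c, w c (T c) = ∏ c, ∑ U, w c U := by
  rw [Finset.prod_univ_sum, Fintype.piFinset_univ]

lemma sum_coloring_le (w : Fin k → Finset ι → ℝ) (hw : ∀ c U, 0 ≤ w c U) :
    ∑ ρ, ∏ c, w c (colorClass ρ c) ≤ ∏ c, ∑ U, w c U := by
  rw [sum_coloring_eq (fun T => ∏ c, w c (T c)), ← sum_prod_eq_prod_sum]
  exact sum_le_sum_of_subset_of_nonneg (filter_subset _ _)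
    fun T _ _ => prod_nonneg fun c _ => hw _ _

lemma sum_prod_mul_prod_le (w : Fin k → Finset ι → ℝ) (hw : ∀ c U, 0 ≤ w c U) (h : Finset ι → ℝ)
    (hh : ∀ U, 0 ≤ h U) {A : ℝ} (S : Finset (Fin k))
    (hS : ∀ c ∈ S, ∑ U, w c U * h U ≤ A * ∑ U, w c U) :
    ∑ T : Fin k → Finset ι, (∏ c, w c (T c)) * ∏ c ∈ S, h (T c) ≤ A ^ #S * ∏ c, ∑ U, w c U := by
  have h1 : ∀ T : Fin k → Finset ι, (∏ c, w c (T c)) * ∏ c ∈ S, h (T c) =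
      ∏ c, (fun c U => w c U * if c ∈ S then h U else 1) c (T c) := by
    intro T
    rw [prod_mul_distrib]
    simp [Finset.prod_ite_mem]
  rw [sum_congr rfl fun T _ => h1 T,
    sum_prod_eq_prod_sum fun c U => w c U * if c ∈ S then h U else 1]
  have h2 : A ^ #S * ∏ c, ∑ U, w c U = ∏ c, ((if c ∈ S then A else 1) * ∑ U, w c U) := by
    rw [prod_mul_distrib]
    simp [Finset.prod_ite_mem]
  rw [h2]
  refine prod_le_prod (fun c _ => sum_nonneg fun U _ => mul_nonneg (hw _ _) ?_) fun c _ => ?_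
  · split_ifs
    · exact hh U
    · exact zero_le_one
  · split_ifs with hc
    · exact hS c hc
    · simp

end coloring

section globalSieve

variable {ι : Type*} [Fintype ι] [DecidableEq ι] (N : ι → ℕ) (k : ℕ) (g : ℕ → ℝ) (R : ℕ)

/-- The smooth weight of a colouring. -/
noncomputable def sieveWeight (ρ : ι → Option (Fin k)) : ℝ :=
  if ∏ c, ∏ i ∈ colorClass ρ c, N i ≤ R then ∏ c, g (∏ i ∈ colorClass ρ c, N i) else 0

/-- The coefficients of the sieve. -/
noncomputable def sieveCoeff (ρ : ι → Option (Fin k)) : ℝ :=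
  sieveWeight N k g R ρ * ∏ i, (ρ i).elim 1 fun _ => 1 / ((N i : ℝ) + k)

variable {N k g R}

lemma sum_sq_sieveWeight_le :
    ∑ ρ, sieveWeight N k g R ρ ^ 2 * ∏ i, (ρ i).elim 1 (fun _ => 1 / (N i : ℝ)) ≤
      (∑ U : Finset ι, g (∏ i ∈ U, N i) ^ 2 / ((∏ i ∈ U, N i : ℕ) : ℝ)) ^ k := by
  have h := sum_coloring_le (ι := ι) (k := k)
    (fun _ U => g (∏ i ∈ U, N i) ^ 2 / ((∏ i ∈ U, N i : ℕ) : ℝ)) (fun _ _ => by positivity)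
  rw [prod_const, card_univ, Fintype.card_fin] at h
  refine le_trans (sum_le_sum fun ρ _ => ?_) h
  rw [prod_elim_eq_prod_colorClass ρ fun _ i => 1 / (N i : ℝ)]
  simp_rw [div_eq_mul_inv, one_mul, prod_mul_distrib, prod_inv_distrib, Nat.cast_prod]
  gcongr
  unfold sieveWeight
  split_ifs
  · rw [prod_pow]
  · rw [zero_pow two_ne_zero]
    exact prod_nonneg fun _ _ => sq_nonneg _

section

variable {Ω : ι → Type*} [∀ i, Fintype (Ω i)] [∀ i, DecidableEq (Ω i)]

/-- The second moment of the sieve with respect to the uniform measure. -/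
theorem prodExpect_uniform_sq_le (hΩ : ∀ i, Fintype.card (Ω i) = N i) (hk : ∀ i, k ≤ N i)
    (hN : ∀ i, 3 ≤ N i) (pt : ∀ i, Fin k → Ω i) (hpt : ∀ i, Function.Injective (pt i)) :
    prodExpect (fun i _ => 1 / (N i : ℝ)) (fun x =>
      localSum (fun i => sieveLocal (pt i)) (sieveCoeff N k g R) x *
        localSum (fun i => sieveLocal (pt i)) (sieveCoeff N k g R) x) ≤
      (∏ i, (1 + k / (N i : ℝ) ^ 2)) *
        (∑ U : Finset ι, g (∏ i ∈ U, N i) ^ 2 / ((∏ i ∈ U, N i : ℕ) : ℝ)) ^ k := by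
  rw [prodExpect_localSum_mul]
  have h := schur_prod_le (fun i (c d : Option (Fin k)) =>
      ∑ t : Ω i, 1 / (N i : ℝ) * (sieveLocal (pt i) c t * sieveLocal (pt i) d t))
    (fun i c d => sum_congr rfl fun t _ => by ring)
    (fun i c => c.elim 1 fun _ => 1 / ((N i : ℝ) + k))
    (fun i c => c.elim (1 + k / (N i : ℝ) ^ 2) fun _ => 1 / (N i : ℝ))
    (fun i c => by cases c <;> simp <;> positivity)
    (fun i c => by
      have := sum_uniform_sieveLocal_row (pt i) (hpt i) (by rw [hΩ]; exact_mod_cast hk i)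
        (by rw [hΩ]; exact_mod_cast hN i) c
      rwa [hΩ] at this) (sieveWeight N k g R)
  refine h.trans (le_trans ?_ (mul_le_mul_of_nonneg_left (sum_sq_sieveWeight_le (R := R))
    (prod_nonneg fun i _ => by positivity)))
  rw [mul_sum]
  refine sum_le_sum fun ρ _ => ?_
  rw [mul_left_comm]
  refine mul_le_mul_of_nonneg_left ?_ (sq_nonneg _)
  rw [← prod_mul_distrib]
  refine prod_le_prod (fun i _ => by cases ρ i <;> simp <;> positivity) fun i _ => ?_
  cases ρ i with
  | none => simp
  | some c =>
    simp only [Option.elim_some]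
    exact le_mul_of_one_le_left (by positivity) (by simp; positivity)

/-- The coefficients of the test function. -/
noncomputable def dualCoeff (N : ι → ℕ) (k : ℕ) (g : ℕ → ℝ) (j : Fin k) (s : ι → Option (Fin k)) :
    ℝ :=
  (∏ c, if c = j then (if colorClass s c = ∅ then 1 else 0) else g (∏ i ∈ colorClass s c, N i)) *
    ∏ i, (s i).elim 1 fun _ => ((N i : ℝ) - k) / N i

/-- Erase a colour. -/
def eraseColor (j : Fin k) (ρ : ι → Option (Fin k)) : ι → Option (Fin k) :=
  fun i => if ρ i = some j then none else ρ i

lemma colorClass_eraseColor (j c : Fin k) (ρ : ι → Option (Fin k)) :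
    colorClass (eraseColor j ρ) c = if c = j then ∅ else colorClass ρ c := by
  ext i
  rw [mem_colorClass, eraseColor]
  split_ifs with h1 h2 h2
  · simp
  · rw [mem_colorClass, h1]
    simpa using fun h => h2 h.symm
  · subst h2; simpa using h1
  · rw [mem_colorClass]

theorem prodExpect_punctured_dual_sq_le (hΩ : ∀ i, Fintype.card (Ω i) = N i) (hk : ∀ i, k < N i)
    (hN : ∀ i, 3 ≤ N i) (pt : ∀ i, Fin k → Ω i) (hpt : ∀ i, Function.Injective (pt i))
    (j : Fin k) :
    prodExpect (fun i => punctured (pt i j)) (fun x =>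
      localSum (fun i => dualLocal (pt i) j) (dualCoeff N k g j) x *
        localSum (fun i => dualLocal (pt i) j) (dualCoeff N k g j) x) ≤
        (∑ U : Finset ι, g (∏ i ∈ U, N i) ^ 2 / ((∏ i ∈ U, N i : ℕ) : ℝ)) ^ (k - 1) := by
  rw [prodExpect_localSum_mul]
  have h := schur_prod_le (fun i (c d : Option (Fin k)) =>
      ∑ t : Ω i, punctured (pt i j) t * (dualLocal (pt i) j c t * dualLocal (pt i) j d t))
    (fun i c d => sum_congr rfl fun t _ => by ring)
    (fun i c => 1) (fun i c => c.elim 1 fun _ => 1 / ((N i : ℝ) - k)) (fun i c => zero_le_one)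
    (fun i c => by
      have := sum_punctured_dualLocal_row (pt i) (hpt i) j (by rw [hΩ]; exact_mod_cast hk i)
        (by rw [hΩ]; exact_mod_cast (hN i).trans_lt' (by norm_num)) c
      rw [hΩ] at this
      simpa using this) (dualCoeff N k g j)
  simp only [prod_const_one, mul_one] at h
  refine h.trans ?_
  have h2 := sum_coloring_le (ι := ι) (k := k)
    (fun c U => if c = j then (if U = ∅ then 1 else 0) else
      g (∏ i ∈ U, N i) ^ 2 / ((∏ i ∈ U, N i : ℕ) : ℝ))
      (fun _ _ => by split_ifs <;> positivity)
  have h3 : (∏ c : Fin k, ∑ U : Finset ι, if c = j then (if U = ∅ then (1 : ℝ) else 0) else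
      g (∏ i ∈ U, N i) ^ 2 / ((∏ i ∈ U, N i : ℕ) : ℝ)) =
      (∑ U : Finset ι, g (∏ i ∈ U, N i) ^ 2 / ((∏ i ∈ U, N i : ℕ) : ℝ)) ^ (k - 1) := by
    rw [← mul_prod_erase univ _ (mem_univ j)]
    simp only [if_true, sum_ite_eq', mem_univ, one_mul]
    rw [prod_congr rfl fun c hc => by simp only [ne_of_mem_erase hc, if_false]; rfl, prod_const,
      card_erase_of_mem (mem_univ j), card_univ, Fintype.card_fin]
  rw [h3] at h2
  refine le_trans (sum_le_sum fun s _ => ?_) h2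
  rw [dualCoeff, mul_pow, ← prod_pow, ← prod_pow, mul_assoc, ← prod_mul_distrib]
  have h4 : ∏ i, ((s i).elim 1 (fun _ => ((N i : ℝ) - k) / N i) ^ 2 *
      (s i).elim 1 fun _ => 1 / ((N i : ℝ) - k)) ≤ ∏ c, ∏ i ∈ colorClass s c, 1 / (N i : ℝ) := by
    rw [← prod_elim_eq_prod_colorClass s fun _ i => 1 / (N i : ℝ)]
    have hp : ∀ i, 0 < (N i : ℝ) - k := fun i => by
      have : (k : ℝ) < N i := by exact_mod_cast hk i
      linarith
    refine prod_le_prod (fun i _ => ?_) fun i _ => ?_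
    · have := hp i
      cases s i <;> simp only [Option.elim_none, Option.elim_some] <;> positivity
    · have := hp i
      cases s i with
      | none => simp
      | some c =>
        simp only [Option.elim_some]
        have h0 : (0 : ℝ) < N i := by have := hN i; positivity
        have h5 : ((N i : ℝ) - k) / N i ≤ 1 := by
          rw [div_le_one h0]
          have : (0 : ℝ) ≤ k := Nat.cast_nonneg k
          linarith
        calc (((N i : ℝ) - k) / N i) ^ 2 * (1 / ((N i : ℝ) - k))
            = ((N i : ℝ) - k) / N i * (1 / N i) := by field_simp
          _ ≤ 1 * (1 / N i) := by gcongr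
          _ = 1 / N i := one_mul _
  refine (mul_le_mul_of_nonneg_left h4 (prod_nonneg fun _ _ => sq_nonneg _)).trans ?_
  rw [← prod_mul_distrib]
  refine prod_le_prod (fun c _ => mul_nonneg (sq_nonneg _) (prod_nonneg fun _ _ => by positivity))
    fun c _ => ?_
  split_ifs with h5 h6
  · rw [h6]; simp
  · simp
  · rw [div_eq_mul_inv, Nat.cast_prod, ← prod_inv_distrib]
    simp

/-- The pairing of the sieve with the test function. -/
theorem prodExpect_punctured_mul_dual (hΩ : ∀ i, Fintype.card (Ω i) = N i) (hk : ∀ i, k < N i)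
    (hN : ∀ i, 3 ≤ N i) (pt : ∀ i, Fin k → Ω i) (hpt : ∀ i, Function.Injective (pt i))
    (j : Fin k) :
    prodExpect (fun i => punctured (pt i j)) (fun x =>
      localSum (fun i => sieveLocal (pt i)) (sieveCoeff N k g R) x *
        localSum (fun i => dualLocal (pt i) j) (dualCoeff N k g j) x) =
      ∑ ρ, sieveCoeff N k g R ρ * dualCoeff N k g j (eraseColor j ρ) := by
  rw [prodExpect_localSum_mul]
  refine sum_congr rfl fun ρ _ => ?_
  have h : ∀ s : ι → Option (Fin k), sieveCoeff N k g R ρ * dualCoeff N k g j s *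
      ∏ i, ∑ t, punctured (pt i j) t * (sieveLocal (pt i) (ρ i) t * dualLocal (pt i) j (s i) t) =
      if s = eraseColor j ρ then sieveCoeff N k g R ρ * dualCoeff N k g j s else 0 := by
    intro s
    by_cases hs : ∃ i, s i = some j
    · obtain ⟨i, hi⟩ := hs
      have h1 : dualCoeff N k g j s = 0 := by
        rw [dualCoeff, prod_eq_zero (mem_univ j), zero_mul]
        rw [if_pos rfl, if_neg]
        rw [← ne_eq, ← nonempty_iff_ne_empty]
        exact ⟨i, mem_colorClass.2 hi⟩
      rw [h1]
      simp
    · push Not at hs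
      rw [prod_congr rfl fun i _ => sum_punctured_sieveLocal_dualLocal (pt i) (hpt i) j
        (by rw [hΩ]; exact_mod_cast hk i)
        (by rw [hΩ]; exact_mod_cast (hN i).trans_lt' (by norm_num)) (ρ i) (s i) (hs i)]
      by_cases h2 : s = eraseColor j ρ
      · rw [if_pos h2, prod_congr rfl fun i _ => if_pos (by rw [h2, eraseColor])]
        simp
      · rw [if_neg h2]
        obtain ⟨i, hi⟩ := Function.ne_iff.1 h2
        rw [prod_eq_zero (mem_univ i) (if_neg hi), mul_zero]
  rw [sum_congr rfl fun s _ => h s]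
  simp

end

end globalSieve

end

section

open Finset

section numerator

lemma one_sub_sum_le_prod_one_sub {α : Type*} (s : Finset α) (t : α → ℝ) (h0 : ∀ i, 0 ≤ t i)
    (h1 : ∀ i, t i ≤ 1) : 1 - ∑ i ∈ s, t i ≤ ∏ i ∈ s, (1 - t i) := by
  classical
  induction s using Finset.induction_on with
  | empty => simp
  | insert a s ha ih =>
    rw [sum_insert ha, prod_insert ha]
    have h2 : 0 ≤ ∑ i ∈ s, t i := sum_nonneg fun i _ => h0 i
    nlinarith [mul_le_mul_of_nonneg_left ih (sub_nonneg.2 (h1 a)), mul_nonneg (h0 a) h2]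

variable {ι : Type*} [Fintype ι] [DecidableEq ι] {N : ι → ℕ} {k : ℕ} {g : ℕ → ℝ} {R : ℕ}

lemma sum_mul_indicator_mem_le (hN : ∀ i, 1 ≤ N i) {G : ℕ → ℝ} (hG0 : ∀ n, 0 ≤ G n)
    (hG : Antitone G) (i : ι) :
    ∑ U : Finset ι, G (∏ l ∈ U, N l) / ((∏ l ∈ U, N l : ℕ) : ℝ) * (if i ∈ U then 1 else 0) ≤
      1 / (N i : ℝ) * ∑ U : Finset ι, G (∏ l ∈ U, N l) / ((∏ l ∈ U, N l : ℕ) : ℝ) := by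
  have h0 : ∀ U : Finset ι, 0 ≤ G (∏ l ∈ U, N l) / ((∏ l ∈ U, N l : ℕ) : ℝ) := fun U =>
    div_nonneg (hG0 _) (Nat.cast_nonneg _)
  simp only [mul_ite, mul_one, mul_zero]
  rw [← sum_filter, mul_sum]
  calc _ ≤ ∑ U : Finset ι with i ∈ U, 1 / (N i : ℝ) *
        (G (∏ l ∈ U.erase i, N l) / ((∏ l ∈ U.erase i, N l : ℕ) : ℝ)) := by
        refine sum_le_sum fun U hU => ?_
        have hU : i ∈ U := by simpa using hU
        rw [← mul_prod_erase U N hU, Nat.cast_mul, div_mul_div_comm, one_mul]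
        gcongr
        exact hG (Nat.le_mul_of_pos_left _ (hN i))
    _ = ∑ V ∈ (univ.filter fun U : Finset ι => i ∈ U).image (·.erase i), 1 / (N i : ℝ) *
        (G (∏ l ∈ V, N l) / ((∏ l ∈ V, N l : ℕ) : ℝ)) := by
        rw [sum_image]
        intro U hU V hV h
        have hU : i ∈ U := by simpa using hU
        have hV : i ∈ V := by simpa using hV
        rw [← insert_erase hU, ← insert_erase hV]
        exact congrArg _ h
    _ ≤ _ := sum_le_sum_of_subset_of_nonneg (subset_univ _)
        fun U _ _ => mul_nonneg (by positivity) (h0 U)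

lemma sieveCoeff_mul_dualCoeff (j : Fin k) (ρ : ι → Option (Fin k)) :
    sieveCoeff N k g R ρ * dualCoeff N k g j (eraseColor j ρ) =
      if ∏ c, ∏ i ∈ colorClass ρ c, N i ≤ R then
        ∏ c, ((if c = j then g (∏ i ∈ colorClass ρ c, N i) else
          g (∏ i ∈ colorClass ρ c, N i) ^ 2) * ∏ i ∈ colorClass ρ c,
            (if c = j then 1 / ((N i : ℝ) + k) else 1 / ((N i : ℝ) + k) * (((N i : ℝ) - k) / N i)))
      else 0 := by
  rw [sieveCoeff, sieveWeight, dualCoeff]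
  split_ifs with h
  · have h1 : ∏ i, (eraseColor j ρ i).elim 1 (fun _ => ((N i : ℝ) - k) / N i) =
        ∏ i, (ρ i).elim 1 fun c => if c = j then 1 else ((N i : ℝ) - k) / N i := by
      refine prod_congr rfl fun i _ => ?_
      rw [eraseColor]
      cases h : ρ i with
      | none => simp
      | some c =>
        by_cases hc : c = j <;> simp [hc]
    rw [h1, prod_elim_eq_prod_colorClass ρ fun _ i => 1 / ((N i : ℝ) + k),
      prod_elim_eq_prod_colorClass ρ fun c i => if c = j then 1 else ((N i : ℝ) - k) / N i]
    rw [← prod_mul_distrib, ← prod_mul_distrib, ← prod_mul_distrib]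
    refine prod_congr rfl fun c _ => ?_
    rw [colorClass_eraseColor]
    by_cases hc : c = j
    · simp [hc]
    · simp only [hc, if_false, prod_mul_distrib]
      ring
  · rw [zero_mul, zero_mul]

/-- The pairing of the sieve with the test function is at least half of its formal main term. -/
theorem le_sum_sieveCoeff_mul_dualCoeff (hN : ∀ i, 1 ≤ N i) (hk : ∀ i, 2 * k ≤ N i)
    (hg0 : ∀ n, 0 ≤ g n) (hg : Antitone g) (hgR : ∀ n, g n ≠ 0 → n ^ 4 ≤ R) (hR : 2 ≤ R)
    (hS : 3 * (k : ℝ) ^ 2 * ∑ i, 1 / (N i : ℝ) ^ 2 ≤ 1 / 4) {A : ℝ}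
    (hA : k * A ≤ 3 / 16 * Real.log R)
    (hX3 : ∑ U : Finset ι, g (∏ i ∈ U, N i) ^ 2 / ((∏ i ∈ U, N i : ℕ) : ℝ) *
        Real.log ((∏ i ∈ U, N i : ℕ) : ℝ) ≤
      A * ∑ U : Finset ι, g (∏ i ∈ U, N i) ^ 2 / ((∏ i ∈ U, N i : ℕ) : ℝ)) (j : Fin k) :
    1 / 2 * ((∑ U : Finset ι, g (∏ i ∈ U, N i) / ((∏ i ∈ U, N i : ℕ) : ℝ)) *
      (∑ U : Finset ι, g (∏ i ∈ U, N i) ^ 2 / ((∏ i ∈ U, N i : ℕ) : ℝ)) ^ (k - 1)) ≤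
      ∑ ρ, sieveCoeff N k g R ρ * dualCoeff N k g j (eraseColor j ρ) := by
  set n : Finset ι → ℕ := fun U => ∏ i ∈ U, N i with hn
  have hn1 : ∀ U, 1 ≤ n U := fun U => Nat.one_le_iff_ne_zero.2 (prod_ne_zero_iff.2 fun i _ => by have := hN i; omega)
  set w : Fin k → Finset ι → ℝ := fun c U => (if c = j then g (n U) else g (n U) ^ 2) / (n U : ℝ)
    with hw
  have hw0 : ∀ c U, 0 ≤ w c U := fun c U => by
    simp only [hw]
    have := hg0 (n U)
    split_ifs <;> positivity
  have hX : ∏ c, ∑ U, w c U = (∑ U : Finset ι, g (n U) / (n U : ℝ)) *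
      (∑ U : Finset ι, g (n U) ^ 2 / (n U : ℝ)) ^ (k - 1) := by
    rw [← mul_prod_erase univ _ (mem_univ j)]
    congr 1
    · simp [hw]
    · rw [prod_congr rfl fun c hc => by simp only [hw, ne_of_mem_erase hc, if_false]; rfl,
        prod_const, card_erase_of_mem (mem_univ j), card_univ, Fintype.card_fin]
  set X := ∏ c, ∑ U, w c U with hXdef
  have hX0 : 0 ≤ X := prod_nonneg fun c _ => sum_nonneg fun U _ => hw0 c U
  have hlogR : 0 < Real.log R := Real.log_pos (by exact_mod_cast hR)
  set ind : ι → Finset ι → ℝ := fun i U => if i ∈ U then 1 else 0 with hind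
  have hind0 : ∀ i U, 0 ≤ ind i U := fun i U => by simp only [hind]; split_ifs <;> norm_num
  have hmem : ∀ c i, ∑ U, w c U * ind i U ≤ 1 / (N i : ℝ) * ∑ U, w c U := by
    intro c i
    by_cases hc : c = j
    · simp only [hw, hc, if_true]
      exact sum_mul_indicator_mem_le hN hg0 hg i
    · simp only [hw, hc, if_false]
      exact sum_mul_indicator_mem_le (G := fun m => g m ^ 2) hN (fun m => sq_nonneg _)
        (fun a b hab => pow_le_pow_left₀ (hg0 _) (hg hab) 2) i
  set t : ι → ℝ := fun i => 2 * k / N i with ht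
  have ht0 : ∀ i, 0 ≤ t i := fun i => by positivity
  have hNpos : ∀ i, (0 : ℝ) < N i := fun i => by exact_mod_cast hN i
  have ht1 : ∀ i, t i ≤ 1 := fun i => by
    rw [ht, div_le_one (hNpos i)]
    exact_mod_cast hk i
  set π : (Fin k → Finset ι) → ℝ := fun T => ∏ c, w c (T c) with hπ
  have hπ0 : ∀ T, 0 ≤ π T := fun T => prod_nonneg fun c _ => hw0 _ _
  set b1 : (Fin k → Finset ι) → ℝ := fun T => ∑ c, ∑ d ∈ univ.erase c, ∑ i, ind i (T c) * ind i (T d)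
    with hb1
  set b2 : (Fin k → Finset ι) → ℝ := fun T => ∑ c ∈ univ.erase j,
    Real.log (n (T c)) / (3 / 4 * Real.log R) with hb2
  set b3 : (Fin k → Finset ι) → ℝ := fun T => ∑ c, ∑ i ∈ T c, t i with hb3
  have hb1n : ∀ T, 0 ≤ b1 T := fun T => sum_nonneg fun c _ => sum_nonneg fun d _ =>
    sum_nonneg fun i _ => mul_nonneg (hind0 _ _) (hind0 _ _)
  have hlogn : ∀ U, 0 ≤ Real.log (n U) := fun U => Real.log_natCast_nonneg _
  have hb2n : ∀ T, 0 ≤ b2 T := fun T => sum_nonneg fun c _ => div_nonneg (hlogn _) (by positivity)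
  have hb3n : ∀ T, 0 ≤ b3 T := fun T => sum_nonneg fun c _ => sum_nonneg fun i _ => ht0 i
  -- the pointwise bound
  have hpt : ∀ T : Fin k → Finset ι, π T * (1 - b1 T - b2 T - b3 T) ≤
      if ∀ c d : Fin k, c ≠ d → Disjoint (T c) (T d) then
        (if ∏ c, n (T c) ≤ R then π T * ∏ c, ∏ i ∈ T c, (1 - t i) else 0) else 0 := by
    intro T
    by_cases hd : ∀ c d : Fin k, c ≠ d → Disjoint (T c) (T d)
    · rw [if_pos hd]
      by_cases hle : ∏ c, n (T c) ≤ R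
      · rw [if_pos hle]
        refine mul_le_mul_of_nonneg_left ?_ (hπ0 T)
        have : 1 - b3 T ≤ ∏ c, ∏ i ∈ T c, (1 - t i) := by
          simp only [hb3]
          rw [Finset.prod_sigma', Finset.sum_sigma']
          exact one_sub_sum_le_prod_one_sub _ _ (fun _ => ht0 _) fun _ => ht1 _
        linarith [hb1n T, hb2n T]
      · rw [if_neg hle]
        rcases (hπ0 T).eq_or_lt with h0 | h0
        · rw [← h0, zero_mul]
        refine mul_nonpos_of_nonneg_of_nonpos h0.le ?_
        have hj : (n (T j)) ^ 4 ≤ R := by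
          refine hgR _ fun h => h0.ne' ?_
          exact prod_eq_zero (mem_univ j) (by simp [hw, h])
        have hj' : 4 * Real.log (n (T j)) ≤ Real.log R := by
          have := Real.log_le_log (by have := hn1 (T j); positivity)
            (by exact_mod_cast hj : ((n (T j) : ℝ)) ^ 4 ≤ R)
          rwa [Real.log_pow] at this
        have h1 : Real.log R ≤ ∑ c, Real.log (n (T c)) := by
          rw [← Real.log_prod fun c _ => by have := hn1 (T c); positivity]
          exact Real.log_le_log (by positivity) (by exact_mod_cast (not_le.1 hle).le)
        rw [← add_sum_erase univ _ (mem_univ j)] at h1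
        have h2 : 1 ≤ b2 T := by
          rw [hb2]
          simp only
          rw [← sum_div, one_le_div (by positivity)]
          linarith
        linarith [hb1n T, hb3n T]
    · rw [if_neg hd]
      refine mul_nonpos_of_nonneg_of_nonpos (hπ0 T) ?_
      push Not at hd
      obtain ⟨c, d, hcd, h⟩ := hd
      obtain ⟨i, hi, hi'⟩ := Finset.not_disjoint_iff.1 h
      have : 1 ≤ b1 T := by
        calc (1 : ℝ) = ind i (T c) * ind i (T d) := by simp [hind, hi, hi']
          _ ≤ ∑ i, ind i (T c) * ind i (T d) := single_le_sum
              (f := fun i => ind i (T c) * ind i (T d))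
              (fun _ _ => mul_nonneg (hind0 _ _) (hind0 _ _)) (mem_univ i)
          _ ≤ ∑ d ∈ univ.erase c, ∑ i, ind i (T c) * ind i (T d) := single_le_sum
              (f := fun d => ∑ i, ind i (T c) * ind i (T d))
              (fun _ _ => sum_nonneg fun _ _ => mul_nonneg (hind0 _ _) (hind0 _ _))
              (mem_erase.2 ⟨hcd.symm, mem_univ d⟩)
          _ ≤ _ := single_le_sum
              (f := fun c => ∑ d ∈ univ.erase c, ∑ i, ind i (T c) * ind i (T d))
              (fun _ _ => sum_nonneg fun _ _ => sum_nonneg fun _ _ =>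
                mul_nonneg (hind0 _ _) (hind0 _ _)) (mem_univ c)
      linarith [hb2n T, hb3n T]
  -- the expectations
  set S : ℝ := ∑ i, 1 / (N i : ℝ) ^ 2 with hSdef
  have hS0 : 0 ≤ S := sum_nonneg fun i _ => by positivity
  have e0 : ∑ T, π T = X := sum_prod_eq_prod_sum w
  have e1 : ∑ T, π T * b1 T ≤ k ^ 2 * S * X := by
    have h1 : ∀ c d, d ≠ c → ∀ i, ∑ T, π T * (ind i (T c) * ind i (T d)) ≤ 1 / (N i : ℝ) ^ 2 * X := by
      intro c d hcd i
      have := sum_prod_mul_prod_le w hw0 (ind i) (hind0 i) {c, d} (fun e _ => hmem e i)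
      rw [card_pair hcd.symm] at this
      simp only [prod_pair hcd.symm] at this
      rwa [div_pow, one_pow] at this
    calc ∑ T, π T * b1 T = ∑ c, ∑ d ∈ univ.erase c, ∑ i, ∑ T, π T * (ind i (T c) * ind i (T d)) := by
          simp only [hb1, mul_sum]
          rw [sum_comm]
          refine sum_congr rfl fun c _ => ?_
          rw [sum_comm]
          refine sum_congr rfl fun d _ => ?_
          rw [sum_comm]
      _ ≤ ∑ c : Fin k, ∑ d ∈ univ.erase c, ∑ i, 1 / (N i : ℝ) ^ 2 * X :=
          sum_le_sum fun c _ => sum_le_sum fun d hd => sum_le_sum fun i _ =>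
            h1 c d (ne_of_mem_erase hd) i
      _ ≤ ∑ c : Fin k, ∑ d : Fin k, ∑ i, 1 / (N i : ℝ) ^ 2 * X :=
          sum_le_sum fun c _ => sum_le_sum_of_subset_of_nonneg (subset_univ _)
            fun d _ _ => sum_nonneg fun i _ => by positivity
      _ = _ := by
          simp only [← sum_mul, sum_const, card_univ, Fintype.card_fin, nsmul_eq_mul]
          ring
  have e2 : ∑ T, π T * b2 T ≤ 1 / 4 * X := by
    have h1 : ∀ c, c ≠ j → ∑ T, π T * Real.log (n (T c)) ≤ A * X := by
      intro c hc
      have := sum_prod_mul_prod_le w hw0 (fun U => Real.log (n U)) hlogn {c} (A := A) (by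
        intro e he
        rw [mem_singleton] at he
        subst he
        simpa only [hw, hc, if_false] using hX3)
      simpa using this
    have hAX : 0 ≤ A * X ∨ k ≤ 1 := by
      by_cases hk1 : k ≤ 1
      · exact Or.inr hk1
      · left
        obtain ⟨c, hc⟩ : ∃ c : Fin k, c ≠ j := by
          have : Nontrivial (Fin k) := Fin.nontrivial_iff_two_le.2 (by omega)
          exact exists_ne j
        exact (sum_nonneg fun T _ => mul_nonneg (hπ0 T) (hlogn _)).trans (h1 c hc)
    have h2 : ∑ T, π T * b2 T = (∑ c ∈ univ.erase j, ∑ T, π T * Real.log (n (T c))) /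
        (3 / 4 * Real.log R) := by
      simp only [hb2, mul_sum]
      rw [sum_comm, sum_div]
      refine sum_congr rfl fun c _ => ?_
      rw [sum_div]
      exact sum_congr rfl fun T _ => by ring
    rw [h2, div_le_iff₀ (by positivity)]
    have h3 : ∑ c ∈ univ.erase j, ∑ T, π T * Real.log (n (T c)) ≤ ((k - 1 : ℕ) : ℝ) * (A * X) := by
      refine (sum_le_sum fun c hc => h1 c (ne_of_mem_erase hc)).trans (le_of_eq ?_)
      rw [sum_const, card_erase_of_mem (mem_univ j), card_univ, Fintype.card_fin, nsmul_eq_mul]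
    refine h3.trans ?_
    rcases hAX with h | h
    · calc ((k - 1 : ℕ) : ℝ) * (A * X) ≤ k * (A * X) := by
            gcongr; exact Nat.sub_le _ _
        _ = k * A * X := by ring
        _ ≤ 3 / 16 * Real.log R * X := by gcongr
        _ = _ := by ring
    · rw [Nat.sub_eq_zero_of_le h]
      simp only [Nat.cast_zero, zero_mul]
      positivity
  have e3 : ∑ T, π T * b3 T ≤ 2 * k ^ 2 * S * X := by
    have h1 : ∀ c i, ∑ T, π T * ind i (T c) ≤ 1 / (N i : ℝ) * X := by
      intro c i
      have := sum_prod_mul_prod_le w hw0 (ind i) (hind0 i) {c} (fun e _ => hmem e i)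
      simpa using this
    have h2 : ∀ T, b3 T = ∑ c, ∑ i, t i * ind i (T c) := by
      intro T
      simp only [hb3, hind]
      refine sum_congr rfl fun c _ => ?_
      simp [Finset.sum_ite_mem]
    calc ∑ T, π T * b3 T = ∑ c, ∑ i, t i * ∑ T, π T * ind i (T c) := by
          simp only [h2, mul_sum]
          rw [sum_comm]
          refine sum_congr rfl fun c _ => ?_
          rw [sum_comm]
          exact sum_congr rfl fun i _ => sum_congr rfl fun T _ => by ring
      _ ≤ ∑ c : Fin k, ∑ i, t i * (1 / (N i : ℝ) * X) :=
          sum_le_sum fun c _ => sum_le_sum fun i _ => mul_le_mul_of_nonneg_left (h1 c i) (ht0 i)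
      _ = _ := by
          simp only [sum_const, card_univ, Fintype.card_fin, nsmul_eq_mul, hSdef, mul_sum, sum_mul]
          refine sum_congr rfl fun i _ => ?_
          simp only [ht]
          have := (hNpos i).ne'
          field_simp
  have hmain : 1 / 2 * X ≤ ∑ T, π T * (1 - b1 T - b2 T - b3 T) := by
    have : ∑ T, π T * (1 - b1 T - b2 T - b3 T) =
        X - ∑ T, π T * b1 T - ∑ T, π T * b2 T - ∑ T, π T * b3 T := by
      rw [← e0, ← sum_sub_distrib, ← sum_sub_distrib, ← sum_sub_distrib]
      exact sum_congr rfl fun T _ => by ring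
    rw [this]
    nlinarith
  rw [← hX]
  refine hmain.trans ((sum_le_sum fun T _ => hpt T).trans ?_)
  rw [← sum_filter, ← sum_coloring_eq (fun T => if ∏ c, n (T c) ≤ R then
    π T * ∏ c, ∏ i ∈ T c, (1 - t i) else 0)]
  refine sum_le_sum fun ρ _ => ?_
  rw [sieveCoeff_mul_dualCoeff]
  by_cases hle : ∏ c, n (colorClass ρ c) ≤ R
  swap
  · rw [if_neg hle, if_neg hle]
  rw [if_pos hle, if_pos hle, hπ, ← prod_mul_distrib]
  refine prod_le_prod (fun c _ => mul_nonneg (hw0 _ _) (prod_nonneg fun i _ => by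
    linarith [ht1 i])) fun c _ => ?_
  simp only [hw, div_eq_mul_inv, mul_assoc]
  refine mul_le_mul_of_nonneg_left ?_ (by split_ifs <;> [exact hg0 _; exact sq_nonneg _])
  simp only [hn, Nat.cast_prod]
  rw [← prod_inv_distrib, ← prod_mul_distrib]
  refine prod_le_prod (fun i _ => mul_nonneg (by positivity) (by linarith [ht1 i])) fun i _ => ?_
  have h0 := hNpos i
  have hk0 : (0 : ℝ) ≤ k := Nat.cast_nonneg k
  have h2 : (N i : ℝ)⁻¹ * (1 - t i) = ((N i : ℝ) - 2 * k) / N i ^ 2 := by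
    simp only [ht]; field_simp
  rw [h2]
  split_ifs
  · rw [one_mul, ← one_div, div_le_div_iff₀ (by positivity) (by positivity)]
    nlinarith
  · rw [one_mul, ← div_eq_mul_inv, ← one_div, div_mul_div_comm, one_mul, div_le_div_iff₀ (by positivity) (by positivity)]
    have : ((N i : ℝ) - 2 * k) * (N i + k) ≤ (N i - k) * N i := by nlinarith
    nlinarith [mul_le_mul_of_nonneg_right this h0.le]

variable {Ω : ι → Type*} [∀ i, Fintype (Ω i)] [∀ i, DecidableEq (Ω i)]

/-- The second moment of the sieve over the generic classes, when one of the forms is prime. -/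
theorem le_prodExpect_punctured_sq (hΩ : ∀ i, Fintype.card (Ω i) = N i) (hk : ∀ i, 2 * k ≤ N i)
    (hN : ∀ i, 3 ≤ N i) (pt : ∀ i, Fin k → Ω i) (hpt : ∀ i, Function.Injective (pt i))
    (hg0 : ∀ n, 0 ≤ g n) (hg1 : 0 < g 1) (hg : Antitone g) (hgR : ∀ n, g n ≠ 0 → n ^ 4 ≤ R)
    (hR : 2 ≤ R)
    (hS : 3 * (k : ℝ) ^ 2 * ∑ i, 1 / (N i : ℝ) ^ 2 ≤ 1 / 4) {A : ℝ}
    (hA : k * A ≤ 3 / 16 * Real.log R)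
    (hX3 : ∑ U : Finset ι, g (∏ i ∈ U, N i) ^ 2 / ((∏ i ∈ U, N i : ℕ) : ℝ) *
        Real.log ((∏ i ∈ U, N i : ℕ) : ℝ) ≤
      A * ∑ U : Finset ι, g (∏ i ∈ U, N i) ^ 2 / ((∏ i ∈ U, N i : ℕ) : ℝ)) (j : Fin k) :
    1 / 4 * ((∑ U : Finset ι, g (∏ i ∈ U, N i) / ((∏ i ∈ U, N i : ℕ) : ℝ)) ^ 2 *
      (∑ U : Finset ι, g (∏ i ∈ U, N i) ^ 2 / ((∏ i ∈ U, N i : ℕ) : ℝ)) ^ (k - 1)) ≤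
    prodExpect (fun i => punctured (pt i j)) (fun x =>
      localSum (fun i => sieveLocal (pt i)) (sieveCoeff N k g R) x *
        localSum (fun i => sieveLocal (pt i)) (sieveCoeff N k g R) x) := by
  have hk' : ∀ i, k < N i := fun i => by have := hk i; have := hN i; omega
  have h1 := le_sum_sieveCoeff_mul_dualCoeff (R := R) (fun i => (hN i).trans' (by norm_num)) hk hg0 hg hgR
    hR hS hA hX3 j
  rw [← prodExpect_punctured_mul_dual hΩ hk' hN pt hpt j] at h1
  have h2 := sq_prodExpect_mul_le (fun i => punctured (pt i j)) (fun i t => punctured_nonneg _ t)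
    (localSum (fun i => sieveLocal (pt i)) (sieveCoeff N k g R))
    (localSum (fun i => dualLocal (pt i) j) (dualCoeff N k g j))
  have h3 := prodExpect_punctured_dual_sq_le (g := g) hΩ hk' hN pt hpt j
  set X1 := ∑ U : Finset ι, g (∏ i ∈ U, N i) / ((∏ i ∈ U, N i : ℕ) : ℝ) with hX1
  set X2 := ∑ U : Finset ι, g (∏ i ∈ U, N i) ^ 2 / ((∏ i ∈ U, N i : ℕ) : ℝ) with hX2
  have hX1n : 0 ≤ X1 := sum_nonneg fun U _ => div_nonneg (hg0 _) (Nat.cast_nonneg _)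
  have hX2p : 0 < X2 := by
    refine (by simpa using pow_pos hg1 2 : (0 : ℝ) <
      g (∏ i ∈ (∅ : Finset ι), N i) ^ 2 / ((∏ i ∈ (∅ : Finset ι), N i : ℕ) : ℝ)).trans_le ?_
    exact single_le_sum (f := fun U : Finset ι => g (∏ i ∈ U, N i) ^ 2 / ((∏ i ∈ U, N i : ℕ) : ℝ))
      (fun U _ => by positivity) (mem_univ ∅)
  set Y := X2 ^ (k - 1) with hY
  have hYp : 0 < Y := pow_pos hX2p _
  set E := prodExpect (fun i => punctured (pt i j)) (fun x =>
      localSum (fun i => sieveLocal (pt i)) (sieveCoeff N k g R) x *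
        localSum (fun i => sieveLocal (pt i)) (sieveCoeff N k g R) x) with hE
  have hE0 : 0 ≤ E := sum_nonneg fun x _ => mul_nonneg
    (prod_nonneg fun i _ => punctured_nonneg _ _) (mul_self_nonneg _)
  have h4 : (1 / 2 * (X1 * Y)) ^ 2 ≤ E * Y :=
    (pow_le_pow_left₀ (by positivity) h1 2).trans (h2.trans (mul_le_mul_of_nonneg_left h3 hE0))
  have h5 : 1 / 4 * (X1 ^ 2 * Y) * Y ≤ E * Y := by
    calc _ = (1 / 2 * (X1 * Y)) ^ 2 := by ring
      _ ≤ _ := h4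
  exact le_of_mul_le_mul_right h5 hYp

end numerator

end

section

open Finset

section profile

/-- A decreasing step function of logarithmic type. -/
noncomputable def stepProfile (J : ℕ) (l : ℝ) (n : ℕ) : ℝ :=
  ∑ j ∈ range (J + 1), (1 / 2 : ℝ) ^ j * if (n : ℝ) ≤ Real.exp (2 ^ j * l) then 1 else 0

variable {J : ℕ} {l : ℝ}

lemma stepProfile_nonneg (n : ℕ) : 0 ≤ stepProfile J l n :=
  sum_nonneg fun j _ => mul_nonneg (by positivity) (by split_ifs <;> norm_num)

lemma stepProfile_antitone : Antitone (stepProfile J l) := by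
  intro a b hab
  refine sum_le_sum fun j _ => mul_le_mul_of_nonneg_left ?_ (by positivity)
  have : (a : ℝ) ≤ b := by exact_mod_cast hab
  split_ifs with h1 h2
  · exact le_rfl
  · exact absurd (this.trans h1) h2
  · exact zero_le_one
  · exact le_rfl

lemma sum_half_pow_le (J : ℕ) (e : ℕ → ℝ) (h1 : ∀ j, e j ≤ 1) :
    ∑ j ∈ range J, (1 / 2 : ℝ) ^ j * e j ≤ 2 := by
  calc _ ≤ ∑ j ∈ range J, (1 / 2 : ℝ) ^ j :=
        sum_le_sum fun j _ => mul_le_of_le_one_right (by positivity) (h1 j)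
    _ ≤ 2 := by
        rw [geom_sum_eq (by norm_num)]
        have : (0 : ℝ) ≤ (1 / 2) ^ J := by positivity
        rw [div_le_iff_of_neg (by norm_num)]
        linarith

lemma stepProfile_le_two (n : ℕ) : stepProfile J l n ≤ 2 :=
  sum_half_pow_le _ (fun j => if (n : ℝ) ≤ Real.exp (2 ^ j * l) then 1 else 0)
    fun j => by split_ifs <;> norm_num

lemma sq_sum_half_pow_le (J : ℕ) (e : ℕ → ℝ) (h : ∀ j, e j = 0 ∨ e j = 1) :
    (∑ j ∈ range J, (1 / 2 : ℝ) ^ j * e j) ^ 2 ≤ 4 * ∑ j ∈ range J, (1 / 4 : ℝ) ^ j * e j := by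
  induction J generalizing e with
  | zero => simp
  | succ J ih =>
    have h0 : ∀ j, 0 ≤ e j := fun j => by rcases h j with h | h <;> simp [h]
    have h1 : ∀ j, e j ≤ 1 := fun j => by rcases h j with h | h <;> simp [h]
    rcases h 0 with h2 | h2
    · rw [sum_range_succ', sum_range_succ', h2]
      have := ih (fun j => e (j + 1)) fun j => h (j + 1)
      have e1 : ∑ j ∈ range J, (1 / 2 : ℝ) ^ (j + 1) * e (j + 1) =
          1 / 2 * ∑ j ∈ range J, (1 / 2 : ℝ) ^ j * e (j + 1) := by
        rw [mul_sum]; exact sum_congr rfl fun j _ => by ring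
      have e2 : ∑ j ∈ range J, (1 / 4 : ℝ) ^ (j + 1) * e (j + 1) =
          1 / 4 * ∑ j ∈ range J, (1 / 4 : ℝ) ^ j * e (j + 1) := by
        rw [mul_sum]; exact sum_congr rfl fun j _ => by ring
      rw [e1, e2]
      nlinarith
    · have h3 := sum_half_pow_le (J + 1) e h1
      have h4 : 0 ≤ ∑ j ∈ range (J + 1), (1 / 2 : ℝ) ^ j * e j :=
        sum_nonneg fun j _ => mul_nonneg (by positivity) (h0 j)
      have h5 : 1 ≤ ∑ j ∈ range (J + 1), (1 / 4 : ℝ) ^ j * e j := by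
        have := single_le_sum (f := fun j => (1 / 4 : ℝ) ^ j * e j)
          (fun j _ => mul_nonneg (by positivity) (h0 j)) (mem_range.2 (Nat.succ_pos J))
        simpa [h2] using this
      nlinarith

lemma stepProfile_sq_le (n : ℕ) : stepProfile J l n ^ 2 ≤
    4 * ∑ j ∈ range (J + 1), (1 / 4 : ℝ) ^ j * if (n : ℝ) ≤ Real.exp (2 ^ j * l) then 1 else 0 :=
  sq_sum_half_pow_le _ (fun j => if (n : ℝ) ≤ Real.exp (2 ^ j * l) then 1 else 0)
    fun j => by split_ifs <;> simp

lemma one_le_stepProfile {n : ℕ} (h : (n : ℝ) ≤ Real.exp l) : 1 ≤ stepProfile J l n := by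
  have := single_le_sum
    (f := fun j => (1 / 2 : ℝ) ^ j * if (n : ℝ) ≤ Real.exp (2 ^ j * l) then (1 : ℝ) else 0)
    (fun j _ => mul_nonneg (by positivity) (by split_ifs <;> norm_num))
    (mem_range.2 (Nat.succ_pos J))
  exact le_trans (by simp [h]) this

lemma le_exp_of_stepProfile_ne_zero (hl : 0 ≤ l) {n : ℕ} (h : stepProfile J l n ≠ 0) :
    (n : ℝ) ≤ Real.exp (2 ^ J * l) := by
  by_contra hn
  refine h (sum_eq_zero fun j hj => ?_)
  rw [if_neg, mul_zero]
  refine fun h' => hn (h'.trans (Real.exp_le_exp.2 (mul_le_mul_of_nonneg_right ?_ hl)))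
  exact pow_le_pow_right₀ one_le_two (Nat.lt_succ_iff.1 (mem_range.1 hj))

variable {α : Type*} [Fintype α] (n : α → ℕ) {B : ℝ}

/-- The reciprocal sum of the values of `n` up to `x`. -/
noncomputable def recipSum (n : α → ℕ) (x : ℝ) : ℝ :=
  ∑ u, 1 / (n u : ℝ) * if (n u : ℝ) ≤ x then 1 else 0

lemma recipSum_le_sum_stepProfile (hlow : ∀ j ≤ J, B / 8 * (2 ^ j * l) ≤ recipSum n (Real.exp (2 ^ j * l))) :
    (J + 1) * (B / 8 * l) ≤ ∑ u, stepProfile J l (n u) / (n u : ℝ) := by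
  have : ∑ u, stepProfile J l (n u) / (n u : ℝ) =
      ∑ j ∈ range (J + 1), (1 / 2 : ℝ) ^ j * recipSum n (Real.exp (2 ^ j * l)) := by
    simp only [stepProfile, recipSum, mul_sum, sum_div]
    rw [sum_comm]
    exact sum_congr rfl fun j _ => sum_congr rfl fun u _ => by ring
  rw [this]
  calc (J + 1) * (B / 8 * l) = ∑ j ∈ range (J + 1), (B / 8 * l) := by simp
    _ ≤ _ := by
      refine sum_le_sum fun j hj => ?_
      calc B / 8 * l = (1 / 2) ^ j * (B / 8 * (2 ^ j * l)) := by
            rw [one_div, inv_pow]; field_simp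
        _ ≤ _ := mul_le_mul_of_nonneg_left (hlow j (Nat.lt_succ_iff.1 (mem_range.1 hj)))
            (by positivity)

lemma sum_sq_stepProfile_le (hB : 0 ≤ B) (hl : 0 ≤ l)
    (hup : ∀ j ≤ J, recipSum n (Real.exp (2 ^ j * l)) ≤ 2 * B * (2 ^ j * l)) :
    ∑ u, stepProfile J l (n u) ^ 2 / (n u : ℝ) ≤ 16 * B * l := by
  calc ∑ u, stepProfile J l (n u) ^ 2 / (n u : ℝ) ≤
        ∑ j ∈ range (J + 1), 4 * ((1 / 4 : ℝ) ^ j * recipSum n (Real.exp (2 ^ j * l))) := by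
        simp only [recipSum, mul_sum]
        rw [sum_comm]
        refine sum_le_sum fun u _ => ?_
        refine (div_le_div_of_nonneg_right (stepProfile_sq_le (n u)) (Nat.cast_nonneg _)).trans
          (le_of_eq ?_)
        rw [mul_sum, sum_div]
        exact sum_congr rfl fun j _ => by ring
    _ ≤ ∑ j ∈ range (J + 1), (8 * B * l) * ((1 / 2 : ℝ) ^ j * 1) := by
        refine sum_le_sum fun j hj => ?_
        have h := mul_le_mul_of_nonneg_left (hup j (Nat.lt_succ_iff.1 (mem_range.1 hj)))
          (by positivity : (0 : ℝ) ≤ 4 * (1 / 4) ^ j)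
        rw [← mul_assoc]
        refine h.trans (le_of_eq ?_)
        have : (1 / 4 : ℝ) ^ j * 2 ^ j = (1 / 2) ^ j := by rw [← mul_pow]; norm_num
        rw [← this]
        ring
    _ ≤ (8 * B * l) * 2 := by
        rw [← mul_sum]
        exact mul_le_mul_of_nonneg_left (sum_half_pow_le _ (fun _ => 1) fun _ => le_rfl)
          (by positivity)
    _ = _ := by ring

lemma le_sum_sq_stepProfile (hlow : B / 8 * l ≤ recipSum n (Real.exp l)) :
    B / 8 * l ≤ ∑ u, stepProfile J l (n u) ^ 2 / (n u : ℝ) := by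
  refine hlow.trans (sum_le_sum fun u _ => ?_)
  split_ifs with h
  · have := one_le_stepProfile (J := J) h
    rw [mul_one]
    gcongr
    nlinarith
  · rw [mul_zero]
    positivity

lemma sum_sq_stepProfile_mul_log_le (hl : 0 ≤ l) (hn : ∀ u, 1 ≤ n u)
    (hup : ∀ j ≤ J, recipSum n (Real.exp (2 ^ j * l)) ≤ 2 * B * (2 ^ j * l)) :
    ∑ u, stepProfile J l (n u) ^ 2 / (n u : ℝ) * Real.log (n u) ≤ 8 * (J + 1) * B * l ^ 2 := by
  calc ∑ u, stepProfile J l (n u) ^ 2 / (n u : ℝ) * Real.log (n u) ≤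
        ∑ j ∈ range (J + 1), 4 * ((1 / 4 : ℝ) ^ j * (2 ^ j * l) * recipSum n (Real.exp (2 ^ j * l))) := by
        simp only [recipSum, mul_sum]
        rw [sum_comm]
        refine sum_le_sum fun u _ => ?_
        have hlog : 0 ≤ Real.log (n u) := Real.log_natCast_nonneg _
        refine (mul_le_mul_of_nonneg_right (div_le_div_of_nonneg_right (stepProfile_sq_le (n u))
          (Nat.cast_nonneg _)) hlog).trans ?_
        rw [mul_sum, sum_div, sum_mul]
        refine sum_le_sum fun j _ => ?_
        split_ifs with h
        · have h' : Real.log (n u) ≤ 2 ^ j * l := by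
            rw [← Real.log_exp (2 ^ j * l)]
            exact Real.log_le_log (by have := hn u; positivity) h
          calc 4 * ((1 / 4 : ℝ) ^ j * 1) / (n u : ℝ) * Real.log (n u) ≤
              4 * ((1 / 4 : ℝ) ^ j * 1) / (n u : ℝ) * (2 ^ j * l) := by gcongr
            _ = _ := by ring
        · simp
    _ ≤ ∑ j ∈ range (J + 1), (8 * B * l ^ 2) := by
        refine sum_le_sum fun j hj => ?_
        have h := mul_le_mul_of_nonneg_left (hup j (Nat.lt_succ_iff.1 (mem_range.1 hj)))
          (by positivity : (0 : ℝ) ≤ 4 * ((1 / 4) ^ j * (2 ^ j * l)))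
        rw [← mul_assoc]
        refine h.trans (le_of_eq ?_)
        have : (1 / 4 : ℝ) ^ j * 2 ^ j * 2 ^ j = 1 := by
          rw [← mul_pow, ← mul_pow]; norm_num
        calc _ = ((1 / 4 : ℝ) ^ j * 2 ^ j * 2 ^ j) * (8 * B * l ^ 2) := by ring
          _ = _ := by rw [this, one_mul]
    _ = _ := by simp; ring

end profile

section maynard

variable {ι : Type*} [Fintype ι] [DecidableEq ι] {N : ι → ℕ} {k J R : ℕ} {l B : ℝ}
  {Ω : ι → Type*} [∀ i, Fintype (Ω i)] [∀ i, DecidableEq (Ω i)]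

lemma profile_ratio_le {X1 X2 Y : ℝ} (hB : 0 ≤ B) (hl : 0 ≤ l)
    (hX1 : (J + 1) * (B / 8 * l) ≤ X1) (hX2 : X2 ≤ 16 * B * l) (hY : 0 ≤ Y) :
    B * l * (J + 1) ^ 2 / 4096 * (X2 * Y) ≤ 1 / 4 * (X1 ^ 2 * Y) := by
  have h1 : ((J + 1) * (B / 8 * l)) ^ 2 ≤ X1 ^ 2 := pow_le_pow_left₀ (by positivity) hX1 2
  rw [← mul_assoc, ← mul_assoc]
  refine mul_le_mul_of_nonneg_right ?_ hY
  calc B * l * (J + 1) ^ 2 / 4096 * X2 ≤ B * l * (J + 1) ^ 2 / 4096 * (16 * B * l) := by gcongr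
    _ = 1 / 4 * ((J + 1) * (B / 8 * l)) ^ 2 := by ring
    _ ≤ _ := by gcongr

/-- The optimized sieve: the second moments over the generic classes exceed the second moment over
all classes by a factor of order `J`. -/
theorem exists_sieve_bounds (hΩ : ∀ i, Fintype.card (Ω i) = N i) (hk : ∀ i, 2 * k ≤ N i)
    (hN : ∀ i, 3 ≤ N i) (hk1 : 1 ≤ k) (hJ : 2 ^ J ≤ k) (hB : 0 < B) (hl : 0 < l)
    (hlR : 400 * k * (J + 1) * l ≤ Real.log R)
    (hS : 3 * (k : ℝ) ^ 2 * ∑ i, 1 / (N i : ℝ) ^ 2 ≤ 1 / 4)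
    (hlow : ∀ j ≤ J, B / 8 * (2 ^ j * l) ≤
      recipSum (fun U : Finset ι => ∏ i ∈ U, N i) (Real.exp (2 ^ j * l)))
    (hup : ∀ j ≤ J, recipSum (fun U : Finset ι => ∏ i ∈ U, N i) (Real.exp (2 ^ j * l)) ≤
      2 * B * (2 ^ j * l)) :
    ∃ Q : ℝ, 1 ≤ Q ∧ (∀ pt : ∀ i, Fin k → Ω i, (∀ i, Function.Injective (pt i)) →
      prodExpect (fun i _ => 1 / (N i : ℝ)) (fun x =>
      localSum (fun i => sieveLocal (pt i)) (sieveCoeff N k (stepProfile J l) R) x *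
        localSum (fun i => sieveLocal (pt i)) (sieveCoeff N k (stepProfile J l) R) x) ≤ 2 * Q) ∧
      ∀ pt : ∀ i, Fin k → Ω i, (∀ i, Function.Injective (pt i)) → ∀ j,
      B * l * (J + 1) ^ 2 / 4096 * Q ≤ prodExpect (fun i => punctured (pt i j)) (fun x =>
      localSum (fun i => sieveLocal (pt i)) (sieveCoeff N k (stepProfile J l) R) x *
        localSum (fun i => sieveLocal (pt i)) (sieveCoeff N k (stepProfile J l) R) x) := by
  set n : Finset ι → ℕ := fun U => ∏ i ∈ U, N i with hn
  set g := stepProfile J l with hg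
  have hn1 : ∀ U, 1 ≤ n U := fun U =>
    Nat.one_le_iff_ne_zero.2 (prod_ne_zero_iff.2 fun i _ => by have := hN i; omega)
  have hX1 := recipSum_le_sum_stepProfile n hlow
  have hX2 := sum_sq_stepProfile_le n hB.le hl.le hup
  have hX2' := le_sum_sq_stepProfile (J := J) n (B := B) (l := l) (by simpa using hlow 0 (Nat.zero_le _))
  have hX3 := sum_sq_stepProfile_mul_log_le n hl.le hn1 hup
  rw [← hg] at hX1 hX2 hX2' hX3
  have hg1 : 1 ≤ g 1 := one_le_stepProfile (by simpa using hl.le)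
  have hX2one : 1 ≤ ∑ U, g (n U) ^ 2 / (n U : ℝ) := by
    have h := single_le_sum (f := fun U : Finset ι => g (n U) ^ 2 / (n U : ℝ))
      (fun U _ => by positivity) (mem_univ ∅)
    refine le_trans ?_ h
    simp only [hn, prod_empty, Nat.cast_one, div_one]
    nlinarith
  set X1 := ∑ U, g (n U) / (n U : ℝ) with hX1d
  set X2 := ∑ U, g (n U) ^ 2 / (n U : ℝ) with hX2d
  have hX20 : 0 < X2 := by linarith
  have hkR : (1 : ℝ) ≤ k := by exact_mod_cast hk1
  have hJ0 : (0 : ℝ) ≤ J := Nat.cast_nonneg J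
  have hR0 : 0 < Real.log R := lt_of_lt_of_le (by positivity) hlR
  have hR : 2 ≤ R := by
    by_contra h
    have : R = 0 ∨ R = 1 := by omega
    rcases this with h | h <;> simp [h] at hR0
  have hgR : ∀ m, g m ≠ 0 → m ^ 4 ≤ R := by
    intro m hm
    have h1 := le_exp_of_stepProfile_ne_zero hl.le hm
    have h2 : ((m ^ 4 : ℕ) : ℝ) ≤ R := by
      rw [← Real.exp_log (by positivity : (0 : ℝ) < R)]
      push_cast
      refine (pow_le_pow_left₀ (Nat.cast_nonneg _) h1 4).trans ?_
      rw [← Real.exp_nat_mul]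
      refine Real.exp_le_exp.2 (le_trans ?_ hlR)
      have : (2 : ℝ) ^ J ≤ k := by exact_mod_cast hJ
      push_cast
      have h3 : 4 * ((2 : ℝ) ^ J * l) ≤ 4 * (k * l) := by gcongr
      have h4 : 0 < k * l := by positivity
      nlinarith [mul_nonneg h4.le hJ0]
    exact_mod_cast h2
  refine ⟨X2 ^ k, one_le_pow₀ hX2one, fun pt hpt => ?_, fun pt hpt j => ?_⟩
  · refine (prodExpect_uniform_sq_le hΩ (fun i => by have := hk i; omega) hN pt hpt).trans ?_
    refine mul_le_mul_of_nonneg_right ?_ (by positivity)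
    calc ∏ i, (1 + k / (N i : ℝ) ^ 2) ≤ ∏ i, Real.exp (k / (N i : ℝ) ^ 2) :=
          prod_le_prod (fun i _ => by positivity) fun i _ => by
            rw [add_comm]; exact Real.add_one_le_exp _
      _ = Real.exp (k * ∑ i, 1 / (N i : ℝ) ^ 2) := by
          rw [← Real.exp_sum, mul_sum]
          congr 1
          exact sum_congr rfl fun i _ => by ring
      _ ≤ Real.exp (1 / 2) := by
          refine Real.exp_le_exp.2 ?_
          have : 0 ≤ ∑ i, 1 / (N i : ℝ) ^ 2 := sum_nonneg fun i _ => by positivity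
          have h2 : (k : ℝ) * ∑ i, 1 / (N i : ℝ) ^ 2 ≤ k ^ 2 * ∑ i, 1 / (N i : ℝ) ^ 2 := by
            gcongr; nlinarith
          linarith
      _ ≤ 2 := by
          have h1 := Real.exp_one_lt_d9
          have h2 : Real.exp (1 / 2) ^ 2 = Real.exp 1 := by rw [← Real.exp_nat_mul]; norm_num
          nlinarith [Real.exp_pos (1 / 2 : ℝ)]
  · have h := le_prodExpect_punctured_sq (R := R) (A := 64 * (J + 1) * l) hΩ hk hN pt hpt
      (g := g) stepProfile_nonneg (by linarith) stepProfile_antitone hgR hR hS ?_ ?_ j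
    · refine le_trans ?_ h
      have h2 : X2 ^ k = X2 * X2 ^ (k - 1) := by rw [← pow_succ']; congr 1; omega
      rw [h2]
      exact profile_ratio_le hB.le hl.le hX1 hX2 (pow_nonneg hX20.le _)
    · have : (0 : ℝ) ≤ k * (J + 1) * l := by positivity
      nlinarith
    · refine hX3.trans ?_
      calc 8 * (J + 1) * B * l ^ 2 = 64 * (J + 1) * l * (B / 8 * l) := by ring
        _ ≤ _ := mul_le_mul_of_nonneg_left hX2' (by positivity)

end maynard

end

section

open Finset

section coprimeRecip

lemma sum_coprime_block_bounds (W : ℕ) (hW : 1 ≤ W) (q : ℕ) (hq : 1 ≤ q) :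
    (W.totient : ℝ) / W * (1 / (q + 1 : ℝ)) ≤
      ∑ u ∈ Ico (q * W) (q * W + W) with W.Coprime u, 1 / (u : ℝ) ∧
    ∑ u ∈ Ico (q * W) (q * W + W) with W.Coprime u, 1 / (u : ℝ) ≤
      (W.totient : ℝ) / W * (1 / (q : ℝ)) := by
  have hc := Nat.filter_coprime_Ico_eq_totient W (q * W)
  have hW0 : (0 : ℝ) < W := by positivity
  have hq0 : (0 : ℝ) < q := by positivity
  constructor
  · have h := card_nsmul_le_sum ((Ico (q * W) (q * W + W)).filter fun u => W.Coprime u)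
      (fun u => 1 / (u : ℝ)) (1 / ((q + 1) * W)) fun u hu => by
        simp only [mem_filter, mem_Ico] at hu
        have h1 : (0 : ℝ) < u := by
          have : 0 < q * W := by positivity
          exact_mod_cast this.trans_le hu.1.1
        have h2 : (u : ℝ) ≤ (q + 1) * W := by
          have : u ≤ (q + 1) * W := by linarith [hu.1.2]
          exact_mod_cast this
        exact one_div_le_one_div_of_le h1 h2
    rw [hc, nsmul_eq_mul] at h
    refine le_trans (le_of_eq ?_) h
    field_simp
  · have h := sum_le_card_nsmul ((Ico (q * W) (q * W + W)).filter fun u => W.Coprime u)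
      (fun u => 1 / (u : ℝ)) (1 / (q * W)) fun u hu => by
        simp only [mem_filter, mem_Ico] at hu
        have h2 : (q * W : ℝ) ≤ u := by exact_mod_cast hu.1.1
        exact one_div_le_one_div_of_le (by positivity) h2
    rw [hc, nsmul_eq_mul] at h
    refine h.trans (le_of_eq ?_)
    field_simp

lemma sum_coprime_bounds (W : ℕ) (hW : 1 ≤ W) (Q : ℕ) (hQ : 1 ≤ Q) :
    (W.totient : ℝ) / W * ((harmonic Q : ℝ) - 1) ≤
      ∑ u ∈ Ico W (Q * W) with W.Coprime u, 1 / (u : ℝ) ∧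
    ∑ u ∈ Ico W (Q * W) with W.Coprime u, 1 / (u : ℝ) ≤
      (W.totient : ℝ) / W * (harmonic (Q - 1) : ℝ) := by
  induction Q, hQ using Nat.le_induction with
  | base => simp
  | succ Q hQ ih =>
    have hsplit : ∑ u ∈ Ico W ((Q + 1) * W) with W.Coprime u, 1 / (u : ℝ) =
        ∑ u ∈ Ico W (Q * W) with W.Coprime u, 1 / (u : ℝ) +
        ∑ u ∈ Ico (Q * W) (Q * W + W) with W.Coprime u, 1 / (u : ℝ) := by
      simp only [sum_filter]
      rw [sum_Ico_consecutive]
      · congr 2; ring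
      · nlinarith
      · omega
    have hb := sum_coprime_block_bounds W hW Q hQ
    rw [hsplit]
    have e1 : (harmonic (Q + 1) : ℝ) = harmonic Q + 1 / (Q + 1 : ℝ) := by
      rw [harmonic_succ]; push_cast; rw [one_div]
    have e2 : (harmonic (Q + 1 - 1) : ℝ) = harmonic (Q - 1) + 1 / (Q : ℝ) := by
      obtain ⟨q, rfl⟩ : ∃ q, Q = q + 1 := ⟨Q - 1, by omega⟩
      simp only [Nat.add_sub_cancel]
      rw [harmonic_succ]; push_cast; rw [one_div]
    constructor
    · rw [e1]; nlinarith [ih.1, hb.1]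
    · rw [e2, mul_add]; linarith [ih.2, hb.2]

lemma sum_coprime_le (W : ℕ) (hW : 1 ≤ W) (x : ℕ) :
    ∑ u ∈ Ioc 0 x with W.Coprime u, 1 / (u : ℝ) ≤
      W + (W.totient : ℝ) / W * (1 + Real.log x) := by
  set Q := x / W + 1 with hQ
  have hxQ : x < Q * W := by
    rw [hQ, mul_comm]; exact Nat.lt_mul_div_succ x (by omega)
  have h1 : ∑ u ∈ Ioc 0 x with W.Coprime u, 1 / (u : ℝ) ≤
      ∑ u ∈ Ico 1 W, 1 / (u : ℝ) + ∑ u ∈ Ico W (Q * W) with W.Coprime u, 1 / (u : ℝ) := by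
    rw [← sum_union]
    · refine sum_le_sum_of_subset_of_nonneg ?_ fun _ _ _ => by positivity
      intro u hu
      simp only [mem_filter, mem_Ioc, mem_union, mem_Ico] at hu ⊢
      by_cases h : u < W
      · left; omega
      · right; exact ⟨⟨by omega, by omega⟩, hu.2⟩
    · rw [disjoint_left]
      intro u hu hu'
      simp only [mem_filter, mem_Ico] at hu hu'
      omega
  have hW0 : (0 : ℝ) < W := by exact_mod_cast hW
  have h2 : ∑ u ∈ Ico 1 W, 1 / (u : ℝ) ≤ W := by
    have := sum_le_card_nsmul (Ico 1 W) (fun u => 1 / (u : ℝ)) 1 fun u hu => by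
      have : (1 : ℝ) ≤ u := by exact_mod_cast (mem_Ico.1 hu).1
      rw [div_le_one (by linarith)]; exact this
    refine this.trans ?_
    simp
  have h3 := (sum_coprime_bounds W hW Q (Nat.le_add_left 1 _)).2
  have h4 : (harmonic (Q - 1) : ℝ) ≤ 1 + Real.log x := by
    refine (harmonic_le_one_add_log _).trans ?_
    rcases Nat.eq_zero_or_pos (x / W) with h | h
    · rw [hQ, h]; simpa using Real.log_natCast_nonneg x
    · have : Real.log ((Q - 1 : ℕ) : ℝ) ≤ Real.log x :=
        Real.log_le_log (by rw [hQ]; exact_mod_cast h) (by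
          rw [hQ]; exact_mod_cast Nat.div_le_self x W)
      linarith
  have h5 : (0 : ℝ) ≤ (W.totient : ℝ) / W := by positivity
  nlinarith [mul_le_mul_of_nonneg_left h4 h5]

lemma le_sum_coprime (W : ℕ) (hW : 1 ≤ W) (x : ℕ) (hx : W ≤ x) :
    (W.totient : ℝ) / W * (Real.log x - Real.log W - 1) ≤
      ∑ u ∈ Ioc 0 x with W.Coprime u, 1 / (u : ℝ) := by
  have hW0 : (0 : ℝ) < W := by exact_mod_cast hW
  have hx0 : (0 : ℝ) < x := by exact_mod_cast hW.trans hx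
  set Q := x / W with hQ
  have hQ1 : 1 ≤ Q := (Nat.one_le_div_iff (by omega)).2 hx
  have h1 := (sum_coprime_bounds W hW Q hQ1).1
  have h2 : ∑ u ∈ Ico W (Q * W) with W.Coprime u, 1 / (u : ℝ) ≤
      ∑ u ∈ Ioc 0 x with W.Coprime u, 1 / (u : ℝ) := by
    refine sum_le_sum_of_subset_of_nonneg ?_ fun _ _ _ => by positivity
    intro u hu
    simp only [mem_filter, mem_Ioc, mem_Ico] at hu ⊢
    have : Q * W ≤ x := Nat.div_mul_le_self x W
    exact ⟨⟨by omega, by omega⟩, hu.2⟩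
  have h3 : Real.log x - Real.log W ≤ harmonic Q := by
    refine le_trans ?_ (log_add_one_le_harmonic Q)
    rw [← Real.log_div (by positivity) (by positivity)]
    refine Real.log_le_log (by positivity) ?_
    rw [div_le_iff₀ (by positivity)]
    have : x < W * (Q + 1) := Nat.lt_mul_div_succ x (by omega)
    have h : (x : ℝ) < W * ((Q + 1 : ℕ) : ℝ) := by exact_mod_cast this
    linarith
  have h5 : (0 : ℝ) ≤ (W.totient : ℝ) / W := by positivity
  refine le_trans ?_ (h1.trans h2)
  exact mul_le_mul_of_nonneg_left (by linarith) h5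

end coprimeRecip

section primeSubsets

lemma primeFactors_prod_coe {P : Finset ℕ} (hP : ∀ p ∈ P, p.Prime) (U : Finset P) :
    (∏ i ∈ U, (i : ℕ)).primeFactors = U.map (Function.Embedding.subtype _) := by
  have : ∏ i ∈ U, (i : ℕ) = ∏ p ∈ U.map (Function.Embedding.subtype _), p := by
    rw [prod_map]; rfl
  rw [this, Nat.primeFactors_prod]
  intro p hp
  obtain ⟨i, _, rfl⟩ := mem_map.1 hp
  exact hP _ i.2

lemma prod_coe_injective {P : Finset ℕ} (hP : ∀ p ∈ P, p.Prime) :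
    Function.Injective fun U : Finset P => ∏ i ∈ U, (i : ℕ) := by
  intro U V h
  have := congrArg Nat.primeFactors h
  simp only at this
  rw [primeFactors_prod_coe hP, primeFactors_prod_coe hP] at this
  exact map_injective _ this

lemma exists_prod_coe_eq {P : Finset ℕ} (hP : ∀ p ∈ P, p.Prime) {n : ℕ} (hn : Squarefree n)
    (h : ∀ p, p.Prime → p ∣ n → p ∈ P) : ∃ U : Finset P, ∏ i ∈ U, (i : ℕ) = n := by
  refine ⟨univ.filter fun i => (i : ℕ) ∣ n, ?_⟩
  conv_rhs => rw [← Nat.prod_primeFactors_of_squarefree hn]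
  refine prod_bij (fun i _ => (i : ℕ)) ?_ ?_ ?_ ?_
  · intro i hi
    exact Nat.mem_primeFactors.2 ⟨hP _ i.2, (mem_filter.1 hi).2, hn.ne_zero⟩
  · intro i _ j _ hij
    exact Subtype.ext hij
  · intro p hp
    have hp' := Nat.mem_primeFactors.1 hp
    exact ⟨⟨p, h p hp'.1 hp'.2.1⟩, mem_filter.2 ⟨mem_univ _, hp'.2.1⟩, rfl⟩
  · intro i _
    rfl

lemma sum_le_sum_comp_of_forall_exists {α β : Type*} [DecidableEq β] (A : Finset α) (S : Finset β)
    (g : β → α) (f : α → ℝ) (h : ∀ u ∈ A, ∃ s ∈ S, g s = u) (hf : ∀ s ∈ S, 0 ≤ f (g s)) :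
    ∑ u ∈ A, f u ≤ ∑ s ∈ S, f (g s) := by
  rcases A.eq_empty_or_nonempty with rfl | ⟨u₀, hu₀⟩
  · simpa using sum_nonneg hf
  have : Nonempty β := ⟨(h u₀ hu₀).choose⟩
  choose! i hi hg using h
  have h1 : ∑ u ∈ A, f u = ∑ s ∈ A.image i, f (g s) := by
    rw [sum_image]
    · exact sum_congr rfl fun u hu => by rw [hg u hu]
    · intro u hu v hv huv
      rw [← hg u hu, ← hg v hv, huv]
  rw [h1]
  refine sum_le_sum_of_subset_of_nonneg ?_ fun s hs _ => hf s hs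
  intro s hs
  obtain ⟨u, hu, rfl⟩ := mem_image.1 hs
  exact hi u hu

lemma recipSum_primes_le {D R p₁ : ℕ} {P : Finset ℕ}
    (hP : P = ((Ioc D R).filter Nat.Prime).erase p₁) {x : ℝ} :
    recipSum (fun U : Finset P => ∏ i ∈ U, (i : ℕ)) x ≤
      ∑ u ∈ Ioc 0 ⌊x⌋₊ with D.factorial.Coprime u, 1 / (u : ℝ) := by
  have hP' : ∀ p ∈ P, p.Prime ∧ D < p := by
    intro p hp
    rw [hP] at hp
    simp only [mem_erase, mem_filter, mem_Ioc] at hp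
    exact ⟨hp.2.2, hp.2.1.1⟩
  have hinj := prod_coe_injective fun p hp => (hP' p hp).1
  unfold recipSum
  simp only [mul_ite, mul_one, mul_zero]
  rw [← sum_filter]
  rw [← sum_image (f := fun u : ℕ => 1 / (u : ℝ)) (g := fun U : Finset P => ∏ i ∈ U, (i : ℕ))
    fun U _ V _ h => hinj h]
  refine sum_le_sum_of_subset_of_nonneg ?_ fun _ _ _ => by positivity
  intro u hu
  obtain ⟨U, hU, rfl⟩ := mem_image.1 hu
  simp only [mem_filter, mem_Ioc]
  refine ⟨⟨prod_pos fun i _ => (hP' _ i.2).1.pos, Nat.le_floor (mem_filter.1 hU).2⟩, ?_⟩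
  refine Nat.Coprime.prod_right fun i _ => ?_
  rw [Nat.coprime_comm, (hP' _ i.2).1.coprime_iff_not_dvd, (hP' _ i.2).1.dvd_factorial]
  exact not_le.2 (hP' _ i.2).2

lemma sum_coprime_le_recipSum_primes {D R p₁ : ℕ} (hp₁ : 2 ≤ p₁) {P : Finset ℕ}
    (hP : P = ((Ioc D R).filter Nat.Prime).erase p₁) {x : ℝ} (hx : 1 ≤ x) (hxR : x ≤ R) :
    ∑ u ∈ Ioc 0 ⌊x⌋₊ with D.factorial.Coprime u, 1 / (u : ℝ) ≤
      3 * recipSum (fun U : Finset P => ∏ i ∈ U, (i : ℕ)) x := by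
  have hP' : ∀ p ∈ P, p.Prime := by
    intro p hp
    rw [hP] at hp
    simp only [mem_erase, mem_filter, mem_Ioc] at hp
    exact hp.2.2
  set S := (univ.filter fun U : Finset P => ((∏ i ∈ U, (i : ℕ) : ℕ) : ℝ) ≤ x) ×ˢ
    (({1, p₁} : Finset ℕ) ×ˢ Ioc 0 ⌊x⌋₊) with hS
  have key := sum_le_sum_comp_of_forall_exists
    (((Ioc 0 ⌊x⌋₊).filter fun u => D.factorial.Coprime u)) S
    (fun s => (∏ i ∈ s.1, (i : ℕ)) * s.2.1 * s.2.2 ^ 2) (fun u => 1 / (u : ℝ)) ?_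
    (fun s _ => by positivity)
  · refine key.trans ?_
    rw [hS, sum_product]
    have hq : (∑ e ∈ ({1, p₁} : Finset ℕ), ∑ c ∈ Ioc 0 ⌊x⌋₊, 1 / ((e : ℝ) * (c : ℝ) ^ 2)) ≤ 3 := by
      have h1 : ∑ c ∈ Ioc 0 ⌊x⌋₊, ((c : ℝ) ^ 2)⁻¹ ≤ 2 := by
        have := sum_Ioo_inv_sq_le (α := ℝ) 0 (⌊x⌋₊ + 1)
        have e : Ioo 0 (⌊x⌋₊ + 1) = Ioc 0 ⌊x⌋₊ := by ext; simp
        rw [e] at this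
        simpa using this
      have h2 : (1 : ℝ) / p₁ ≤ 1 / 2 := one_div_le_one_div_of_le (by norm_num) (by exact_mod_cast hp₁)
      rw [sum_pair (by omega)]
      have e1 : ∀ e : ℝ, ∑ c ∈ Ioc 0 ⌊x⌋₊, 1 / (e * (c : ℝ) ^ 2) =
          1 / e * ∑ c ∈ Ioc 0 ⌊x⌋₊, ((c : ℝ) ^ 2)⁻¹ := by
        intro e
        rw [mul_sum]
        exact sum_congr rfl fun c _ => by rw [one_div, mul_inv, one_div]
      rw [e1, e1]
      have h0 : 0 ≤ ∑ c ∈ Ioc 0 ⌊x⌋₊, ((c : ℝ) ^ 2)⁻¹ := sum_nonneg fun _ _ => by positivity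
      push_cast
      nlinarith [mul_le_mul_of_nonneg_right h2 h0]
    unfold recipSum
    simp only [mul_ite, mul_one, mul_zero]
    rw [← sum_filter, mul_sum]
    refine sum_le_sum fun U hU => ?_
    rw [sum_product]
    have e2 : ∑ e ∈ ({1, p₁} : Finset ℕ), ∑ c ∈ Ioc 0 ⌊x⌋₊,
        1 / (((∏ i ∈ U, (i : ℕ)) * e * c ^ 2 : ℕ) : ℝ) =
        1 / ((∏ i ∈ U, (i : ℕ) : ℕ) : ℝ) *
        (∑ e ∈ ({1, p₁} : Finset ℕ), ∑ c ∈ Ioc 0 ⌊x⌋₊, 1 / ((e : ℝ) * (c : ℝ) ^ 2)) := by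
      simp only [mul_sum]
      refine sum_congr rfl fun e _ => sum_congr rfl fun c _ => ?_
      rw [Nat.cast_mul, Nat.cast_mul, Nat.cast_pow, mul_assoc, one_div_mul_one_div]
    rw [e2, mul_comm (3 : ℝ)]
    exact mul_le_mul_of_nonneg_left hq (by positivity)
  · intro u hu
    simp only [mem_filter, mem_Ioc] at hu
    obtain ⟨s, c, hcs, hs⟩ := Nat.sq_mul_squarefree u
    have hu0 : 0 < u := hu.1.1
    have hc0 : 0 < c := Nat.pos_of_ne_zero fun h => by rw [h] at hcs; simp at hcs; omega
    have hs0 : 0 < s := Nat.pos_of_ne_zero hs.ne_zero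
    have hsu : s ∣ u := ⟨c ^ 2, by rw [← hcs, mul_comm]⟩
    have hmem : ∀ t, t ∣ s → ¬ p₁ ∣ t → ∀ p, p.Prime → p ∣ t → p ∈ P := by
      intro t hts hpt p hp hpt'
      rw [hP]
      have hpu : p ∣ u := (hpt'.trans hts).trans hsu
      simp only [mem_erase, mem_filter, mem_Ioc]
      refine ⟨fun h => hpt (h ▸ hpt'), ⟨?_, ?_⟩, hp⟩
      · by_contra hcon
        have : p ∣ D.factorial := hp.dvd_factorial.2 (not_lt.1 hcon)
        exact hp.one_lt.ne' (Nat.dvd_one.1 (hu.2 ▸ Nat.dvd_gcd this hpu))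
      · have h1 : p ≤ ⌊x⌋₊ := (Nat.le_of_dvd hu0 hpu).trans hu.1.2
        have h2 : ⌊x⌋₊ ≤ R := Nat.floor_le_of_le hxR
        exact h1.trans h2
    have hle : ∀ t, t ∣ s → (t : ℝ) ≤ x := by
      intro t hts
      have h1 : t ≤ ⌊x⌋₊ := (Nat.le_of_dvd hu0 (hts.trans hsu)).trans hu.1.2
      exact (Nat.le_floor_iff (by linarith)).1 h1
    have hcx : c ≤ ⌊x⌋₊ := by
      refine le_trans ?_ hu.1.2
      exact Nat.le_of_dvd hu0 ⟨c * s, by rw [← hcs]; ring⟩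
    by_cases hps : p₁ ∣ s
    · obtain ⟨t, rfl⟩ := hps
      have hpt : ¬ p₁ ∣ t := by
        intro h
        have := hs p₁ (mul_dvd_mul_left _ h)
        rw [Nat.isUnit_iff] at this
        omega
      obtain ⟨U, hU⟩ := exists_prod_coe_eq hP' (hs.squarefree_of_dvd (dvd_mul_left t p₁))
        (hmem t (dvd_mul_left _ _) hpt)
      refine ⟨(U, p₁, c), ?_, ?_⟩
      · rw [hS]
        simp only [mem_product, mem_filter, mem_univ, true_and, mem_insert, mem_singleton, mem_Ioc]
        exact ⟨by rw [hU]; exact hle t (dvd_mul_left _ _), by simp, hc0, hcx⟩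
      · simp only [hU]; rw [← hcs]; ring
    · obtain ⟨U, hU⟩ := exists_prod_coe_eq hP' hs (hmem s dvd_rfl hps)
      refine ⟨(U, 1, c), ?_, ?_⟩
      · rw [hS]
        simp only [mem_product, mem_filter, mem_univ, true_and, mem_insert, mem_singleton, mem_Ioc]
        exact ⟨by rw [hU]; exact hle s dvd_rfl, by simp, hc0, hcx⟩
      · simp only [hU]; rw [← hcs]; ring

/-- Upper and lower bounds of the right order for the reciprocal sum over squarefree integers
composed of the primes in `(D, R]`, uniformly when one prime is omitted. -/
theorem exists_recipSum_bounds (D : ℕ) : ∃ L₀ : ℝ, 1 ≤ L₀ ∧ ∀ (R p₁ : ℕ) (P : Finset ℕ), 2 ≤ p₁ →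
    P = ((Ioc D R).filter Nat.Prime).erase p₁ → ∀ L, L₀ ≤ L →
    recipSum (fun U : Finset P => ∏ i ∈ U, (i : ℕ)) (Real.exp L) ≤
      2 * ((D.factorial.totient : ℝ) / D.factorial) * L ∧
    (Real.exp L ≤ R → (D.factorial.totient : ℝ) / D.factorial / 8 * L ≤
      recipSum (fun U : Finset P => ∏ i ∈ U, (i : ℕ)) (Real.exp L)) := by
  set W := D.factorial with hWdef
  have hW : 1 ≤ W := Nat.factorial_pos D
  have hW0 : (0 : ℝ) < W := by exact_mod_cast hW
  have hκ0 : (0 : ℝ) < (W.totient : ℝ) / W := by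
    have : 0 < W.totient := Nat.totient_pos.2 hW
    positivity
  set κ := (W.totient : ℝ) / W with hκ
  refine ⟨max 1 (max (W / κ + 1) (4 * (Real.log W + 2))), le_max_left _ _, ?_⟩
  intro R p₁ P hp₁ hP L hL
  have hL1 : 1 ≤ L := (le_max_left _ _).trans hL
  have hL2 : W / κ + 1 ≤ L := ((le_max_left _ _).trans (le_max_right _ _)).trans hL
  have hL3 : 4 * (Real.log W + 2) ≤ L := ((le_max_right _ _).trans (le_max_right _ _)).trans hL
  have hx1 : 1 ≤ Real.exp L := Real.one_le_exp (by linarith)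
  have hfl : 1 ≤ ⌊Real.exp L⌋₊ := Nat.one_le_floor_iff _ |>.2 hx1
  have hfl0 : (0 : ℝ) < ⌊Real.exp L⌋₊ := by exact_mod_cast hfl
  have hlogle : Real.log ⌊Real.exp L⌋₊ ≤ L := by
    have := Real.log_le_log hfl0 (Nat.floor_le (Real.exp_pos L).le)
    rwa [Real.log_exp] at this
  constructor
  · refine (recipSum_primes_le hP).trans ((sum_coprime_le W hW _).trans ?_)
    have h1 : (W : ℝ) ≤ κ * (L - 1) := by
      have : (W : ℝ) / κ ≤ L - 1 := by linarith
      rw [div_le_iff₀ hκ0] at this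
      linarith
    have h2 := mul_le_mul_of_nonneg_left hlogle hκ0.le
    nlinarith
  · intro hR
    have h1 := sum_coprime_le_recipSum_primes hp₁ hP hx1 hR
    have hlogW : 0 ≤ Real.log W := Real.log_nonneg (by exact_mod_cast hW)
    have hlow : L - 1 ≤ Real.log ⌊Real.exp L⌋₊ := by
      have h3 : Real.exp (L - 1) ≤ ⌊Real.exp L⌋₊ := by
        have h4 := Nat.lt_floor_add_one (Real.exp L)
        have h5 : (1 : ℝ) ≤ ⌊Real.exp L⌋₊ := by exact_mod_cast hfl
        have h6 : Real.exp L = Real.exp (L - 1) * Real.exp 1 := by rw [← Real.exp_add]; ring_nf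
        have h7 : (2 : ℝ) ≤ Real.exp 1 := by have := Real.add_one_le_exp 1; linarith
        nlinarith [Real.exp_pos (L - 1)]
      have := Real.log_le_log (Real.exp_pos _) h3
      rwa [Real.log_exp] at this
    have hWx : W ≤ ⌊Real.exp L⌋₊ := by
      refine Nat.le_floor ?_
      rw [← Real.exp_log hW0]
      exact Real.exp_le_exp.2 (by linarith)
    have h2 := le_sum_coprime W hW _ hWx
    have h3 : κ * (3 / 4 * L) ≤ κ * (Real.log ⌊Real.exp L⌋₊ - Real.log W - 1) :=
      mul_le_mul_of_nonneg_left (by linarith) hκ0.le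
    have h4 : 0 ≤ κ * L := by positivity
    linarith

end primeSubsets

end

section

open Finset Filter Topology
open scoped ArithmeticFunction.vonMangoldt Nat

section logWeight

/-- The weight `(log n) ^ K / n ^ (1 + η)`. -/
noncomputable def logWeight (K : ℕ) (η : ℝ) (n : ℕ) : ℝ := Real.log n ^ K / (n : ℝ) ^ (1 + η)

lemma logWeight_nonneg (K : ℕ) (η : ℝ) (n : ℕ) : 0 ≤ logWeight K η n :=
  div_nonneg (pow_nonneg (Real.log_natCast_nonneg n) K) (Real.rpow_nonneg n.cast_nonneg _)

lemma LSeries_term_logWeight (a : ℕ → ℂ) (K : ℕ) (η : ℝ) (hη : 0 < η) (n : ℕ) :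
    LSeries.term (fun m => (Real.log m : ℂ) ^ K * a m) ((1 + η : ℝ) : ℂ) n =
      logWeight K η n * a n := by
  rcases eq_or_ne n 0 with rfl | hn
  · have : (1 + η) ≠ 0 := by linarith
    simp [logWeight, Real.zero_rpow this]
  · rw [LSeries.term_of_ne_zero hn, logWeight]
    push_cast
    rw [Complex.ofReal_cpow n.cast_nonneg]
    push_cast
    ring

lemma logMul_iterate (a : ℕ → ℂ) (K : ℕ) {m : ℕ} :
    (LSeries.logMul^[K] a) m = (Real.log m : ℂ) ^ K * a m := by
  induction K with
  | zero => simp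
  | succ n ih =>
    rw [Function.iterate_succ_apply', LSeries.logMul, ih, pow_succ', Complex.natCast_log]
    ring

lemma summable_logWeight_mul {a : ℕ → ℂ} (ha : LSeries.abscissaOfAbsConv a ≤ 1) (K : ℕ) {η : ℝ}
    (hη : 0 < η) : Summable fun n => (logWeight K η n : ℂ) * a n := by
  have h1 : LSeries.abscissaOfAbsConv (LSeries.logMul^[K] a) < (((1 + η : ℝ) : ℂ)).re := by
    rw [LSeries.absicssaOfAbsConv_logPowMul, Complex.ofReal_re]
    exact ha.trans_lt (by exact_mod_cast (by linarith : 1 < 1 + η))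
  have h2 := LSeriesSummable_of_abscissaOfAbsConv_lt_re h1
  have h3 : LSeries.logMul^[K] a = fun m : ℕ => (Real.log m : ℂ) ^ K * a m :=
    funext fun m => logMul_iterate a K
  rw [h3] at h2
  exact h2.congr fun n => LSeries_term_logWeight a K η hη n

/-- High logarithmic moments of a Dirichlet series with at most a simple pole at `1`. -/
theorem exists_norm_tsum_logWeight_sub_le {a : ℕ → ℂ} {c : ℂ}
    (ha : LSeries.abscissaOfAbsConv a ≤ 1) {g : ℂ → ℂ} (hg : AnalyticAt ℂ g 1)
    (h : ∀ s : ℂ, 1 < s.re → LSeries a s = c / (s - 1) + g s) :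
    ∃ r > 0, ∃ M : ℝ, 0 ≤ M ∧ ∀ η, 0 < η → η ≤ r → ∀ K : ℕ,
      ‖∑' n, (logWeight K η n : ℂ) * a n - c * K ! / (η : ℂ) ^ (K + 1)‖ ≤ K ! * M / r ^ K := by
  obtain ⟨R, hR, hRg⟩ := Metric.eventually_nhds_iff_ball.1
    (hg.eventually_analyticAt.and (hg.continuousAt.norm.eventually_lt_const
      (lt_add_one ‖g 1‖)))
  refine ⟨R / 3, by positivity, ‖g 1‖ + 1, by positivity, fun η hη hηr K => ?_⟩
  set s₀ : ℂ := ((1 + η : ℝ) : ℂ) with hs₀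
  have hs₀re : 1 < s₀.re := by rw [hs₀, Complex.ofReal_re]; linarith
  have hdist : dist s₀ 1 = η := by
    rw [hs₀, dist_eq_norm]
    push_cast
    rw [add_sub_cancel_left, Complex.norm_real, Real.norm_of_nonneg hη.le]
  have hsub : Metric.closedBall s₀ (R / 3) ⊆ Metric.ball 1 R := by
    intro z hz
    have := dist_triangle z s₀ 1
    rw [Metric.mem_closedBall] at hz
    rw [Metric.mem_ball]
    linarith
  have hgd : DiffContOnCl ℂ g (Metric.ball s₀ (R / 3)) := by
    refine DifferentiableOn.diffContOnCl fun z hz => ?_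
    have hz' := hsub (Metric.closure_ball_subset_closedBall hz)
    exact (hRg z hz').1.differentiableAt.differentiableWithinAt
  have key := Complex.norm_iteratedDeriv_le_of_forall_mem_sphere_norm_le K
    (by positivity : 0 < R / 3) hgd
    (fun z hz => (hRg z (hsub (Metric.sphere_subset_closedBall hz))).2.le)
  have hopen : IsOpen {s : ℂ | 1 < s.re} := isOpen_lt continuous_const Complex.continuous_re
  have hev : LSeries a =ᶠ[𝓝 s₀] fun s => c * (1 * s - 1)⁻¹ + g s := by
    filter_upwards [hopen.mem_nhds hs₀re] with s hs
    rw [h s hs, one_mul, div_eq_mul_inv]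
  have h1 := hev.iteratedDeriv_eq K
  have hgan : AnalyticAt ℂ g s₀ := (hRg s₀ (hsub (Metric.mem_closedBall_self (by positivity)))).1
  have hne : (1 : ℂ) * s₀ - 1 ≠ 0 := by
    rw [hs₀]; push_cast
    have : (η : ℂ) ≠ 0 := by exact_mod_cast hη.ne'
    ring_nf; simpa using this
  have hpan : AnalyticAt ℂ (fun s : ℂ => (1 * s - 1)⁻¹) s₀ :=
    ((analyticAt_const.mul analyticAt_id).sub analyticAt_const).inv hne
  have h2 : iteratedDeriv K (fun s => c * (1 * s - 1)⁻¹ + g s) s₀ =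
      c * ((-1) ^ K * K ! * (η : ℂ) ^ (-1 - K : ℤ)) + iteratedDeriv K g s₀ := by
    have hcp : ContDiffAt ℂ K (fun s : ℂ => c * (1 * s - 1)⁻¹) s₀ :=
      contDiffAt_const.mul hpan.contDiffAt
    rw [iteratedDeriv_fun_add hcp hgan.contDiffAt,
      iteratedDeriv_const_mul _ hpan.contDiffAt, iteratedDeriv_eq_iterate,
      iter_deriv_inv_linear_sub]
    congr 3
    rw [hs₀]; push_cast; ring_nf
  rw [h2, LSeries_iteratedDeriv K (ha.trans_lt (by exact_mod_cast hs₀re))] at h1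
  have h3 : LSeries (LSeries.logMul^[K] a) s₀ = ∑' n, (logWeight K η n : ℂ) * a n := by
    have h3 : LSeries.logMul^[K] a = fun m : ℕ => (Real.log m : ℂ) ^ K * a m :=
      funext fun m => logMul_iterate a K
    rw [h3, LSeries]
    exact tsum_congr fun n => LSeries_term_logWeight a K η hη n
  rw [h3] at h1
  have hη0 : (η : ℂ) ≠ 0 := by exact_mod_cast hη.ne'
  have h4 : (η : ℂ) ^ (-1 - K : ℤ) = 1 / (η : ℂ) ^ (K + 1) := by
    rw [show (-1 - K : ℤ) = -((K + 1 : ℕ) : ℤ) by push_cast; ring, zpow_neg, zpow_natCast, one_div]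
  rw [h4] at h1
  have h5 : iteratedDeriv K g s₀ = (-1) ^ K * (∑' n, (logWeight K η n : ℂ) * a n -
      c * K ! / (η : ℂ) ^ (K + 1)) := by
    rw [mul_sub, h1]; ring
  rw [h5, norm_mul, norm_pow, norm_neg, norm_one, one_pow, one_mul] at key
  exact key

lemma factorial_mul_div_pow_le {M r η ε : ℝ} (hη : 0 < η) (hM : 0 ≤ M) (hηr : η ≤ r)
    (hε : M * η ≤ ε) (K : ℕ) : (K ! : ℝ) * M / r ^ K ≤ ε * (K ! / η ^ (K + 1)) := by
  have h1 : (K ! : ℝ) * M / r ^ K ≤ K ! * M / η ^ K := by gcongr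
  have h2 : (K ! : ℝ) * M / η ^ K = (M * η) * (K ! / η ^ (K + 1)) := by
    field_simp; ring
  rw [h2] at h1
  exact h1.trans (mul_le_mul_of_nonneg_right hε (by positivity))

/-- The moments of the zeta function. -/
lemma exists_tsum_logWeight_le : ∃ r > 0, ∀ η, 0 < η → η ≤ r → ∀ K : ℕ,
    Summable (logWeight K η) ∧ ∑' n, logWeight K η n ≤ 2 * (K ! / η ^ (K + 1)) := by
  have ha : LSeries.abscissaOfAbsConv (fun _ : ℕ => (1 : ℂ)) ≤ 1 :=
    LSeries.abscissaOfAbsConv_one.le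
  have hg : AnalyticAt ℂ riemannZeta₀ 1 :=
    differentiable_riemannZeta₀.analyticAt 1
  obtain ⟨r, hr, M, hM, hb⟩ := exists_norm_tsum_logWeight_sub_le (c := 1) ha hg fun s hs => by
    have hs1 : s ≠ 1 := fun h => by rw [h, Complex.one_re] at hs; exact lt_irrefl _ hs
    rw [one_div, ← riemannZeta_eq_inv_sub_add hs1]
    exact LSeries_one_eq_riemannZeta hs
  refine ⟨min r (1 / (M + 1)), by positivity, fun η hη hηr K => ?_⟩
  have hηr' := hηr.trans (min_le_left _ _)
  have h1 := hb η hη hηr' K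
  have hs := summable_logWeight_mul ha K hη
  simp only [mul_one] at hs h1
  have hs' : Summable (logWeight K η) := Complex.summable_ofReal.1 hs
  refine ⟨hs', ?_⟩
  have h2 : ‖∑' n, (logWeight K η n : ℂ) - 1 * K ! / (η : ℂ) ^ (K + 1)‖ =
      |∑' n, logWeight K η n - K ! / η ^ (K + 1)| := by
    rw [← Real.norm_eq_abs, ← Complex.norm_real]
    push_cast
    rw [one_mul]
  rw [h2] at h1
  have h3 : (K ! : ℝ) * M / r ^ K ≤ 1 * (K ! / η ^ (K + 1)) := by
    refine factorial_mul_div_pow_le hη hM hηr' ?_ K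
    have := hηr.trans (min_le_right _ _)
    rw [le_div_iff₀ (by positivity)] at this
    linarith
  linarith [(abs_le.1 h1).2]

open ArithmeticFunction.vonMangoldt DirichletCharacter in
lemma analyticAt_LFunctionResidueClassAux {q : ℕ} [NeZero q] (a : ZMod q) :
    AnalyticAt ℂ (LFunctionResidueClassAux a) 1 := by
  classical
  have hT := (differentiable_LFunctionTrivChar₁ q).analyticAt 1
  refine analyticAt_const.mul ((hT.deriv.neg.div hT
    (LFunctionTrivChar₁_apply_one_ne_zero q)).sub ?_)
  refine Finset.analyticAt_fun_sum _ fun χ hχ => ?_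
  have hχ1 : χ ≠ 1 := by simpa using hχ
  have hL := (differentiable_LFunction hχ1).analyticAt 1
  exact (analyticAt_const.mul hL.deriv).div hL (LFunction_apply_one_ne_zero hχ1)

open ArithmeticFunction.vonMangoldt in
/-- The moments of the von Mangoldt function in the residue class of `1`. -/
lemma exists_le_tsum_vonMangoldt_logWeight (q : ℕ) [NeZero q] :
    ∃ r > 0, ∀ η, 0 < η → η ≤ r → ∀ K : ℕ,
    Summable (fun n : ℕ => logWeight K η n * residueClass (1 : ZMod q) n) ∧
    1 / (2 * q.totient) * (K ! / η ^ (K + 1)) ≤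
      ∑' n : ℕ, logWeight K η n * residueClass (1 : ZMod q) n := by
  have ha : LSeries.abscissaOfAbsConv (fun n => (residueClass (1 : ZMod q) n : ℂ)) ≤ 1 :=
    abscissaOfAbsConv_residueClass_le_one 1
  obtain ⟨r, hr, M, hM, hb⟩ := exists_norm_tsum_logWeight_sub_le
    (c := (q.totient : ℂ)⁻¹) ha (analyticAt_LFunctionResidueClassAux (1 : ZMod q)) fun s hs => by
      rw [eqOn_LFunctionResidueClassAux isUnit_one hs]
      ring
  have hφ : 0 < (q.totient : ℝ) := by
    exact_mod_cast Nat.totient_pos.2 (NeZero.pos q)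
  refine ⟨min r (1 / (2 * q.totient * (M + 1))), by positivity, fun η hη hηr K => ?_⟩
  have hηr' := hηr.trans (min_le_left _ _)
  have h1 := hb η hη hηr' K
  have hs := summable_logWeight_mul ha K hη
  have hs' : Summable (fun n : ℕ => logWeight K η n * residueClass (1 : ZMod q) n) := by
    refine Complex.summable_ofReal.1 (hs.congr fun n => ?_)
    push_cast; rfl
  refine ⟨hs', ?_⟩
  have h2 : ‖∑' n : ℕ, (logWeight K η n : ℂ) * (residueClass (1 : ZMod q) n : ℂ) -
      (q.totient : ℂ)⁻¹ * K ! / (η : ℂ) ^ (K + 1)‖ =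
      |∑' n : ℕ, logWeight K η n * residueClass (1 : ZMod q) n -
        (q.totient : ℝ)⁻¹ * K ! / η ^ (K + 1)| := by
    rw [← Real.norm_eq_abs, ← Complex.norm_real]
    push_cast
    rfl
  rw [h2] at h1
  have h3 : (K ! : ℝ) * M / r ^ K ≤ 1 / (2 * q.totient) * (K ! / η ^ (K + 1)) := by
    refine factorial_mul_div_pow_le hη hM hηr' ?_ K
    have := hηr.trans (min_le_right _ _)
    rw [le_div_iff₀ (by positivity)] at this
    rw [le_div_iff₀ (by positivity)]
    nlinarith [mul_pos hη hφ]
  have h4 : (q.totient : ℝ)⁻¹ * K ! / η ^ (K + 1) =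
      2 * (1 / (2 * q.totient) * (K ! / η ^ (K + 1))) := by
    field_simp
  rw [h4] at h1
  linarith [(abs_le.1 h1).1]

end logWeight

end

section

open Finset Filter Topology
open scoped ArithmeticFunction.vonMangoldt Nat

section window

lemma pow_mul_exp_neg_le {K : ℕ} {x y : ℝ} (hx : 0 < x) (hK : K ≤ x) (hxy : x ≤ y) :
    y ^ K * Real.exp (-y) ≤ x ^ K * Real.exp (-x) := by
  have h1 : y ≤ x * Real.exp ((y - x) / x) := by
    have := Real.add_one_le_exp ((y - x) / x)
    calc y = x * ((y - x) / x + 1) := by field_simp; ring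
      _ ≤ _ := by gcongr
  have h2 : y ^ K ≤ x ^ K * Real.exp (y - x) := by
    calc y ^ K ≤ (x * Real.exp ((y - x) / x)) ^ K := by gcongr; linarith
      _ = x ^ K * Real.exp (K * ((y - x) / x)) := by rw [mul_pow, ← Real.exp_nat_mul]
      _ ≤ _ := by
        gcongr
        rw [mul_div_assoc', div_le_iff₀ hx]
        nlinarith
  calc y ^ K * Real.exp (-y) ≤ x ^ K * Real.exp (y - x) * Real.exp (-y) := by gcongr
    _ = _ := by rw [mul_assoc, ← Real.exp_add]; ring_nf

lemma logWeight_eq {K : ℕ} {η : ℝ} {n : ℕ} (hn : n ≠ 0) :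
    logWeight K η n =
      Real.log n ^ K * Real.exp (-Real.log n) * Real.exp (-(η * Real.log n)) := by
  have h0 : (0 : ℝ) < n := by positivity
  rw [logWeight, Real.rpow_def_of_pos h0, div_eq_mul_inv, ← Real.exp_neg, mul_assoc,
    ← Real.exp_add]
  ring_nf

lemma logWeight_le_of_le {K : ℕ} {η : ℝ} (hη : 0 ≤ η) {m n : ℕ} (hm : K ≤ Real.log m)
    (hm1 : 2 ≤ m) (hmn : m ≤ n) : logWeight K η n ≤ logWeight K η m := by
  have hlm : 0 < Real.log m := Real.log_pos (by exact_mod_cast hm1)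
  have hm0 : (0 : ℝ) < m := by positivity
  have hl : Real.log m ≤ Real.log n := Real.log_le_log hm0 (by exact_mod_cast hmn)
  rw [logWeight_eq (by omega), logWeight_eq (by omega)]
  have := pow_mul_exp_neg_le hlm hm hl
  gcongr

lemma logWeight_le_div {K : ℕ} {η : ℝ} (hη : 0 ≤ η) (n : ℕ) (hn : 1 ≤ n) :
    logWeight K η n ≤ Real.log n ^ K / n := by
  have h1 : (1 : ℝ) ≤ n := by exact_mod_cast hn
  rw [logWeight]
  have : (n : ℝ) ≤ (n : ℝ) ^ (1 + η) := Real.self_le_rpow_of_one_le h1 (by linarith)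
  have := Real.log_natCast_nonneg n
  gcongr

/-- Abel summation against an eventually decreasing weight, on average over a family. -/
lemma sum_norm_sum_mul_le {ι : Type*} [Fintype ι] (w : ℕ → ℝ) (g : ι → ℕ → ℂ) {u M : ℕ} {ε : ℝ}
    (hw0 : ∀ n, 0 ≤ w n) (hw : ∀ n, u ≤ n → w (n + 1) ≤ w n) (huM : u ≤ M)
    (hg : ∀ x, u ≤ x → x ≤ M → ∑ i, ‖∑ n ∈ Ioc 0 x, g i n‖ ≤ ε * x) :
    ∑ i, ‖∑ n ∈ Ioc u M, (w n : ℂ) * g i n‖ ≤ ε * (2 * (u * w u) + ∑ n ∈ Ioc u M, w n) := by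
  have abel : ∀ (h : ℕ → ℂ) (M : ℕ), u ≤ M → ∑ n ∈ Ioc u M, (w n : ℂ) * h n =
      w M * ∑ n ∈ Ioc 0 M, h n - w u * ∑ n ∈ Ioc 0 u, h n +
        ∑ n ∈ Ico u M, ((w n - w (n + 1) : ℝ) : ℂ) * ∑ m ∈ Ioc 0 n, h m := by
    intro h M hM
    induction M, hM using Nat.le_induction with
    | base => simp
    | succ M hM ih =>
      rw [sum_Ioc_succ_top hM, ih, sum_Ioc_succ_top (Nat.zero_le M), sum_Ico_succ_top hM]
      push_cast
      ring
  have abel1 := congrArg Complex.re (abel (fun _ => 1) M huM)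
  have e1 : ∑ n ∈ Ioc u M, w n = w M * M - w u * u + ∑ n ∈ Ico u M, (w n - w (n + 1)) * n := by
    have := abel (fun _ => 1) M huM
    simp only [mul_one, sum_const, Nat.card_Ioc, tsub_zero, nsmul_eq_mul] at this
    exact_mod_cast this
  have hb : ∀ i, ‖∑ n ∈ Ioc u M, (w n : ℂ) * g i n‖ ≤
      w M * ‖∑ n ∈ Ioc 0 M, g i n‖ + w u * ‖∑ n ∈ Ioc 0 u, g i n‖ +
        ∑ n ∈ Ico u M, (w n - w (n + 1)) * ‖∑ m ∈ Ioc 0 n, g i m‖ := by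
    intro i
    rw [abel (g i) M huM]
    refine (norm_add_le _ _).trans (add_le_add ((norm_sub_le _ _).trans ?_) ?_)
    · rw [norm_mul, norm_mul, Complex.norm_real, Complex.norm_real, Real.norm_of_nonneg (hw0 M),
        Real.norm_of_nonneg (hw0 u)]
    · refine (norm_sum_le _ _).trans (sum_le_sum fun n hn => ?_)
      rw [norm_mul, Complex.norm_real,
        Real.norm_of_nonneg (sub_nonneg.2 (hw n (mem_Ico.1 hn).1))]
  refine (sum_le_sum fun i _ => hb i).trans ?_
  rw [sum_add_distrib, sum_add_distrib, sum_comm]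
  simp only [← mul_sum]
  have h1 := mul_le_mul_of_nonneg_left (hg M huM le_rfl) (hw0 M)
  have h2 := mul_le_mul_of_nonneg_left (hg u le_rfl huM) (hw0 u)
  have h3 : ∑ n ∈ Ico u M, (w n - w (n + 1)) * ∑ i, ‖∑ m ∈ Ioc 0 n, g i m‖ ≤
      ∑ n ∈ Ico u M, (w n - w (n + 1)) * (ε * n) := sum_le_sum fun n hn =>
    mul_le_mul_of_nonneg_left (hg n (mem_Ico.1 hn).1 (mem_Ico.1 hn).2.le)
      (sub_nonneg.2 (hw n (mem_Ico.1 hn).1))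
  have h4 : ∑ n ∈ Ico u M, (w n - w (n + 1)) * (ε * n) =
      ε * ∑ n ∈ Ico u M, (w n - w (n + 1)) * n := by
    rw [mul_sum]; exact sum_congr rfl fun _ _ => by ring
  rw [e1]
  nlinarith

lemma sum_vonMangoldt_logWeight_small_le {K : ℕ} {η : ℝ} (hη : 0 ≤ η) (M : ℕ) :
    ∑ m ∈ Ioc 0 M, Λ m * logWeight K η m ≤ Real.log M ^ (K + 1) * (1 + Real.log M) := by
  have h1 : ∀ m ∈ Ioc 0 M, Λ m * logWeight K η m ≤ Real.log M ^ (K + 1) * (1 / (m : ℝ)) := by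
    intro m hm
    obtain ⟨hm0, hmM⟩ := mem_Ioc.1 hm
    have hm0' : (0 : ℝ) < m := by exact_mod_cast hm0
    have hl : Real.log m ≤ Real.log M := Real.log_le_log hm0' (by exact_mod_cast hmM)
    have hl0 := Real.log_natCast_nonneg m
    calc Λ m * logWeight K η m ≤ Real.log m * (Real.log m ^ K / m) := by
          gcongr
          · exact logWeight_nonneg _ _ _
          · exact ArithmeticFunction.vonMangoldt_le_log
          · exact logWeight_le_div hη m hm0
      _ = Real.log m ^ (K + 1) * (1 / m) := by ring
      _ ≤ _ := by gcongr
  refine (sum_le_sum h1).trans ?_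
  rw [← mul_sum]
  exact mul_le_mul_of_nonneg_left (harmonic_le M) (pow_nonneg (Real.log_natCast_nonneg M) _)

lemma vonMangoldt_logWeight_large_le {K : ℕ} {T η : ℝ} (hT : 0 < T) (hη : K / T ≤ η) {m : ℕ}
    (hm : 16 * T ≤ Real.log m) :
    Λ m * logWeight K η m ≤ (16 * T * Real.exp (-8)) ^ K * logWeight 1 (η / 2) m := by
  have hm0 : m ≠ 0 := by rintro rfl; simp at hm; linarith
  rw [logWeight_eq hm0, logWeight_eq hm0, pow_one]
  set v := Real.log m with hv
  have hv0 : 0 < v := by linarith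
  have h1 : v ^ K * Real.exp (-(η * v)) ≤
      (16 * T * Real.exp (-8)) ^ K * Real.exp (-(η / 2 * v)) := by
    have h2 : v / (16 * T) ≤ Real.exp (v / (16 * T) - 1) := by
      have := Real.add_one_le_exp (v / (16 * T) - 1); linarith
    have h3 : v ^ K ≤ (16 * T * Real.exp (v / (2 * T) - 8)) ^ K := by
      refine pow_le_pow_left₀ hv0.le ?_ K
      calc v = 16 * T * (v / (16 * T)) := by field_simp
        _ ≤ 16 * T * Real.exp (v / (16 * T) - 1) := by gcongr
        _ ≤ _ := by
          refine mul_le_mul_of_nonneg_left (Real.exp_le_exp.2 ?_) (by positivity)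
          have e : v / (2 * T) = 8 * (v / (16 * T)) := by field_simp; ring
          rw [e]
          have : 1 ≤ v / (16 * T) := by rw [le_div_iff₀ (by positivity)]; linarith
          linarith
    calc v ^ K * Real.exp (-(η * v)) ≤
        (16 * T * Real.exp (v / (2 * T) - 8)) ^ K * Real.exp (-(η * v)) := by gcongr
      _ = (16 * T * Real.exp (-8)) ^ K * Real.exp (K * (v / (2 * T)) - η * v) := by
        rw [sub_eq_add_neg (v / (2 * T)), add_comm (v / (2 * T)), Real.exp_add, ← mul_assoc,
          mul_pow _ (Real.exp (v / (2 * T))), ← Real.exp_nat_mul, mul_assoc, ← Real.exp_add]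
        ring_nf
      _ ≤ _ := by
        gcongr
        have : K * (v / (2 * T)) = K / T * v / 2 := by field_simp
        rw [this]
        nlinarith [mul_le_mul_of_nonneg_right hη hv0.le]
  have hl : Λ m ≤ v := ArithmeticFunction.vonMangoldt_le_log
  have hΛ : 0 ≤ Λ m := ArithmeticFunction.vonMangoldt_nonneg
  calc Λ m * (v ^ K * Real.exp (-v) * Real.exp (-(η * v))) =
      Λ m * Real.exp (-v) * (v ^ K * Real.exp (-(η * v))) := by ring
    _ ≤ v * Real.exp (-v) * ((16 * T * Real.exp (-8)) ^ K * Real.exp (-(η / 2 * v))) := by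
      gcongr
    _ = _ := by ring

lemma sum_vonMangoldt_not_prime_le (x : ℕ) (hx : 1 ≤ x) :
    ∑ n ∈ Ioc 0 x, (if n.Prime then 0 else Λ n) ≤ 2 * √x * Real.log x := by
  have h := Chebyshev.psi_sub_theta_le (x := x) (by exact_mod_cast hx)
  have h2 := Chebyshev.psi_sub_theta_eq_sum_not_prime (x : ℝ)
  rw [Nat.floor_natCast] at h2
  refine le_trans (le_of_eq ?_) h
  rw [h2]
  rw [sum_filter]
  refine sum_congr rfl fun n _ => by split_ifs <;> simp_all

lemma sum_Ioc_not_prime_logWeight_le {K M₀ M₁ : ℕ} {η : ℝ} (hη0 : 0 ≤ η) (hM₀ : 2 ≤ M₀)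
    (hM : M₀ ≤ M₁) (hK : K ≤ Real.log M₀) :
    ∑ m ∈ Ioc M₀ M₁, logWeight K η m * (if m.Prime then 0 else Λ m) ≤
      2 * Real.log M₁ / √M₀ * (2 * Real.log M₀ ^ K + ∑ m ∈ Ioc M₀ M₁, logWeight K η m) := by
  have hM₀' : (2 : ℝ) ≤ M₀ := by exact_mod_cast hM₀
  have habel := sum_norm_sum_mul_le (ι := Unit) (logWeight K η)
    (fun _ n => ((if n.Prime then 0 else Λ n : ℝ) : ℂ)) (u := M₀) (M := M₁)
    (ε := 2 * Real.log M₁ / √M₀) (logWeight_nonneg K η)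
    (fun n hn => logWeight_le_of_le hη0
      (hK.trans (Real.log_le_log (by linarith) (by exact_mod_cast hn)))
      (hM₀.trans hn) n.le_succ) hM fun x hx hx' => ?_
  · simp only [univ_unique, sum_const, card_singleton, one_smul] at habel
    have hn0 : ∀ m : ℕ, 0 ≤ (if m.Prime then 0 else Λ m : ℝ) := by
      intro m; split_ifs
      · exact le_rfl
      · exact ArithmeticFunction.vonMangoldt_nonneg
    have e : (∑ n ∈ Ioc M₀ M₁, (logWeight K η n : ℂ) * ((if n.Prime then 0 else Λ n : ℝ) : ℂ)) =
        ((∑ n ∈ Ioc M₀ M₁, logWeight K η n * (if n.Prime then 0 else Λ n : ℝ) : ℝ) : ℂ) := by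
      push_cast; rfl
    rw [e, Complex.norm_real, Real.norm_of_nonneg (sum_nonneg fun m _ =>
      mul_nonneg (logWeight_nonneg _ _ _) (hn0 m))] at habel
    refine habel.trans ?_
    have hd := logWeight_le_div (K := K) hη0 M₀ (by omega)
    rw [le_div_iff₀ (by linarith)] at hd
    have := Real.log_natCast_nonneg M₁
    gcongr
    linarith
  · simp only [univ_unique, sum_const, card_singleton, one_smul]
    have hx0 : (2 : ℝ) ≤ x := hM₀'.trans (by exact_mod_cast hx)
    rw [← Complex.ofReal_sum, Complex.norm_real, Real.norm_of_nonneg (sum_nonneg fun m _ => by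
      split_ifs
      · exact le_rfl
      · exact ArithmeticFunction.vonMangoldt_nonneg)]
    refine (sum_vonMangoldt_not_prime_le x (by omega)).trans ?_
    have hl : Real.log x ≤ Real.log M₁ := Real.log_le_log (by linarith) (by exact_mod_cast hx')
    have hl0 := Real.log_natCast_nonneg x
    have hs : √(M₀ : ℝ) ≤ √x := Real.sqrt_le_sqrt (by exact_mod_cast hx)
    have hs0 : 0 < √(M₀ : ℝ) := Real.sqrt_pos.2 (by linarith)
    have e : (2 * √x * Real.log x : ℝ) = 2 * Real.log x / √x * x := by
      have : √(x : ℝ) ≠ 0 := (hs0.trans_le hs).ne'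
      have hxx : (x : ℝ) = √x * √x := (Real.mul_self_sqrt (by linarith)).symm
      rw [div_mul_eq_mul_div, eq_div_iff this]
      linear_combination (-(2 * Real.log x)) * hxx
    rw [e]
    gcongr

/-- The primes in `(u, v]`. -/
def primeWindow (u v : ℕ) : Finset ℕ := (Ioc u v).filter Nat.Prime

lemma sum_range_outside_primeWindow_le {K M₀ M₁ : ℕ} {T η : ℝ} (hT : 0 < T) (hη0 : 0 < η)
    (hη : K / T ≤ η) (hM₀ : 2 ≤ M₀) (hM : M₀ ≤ M₁) (hK : K ≤ Real.log M₀)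
    (hM₁ : 16 * T ≤ Real.log (M₁ + 1 : ℕ)) (n : ℕ) :
    ∑ m ∈ range n, (if m ∈ primeWindow M₀ M₁ then 0 else Λ m * logWeight K η m) ≤
      Real.log M₀ ^ (K + 1) * (1 + Real.log M₀) +
      2 * Real.log M₁ / √M₀ * (2 * Real.log M₀ ^ K + ∑ m ∈ Ioc M₀ M₁, logWeight K η m) +
      (16 * T * Real.exp (-8)) ^ K * ∑ m ∈ range n, logWeight 1 (η / 2) m := by
  have hM₀' : (2 : ℝ) ≤ M₀ := by exact_mod_cast hM₀
  have h1 : ∀ m, (if m ∈ primeWindow M₀ M₁ then 0 else Λ m * logWeight K η m) ≤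
      (if m ∈ Ioc 0 M₀ then Λ m * logWeight K η m else 0) +
      (if m ∈ Ioc M₀ M₁ then logWeight K η m * (if m.Prime then 0 else Λ m) else 0) +
      (16 * T * Real.exp (-8)) ^ K * logWeight 1 (η / 2) m := by
    intro m
    have hΛ : 0 ≤ Λ m := ArithmeticFunction.vonMangoldt_nonneg
    have hw := logWeight_nonneg K η m
    have hΛw : 0 ≤ Λ m * logWeight K η m := by positivity
    have h3 : 0 ≤ (16 * T * Real.exp (-8)) ^ K * logWeight 1 (η / 2) m :=
      mul_nonneg (by positivity) (logWeight_nonneg _ _ _)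
    have h2 : 0 ≤ (if m ∈ Ioc M₀ M₁ then logWeight K η m * (if m.Prime then 0 else Λ m) else 0) := by
      split_ifs <;> positivity
    have h2' : 0 ≤ (if m ∈ Ioc 0 M₀ then Λ m * logWeight K η m else 0) := by
      split_ifs <;> positivity
    by_cases hmem : m ∈ primeWindow M₀ M₁
    · rw [if_pos hmem]; linarith
    rw [if_neg hmem]
    rcases Nat.eq_zero_or_pos m with rfl | hm0
    · simp at *; linarith
    by_cases ha : m ≤ M₀
    · have : m ∈ Ioc 0 M₀ := mem_Ioc.2 ⟨hm0, ha⟩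
      rw [if_pos this] at h2' ⊢
      linarith
    by_cases hb : m ≤ M₁
    · have hI : m ∈ Ioc M₀ M₁ := mem_Ioc.2 ⟨not_le.1 ha, hb⟩
      have hp : ¬ m.Prime := fun hp => hmem (mem_filter.2 ⟨hI, hp⟩)
      rw [if_pos hI, if_neg hp]
      linarith
    · have hlm : 16 * T ≤ Real.log m := hM₁.trans (Real.log_le_log (by positivity)
        (by exact_mod_cast (not_le.1 hb)))
      have := vonMangoldt_logWeight_large_le (K := K) hT hη hlm
      linarith
  refine (sum_le_sum fun m _ => h1 m).trans ?_
  rw [sum_add_distrib, sum_add_distrib, ← mul_sum]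
  have hA : ∀ (s : Finset ℕ) (f : ℕ → ℝ), (∀ m, 0 ≤ f m) →
      ∑ m ∈ range n, (if m ∈ s then f m else 0) ≤ ∑ m ∈ s, f m := by
    intro s f hf
    rw [← sum_filter]
    refine sum_le_sum_of_subset_of_nonneg (fun m hm => (mem_filter.1 hm).2) fun m _ _ => hf m
  refine add_le_add (add_le_add ?_ ?_) le_rfl
  · exact (hA _ _ fun m => mul_nonneg ArithmeticFunction.vonMangoldt_nonneg
      (logWeight_nonneg _ _ _)).trans (sum_vonMangoldt_logWeight_small_le hη0.le M₀)
  · refine (hA _ _ fun m => mul_nonneg (logWeight_nonneg _ _ _) ?_).trans ?_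
    · split_ifs
      · exact le_rfl
      · exact ArithmeticFunction.vonMangoldt_nonneg
    exact sum_Ioc_not_prime_logWeight_le hη0.le hM₀ hM hK

end window

end

section

open Finset Filter Topology
open scoped ArithmeticFunction.vonMangoldt Nat

section parameters

lemma eventually_mul_pow_le_exp (C : ℝ) (n : ℕ) :
    ∀ᶠ l : ℕ in atTop, C * ((l : ℝ) + 1) ^ n ≤ Real.exp l := by
  have h1 : Tendsto (fun x : ℝ => C * (x + 1) ^ n / Real.exp x) atTop (𝓝 0) := by
    have h := (Real.tendsto_pow_mul_exp_neg_atTop_nhds_zero n).comp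
      (tendsto_atTop_add_const_right atTop (1 : ℝ) tendsto_id)
    have h2 := h.const_mul (C * Real.exp 1)
    rw [mul_zero] at h2
    refine h2.congr fun x => ?_
    simp only [Function.comp, id]
    rw [neg_add, Real.exp_add, Real.exp_neg, Real.exp_neg]
    field_simp
  have h3 := (h1.comp tendsto_natCast_atTop_atTop).eventually_le_const (zero_lt_one)
  filter_upwards [h3] with l hl
  simp only [Function.comp] at hl
  rwa [div_le_one (Real.exp_pos _)] at hl

/-- The decay parameter of the weights. -/
noncomputable def decay (A l : ℕ) : ℝ := ((A * l : ℕ) + 1) / Real.exp l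

lemma decay_pos (A l : ℕ) : 0 < decay A l := by unfold decay; positivity

/-- The size of the main term. -/
noncomputable def mainSize (A l : ℕ) : ℝ := (A * l)! / decay A l ^ (A * l + 1)

lemma mainSize_pos (A l : ℕ) : 0 < mainSize A l := by
  unfold mainSize; have := decay_pos A l; positivity

/-- The lower end of the window. -/
noncomputable def lowEnd (l : ℕ) : ℕ := ⌊Real.exp (Real.exp l / 8)⌋₊

/-- The upper end of the window. -/
noncomputable def highEnd (l : ℕ) : ℕ := ⌊Real.exp (16 * Real.exp l)⌋₊

lemma tendsto_decay (A : ℕ) : Tendsto (decay A) atTop (𝓝 0) := by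
  rw [Metric.tendsto_nhds]
  intro ε hε
  filter_upwards [eventually_mul_pow_le_exp ((A + 1) * 2 / ε) 1] with l hl
  rw [dist_zero_right, Real.norm_of_nonneg (decay_pos A l).le, decay, div_lt_iff₀ (Real.exp_pos _)]
  push_cast
  rw [pow_one, div_mul_eq_mul_div, div_le_iff₀ hε] at hl
  have h1 : (0 : ℝ) ≤ A * l := by positivity
  have h2 : (0 : ℝ) ≤ A := by positivity
  have h3 : (0 : ℝ) ≤ l := by positivity
  nlinarith

lemma exp_two_lt_eight : Real.exp 2 < 8 := by
  have h := Real.exp_one_lt_d9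
  have h0 := Real.exp_pos 1
  rw [show (2 : ℝ) = 1 + 1 by norm_num, Real.exp_add]
  nlinarith

lemma eventually_div_exp_pow_le_mainSize (A : ℕ) :
    ∀ᶠ l : ℕ in atTop, (Real.exp l / Real.exp 1) ^ (A * l) ≤ mainSize A l := by
  filter_upwards [eventually_mul_pow_le_exp (3 * (A + 1)) 1] with l hl
  set K := A * l with hK
  set T := Real.exp l with hT
  have hT0 : 0 < T := Real.exp_pos _
  have hl0 : (0 : ℝ) ≤ l := by positivity
  have hA0 : (0 : ℝ) ≤ A := by positivity
  have hKT : 3 * ((K : ℝ) + 1) ≤ T := by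
    rw [pow_one] at hl
    rw [hK]; push_cast
    nlinarith
  have hfac : (K : ℝ) ^ K ≤ K ! * Real.exp K := by
    have := Real.pow_div_factorial_le_exp (K : ℝ) (by positivity) K
    rw [div_le_iff₀ (by positivity)] at this
    linarith
  have hK1 : ((K : ℝ) + 1) ^ K ≤ Real.exp 1 * K ^ K := by
    rcases Nat.eq_zero_or_pos K with h0 | h0
    · rw [h0]; simp
    have hk : (0 : ℝ) < K := by exact_mod_cast h0
    have h1 : (K : ℝ) + 1 ≤ K * Real.exp (1 / K) := by
      have := Real.add_one_le_exp (1 / (K : ℝ))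
      calc (K : ℝ) + 1 = K * (1 / K + 1) := by field_simp; ring
        _ ≤ _ := by gcongr
    calc ((K : ℝ) + 1) ^ K ≤ (K * Real.exp (1 / K)) ^ K := by gcongr
      _ = K ^ K * Real.exp (K * (1 / K)) := by rw [mul_pow, ← Real.exp_nat_mul]
      _ = _ := by rw [mul_one_div_cancel hk.ne', mul_comm]
  have hmain : mainSize A l = K ! * (T / (K + 1)) ^ K * (T / (K + 1)) := by
    unfold mainSize decay
    rw [← hK, ← hT, mul_assoc, ← pow_succ, div_eq_mul_inv, ← inv_pow, inv_div]
  have h3 : Real.exp 1 ≤ T / (K + 1) := by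
    rw [le_div_iff₀ (by positivity)]
    have := Real.exp_one_lt_d9
    nlinarith [(Nat.cast_nonneg K : (0 : ℝ) ≤ K)]
  have h4 : (T / Real.exp 1) ^ K ≤ K ! * (T / (K + 1)) ^ K * Real.exp 1 := by
    have he : Real.exp 1 ^ K = Real.exp K := by rw [← Real.exp_nat_mul, mul_one]
    rw [div_pow, div_pow, he, div_le_iff₀ (Real.exp_pos _)]
    have h5 : ((K : ℝ) + 1) ^ K ≤ Real.exp 1 * (K ! * Real.exp K) :=
      hK1.trans (by gcongr)
    calc T ^ K = T ^ K / (K + 1) ^ K * (K + 1) ^ K := by field_simp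
      _ ≤ T ^ K / (K + 1) ^ K * (Real.exp 1 * (K ! * Real.exp K)) := by gcongr
      _ = _ := by ring
  rw [hmain]
  exact h4.trans (by gcongr)

end parameters

end

section

open Finset Filter Topology
open scoped ArithmeticFunction.vonMangoldt Nat

section eventual

lemma eventually_linear_le_exp (A : ℕ) : ∀ᶠ l : ℕ in atTop,
    256 * ((A * l : ℕ) + 2 : ℝ) ≤ Real.exp l := by
  filter_upwards [eventually_mul_pow_le_exp (256 * (A + 2)) 1] with l hl
  have hl0 : (0 : ℝ) ≤ l := by positivity
  have hA0 : (0 : ℝ) ≤ A := by positivity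
  push_cast
  nlinarith

lemma window_bounds {l : ℕ} {K : ℝ} (hK0 : 0 ≤ K) (hK : 256 * (K + 2) ≤ Real.exp l) :
    2 ≤ lowEnd l ∧ lowEnd l ≤ highEnd l ∧ K + 1 ≤ Real.log (lowEnd l) ∧
      Real.log (lowEnd l) ≤ Real.exp l / 8 ∧ 16 * Real.exp l ≤ Real.log (highEnd l + 1 : ℕ) ∧
      Real.log (highEnd l) ≤ 16 * Real.exp l ∧ Real.exp (Real.exp l / 16) / 2 ≤ √(lowEnd l) ∧
      Real.exp (Real.exp l / 8) / 2 ≤ lowEnd l := by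
  set T := Real.exp l with hT
  have h1 : (4 : ℝ) ≤ Real.exp (T / 8) := by
    have := Real.add_one_le_exp (T / 8); linarith
  have h2 : Real.exp (T / 8) - 1 < lowEnd l := Nat.sub_one_lt_floor _
  have h3 : (lowEnd l : ℝ) ≤ Real.exp (T / 8) := Nat.floor_le (by positivity)
  have h4 : (highEnd l : ℝ) ≤ Real.exp (16 * T) := Nat.floor_le (by positivity)
  have h5 : Real.exp (16 * T) < highEnd l + 1 := Nat.lt_floor_add_one _
  have h6 : Real.exp (T / 8) / 2 ≤ lowEnd l := by linarith
  have hle : lowEnd l ≤ highEnd l := Nat.floor_le_floor (Real.exp_le_exp.2 (by linarith))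
  have hpos : (0 : ℝ) < lowEnd l := by linarith
  refine ⟨?_, hle, ?_, ?_, ?_, ?_, ?_, h6⟩
  · have : (2 : ℝ) ≤ lowEnd l := by linarith
    exact_mod_cast this
  · have : Real.log (Real.exp (T / 8) / 2) ≤ Real.log (lowEnd l) :=
      Real.log_le_log (by positivity) h6
    rw [Real.log_div (by positivity) two_ne_zero, Real.log_exp] at this
    have := Real.log_two_lt_d9
    linarith
  · have := Real.log_le_log hpos h3
    rwa [Real.log_exp] at this
  · have := Real.log_le_log (Real.exp_pos _) h5.le
    rw [Real.log_exp] at this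
    exact_mod_cast this
  · have := Real.log_le_log (hpos.trans_le (by exact_mod_cast hle)) h4
    rwa [Real.log_exp] at this
  · refine Real.le_sqrt_of_sq_le (le_trans ?_ h6)
    have : Real.exp (T / 8) = Real.exp (T / 16) ^ 2 := by
      rw [← Real.exp_nat_mul]; congr 1; push_cast; ring
    rw [div_pow, ← this]
    linarith

lemma div_pow_le_mul_exp_neg {T : ℝ} (hT : 0 ≤ T) (K : ℕ) :
    (T / 8) ^ K ≤ (T / Real.exp 1) ^ K * Real.exp (-K) := by
  have h : T / 8 ≤ T / Real.exp 1 * Real.exp (-1) := by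
    rw [div_mul_eq_mul_div, mul_div_assoc, ← Real.exp_sub, div_eq_mul_inv T 8,
      ← inv_inv (Real.exp (-1 - 1)), ← Real.exp_neg]
    have := exp_two_lt_eight
    gcongr
    norm_num
    exact this.le
  calc (T / 8) ^ K ≤ (T / Real.exp 1 * Real.exp (-1)) ^ K := by gcongr
    _ = _ := by rw [mul_pow, ← Real.exp_nat_mul]; ring_nf

lemma mul_exp_neg_pow_le {T : ℝ} (hT : 0 ≤ T) (K : ℕ) :
    (16 * T * Real.exp (-8)) ^ K ≤ (T / Real.exp 1) ^ K * Real.exp (-K) := by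
  have h : 16 * T * Real.exp (-8) ≤ T / Real.exp 1 * Real.exp (-1) := by
    have h1 : (2 : ℝ) ≤ Real.exp 1 := by
      have := Real.exp_one_gt_d9; linarith
    have h2 : (16 : ℝ) ≤ Real.exp 6 := by
      calc (16 : ℝ) ≤ 2 ^ 6 := by norm_num
        _ ≤ Real.exp 1 ^ 6 := by gcongr
        _ = Real.exp 6 := by rw [← Real.exp_nat_mul]; norm_num
    have e : T / Real.exp 1 * Real.exp (-1) = Real.exp 6 * T * Real.exp (-8) := by
      rw [div_eq_mul_inv, ← Real.exp_neg, mul_assoc, ← Real.exp_add, mul_comm (Real.exp 6),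
        mul_assoc, ← Real.exp_add]
      norm_num
    rw [e]
    gcongr
  calc (16 * T * Real.exp (-8)) ^ K ≤ (T / Real.exp 1 * Real.exp (-1)) ^ K := by gcongr
    _ = _ := by rw [mul_pow, ← Real.exp_nat_mul]; ring_nf

/-- The total weight is bounded by twice the main term. -/
lemma eventually_tsum_logWeight_le (A : ℕ) : ∀ᶠ l : ℕ in atTop,
    (Summable (logWeight (A * l) (decay A l)) ∧
      ∑' n, logWeight (A * l) (decay A l) n ≤ 2 * mainSize A l) ∧
    (Summable (logWeight (A * l + 1) (decay A l)) ∧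
      ∑' n, logWeight (A * l + 1) (decay A l) n ≤ 2 * (Real.exp l * mainSize A l)) ∧
    (Summable (logWeight 1 (decay A l / 2)) ∧
      ∑' n, logWeight 1 (decay A l / 2) n ≤ 8 * Real.exp l ^ 2) := by
  obtain ⟨r, hr, h⟩ := exists_tsum_logWeight_le
  filter_upwards [(tendsto_decay A).eventually_le_const hr] with l hl
  have hd := decay_pos A l
  refine ⟨h _ hd hl _, ⟨(h _ hd hl _).1, (h _ hd hl _).2.trans_eq ?_⟩,
    ⟨(h _ (half_pos hd) (by linarith) _).1, (h _ (half_pos hd) (by linarith) _).2.trans ?_⟩⟩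
  · unfold mainSize
    rw [Nat.factorial_succ, pow_succ]
    have e : (A * l : ℕ) + 1 = decay A l * Real.exp l := by
      unfold decay; field_simp
    push_cast at e ⊢
    rw [e]
    field_simp
  · have e : (1 : ℝ) ≤ decay A l * Real.exp l := by
      unfold decay
      rw [div_mul_cancel₀ _ (Real.exp_ne_zero _)]
      have : (0 : ℝ) ≤ (A * l : ℕ) := by positivity
      linarith
    norm_num
    rw [← div_eq_mul_inv, div_le_iff₀ (by positivity)]
    nlinarith

end eventual

end

section

open Finset Filter Topology
open scoped ArithmeticFunction.vonMangoldt Nat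

section tail

/-- The non-primes in the window contribute a negligible amount, even with many repetitions. -/
lemma eventually_sum_not_prime_le (A : ℕ) : ∀ᶠ l : ℕ in atTop,
    ∑ m ∈ Ioc (lowEnd l) (highEnd l),
        logWeight (A * l) (decay A l) m * (if m.Prime then 0 else Λ m) ≤
      256 * Real.exp l * Real.exp (-(Real.exp l / 16)) * mainSize A l := by
  filter_upwards [eventually_linear_le_exp A, eventually_tsum_logWeight_le A,
    eventually_div_exp_pow_le_mainSize A] with l h1 h2 h3
  obtain ⟨w1, w2, w3, w4, w5, w6, w7, w8⟩ := window_bounds (by positivity) h1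
  set K := A * l with hK
  set T := Real.exp l with hT
  have hM := mainSize_pos A l
  have hT0 : 0 < T := Real.exp_pos _
  refine (sum_Ioc_not_prime_logWeight_le (decay_pos A l).le w1 w2 (by linarith)).trans ?_
  have e1 : ∑ m ∈ Ioc (lowEnd l) (highEnd l), logWeight K (decay A l) m ≤ 2 * mainSize A l :=
    (h2.1.1.sum_le_tsum _ fun _ _ => logWeight_nonneg _ _ _).trans h2.1.2
  have e2 : Real.log (lowEnd l) ^ K ≤ mainSize A l := by
    have h0 := Real.log_natCast_nonneg (lowEnd l)
    calc Real.log (lowEnd l) ^ K ≤ (T / 8) ^ K := by gcongr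
      _ ≤ (T / Real.exp 1) ^ K * Real.exp (-K) := div_pow_le_mul_exp_neg hT0.le K
      _ ≤ mainSize A l * 1 := by
        gcongr
        exact Real.exp_le_one_iff.2 (by simp)
      _ = _ := mul_one _
  calc 2 * Real.log (highEnd l) / √(lowEnd l) *
        (2 * Real.log (lowEnd l) ^ K + ∑ m ∈ Ioc (lowEnd l) (highEnd l), logWeight K (decay A l) m)
      ≤ 2 * (16 * T) / (Real.exp (T / 16) / 2) * (2 * mainSize A l + 2 * mainSize A l) := by
        have h0 := Real.log_natCast_nonneg (lowEnd l)
        have h0' : 0 ≤ ∑ m ∈ Ioc (lowEnd l) (highEnd l), logWeight K (decay A l) m :=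
          sum_nonneg fun _ _ => logWeight_nonneg _ _ _
        gcongr
    _ = _ := by rw [Real.exp_neg]; field_simp; ring

lemma eventually_sum_range_outside_le (A : ℕ) : ∀ᶠ l : ℕ in atTop, ∀ n : ℕ,
    ∑ m ∈ range n, (if m ∈ primeWindow (lowEnd l) (highEnd l) then 0
        else Λ m * logWeight (A * l) (decay A l) m) ≤
      Real.exp l ^ 3 * Real.exp (-(A * l : ℕ)) * mainSize A l := by
  filter_upwards [eventually_linear_le_exp A, eventually_tsum_logWeight_le A,
    eventually_div_exp_pow_le_mainSize A] with l h1 h2 h3 n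
  obtain ⟨w1, w2, w3, w4, w5, w6, w7, w8⟩ := window_bounds (by positivity) h1
  have hM := mainSize_pos A l
  have hT0 : 0 < Real.exp l := Real.exp_pos _
  have hη : (A * l : ℕ) / Real.exp l ≤ decay A l := by unfold decay; gcongr; linarith
  refine (sum_range_outside_primeWindow_le hT0 (decay_pos A l) hη w1 w2 (by linarith) w5 n).trans ?_
  have e1 : ∑ m ∈ Ioc (lowEnd l) (highEnd l), logWeight (A * l) (decay A l) m ≤ 2 * mainSize A l :=
    (h2.1.1.sum_le_tsum _ fun _ _ => logWeight_nonneg _ _ _).trans h2.1.2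
  have e3 : ∑ m ∈ range n, logWeight 1 (decay A l / 2) m ≤ 8 * Real.exp l ^ 2 :=
    (h2.2.2.1.sum_le_tsum _ fun _ _ => logWeight_nonneg _ _ _).trans h2.2.2.2
  set K := A * l with hK
  set T := Real.exp l with hT
  set M := mainSize A l with hMd
  set V := Real.exp (-(K : ℝ)) with hV
  have hV0 : 0 < V := Real.exp_pos _
  have hV1 : V ≤ 1 := Real.exp_le_one_iff.2 (by simp)
  have h0 := Real.log_natCast_nonneg (lowEnd l)
  have hT256 : 512 ≤ T := by
    have : (0 : ℝ) ≤ K := by positivity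
    linarith
  have e2 : (T / 8) ^ K ≤ M * V :=
    (div_pow_le_mul_exp_neg hT0.le K).trans (by gcongr)
  have e4 : (16 * T * Real.exp (-8)) ^ K ≤ M * V :=
    (mul_exp_neg_pow_le hT0.le K).trans (by gcongr)
  have t1 : Real.log (lowEnd l) ^ (K + 1) * (1 + Real.log (lowEnd l)) ≤ M * V * T ^ 2 := by
    calc Real.log (lowEnd l) ^ (K + 1) * (1 + Real.log (lowEnd l))
        ≤ (T / 8) ^ (K + 1) * (1 + T / 8) := by gcongr
      _ = (T / 8) ^ K * (T / 8 * (1 + T / 8)) := by ring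
      _ ≤ M * V * T ^ 2 := by gcongr; nlinarith
  have t3 : (16 * T * Real.exp (-8)) ^ K * ∑ m ∈ range n, logWeight 1 (decay A l / 2) m ≤
      M * V * (8 * T ^ 2) := by
    gcongr
    exact sum_nonneg fun _ _ => logWeight_nonneg _ _ _
  have t2 : 2 * Real.log (highEnd l) / √(lowEnd l) *
      (2 * Real.log (lowEnd l) ^ K + ∑ m ∈ Ioc (lowEnd l) (highEnd l), logWeight K (decay A l) m) ≤
      M * V * T ^ 2 := by
    have e5 : Real.log (lowEnd l) ^ K ≤ M := by
      calc Real.log (lowEnd l) ^ K ≤ (T / 8) ^ K := by gcongr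
        _ ≤ M * V := e2
        _ ≤ M * 1 := by gcongr
        _ = _ := mul_one _
    have e6 : Real.exp (-(T / 16)) ≤ V := Real.exp_le_exp.2 (by linarith)
    have e7 : 0 ≤ ∑ m ∈ Ioc (lowEnd l) (highEnd l), logWeight K (decay A l) m :=
      sum_nonneg fun _ _ => logWeight_nonneg _ _ _
    calc _ ≤ 2 * (16 * T) / (Real.exp (T / 16) / 2) * (2 * M + 2 * M) := by gcongr
      _ = 256 * T * Real.exp (-(T / 16)) * M := by rw [Real.exp_neg]; field_simp; ring
      _ ≤ T * T * V * M := by gcongr; linarith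
      _ = _ := by ring
  have : 10 * T ^ 2 ≤ T ^ 3 := by nlinarith [sq_nonneg T]
  have h5 : M * V * (10 * T ^ 2) ≤ M * V * T ^ 3 := by gcongr
  linarith

end tail

end

section

open Finset Filter Topology
open scoped ArithmeticFunction.vonMangoldt Nat

section primeSums

lemma norm_sum_sub_tsum_le_of_sum_range_le {a : ℕ → ℂ} (ha : Summable a) (s : Finset ℕ) {E : ℝ}
    (h : ∀ n, ∑ m ∈ range n, (if m ∈ s then 0 else ‖a m‖) ≤ E) :
    ‖∑ m ∈ s, a m - ∑' m, a m‖ ≤ E := by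
  have h1 : HasSum (fun m => if m ∈ s then a m else 0) (∑ m ∈ s, a m) := by
    have := hasSum_sum_of_ne_finset_zero (L := .unconditional ℕ)
      (f := fun m => if m ∈ s then a m else 0) (s := s) (fun m hm => if_neg hm)
    rwa [sum_congr rfl fun m hm => if_pos hm] at this
  have h2 := (h1.sub ha.hasSum).tendsto_sum_nat.norm
  refine le_of_tendsto' h2 fun n => ((norm_sum_le _ _).trans (le_of_eq ?_)).trans (h n)
  refine sum_congr rfl fun m _ => ?_
  split_ifs <;> simp

lemma eventually_norm_sum_primeWindow_sub_tsum_le (A : ℕ) : ∀ᶠ l : ℕ in atTop, ∀ a : ℕ → ℂ,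
    (∀ n, ‖a n‖ ≤ Λ n) → Summable (fun n => (logWeight (A * l) (decay A l) n : ℂ) * a n) →
    ‖∑ m ∈ primeWindow (lowEnd l) (highEnd l), (logWeight (A * l) (decay A l) m : ℂ) * a m -
      ∑' m, (logWeight (A * l) (decay A l) m : ℂ) * a m‖ ≤
      Real.exp l ^ 3 * Real.exp (-(A * l : ℕ)) * mainSize A l := by
  filter_upwards [eventually_sum_range_outside_le A] with l h a ha hs
  refine norm_sum_sub_tsum_le_of_sum_range_le hs _ fun n => (sum_le_sum fun m _ => ?_).trans (h n)
  split_ifs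
  · exact le_rfl
  · rw [norm_mul, Complex.norm_real, Real.norm_of_nonneg (logWeight_nonneg _ _ _), mul_comm]
    exact mul_le_mul_of_nonneg_right (ha m) (logWeight_nonneg _ _ _)

lemma exp_pow_mul_exp_neg_le {A : ℕ} (n : ℕ) (hA : n + 1 ≤ A) (l : ℕ) :
    Real.exp l ^ n * Real.exp (-(A * l : ℕ)) ≤ Real.exp (-l) := by
  rw [← Real.exp_nat_mul, ← Real.exp_add]
  refine Real.exp_le_exp.2 ?_
  have hA' : (n + 1 : ℝ) ≤ A := by exact_mod_cast hA
  have : (0 : ℝ) ≤ l := by positivity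
  push_cast
  nlinarith

lemma eventually_exp_neg_le {c : ℝ} (hc : 0 < c) : ∀ᶠ l : ℕ in atTop, Real.exp (-l) ≤ c := by
  have h : Tendsto (fun l : ℕ => Real.exp (-(l : ℝ))) atTop (𝓝 0) :=
    Real.tendsto_exp_neg_atTop_nhds_zero.comp tendsto_natCast_atTop_atTop
  exact h.eventually_le_const hc

lemma eventually_mainSize_le_sum_primeWindow {A : ℕ} (hA : 4 ≤ A) (q : ℕ) [NeZero q] :
    ∀ᶠ l : ℕ in atTop, mainSize A l / (4 * q.totient) ≤
      ∑ m ∈ primeWindow (lowEnd l) (highEnd l), logWeight (A * l) (decay A l) m *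
        ArithmeticFunction.vonMangoldt.residueClass (1 : ZMod q) m := by
  obtain ⟨r, hr, h⟩ := exists_le_tsum_vonMangoldt_logWeight q
  have hq : (0 : ℝ) < q.totient := by exact_mod_cast Nat.totient_pos.2 (NeZero.pos q)
  filter_upwards [eventually_norm_sum_primeWindow_sub_tsum_le A,
    (tendsto_decay A).eventually_le_const hr,
    eventually_exp_neg_le (c := 1 / (4 * q.totient)) (by positivity)] with l h1 h2 h3
  obtain ⟨h4, h5⟩ := h _ (decay_pos A l) h2 (A * l)
  have h6 := h1 (fun n => (ArithmeticFunction.vonMangoldt.residueClass (1 : ZMod q) n : ℂ))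
    (fun n => by
      rw [Complex.norm_real, Real.norm_of_nonneg
        (ArithmeticFunction.vonMangoldt.residueClass_nonneg _ _)]
      exact ArithmeticFunction.vonMangoldt.residueClass_le _ _)
    (by
      have := Complex.ofRealCLM.summable h4
      refine this.congr fun n => ?_
      simp)
  have hM := mainSize_pos A l
  have e : ∀ n, ((logWeight (A * l) (decay A l) n : ℂ) *
      (ArithmeticFunction.vonMangoldt.residueClass (1 : ZMod q) n : ℂ)) =
      ((logWeight (A * l) (decay A l) n *
        ArithmeticFunction.vonMangoldt.residueClass (1 : ZMod q) n : ℝ) : ℂ) := by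
    intro n; push_cast; rfl
  simp only [e] at h6
  rw [← Complex.ofReal_sum, ← Complex.ofReal_tsum, ← Complex.ofReal_sub, Complex.norm_real,
    Real.norm_eq_abs, abs_le] at h6
  have h7 : Real.exp l ^ 3 * Real.exp (-(A * l : ℕ)) * mainSize A l ≤
      1 / (4 * q.totient) * mainSize A l := by
    gcongr
    exact (exp_pow_mul_exp_neg_le 3 hA l).trans h3
  have h8 : 1 / (2 * (q.totient : ℝ)) * mainSize A l =
      1 / (4 * q.totient) * mainSize A l + mainSize A l / (4 * q.totient) := by
    field_simp; norm_num
  change 1 / (2 * (q.totient : ℝ)) * mainSize A l ≤ _ at h5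
  linarith [h6.1]

lemma eventually_sum_norm_primeWindow_le (A : ℕ) : ∀ᶠ l : ℕ in atTop,
    ∀ (ι : Type) [Fintype ι] (f : ι → ℕ →* ℂ) (D : ℕ), (∀ i n, ‖f i n‖ ≤ 1) → 1 ≤ D →
      Fintype.card ι ≤ D → (∀ i y, ‖∑ n ∈ Ioc 0 y, f i n‖ ≤ D) →
      (∀ i j, i ≠ j → ∀ y, ‖∑ n ∈ Ioc 0 y, f i n * starRingEnd ℂ (f j n)‖ ≤ D) →
      D ^ 8 ≤ lowEnd l →
      ∑ i, ‖∑ m ∈ primeWindow (lowEnd l) (highEnd l),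
        (logWeight (A * l) (decay A l) m : ℂ) * (Λ m * f i m)‖ ≤
        Real.exp l ^ 6 * mainSize A l := by
  have hlarge : ∀ᶠ l : ℕ in atTop, (2000 : ℝ) ≤ Real.exp l := by
    filter_upwards [eventually_mul_pow_le_exp 2000 0] with l hl
    simpa using hl
  filter_upwards [eventually_linear_le_exp A, eventually_tsum_logWeight_le A,
    eventually_div_exp_pow_le_mainSize A, eventually_sum_not_prime_le A, hlarge]
    with l h1 h2 h3 h4 h5 ι _ f D hf1 hD1 hcard hs hs2 hD
  obtain ⟨w1, w2, w3, w4, w5, w6, w7, w8⟩ := window_bounds (by positivity) h1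
  set K := A * l with hK
  set T := Real.exp l with hT
  set M := mainSize A l with hMd
  have hM : 0 < M := mainSize_pos A l
  have hT0 : 0 < T := Real.exp_pos _
  have hη := (decay_pos A l).le
  have e1 : ∑ m ∈ Ioc (lowEnd l) (highEnd l), logWeight K (decay A l) m ≤ 2 * M :=
    (h2.1.1.sum_le_tsum _ fun _ _ => logWeight_nonneg _ _ _).trans h2.1.2
  have e2 : Real.log (lowEnd l) ^ K ≤ M := by
    have h0 := Real.log_natCast_nonneg (lowEnd l)
    calc Real.log (lowEnd l) ^ K ≤ (T / 8) ^ K := by gcongr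
      _ ≤ (T / Real.exp 1) ^ K * Real.exp (-K) := div_pow_le_mul_exp_neg hT0.le K
      _ ≤ M * 1 := by
        gcongr
        exact Real.exp_le_one_iff.2 (by simp)
      _ = _ := mul_one _
  have hlow0 : (0 : ℝ) < lowEnd l := by exact_mod_cast (by omega : 0 < lowEnd l)
  have habel := sum_norm_sum_mul_le (logWeight K (decay A l)) (fun i n => (Λ n : ℂ) * f i n)
    (u := lowEnd l) (M := highEnd l) (ε := 7 * (17 * T) ^ 4) (logWeight_nonneg _ _)
    (fun n hn => logWeight_le_of_le hη
        ((by linarith : (K : ℝ) ≤ Real.log (lowEnd l)).trans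
          (Real.log_le_log hlow0 (by exact_mod_cast hn)))
        (w1.trans hn) n.le_succ) w2 (fun x hx hx' => by
      refine (sum_norm_sum_vonMangoldt_le f hf1 D hD1 hcard hs hs2 x (hD.trans hx)).trans ?_
      have hx0 : (0 : ℝ) < x := hlow0.trans_le (by exact_mod_cast hx)
      have hl1 : Real.log x ≤ 16 * T :=
        (Real.log_le_log hx0 (by exact_mod_cast hx')).trans w6
      have hl0 := Real.log_natCast_nonneg x
      calc 7 * (x : ℝ) * (1 + Real.log x) ^ 4 ≤ 7 * x * (17 * T) ^ 4 := by
            gcongr; linarith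
        _ = _ := by ring)
  have hd := logWeight_le_div (K := K) hη (lowEnd l) (by omega)
  rw [le_div_iff₀ hlow0] at hd
  have hDT : (D : ℝ) ≤ Real.exp (T / 64) := by
    have h6 : (D : ℝ) ^ 8 ≤ Real.exp (T / 64) ^ 8 := by
      rw [← Real.exp_nat_mul]
      have h7 : (D : ℝ) ^ 8 ≤ lowEnd l := by exact_mod_cast hD
      refine h7.trans ((Nat.floor_le (Real.exp_pos _).le).trans (Real.exp_le_exp.2 ?_))
      push_cast
      linarith
    exact le_of_pow_le_pow_left₀ (by norm_num) (Real.exp_pos _).le h6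
  have hsplit : ∀ i, ‖∑ m ∈ primeWindow (lowEnd l) (highEnd l),
      (logWeight K (decay A l) m : ℂ) * (Λ m * f i m)‖ ≤
      ‖∑ m ∈ Ioc (lowEnd l) (highEnd l), (logWeight K (decay A l) m : ℂ) * (Λ m * f i m)‖ +
      256 * T * Real.exp (-(T / 16)) * M := by
    intro i
    have e3 : ∑ m ∈ primeWindow (lowEnd l) (highEnd l),
        (logWeight K (decay A l) m : ℂ) * (Λ m * f i m) =
        ∑ m ∈ Ioc (lowEnd l) (highEnd l), (logWeight K (decay A l) m : ℂ) * (Λ m * f i m) -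
        ∑ m ∈ Ioc (lowEnd l) (highEnd l), (logWeight K (decay A l) m : ℂ) *
          ((if m.Prime then 0 else Λ m : ℝ) * f i m) := by
      rw [primeWindow, sum_filter, ← sum_sub_distrib]
      refine sum_congr rfl fun m _ => ?_
      split_ifs <;> simp
    rw [e3]
    refine (norm_sub_le _ _).trans (add_le_add le_rfl (((norm_sum_le _ _).trans
      (sum_le_sum fun m _ => ?_)).trans h4))
    rw [norm_mul, norm_mul, Complex.norm_real, Complex.norm_real,
      Real.norm_of_nonneg (logWeight_nonneg _ _ _)]
    have h8 : 0 ≤ (if m.Prime then 0 else Λ m : ℝ) := by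
      split_ifs
      exacts [le_rfl, ArithmeticFunction.vonMangoldt_nonneg]
    rw [Real.norm_of_nonneg h8]
    refine mul_le_mul_of_nonneg_left ?_ (logWeight_nonneg _ _ _)
    calc _ ≤ (if m.Prime then 0 else Λ m : ℝ) * 1 := by gcongr; exact hf1 i m
      _ = _ := mul_one _
  refine (sum_le_sum fun i _ => hsplit i).trans ?_
  rw [sum_add_distrib, sum_const, card_univ, nsmul_eq_mul]
  have hcD : (Fintype.card ι : ℝ) ≤ Real.exp (T / 64) :=
    le_trans (by exact_mod_cast hcard) hDT
  have t1 : (Fintype.card ι : ℝ) * (256 * T * Real.exp (-(T / 16)) * M) ≤ 256 * T * M := by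
    have h9 : Real.exp (T / 64) * Real.exp (-(T / 16)) ≤ 1 := by
      rw [← Real.exp_add]; exact Real.exp_le_one_iff.2 (by linarith)
    calc (Fintype.card ι : ℝ) * (256 * T * Real.exp (-(T / 16)) * M)
        ≤ Real.exp (T / 64) * (256 * T * Real.exp (-(T / 16)) * M) := by gcongr
      _ = 256 * T * M * (Real.exp (T / 64) * Real.exp (-(T / 16))) := by ring
      _ ≤ 256 * T * M * 1 := by gcongr
      _ = _ := mul_one _
  have t2 : 7 * (17 * T) ^ 4 * (2 * ((lowEnd l : ℝ) * logWeight K (decay A l) (lowEnd l)) +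
      ∑ m ∈ Ioc (lowEnd l) (highEnd l), logWeight K (decay A l) m) ≤ 7 * (17 * T) ^ 4 * (4 * M) := by
    gcongr
    linarith
  have t3 : 7 * (17 * T) ^ 4 * (4 * M) + 256 * T * M ≤ T ^ 6 * M := by
    have : 7 * (17 * T) ^ 4 * 4 + 256 * T ≤ T ^ 6 := by
      have a1 : (4000000 : ℝ) ≤ T ^ 2 := by nlinarith
      have a2 : (0 : ℝ) ≤ T ^ 4 := by positivity
      have a3 : 4000000 * T ^ 4 ≤ T ^ 2 * T ^ 4 := by gcongr
      have a4 : 1 * T ≤ T ^ 3 * T := by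
        gcongr
        exact one_le_pow₀ (by linarith)
      nlinarith
    nlinarith
  linarith

end primeSums

end

section

open Finset

section periodic

lemma sum_range_mul_of_coprime {A B : ℕ} (hAB : A.Coprime B) (hA : 0 < A) (hB : 0 < B)
    {F G : ℕ → ℂ} (hF : Function.Periodic F A) (hG : Function.Periodic G B) :
    ∑ n ∈ range (A * B), F n * G n = (∑ n ∈ range A, F n) * ∑ n ∈ range B, G n := by
  rw [sum_mul_sum, ← sum_product']
  have hinj : Set.InjOn (fun n : ℕ => (n % A, n % B)) (range (A * B) : Finset ℕ) := by
    intro x hx y hy hxy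
    simp only [Prod.mk.injEq] at hxy
    have h := (Nat.modEq_and_modEq_iff_modEq_mul hAB).1 hxy
    exact h.eq_of_lt_of_lt (mem_range.1 hx) (mem_range.1 hy)
  have hmaps : ∀ n ∈ range (A * B), (n % A, n % B) ∈ range A ×ˢ range B := fun n _ =>
    mem_product.2 ⟨mem_range.2 (Nat.mod_lt _ hA), mem_range.2 (Nat.mod_lt _ hB)⟩
  have himg : (range (A * B)).image (fun n : ℕ => (n % A, n % B)) = range A ×ˢ range B := by
    refine eq_of_subset_of_card_le (image_subset_iff.2 hmaps) ?_
    rw [card_image_of_injOn hinj]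
    simp
  rw [← himg, sum_image hinj]
  exact sum_congr rfl fun n _ => by rw [hF.map_mod_nat, hG.map_mod_nat]

lemma prod_periodic {ι : Type*} (S : Finset ι) (q : ι → ℕ) {Q : ℕ} {F₀ : ℕ → ℂ} {F : ι → ℕ → ℂ}
    (hF₀ : Function.Periodic F₀ Q) (hF : ∀ i ∈ S, Function.Periodic (F i) (q i)) :
    Function.Periodic (fun n => F₀ n * ∏ i ∈ S, F i n) (Q * ∏ i ∈ S, q i) := by
  intro n
  have h1 : F₀ (n + Q * ∏ i ∈ S, q i) = F₀ n := by
    have := hF₀.nat_mul (∏ i ∈ S, q i) n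
    rwa [mul_comm Q]
  have h2 : ∏ i ∈ S, F i (n + Q * ∏ i ∈ S, q i) = ∏ i ∈ S, F i n := by
    refine prod_congr rfl fun i hi => ?_
    obtain ⟨c, hc⟩ := dvd_prod_of_mem q hi
    have := (hF i hi).nat_mul (Q * c) n
    rw [hc, show Q * (q i * c) = Q * c * q i by ring]
    exact this
  simp only [h1, h2]

lemma sum_range_prod_of_coprime {ι : Type*} [DecidableEq ι] (S : Finset ι) (q : ι → ℕ) {Q : ℕ}
    (hQ : 0 < Q) (hq : ∀ i ∈ S, 0 < q i) (hc : ∀ i ∈ S, Q.Coprime (q i))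
    (hcc : ∀ i ∈ S, ∀ j ∈ S, i ≠ j → (q i).Coprime (q j)) {F₀ : ℕ → ℂ} {F : ι → ℕ → ℂ}
    (hF₀ : Function.Periodic F₀ Q) (hF : ∀ i ∈ S, Function.Periodic (F i) (q i)) :
    ∑ n ∈ range (Q * ∏ i ∈ S, q i), F₀ n * ∏ i ∈ S, F i n =
      (∑ n ∈ range Q, F₀ n) * ∏ i ∈ S, ∑ n ∈ range (q i), F i n := by
  induction S using Finset.induction_on with
  | empty => simp
  | insert i S hi ih =>
    have hS : ∀ j ∈ S, j ∈ insert i S := fun j hj => mem_insert_of_mem hj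
    have ih' := ih (fun j hj => hq j (hS j hj)) (fun j hj => hc j (hS j hj))
      (fun j hj j' hj' => hcc j (hS j hj) j' (hS j' hj')) (fun j hj => hF j (hS j hj))
    have hper := prod_periodic S q hF₀ fun j hj => hF j (hS j hj)
    have hi' := mem_insert_self i S
    have hcop : (Q * ∏ j ∈ S, q j).Coprime (q i) :=
      Nat.Coprime.mul_left (hc i hi') (Nat.Coprime.prod_left fun j hj =>
        hcc j (hS j hj) i hi' fun h => hi (h ▸ hj))
    have h := sum_range_mul_of_coprime hcop
      (Nat.mul_pos hQ (prod_pos fun j hj => hq j (hS j hj))) (hq i hi') hper (hF i hi')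
    simp only [prod_insert hi]
    rw [show Q * (q i * ∏ j ∈ S, q j) = (Q * ∏ j ∈ S, q j) * q i by ring]
    calc _ = _ := sum_congr rfl fun n _ => by ring
      _ = _ := h
      _ = _ := by rw [ih']; ring

lemma norm_sum_Ioc_le_of_periodic {N : ℕ} (hN : 0 < N) {F : ℕ → ℂ} {C : ℝ}
    (hF : Function.Periodic F N) (hC : ∀ n, ‖F n‖ ≤ C) (h0 : ∑ n ∈ range N, F n = 0) (y : ℕ) :
    ‖∑ n ∈ Ioc 0 y, F n‖ ≤ N * C := by
  have hshift : ∀ c, ∑ n ∈ range N, F (c + n) = 0 := by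
    intro c
    induction c with
    | zero => simpa using h0
    | succ c ih =>
      have h1 := sum_range_succ (fun n => F (c + n)) N
      have h2 := sum_range_succ' (fun n => F (c + n)) N
      rw [h1, ih] at h2
      have : F (c + N) = F c := hF c
      simp only [add_zero, this, zero_add] at h2
      have h3 : ∑ n ∈ range N, F (c + (n + 1)) = 0 := by
        have : F c = (∑ n ∈ range N, F (c + (n + 1))) + F c := h2
        simpa using this
      rw [← h3]
      exact sum_congr rfl fun n _ => by ring_nf
  have hC0 : 0 ≤ C := (norm_nonneg _).trans (hC 0)
  have e : ∀ y, ∑ n ∈ Ioc 0 y, F n = ∑ n ∈ range y, F (1 + n) := by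
    intro y
    rw [show Ioc 0 y = Ico 1 (1 + y) by ext; simp; omega, sum_Ico_eq_sum_range]
    simp
  rw [e]
  have hblock : ∀ d r, ∑ n ∈ range (r + N * d), F (1 + n) = ∑ n ∈ range r, F (1 + n) := by
    intro d r
    induction d with
    | zero => simp
    | succ d ih =>
      rw [mul_add, mul_one, ← add_assoc, sum_range_add, ih]
      have := hshift (1 + (r + N * d))
      simp only [add_assoc] at this ⊢
      rw [this, add_zero]
  have hy : y = y % N + N * (y / N) := (Nat.mod_add_div y N).symm
  rw [hy, hblock]
  refine (norm_sum_le _ _).trans ((sum_le_card_nsmul _ _ C fun n _ => hC _).trans ?_)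
  rw [card_range, nsmul_eq_mul]
  gcongr
  exact (Nat.mod_lt _ hN).le

lemma norm_sum_Ioc_sub_mean_le {N : ℕ} (hN : 0 < N) {F : ℕ → ℂ} {C : ℝ}
    (hF : Function.Periodic F N) (hC : ∀ n, ‖F n‖ ≤ C) (y : ℕ) :
    ‖∑ n ∈ Ioc 0 y, (F n - (∑ m ∈ range N, F m) / N)‖ ≤ N * (2 * C) := by
  have hN' : (N : ℂ) ≠ 0 := by exact_mod_cast hN.ne'
  refine norm_sum_Ioc_le_of_periodic hN (fun n => by simp [hF n]) (fun n => ?_) ?_ y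
  · refine (norm_sub_le _ _).trans ?_
    have : ‖(∑ m ∈ range N, F m) / N‖ ≤ C := by
      rw [norm_div, Complex.norm_natCast, div_le_iff₀ (by exact_mod_cast hN)]
      refine (norm_sum_le _ _).trans ((sum_le_card_nsmul _ _ C fun n _ => hC _).trans ?_)
      rw [card_range, nsmul_eq_mul, mul_comm]
    linarith [hC n]
  · rw [sum_sub_distrib, sum_const, card_range, nsmul_eq_mul]
    field_simp
    ring

lemma norm_sum_Ioc_prod_le {ι : Type*} [DecidableEq ι] (S : Finset ι) (q : ι → ℕ) {Q : ℕ}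
    (hQ : 0 < Q) (hq : ∀ i ∈ S, 0 < q i) (hc : ∀ i ∈ S, Q.Coprime (q i))
    (hcc : ∀ i ∈ S, ∀ j ∈ S, i ≠ j → (q i).Coprime (q j)) {F₀ : ℕ → ℂ} {F : ι → ℕ → ℂ}
    (hF₀ : Function.Periodic F₀ Q) (hF : ∀ i ∈ S, Function.Periodic (F i) (q i))
    (hF₀1 : ∀ n, ‖F₀ n‖ ≤ 1) (hF1 : ∀ i ∈ S, ∀ n, ‖F i n‖ ≤ 1)
    (h0 : ∑ n ∈ range Q, F₀ n = 0 ∨ ∃ i ∈ S, ∑ n ∈ range (q i), F i n = 0) (y : ℕ) :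
    ‖∑ n ∈ Ioc 0 y, F₀ n * ∏ i ∈ S, F i n‖ ≤ (Q * ∏ i ∈ S, q i : ℕ) := by
  have h := norm_sum_Ioc_le_of_periodic (Nat.mul_pos hQ (prod_pos hq)) (prod_periodic S q hF₀ hF)
    (C := 1) (fun n => ?_) ?_ y
  · simpa using h
  · rw [norm_mul, norm_prod]
    exact mul_le_one₀ (hF₀1 n) (by positivity)
      (prod_le_one (fun _ _ => norm_nonneg _) fun i hi => hF1 i hi n)
  · rw [sum_range_prod_of_coprime S q hQ hq hc hcc hF₀ hF]
    rcases h0 with h0 | ⟨i, hi, h0⟩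
    · rw [h0, zero_mul]
    · rw [prod_eq_zero hi h0, mul_zero]

end periodic

end

section

open Finset Filter Topology
open scoped ArithmeticFunction.vonMangoldt Nat

section twist

variable {Q : ℕ}

/-- The completely multiplicative function `n ↦ ξ(n) ∏ χ_p(n)`. -/
noncomputable def twist [Nontrivial (ZMod Q)] (ξ : DirichletCharacter ℂ Q) (S : Finset ℕ)
    (c : ∀ p : ℕ, DirichletCharacter ℂ p) : ℕ →*₀ ℂ where
  toFun n := ξ n * ∏ p ∈ S, c p n
  map_zero' := by rw [Nat.cast_zero, ξ.map_nonunit not_isUnit_zero, zero_mul]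
  map_one' := by simp
  map_mul' m n := by
    simp only [Nat.cast_mul, map_mul, prod_mul_distrib]
    ring

variable [Nontrivial (ZMod Q)]

lemma twist_apply (ξ : DirichletCharacter ℂ Q) (S : Finset ℕ)
    (c : ∀ p : ℕ, DirichletCharacter ℂ p) (n : ℕ) :
    twist ξ S c n = ξ n * ∏ p ∈ S, c p n := rfl

lemma norm_twist_le_one (ξ : DirichletCharacter ℂ Q) (S : Finset ℕ)
    (c : ∀ p : ℕ, DirichletCharacter ℂ p) (n : ℕ) : ‖twist ξ S c n‖ ≤ 1 := by
  rw [twist_apply, norm_mul, norm_prod]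
  exact mul_le_one₀ (ξ.norm_le_one _) (by positivity)
    (prod_le_one (fun _ _ => norm_nonneg _) fun p _ => (c p).norm_le_one _)

lemma sum_range_dirichletCharacter {q : ℕ} (hq : 0 < q) {χ : DirichletCharacter ℂ q} (h : χ ≠ 1) :
    ∑ n ∈ range q, χ n = 0 := by
  have : NeZero q := ⟨hq.ne'⟩
  rw [← MulChar.sum_eq_zero_of_ne_one h, Finset.sum_range]
  refine Fintype.sum_bijective (fun i : Fin q => ((i : ℕ) : ZMod q)) ?_ _ _ fun _ => rfl
  rw [Fintype.bijective_iff_injective_and_card]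
  refine ⟨fun i j hij => ?_, by simp [ZMod.card]⟩
  rw [ZMod.natCast_eq_natCast_iff', Nat.mod_eq_of_lt i.2, Nat.mod_eq_of_lt j.2] at hij
  exact Fin.ext hij

lemma periodic_dirichletCharacter {q : ℕ} (χ : DirichletCharacter ℂ q) :
    Function.Periodic (fun n : ℕ => χ n) q := by
  intro n; simp

/-- The supports `S` allowed for the twists. -/
def GoodSupport (Q : ℕ) (S : Finset ℕ) : Prop := ∀ p ∈ S, p.Prime ∧ Q.Coprime p

lemma norm_sum_twist_mul_twist_le (hQ : 0 < Q) {S S' : Finset ℕ} (hS : GoodSupport Q S)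
    (hS' : GoodSupport Q S') (ξ ξ' : DirichletCharacter ℂ Q)
    (c c' : ∀ p : ℕ, DirichletCharacter ℂ p)
    (h : ξ * ξ' ≠ 1 ∨ (∃ p ∈ S, p ∉ S' ∧ c p ≠ 1) ∨ (∃ p ∈ S', p ∉ S ∧ c' p ≠ 1) ∨
      ∃ p ∈ S, p ∈ S' ∧ c p * c' p ≠ 1) (y : ℕ) :
    ‖∑ n ∈ Ioc 0 y, twist ξ S c n * twist ξ' S' c' n‖ ≤ (Q * ((∏ p ∈ S, p) * ∏ p ∈ S', p) : ℕ) := by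
  have hU : GoodSupport Q (S ∪ S') := fun p hp => (mem_union.1 hp).elim (hS p) (hS' p)
  set F : ℕ → ℕ → ℂ := fun p n =>
    (if p ∈ S then c p n else 1) * (if p ∈ S' then c' p n else 1) with hF
  have e : ∀ n, twist ξ S c n * twist ξ' S' c' n = (ξ * ξ') n * ∏ p ∈ S ∪ S', F p n := by
    intro n
    rw [hF]
    simp only [prod_mul_distrib, MulChar.mul_apply, twist_apply]
    rw [prod_ite_mem, prod_ite_mem, union_inter_cancel_left, union_inter_cancel_right]
    ring
  simp only [e]
  refine (norm_sum_Ioc_prod_le (S ∪ S') (fun p => p) hQ (fun p hp => (hU p hp).1.pos)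
    (fun p hp => (hU p hp).2) (fun p hp p' hp' hne =>
      (Nat.coprime_primes (hU p hp).1 (hU p' hp').1).2 hne) (periodic_dirichletCharacter _)
    (fun p _ n => by simp [hF]) (fun n => DirichletCharacter.norm_le_one _ _)
    (fun p _ n => ?_) ?_ y).trans ?_
  · rw [hF, norm_mul]
    refine mul_le_one₀ ?_ (norm_nonneg _) ?_
    all_goals
      split_ifs
      · exact DirichletCharacter.norm_le_one _ _
      · simp
  · rcases h with h | ⟨p, hp, hp', hc⟩ | ⟨p, hp, hp', hc⟩ | ⟨p, hp, hp', hc⟩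
    · exact Or.inl (sum_range_dirichletCharacter hQ h)
    · refine Or.inr ⟨p, mem_union_left _ hp, ?_⟩
      simp only [hF, if_pos hp, if_neg hp', mul_one]
      exact sum_range_dirichletCharacter (hS p hp).1.pos hc
    · refine Or.inr ⟨p, mem_union_right _ hp, ?_⟩
      simp only [hF, if_pos hp, if_neg hp', one_mul]
      exact sum_range_dirichletCharacter (hS' p hp).1.pos hc
    · refine Or.inr ⟨p, mem_union_left _ hp, ?_⟩
      simp only [hF, if_pos hp, if_pos hp', ← MulChar.mul_apply]
      exact sum_range_dirichletCharacter (hS p hp).1.pos hc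
  · norm_cast
    refine Nat.mul_le_mul_left _ ?_
    rw [← prod_union_inter]
    exact Nat.le_mul_of_pos_right _ (prod_pos fun p hp => (hS p (mem_inter.1 hp).1).1.pos)

lemma norm_sum_twist_le (hQ : 0 < Q) {S : Finset ℕ} (hS : GoodSupport Q S)
    (ξ : DirichletCharacter ℂ Q) (c : ∀ p : ℕ, DirichletCharacter ℂ p)
    (h : ∃ p ∈ S, c p ≠ 1) (y : ℕ) :
    ‖∑ n ∈ Ioc 0 y, twist ξ S c n‖ ≤ (Q * ∏ p ∈ S, p : ℕ) := by
  obtain ⟨p, hp, hc⟩ := h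
  have := norm_sum_twist_mul_twist_le hQ hS (S' := ∅) (by simp [GoodSupport]) ξ 1 c (fun _ => 1)
    (Or.inr (Or.inl ⟨p, hp, by simp, hc⟩)) y
  have e : ∀ n, twist ξ S c n * twist (1 : DirichletCharacter ℂ Q) ∅ (fun _ => 1) n =
      twist ξ S c n := by
    intro n
    simp only [twist_apply, prod_empty, mul_one]
    rw [mul_right_comm, ← MulChar.mul_apply, mul_one]
  simpa only [e, prod_empty, mul_one] using this

lemma conj_dirichletCharacter {q : ℕ} [NeZero q] (χ : DirichletCharacter ℂ q) (a : ZMod q) :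
    starRingEnd ℂ (χ a) = χ⁻¹ a := MulChar.star_apply' χ a

lemma conj_twist (hQ : 0 < Q) {S : Finset ℕ} (hS : GoodSupport Q S)
    (ξ : DirichletCharacter ℂ Q) (c : ∀ p : ℕ, DirichletCharacter ℂ p) (n : ℕ) :
    starRingEnd ℂ (twist ξ S c n) = twist ξ⁻¹ S (fun p => (c p)⁻¹) n := by
  have : NeZero Q := ⟨hQ.ne'⟩
  rw [twist_apply, twist_apply, map_mul, map_prod, conj_dirichletCharacter]
  congr 1
  refine prod_congr rfl fun p hp => ?_
  have : NeZero p := ⟨(hS p hp).1.ne_zero⟩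
  exact conj_dirichletCharacter _ _

/-- Parameter range in which the zero-free region applies. -/
lemma eventually_zero_free_params (A B : ℕ) (hQ : 1 ≤ Q) : ∀ᶠ l : ℕ in atTop,
    2 ≤ Real.log (Q * Real.exp (2 * (B + 1) * l)) ∧
    7 * decay A l ≤ 1 / (2 * Real.log (Q * Real.exp (2 * (B + 1) * l))) ∧
    8 * 24 ^ 4 * lConst ^ 5 * Real.log (Q * Real.exp (2 * (B + 1) * l)) ^ 9 * decay A l < 1 ∧
    2 * Real.log (4 * lConst * Real.log (Q * Real.exp (2 * (B + 1) * l)) / decay A l ^ 2) ≤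
      Real.exp l := by
  have hQ0 : (0 : ℝ) < Q := by exact_mod_cast hQ
  have hC := one_le_lConst
  set G : ℝ := Real.log Q + 2 * (B + 1) with hG
  have hlQ : 0 ≤ Real.log Q := Real.log_natCast_nonneg Q
  have hB0 : (0 : ℝ) ≤ B := by positivity
  have hG0 : 2 ≤ G := by rw [hG]; linarith
  have hLb : ∀ x : ℝ, 1 ≤ x → 2 ≤ Real.log Q + 2 * (B + 1) * x ∧
      Real.log Q + 2 * (B + 1) * x ≤ G * (x + 1) := by
    intro x hx
    have h1 : 0 ≤ B * x := by positivity
    have h2 : 0 ≤ Real.log Q * x := by positivity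
    rw [hG]
    constructor <;> linarith
  filter_upwards [eventually_ge_atTop 1,
    eventually_mul_pow_le_exp (14 * G * (A + 1)) 2,
    eventually_mul_pow_le_exp (2 * (8 * 24 ^ 4 * lConst ^ 5 * G ^ 9 * (A + 1))) 10,
    eventually_mul_pow_le_exp (2 * (4 * lConst * G + 4)) 1] with l h1 h2 h3 h4
  have hl : (1 : ℝ) ≤ l := by exact_mod_cast h1
  have e : Real.log (Q * Real.exp (2 * (B + 1) * l)) = Real.log Q + 2 * (B + 1) * l := by
    rw [Real.log_mul hQ0.ne' (Real.exp_ne_zero _), Real.log_exp]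
  rw [e]
  set L := Real.log Q + 2 * (B + 1) * l with hL
  obtain ⟨hL2, hLG⟩ : 2 ≤ L ∧ L ≤ G * (l + 1) := hLb l hl
  have hd : decay A l ≤ (A + 1) * (l + 1) / Real.exp l := by
    unfold decay; push_cast; gcongr
    have : (0 : ℝ) ≤ A := by positivity
    linarith
  have hd0 := decay_pos A l
  have hE := Real.exp_pos l
  have hE1 : 1 / Real.exp l ≤ decay A l := by
    unfold decay; gcongr
    have : (0 : ℝ) ≤ (A * l : ℕ) := by positivity
    linarith
  refine ⟨hL2, ?_, ?_, ?_⟩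
  · rw [le_div_iff₀ (by linarith)]
    calc 7 * decay A l * (2 * L) ≤ 7 * ((A + 1) * (l + 1) / Real.exp l) * (2 * (G * (l + 1))) := by
          gcongr
      _ = 14 * G * (A + 1) * (l + 1) ^ 2 / Real.exp l := by ring
      _ ≤ 1 := by rwa [div_le_one hE]
  · calc 8 * 24 ^ 4 * lConst ^ 5 * L ^ 9 * decay A l
        ≤ 8 * 24 ^ 4 * lConst ^ 5 * (G * (l + 1)) ^ 9 * ((A + 1) * (l + 1) / Real.exp l) := by
          gcongr
      _ = 2 * (8 * 24 ^ 4 * lConst ^ 5 * G ^ 9 * (A + 1)) * (l + 1) ^ 10 / Real.exp l / 2 := by ring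
      _ ≤ 1 / 2 := by gcongr; rwa [div_le_one hE]
      _ < 1 := by norm_num
  · have h5 : 4 * lConst * L / decay A l ^ 2 ≤ (4 * lConst * G * (l + 1)) * Real.exp (2 * l) := by
      rw [div_le_iff₀ (by positivity)]
      have h6 : 1 ≤ Real.exp (2 * l) * decay A l ^ 2 := by
        have : Real.exp (2 * l) = Real.exp l ^ 2 := by rw [← Real.exp_nat_mul]; norm_num
        rw [this, ← mul_pow]
        refine one_le_pow₀ ?_
        rwa [div_le_iff₀ hE, mul_comm] at hE1
      calc 4 * lConst * L ≤ 4 * lConst * (G * (l + 1)) * 1 := by rw [mul_one]; gcongr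
        _ ≤ 4 * lConst * (G * (l + 1)) * (Real.exp (2 * l) * decay A l ^ 2) := by gcongr
        _ = _ := by ring
    have h7 : Real.log (4 * lConst * L / decay A l ^ 2) ≤ 4 * lConst * G * (l + 1) + 2 * l := by
      refine (Real.log_le_log (by positivity) h5).trans ?_
      rw [Real.log_mul (by positivity) (Real.exp_ne_zero _), Real.log_exp]
      have := Real.log_le_sub_one_of_pos (show 0 < 4 * lConst * G * (l + 1) by positivity)
      linarith
    rw [pow_one] at h4
    linarith

/-- There is at most one exceptional support. -/
lemma eventually_exists_exceptional (A B : ℕ) (hQ : 1 ≤ Q) : ∀ᶠ l : ℕ in atTop,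
    ∃ p₁, 2 ≤ p₁ ∧ ∀ (ξ : DirichletCharacter ℂ Q) (S : Finset ℕ)
      (c : ∀ p : ℕ, DirichletCharacter ℂ p), S.Nonempty → GoodSupport Q S → (∀ p ∈ S, c p ≠ 1) →
      ((∏ p ∈ S, p : ℕ) : ℝ) ≤ Real.exp (B * l) → p₁ ∉ S →
      ¬ HasNearZero (fun n => twist ξ S c n) (decay A l) := by
  filter_upwards [eventually_zero_free_params A B hQ] with l ⟨h1, h2, h3, _⟩
  have hQ0 : (0 : ℝ) < Q := by exact_mod_cast hQ
  have key : ∀ (ξ ξ' : DirichletCharacter ℂ Q) (S S' : Finset ℕ)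
      (c c' : ∀ p : ℕ, DirichletCharacter ℂ p), S.Nonempty → S'.Nonempty → GoodSupport Q S →
      GoodSupport Q S' → (∀ p ∈ S, c p ≠ 1) → (∀ p ∈ S', c' p ≠ 1) →
      ((∏ p ∈ S, p : ℕ) : ℝ) ≤ Real.exp (B * l) → ((∏ p ∈ S', p : ℕ) : ℝ) ≤ Real.exp (B * l) →
      HasNearZero (fun n => twist ξ S c n) (decay A l) →
      HasNearZero (fun n => twist ξ' S' c' n) (decay A l) → S = S' := by
    intro ξ ξ' S S' c c' hne hne' hS hS' hc hc' hZ hZ' hz hz'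
    by_contra hSS
    have hl0 : (0 : ℝ) ≤ B * l := by positivity
    have hl0' : (0 : ℝ) ≤ l := by positivity
    have hb : ∀ x : ℕ, (x : ℝ) ≤ Real.exp (B * l) →
        ((Q * x : ℕ) : ℝ) ≤ Q * Real.exp (2 * (B + 1) * l) := by
      intro x hx
      push_cast
      gcongr
      exact hx.trans (Real.exp_le_exp.2 (by linarith))
    obtain ⟨p, hp⟩ := hne
    obtain ⟨p', hp'⟩ := hne'
    have := not_hasNearZero_pair (norm_twist_le_one ξ S c) (norm_twist_le_one ξ' S' c') h1
      (fun n => (norm_sum_twist_le hQ hS ξ c ⟨p, hp, hc p hp⟩ n).trans (hb _ hZ))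
      (fun n => (norm_sum_twist_le hQ hS' ξ' c' ⟨p', hp', hc' p' hp'⟩ n).trans (hb _ hZ'))
      (fun n => (norm_sum_twist_mul_twist_le hQ hS hS' ξ ξ' c c' (by
        by_cases hsub : S ⊆ S'
        · obtain ⟨x, hx, hx'⟩ := not_subset.1 fun h => hSS (hsub.antisymm h)
          exact Or.inr (Or.inr (Or.inl ⟨x, hx, hx', hc' x hx⟩))
        · obtain ⟨x, hx, hx'⟩ := not_subset.1 hsub
          exact Or.inr (Or.inl ⟨x, hx, hx', hc x hx⟩)) n).trans (by
        push_cast at hZ hZ' ⊢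
        have e : Real.exp (2 * (B + 1) * l) = Real.exp (B * l) * Real.exp (B * l) *
            Real.exp (2 * l) := by
          rw [← Real.exp_add, ← Real.exp_add]; ring_nf
        have e1 : 1 ≤ Real.exp (2 * (l : ℝ)) := Real.one_le_exp (by linarith)
        rw [e]
        refine mul_le_mul_of_nonneg_left ?_ hQ0.le
        calc _ ≤ Real.exp (B * l) * Real.exp (B * l) :=
              mul_le_mul hZ hZ' (by positivity) (by positivity)
          _ = Real.exp (B * l) * Real.exp (B * l) * 1 := (mul_one _).symm
          _ ≤ _ := by gcongr))
      (decay_pos A l) h2 hz hz'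
    linarith
  by_cases hbad : ∃ (ξ : DirichletCharacter ℂ Q) (S : Finset ℕ)
      (c : ∀ p : ℕ, DirichletCharacter ℂ p), S.Nonempty ∧ GoodSupport Q S ∧ (∀ p ∈ S, c p ≠ 1) ∧
      ((∏ p ∈ S, p : ℕ) : ℝ) ≤ Real.exp (B * l) ∧ HasNearZero (fun n => twist ξ S c n) (decay A l)
  · obtain ⟨ξ, S, c, hne, hS, hc, hZ, hz⟩ := hbad
    obtain ⟨p, hp⟩ := id hne
    refine ⟨p, (hS p hp).1.two_le, fun ξ' S' c' hne' hS' hc' hZ' hp' hz' => hp' ?_⟩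
    rw [← key ξ ξ' S S' c c' hne hne' hS hS' hc hc' hZ hZ' hz hz']
    exact hp
  · push Not at hbad
    exact ⟨2, le_rfl, fun ξ S c hne hS hc hZ _ => hbad ξ S c hne hS hc hZ⟩

end twist

end

section

open Finset

section unitCoeff

variable {q : ℕ} [NeZero q]

/-- The Fourier coefficients of the restriction of `h` to the units. -/
noncomputable def unitCoeff (h : ZMod q → ℂ) (χ : DirichletCharacter ℂ q) : ℂ :=
  (∑ x, h x * χ⁻¹ x) / q.totient

lemma sum_unitCoeff_mul (h : ZMod q → ℂ) {u : ZMod q} (hu : IsUnit u) :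
    ∑ χ : DirichletCharacter ℂ q, unitCoeff h χ * χ u = h u := by
  have hφ : (q.totient : ℂ) ≠ 0 :=
    Nat.cast_ne_zero.2 (Nat.totient_pos.2 (NeZero.pos q)).ne'
  have hx : ∀ x : ZMod q, ∑ χ : DirichletCharacter ℂ q, χ⁻¹ x * χ u =
      if x = u then (q.totient : ℂ) else 0 := by
    intro x
    by_cases hxu : IsUnit x
    · rw [← DirichletCharacter.sum_char_inv_mul_char_eq ℂ hxu u]
      refine sum_congr rfl fun χ _ => ?_
      rw [MulChar.inv_apply]
      congr 2
      obtain ⟨v, rfl⟩ := hxu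
      rw [Ring.inverse_unit, ZMod.inv_coe_unit]
    · rw [if_neg (by rintro rfl; exact hxu hu)]
      exact sum_eq_zero fun χ _ => by rw [χ⁻¹.map_nonunit hxu, zero_mul]
  calc _ = (∑ x, h x * ∑ χ : DirichletCharacter ℂ q, χ⁻¹ x * χ u) / q.totient := by
        simp_rw [unitCoeff, div_mul_eq_mul_div, ← sum_div, sum_mul, mul_sum]
        rw [sum_comm]
        simp_rw [mul_assoc]
    _ = _ := by simp [hx, hφ]

lemma unitCoeff_const_one [DecidableEq (DirichletCharacter ℂ q)] (χ : DirichletCharacter ℂ q) :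
    unitCoeff (fun _ => 1) χ = if χ = 1 then 1 else 0 := by
  have hφ : (q.totient : ℂ) ≠ 0 :=
    Nat.cast_ne_zero.2 (Nat.totient_pos.2 (NeZero.pos q)).ne'
  unfold unitCoeff
  split_ifs with h
  · subst h
    simp only [inv_one, one_mul]
    rw [MulChar.sum_one_eq_card_units, ZMod.card_units_eq_totient, div_self hφ]
  · simp only [one_mul]
    rw [MulChar.sum_eq_zero_of_ne_one (inv_ne_one.2 h), zero_div]

lemma norm_unitCoeff_le {h : ZMod q → ℂ} {b : ℝ} (hb : ∑ x, ‖h x‖ ≤ b * q.totient)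
    (χ : DirichletCharacter ℂ q) : ‖unitCoeff h χ‖ ≤ b := by
  have hφ : (0 : ℝ) < q.totient := Nat.cast_pos.2 (Nat.totient_pos.2 (NeZero.pos q))
  rw [unitCoeff, norm_div, Complex.norm_natCast, div_le_iff₀ hφ]
  refine (norm_sum_le _ _).trans (le_trans (sum_le_sum fun x _ => ?_) hb)
  rw [norm_mul]
  exact mul_le_of_le_one_right (norm_nonneg _) (DirichletCharacter.norm_le_one _ _)

lemma norm_unitCoeff_le_one {h : ZMod q → ℂ} (hh : ∀ x, ‖h x‖ ≤ 1)
    (χ : DirichletCharacter ℂ q) : ‖unitCoeff h χ‖ ≤ 1 := by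
  have hφ : (0 : ℝ) < q.totient := Nat.cast_pos.2 (Nat.totient_pos.2 (NeZero.pos q))
  rw [unitCoeff, norm_div, Complex.norm_natCast, div_le_iff₀ hφ, one_mul]
  refine (norm_sum_le _ _).trans ?_
  calc ∑ x, ‖h x * χ⁻¹ x‖ ≤ ∑ x : ZMod q, ‖(1 : DirichletCharacter ℂ q) x‖ := by
        refine sum_le_sum fun x _ => ?_
        by_cases hx : IsUnit x
        · rw [norm_mul, MulChar.one_apply hx, norm_one]
          exact mul_le_one₀ (hh x) (norm_nonneg _) (DirichletCharacter.norm_le_one _ _)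
        · rw [MulChar.map_nonunit _ hx, MulChar.map_nonunit _ hx, mul_zero]
    _ = ∑ x : ZMod q, if IsUnit x then (1 : ℝ) else 0 := by
        refine sum_congr rfl fun x _ => ?_
        split_ifs with hx
        · rw [MulChar.one_apply hx, norm_one]
        · rw [MulChar.map_nonunit _ hx, norm_zero]
    _ = _ := by
        rw [← ZMod.card_units_eq_totient, ← MulChar.sum_one_eq_card_units (R := ZMod q)]
        refine sum_congr rfl fun x _ => ?_
        split_ifs with hx
        · rw [MulChar.one_apply hx]
        · rw [MulChar.map_nonunit _ hx]

end unitCoeff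

section prime

variable {p : ℕ} [hp : Fact p.Prime]

lemma unitCoeff_one_prime (h : ZMod p → ℝ) :
    unitCoeff (fun t => (h t : ℂ)) 1 = ((∑ t, punctured 0 t * h t : ℝ) : ℂ) := by
  have h1 : ∀ x : ZMod p, (1 : DirichletCharacter ℂ p)⁻¹ x = if x = 0 then 0 else 1 := by
    intro x
    rw [inv_one]
    split_ifs with hx
    · rw [hx, MulChar.map_nonunit _ not_isUnit_zero]
    · exact MulChar.one_apply (isUnit_iff_ne_zero.2 hx)
  rw [unitCoeff, Nat.totient_prime hp.out, Complex.ofReal_sum, sum_div]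
  refine sum_congr rfl fun t _ => ?_
  rw [h1, punctured, ZMod.card, Nat.cast_sub hp.out.one_le]
  split_ifs <;> simp [div_eq_mul_inv, mul_comm]

variable {k : ℕ} (pt : Fin k → ZMod p)

lemma abs_sieveLocal_le (o : Option (Fin k)) (t : ZMod p) : |sieveLocal pt o t| ≤ p := by
  have h2 : (2 : ℝ) ≤ p := by exact_mod_cast hp.out.two_le
  rcases o with _ | i
  · simp only [sieveLocal, abs_one]; linarith
  · simp only [sieveLocal, ZMod.card]
    split_ifs <;> rw [abs_le] <;> constructor <;> linarith

lemma sum_abs_sieveLocal_le (i : Fin k) :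
    ∑ t, |sieveLocal pt (some i) t| ≤ 2 * ((p - 1 : ℕ) : ℝ) := by
  have h2 : (2 : ℝ) ≤ p := by exact_mod_cast hp.out.two_le
  rw [← add_sum_erase univ _ (mem_univ (pt i)), Nat.cast_sub hp.out.one_le]
  have h1 : ∑ t ∈ univ.erase (pt i), |sieveLocal pt (some i) t| = p - 1 := by
    rw [sum_congr rfl (g := fun _ => (1 : ℝ)) fun t ht => by
      simp [sieveLocal, ne_of_mem_erase ht]]
    rw [sum_const, card_erase_of_mem (mem_univ _), card_univ, ZMod.card, nsmul_eq_mul,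
      Nat.cast_sub hp.out.one_le]
    simp
  rw [h1]
  have h3 : |sieveLocal pt (some i) (pt i)| ≤ p - 2 + 0 := by
    simp only [sieveLocal, ZMod.card, if_true]
    rw [abs_le]; constructor <;> linarith
  push_cast
  linarith

/-- The local contribution of a pair of colours to the Fourier coefficient at `χ`. -/
noncomputable def localCoeff (χ : DirichletCharacter ℂ p) (o o' : Option (Fin k)) : ℂ :=
  unitCoeff (fun t => ((sieveLocal pt o t * sieveLocal pt o' t : ℝ) : ℂ)) χ

lemma localCoeff_none_none [DecidableEq (DirichletCharacter ℂ p)] (χ : DirichletCharacter ℂ p) :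
    localCoeff pt χ none none = if χ = 1 then 1 else 0 := by
  rw [← unitCoeff_const_one]
  simp [localCoeff, sieveLocal]

lemma norm_localCoeff_none_left_le (χ : DirichletCharacter ℂ p) (i : Fin k) :
    ‖localCoeff pt χ none (some i)‖ ≤ 2 := by
  refine norm_unitCoeff_le ?_ χ
  rw [Nat.totient_prime hp.out]
  refine le_trans (le_of_eq (sum_congr rfl fun t _ => ?_)) (sum_abs_sieveLocal_le pt i)
  rw [Complex.norm_real, Real.norm_eq_abs]
  simp only [sieveLocal, one_mul]

lemma localCoeff_comm (χ : DirichletCharacter ℂ p) (o o' : Option (Fin k)) :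
    localCoeff pt χ o o' = localCoeff pt χ o' o := by
  simp only [localCoeff, mul_comm]

lemma norm_localCoeff_some_some_le (χ : DirichletCharacter ℂ p) (i j : Fin k) :
    ‖localCoeff pt χ (some i) (some j)‖ ≤ 2 * p := by
  refine norm_unitCoeff_le ?_ χ
  rw [Nat.totient_prime hp.out]
  calc _ ≤ ∑ t, p * |sieveLocal pt (some j) t| := sum_le_sum fun t _ => by
        rw [Complex.norm_real, Real.norm_eq_abs, abs_mul]
        exact mul_le_mul_of_nonneg_right (abs_sieveLocal_le pt _ t) (abs_nonneg _)
    _ ≤ _ := by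
        rw [← mul_sum]
        have := mul_le_mul_of_nonneg_left (sum_abs_sieveLocal_le pt j) (Nat.cast_nonneg (α := ℝ) p)
        linarith

lemma sum_localCoeff_le [DecidableEq (DirichletCharacter ℂ p)] (χ : DirichletCharacter ℂ p) :
    ∑ o : Option (Fin k), ∑ o' : Option (Fin k),
      o.elim 1 (fun _ => 1 / (p : ℝ)) * o'.elim 1 (fun _ => 1 / (p : ℝ)) * ‖localCoeff pt χ o o'‖ ≤
      (if χ = 1 then 1 else 0) + 6 * (k : ℝ) ^ 2 / p := by
  have hp0 : (0 : ℝ) < p := by exact_mod_cast hp.out.pos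
  simp only [Fintype.sum_option, Option.elim_none, Option.elim_some, one_mul, mul_one]
  have h00 : ‖localCoeff pt χ none none‖ = if χ = 1 then 1 else 0 := by
    rw [localCoeff_none_none]; split_ifs <;> simp
  have h01 : ∑ j : Fin k, 1 / (p : ℝ) * ‖localCoeff pt χ none (some j)‖ ≤ k * (2 / p) := by
    refine (sum_le_card_nsmul _ _ (2 / (p : ℝ)) fun j _ => ?_).trans (by simp)
    rw [div_mul_eq_mul_div, one_mul]
    exact div_le_div_of_nonneg_right (norm_localCoeff_none_left_le pt χ j) hp0.le
  have h1 : ∑ i : Fin k, (1 / (p : ℝ) * ‖localCoeff pt χ (some i) none‖ +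
      ∑ j : Fin k, 1 / (p : ℝ) * (1 / p) * ‖localCoeff pt χ (some i) (some j)‖) ≤
      k * (2 / p + k * (2 / p)) := by
    refine (sum_le_card_nsmul _ _ (2 / (p : ℝ) + k * (2 / p)) fun i _ => ?_).trans
      (le_of_eq (by rw [card_univ, Fintype.card_fin, nsmul_eq_mul]))
    refine add_le_add ?_ ((sum_le_card_nsmul _ _ (2 / (p : ℝ)) fun j _ => ?_).trans (by simp))
    · rw [div_mul_eq_mul_div, one_mul, localCoeff_comm]
      exact div_le_div_of_nonneg_right (norm_localCoeff_none_left_le pt χ i) hp0.le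
    · calc _ ≤ 1 / (p : ℝ) * (1 / p) * (2 * p) :=
          mul_le_mul_of_nonneg_left (norm_localCoeff_some_some_le pt χ i j) (by positivity)
        _ = _ := by field_simp
  have hk : (k : ℝ) ≤ (k : ℝ) ^ 2 := by exact_mod_cast Nat.le_self_pow two_ne_zero k
  calc _ ≤ (if χ = 1 then 1 else 0) + k * (2 / p) + k * (2 / (p : ℝ) + k * (2 / p)) := by
        rw [h00]; exact add_le_add (add_le_add le_rfl h01) h1
    _ = (if χ = 1 then 1 else 0) + (4 * k + 2 * (k : ℝ) ^ 2) / p := by ring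
    _ ≤ _ := by gcongr; linarith

end prime

section productCoeff

variable {ι : Type*} [Fintype ι] [DecidableEq ι] {N : ι → ℕ} [hN : ∀ i, Fact (N i).Prime] {k : ℕ}
  (pt : ∀ i, Fin k → ZMod (N i)) (a : (ι → Option (Fin k)) → ℝ)

/-- The Fourier coefficients of the square of the sieve weight on the units. -/
noncomputable def squareCoeff (χ : ∀ i, DirichletCharacter ℂ (N i)) : ℂ :=
  ∑ ρ, ∑ σ, ((a ρ * a σ : ℝ) : ℂ) * ∏ i, localCoeff (pt i) (χ i) (ρ i) (σ i)

/-- The sieve weight at an integer. -/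
noncomputable def sieveSum (m : ℕ) : ℝ :=
  localSum (fun i => sieveLocal (pt i)) a fun i => (m : ZMod (N i))

lemma sum_squareCoeff_mul [∀ i, DecidableEq (DirichletCharacter ℂ (N i))]
    {m : ℕ} (hm : ∀ i, m.Coprime (N i)) :
    ∑ χ, squareCoeff pt a χ * ∏ i, χ i (m : ZMod (N i)) = ((sieveSum pt a m ^ 2 : ℝ) : ℂ) := by
  have h1 : ∀ ρ σ : ι → Option (Fin k),
      ∑ χ : ∀ i, DirichletCharacter ℂ (N i), (∏ i, localCoeff (pt i) (χ i) (ρ i) (σ i)) *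
        ∏ i, χ i (m : ZMod (N i)) =
      ((∏ i, (sieveLocal (pt i) (ρ i) m * sieveLocal (pt i) (σ i) m) : ℝ) : ℂ) := by
    intro ρ σ
    simp_rw [← prod_mul_distrib]
    rw [← Fintype.piFinset_univ, ← Finset.prod_univ_sum (fun _ => univ)
      (fun i χ => localCoeff (pt i) χ (ρ i) (σ i) * χ (m : ZMod (N i))), Complex.ofReal_prod]
    exact prod_congr rfl fun i _ => sum_unitCoeff_mul _ ((ZMod.isUnit_iff_coprime _ _).2 (hm i))
  calc _ = ∑ ρ, ∑ σ, ((a ρ * a σ : ℝ) : ℂ) *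
        ∑ χ : ∀ i, DirichletCharacter ℂ (N i), (∏ i, localCoeff (pt i) (χ i) (ρ i) (σ i)) *
          ∏ i, χ i (m : ZMod (N i)) := by
        simp_rw [squareCoeff, sum_mul, mul_sum, mul_assoc]
        rw [sum_comm]
        exact sum_congr rfl fun _ _ => sum_comm
    _ = _ := by
        simp_rw [h1, sq, sieveSum, localSum, sum_mul_sum]
        push_cast
        exact sum_congr rfl fun ρ _ => sum_congr rfl fun σ _ => by rw [prod_mul_distrib]; ring

lemma squareCoeff_one :
    squareCoeff pt a 1 = ((prodExpect (fun i => punctured (0 : ZMod (N i))) fun x =>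
      localSum (fun i => sieveLocal (pt i)) a x * localSum (fun i => sieveLocal (pt i)) a x : ℝ) :
      ℂ) := by
  rw [prodExpect_localSum_mul, squareCoeff]
  push_cast
  refine sum_congr rfl fun ρ _ => sum_congr rfl fun σ _ => ?_
  congr 1
  refine prod_congr rfl fun i _ => ?_
  rw [Pi.one_apply, localCoeff, unitCoeff_one_prime]
  push_cast
  rfl

lemma norm_squareCoeff_le [∀ i, DecidableEq (DirichletCharacter ℂ (N i))] {b : ℝ} (hb : 0 ≤ b)
    (ha : ∀ ρ, |a ρ| ≤ b * ∏ i, (ρ i).elim 1 fun _ => 1 / (N i : ℝ))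
    (χ : ∀ i, DirichletCharacter ℂ (N i)) :
    ‖squareCoeff pt a χ‖ ≤
      b ^ 2 * ∏ i, ((if χ i = 1 then 1 else 0) + 6 * (k : ℝ) ^ 2 / N i) := by
  set α : ∀ _ : ι, Option (Fin k) → ℝ := fun i o => o.elim 1 fun _ => 1 / (N i : ℝ) with hα
  have hα0 : ∀ i o, 0 ≤ α i o := by
    intro i o; rcases o with _ | c <;> simp [hα]
  have hdist : ∑ ρ : ι → Option (Fin k), ∑ σ : ι → Option (Fin k),
      ∏ i, (α i (ρ i) * α i (σ i) * ‖localCoeff (pt i) (χ i) (ρ i) (σ i)‖) =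
      ∏ i, ∑ o, ∑ o', α i o * α i o' * ‖localCoeff (pt i) (χ i) o o'‖ := by
    simp_rw [← Fintype.sum_prod_type', Finset.prod_univ_sum, Fintype.piFinset_univ]
    exact (Fintype.sum_equiv (Equiv.arrowProdEquivProdArrow ι _ _) _ _ fun _ => rfl).symm
  calc _ ≤ ∑ ρ, ∑ σ, ‖((a ρ * a σ : ℝ) : ℂ) * ∏ i, localCoeff (pt i) (χ i) (ρ i) (σ i)‖ :=
        (norm_sum_le _ _).trans (sum_le_sum fun _ _ => norm_sum_le _ _)
    _ ≤ ∑ ρ : ι → Option (Fin k), ∑ σ : ι → Option (Fin k),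
        b ^ 2 * ∏ i, (α i (ρ i) * α i (σ i) * ‖localCoeff (pt i) (χ i) (ρ i) (σ i)‖) := by
        refine sum_le_sum fun ρ _ => sum_le_sum fun σ _ => ?_
        rw [norm_mul, Complex.norm_real, Real.norm_eq_abs, abs_mul, norm_prod, prod_mul_distrib,
          prod_mul_distrib]
        calc _ ≤ ((b * ∏ i, α i (ρ i)) * (b * ∏ i, α i (σ i))) *
            ∏ i, ‖localCoeff (pt i) (χ i) (ρ i) (σ i)‖ :=
              mul_le_mul_of_nonneg_right (mul_le_mul (ha ρ) (ha σ) (abs_nonneg _)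
                (mul_nonneg hb (prod_nonneg fun i _ => hα0 _ _)))
                (prod_nonneg fun _ _ => norm_nonneg _)
          _ = _ := by ring
    _ = b ^ 2 * ∏ i, ∑ o, ∑ o', α i o * α i o' * ‖localCoeff (pt i) (χ i) o o'‖ := by
        rw [← hdist]; simp_rw [mul_sum]
    _ ≤ _ := by
        refine mul_le_mul_of_nonneg_left (prod_le_prod (fun i _ => sum_nonneg fun o _ =>
          sum_nonneg fun o' _ => mul_nonneg (mul_nonneg (hα0 _ _) (hα0 _ _)) (norm_nonneg _))
          fun i _ => sum_localCoeff_le (pt i) (χ i)) (sq_nonneg b)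

lemma squareCoeff_eq_zero {M : ℕ}
    (ha : ∀ ρ, a ρ ≠ 0 → ∏ i ∈ univ.filter (fun i => ρ i ≠ none), N i ≤ M)
    {χ : ∀ i, DirichletCharacter ℂ (N i)} {S : Finset ι} (hS : ∀ i ∈ S, χ i ≠ 1)
    (hM : M ^ 2 < ∏ i ∈ S, N i) : squareCoeff pt a χ = 0 := by
  classical
  refine sum_eq_zero fun ρ _ => sum_eq_zero fun σ _ => ?_
  by_cases hρ : a ρ = 0
  · simp [hρ]
  by_cases hσ : a σ = 0
  · simp [hσ]
  have hex : ∃ i ∈ S, ρ i = none ∧ σ i = none := by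
    by_contra! hcon
    refine absurd hM (not_lt.2 ?_)
    set U := univ.filter (fun i => ρ i ≠ none)
    set V := univ.filter (fun i => σ i ≠ none)
    have hpos : ∀ i, 1 ≤ N i := fun i => (hN i).out.one_le
    calc ∏ i ∈ S, N i ≤ ∏ i ∈ U ∪ V, N i :=
          prod_le_prod_of_subset_of_one_le' (fun i hi => by
            have := hcon i hi
            simp only [U, V, mem_union, mem_filter, mem_univ, true_and]
            tauto) fun i _ _ => hpos i
      _ ≤ (∏ i ∈ U ∪ V, N i) * ∏ i ∈ U ∩ V, N i :=
          Nat.le_mul_of_pos_right _ (prod_pos fun i _ => hpos i)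
      _ = (∏ i ∈ U, N i) * ∏ i ∈ V, N i := prod_union_inter
      _ ≤ M ^ 2 := by rw [sq]; exact Nat.mul_le_mul (ha ρ hρ) (ha σ hσ)
  obtain ⟨i, hi, h1, h2⟩ := hex
  rw [prod_eq_zero (mem_univ i), mul_zero]
  rw [h1, h2, localCoeff_none_none, if_neg (hS i hi)]

end productCoeff

section sieveCoeff

variable {ι : Type*} [Fintype ι] [DecidableEq ι] {N : ι → ℕ} {k : ℕ} {g : ℕ → ℝ} {R : ℕ}

lemma prod_filter_ne_none (ρ : ι → Option (Fin k)) :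
    ∏ i ∈ univ.filter (fun i => ρ i ≠ none), N i = ∏ c, ∏ i ∈ colorClass ρ c, N i := by
  rw [← prod_elim_eq_prod_colorClass ρ fun _ i => N i, prod_filter]
  refine prod_congr rfl fun i _ => ?_
  rcases h : ρ i with _ | c <;> simp

lemma prod_le_of_sieveCoeff_ne_zero {ρ : ι → Option (Fin k)} (h : sieveCoeff N k g R ρ ≠ 0) :
    ∏ i ∈ univ.filter (fun i => ρ i ≠ none), N i ≤ R := by
  rw [prod_filter_ne_none]
  by_contra hcon
  exact h (by rw [sieveCoeff, sieveWeight, if_neg hcon, zero_mul])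

lemma abs_sieveCoeff_le {b : ℝ} (hg : ∀ n, |g n| ≤ b) (hN : ∀ i, 1 ≤ N i)
    (ρ : ι → Option (Fin k)) :
    |sieveCoeff N k g R ρ| ≤ b ^ k * ∏ i, (ρ i).elim 1 fun _ => 1 / (N i : ℝ) := by
  have hb : 0 ≤ b := (abs_nonneg _).trans (hg 0)
  rw [sieveCoeff, abs_mul, abs_prod]
  refine mul_le_mul ?_ (prod_le_prod (fun _ _ => abs_nonneg _) fun i _ => ?_)
    (prod_nonneg fun _ _ => abs_nonneg _) (pow_nonneg hb k)
  · rw [sieveWeight]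
    split_ifs
    · rw [abs_prod]
      refine (prod_le_prod (fun _ _ => abs_nonneg _) fun c _ => hg _).trans (by simp)
    · rw [abs_zero]; exact pow_nonneg hb k
  · have : (1 : ℝ) ≤ N i := by exact_mod_cast hN i
    rcases ρ i with _ | c
    · simp
    · simp only [Option.elim_some]
      rw [abs_of_nonneg (by positivity)]
      gcongr
      simp

end sieveCoeff

end

section

open Finset Filter Topology
open scoped Nat

lemma exists_forall_extend_eq {ι : Type*} {N : ι → ℕ} (hN : Function.Injective N) {β : ℕ → Type*}
    [∀ n, Inhabited (β n)] (f : ∀ i, β (N i)) : ∃ c : ∀ n, β n, ∀ i, c (N i) = f i := by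
  classical
  refine ⟨fun n => if h : ∃ i, N i = n then h.choose_spec ▸ f h.choose else default, fun i => ?_⟩
  have h : ∃ j, N j = N i := ⟨i, rfl⟩
  simp only [dif_pos h]
  have key : ∀ (j : ι) (e : N j = N i), j = i → (e ▸ f j : β (N i)) = f i := by
    rintro j e rfl; rfl
  exact key _ _ (hN h.choose_spec)

section eulerProduct

variable {ι : Type*} [Fintype ι] [DecidableEq ι] {N : ι → ℕ}

lemma prod_image_id (hN : Function.Injective N) (U : Finset ι) :
    ∏ p ∈ U.image N, p = ∏ i ∈ U, N i := prod_image fun _ _ _ _ h => hN h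

lemma prod_subset_injective (hN : Function.Injective N) (hp : ∀ i, (N i).Prime) :
    Function.Injective fun U : Finset ι => ∏ i ∈ U, N i := by
  have h : ∀ U : Finset ι, (∏ i ∈ U, N i).primeFactors = U.image N := fun U => by
    rw [← prod_image_id hN U, Nat.primeFactors_prod]
    intro p h
    obtain ⟨i, -, rfl⟩ := mem_image.1 h
    exact hp i
  intro U V hUV
  have := congrArg Nat.primeFactors hUV
  simp only [h] at this
  exact image_injective hN this

lemma prod_one_add_rpow_le (hN : Function.Injective N) (hp : ∀ i, (N i).Prime) {η : ℝ}
    (hs : Summable (logWeight 0 η)) :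
    ∏ i, (1 + 1 / (N i : ℝ) ^ (1 + η)) ≤ ∑' n, logWeight 0 η n := by
  have h1 : ∏ i, (1 + 1 / (N i : ℝ) ^ (1 + η)) =
      ∑ U : Finset ι, logWeight 0 η (∏ i ∈ U, N i) := by
    rw [prod_one_add, powerset_univ]
    refine sum_congr rfl fun U _ => ?_
    rw [logWeight, pow_zero, Nat.cast_prod, ← Real.finsetProd_rpow _ _ fun i _ => Nat.cast_nonneg _]
    simp
  rw [h1, ← sum_image (f := logWeight 0 η) (g := fun U : Finset ι => ∏ i ∈ U, N i)
    fun U _ V _ h => prod_subset_injective hN hp h]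
  exact hs.sum_le_tsum _ fun n _ => logWeight_nonneg _ _ _

/-- A Mertens-type upper bound for a product over distinct primes. -/
lemma exists_prod_one_add_div_le : ∃ R₀ : ℕ, ∀ R : ℕ, R₀ ≤ R → ∀ (ι : Type) [Fintype ι]
    [DecidableEq ι] (N : ι → ℕ), Function.Injective N → (∀ i, (N i).Prime) → (∀ i, N i ≤ R) →
    ∀ C : ℕ, ∏ i, (1 + (C : ℝ) / N i) ≤ (2 * Real.log R) ^ (3 * C) := by
  obtain ⟨r, hr, h⟩ := exists_tsum_logWeight_le
  refine ⟨⌈Real.exp (1 / r)⌉₊, fun R hR ι _ _ N hN hp hNR C => ?_⟩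
  have hR1 : Real.exp (1 / r) ≤ R := (Nat.le_ceil _).trans (by exact_mod_cast hR)
  have hR0 : (0 : ℝ) < R := (Real.exp_pos _).trans_le hR1
  have hlog : 1 / r ≤ Real.log R := (Real.le_log_iff_exp_le hR0).2 hR1
  have hlog0 : 0 < Real.log R := (by positivity : 0 < 1 / r).trans_le hlog
  set η := 1 / Real.log R with hη
  have hη0 : 0 < η := by positivity
  obtain ⟨hs, hle⟩ := h η hη0 ((one_div_le hr hlog0).1 hlog) 0
  have hle' : ∑' n, logWeight 0 η n ≤ 2 * Real.log R := by
    simpa [hη] using hle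
  have hloc : ∀ i, 1 + (C : ℝ) / N i ≤ ((1 + 1 / (N i : ℝ) ^ (1 + η)) ^ 3) ^ C := by
    intro i
    have hp0 : (0 : ℝ) < N i := by exact_mod_cast (hp i).pos
    have h1 : 1 + 1 / (N i : ℝ) ≤ (1 + 1 / (N i : ℝ) ^ (1 + η)) ^ 3 := by
      have h2 : (N i : ℝ) ^ η ≤ 3 := by
        rw [Real.rpow_def_of_pos hp0]
        have : Real.log (N i) * η ≤ 1 := by
          rw [hη, mul_one_div, div_le_one hlog0]
          exact Real.log_le_log hp0 (by exact_mod_cast hNR i)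
        exact (Real.exp_le_exp.2 this).trans (by linarith [Real.exp_one_lt_d9])
      have h3 : 1 / (N i : ℝ) ≤ 3 * (1 / (N i : ℝ) ^ (1 + η)) := by
        rw [Real.rpow_add hp0, Real.rpow_one]
        have h4 : 0 < (N i : ℝ) ^ η := Real.rpow_pos_of_pos hp0 _
        rw [← mul_div_assoc, mul_one, div_le_div_iff₀ hp0 (by positivity)]
        nlinarith
      have h5 : 0 ≤ 1 / (N i : ℝ) ^ (1 + η) := by positivity
      nlinarith [pow_nonneg h5 2, pow_nonneg h5 3]
    calc 1 + (C : ℝ) / N i = 1 + C * (1 / (N i : ℝ)) := by rw [mul_one_div]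
      _ ≤ (1 + 1 / (N i : ℝ)) ^ C :=
          one_add_mul_le_pow (by have : 0 ≤ 1 / (N i : ℝ) := by positivity
                                 linarith) C
      _ ≤ _ := by gcongr
  calc ∏ i, (1 + (C : ℝ) / N i) ≤ ∏ i, ((1 + 1 / (N i : ℝ) ^ (1 + η)) ^ 3) ^ C :=
        prod_le_prod (fun i _ => by positivity) fun i _ => hloc i
    _ = (∏ i, (1 + 1 / (N i : ℝ) ^ (1 + η))) ^ (3 * C) := by
        rw [pow_mul, prod_pow, prod_pow]
    _ ≤ _ := by
        gcongr
        exact (prod_one_add_rpow_le hN hp hs).trans hle'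

end eulerProduct

section conductor

variable {ι : Type*} [Fintype ι] [DecidableEq ι] {N : ι → ℕ} [hN : ∀ i, Fact (N i).Prime]
  [∀ i, DecidableEq (DirichletCharacter ℂ (N i))]

/-- The places where a tuple of characters is nontrivial. -/
noncomputable def charSupp (χ : ∀ i, DirichletCharacter ℂ (N i)) : Finset ι := univ.filter fun i => χ i ≠ 1

/-- The conductor of a tuple of characters to distinct prime moduli. -/
noncomputable def charCond (χ : ∀ i, DirichletCharacter ℂ (N i)) : ℕ := ∏ i ∈ charSupp χ, N i

lemma mem_charSupp {χ : ∀ i, DirichletCharacter ℂ (N i)} {i : ι} : i ∈ charSupp χ ↔ χ i ≠ 1 := by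
  simp [charSupp]

lemma charSupp_nonempty {χ : ∀ i, DirichletCharacter ℂ (N i)} (h : χ ≠ 1) :
    (charSupp χ).Nonempty := by
  obtain ⟨i, hi⟩ := Function.ne_iff.1 h
  exact ⟨i, mem_charSupp.2 hi⟩

lemma one_le_charCond (χ : ∀ i, DirichletCharacter ℂ (N i)) : 1 ≤ charCond χ :=
  prod_pos fun i _ => (hN i).out.pos

lemma charCond_eq_prod (χ : ∀ i, DirichletCharacter ℂ (N i)) :
    charCond χ = ∏ i, if χ i = 1 then 1 else N i := by
  simp only [charCond, charSupp, prod_filter, ite_not]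

lemma card_charCond_le {Z : ℝ} :
    ((univ.filter fun χ : ∀ i, DirichletCharacter ℂ (N i) => (charCond χ : ℝ) ≤ Z).card : ℝ) ≤
      Z ^ 2 * ∏ i, (1 + 1 / (N i : ℝ)) := by
  have hpos : ∀ i, (0 : ℝ) < N i := fun i => by exact_mod_cast (hN i).out.pos
  calc _ ≤ ∑ χ ∈ univ.filter (fun χ : ∀ i, DirichletCharacter ℂ (N i) => (charCond χ : ℝ) ≤ Z),
        Z ^ 2 * (1 / (charCond χ : ℝ) ^ 2) := by
        rw [card_eq_sum_ones, Nat.cast_sum]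
        refine sum_le_sum fun χ hχ => ?_
        have h1 : (1 : ℝ) ≤ charCond χ := by exact_mod_cast one_le_charCond χ
        rw [mul_one_div, Nat.cast_one, one_le_div (by positivity)]
        exact pow_le_pow_left₀ (by linarith) (mem_filter.1 hχ).2 2
    _ ≤ ∑ χ : ∀ i, DirichletCharacter ℂ (N i), Z ^ 2 * (1 / (charCond χ : ℝ) ^ 2) :=
        sum_le_sum_of_subset_of_nonneg (filter_subset _ _) fun _ _ _ => by positivity
    _ = Z ^ 2 * ∏ i, ∑ χ : DirichletCharacter ℂ (N i), 1 / (if χ = 1 then 1 else (N i : ℝ)) ^ 2 := by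
        rw [← mul_sum, Finset.prod_univ_sum, Fintype.piFinset_univ]
        congr 1
        refine sum_congr rfl fun χ _ => ?_
        rw [charCond_eq_prod, prod_div_distrib, prod_pow, prod_const_one]
        push_cast
        rfl
    _ ≤ _ := by
        refine mul_le_mul_of_nonneg_left (prod_le_prod (fun i _ => sum_nonneg fun _ _ => by positivity)
          fun i _ => ?_) (sq_nonneg Z)
        rw [← add_sum_erase univ _ (mem_univ 1), if_pos rfl, one_pow, div_one]
        gcongr
        calc _ ≤ ∑ _χ ∈ univ.erase (1 : DirichletCharacter ℂ (N i)), 1 / (N i : ℝ) ^ 2 :=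
              sum_le_sum fun χ hχ => by rw [if_neg (ne_of_mem_erase hχ)]
          _ ≤ ∑ _χ : DirichletCharacter ℂ (N i), 1 / (N i : ℝ) ^ 2 :=
              sum_le_sum_of_subset_of_nonneg (erase_subset _ _) fun _ _ _ => by positivity
          _ ≤ N i * (1 / (N i : ℝ) ^ 2) := by
              rw [sum_const, nsmul_eq_mul, card_univ, ← Nat.card_eq_fintype_card,
                DirichletCharacter.card_eq_totient_of_hasEnoughRootsOfUnity]
              gcongr
              exact Nat.totient_le _
          _ = _ := by have := hpos i; field_simp

lemma prod_ite_add_div_le {C : ℝ} (hC : 0 ≤ C) (hCN : ∀ i, C ^ 2 ≤ N i)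
    (χ : ∀ i, DirichletCharacter ℂ (N i)) :
    ∏ i, ((if χ i = 1 then 1 else 0) + C / N i) ≤
      (∏ i, (1 + C / N i)) / √(charCond χ) := by
  have hpos : ∀ i, (0 : ℝ) < N i := fun i => by exact_mod_cast (hN i).out.pos
  have hs : √(charCond χ : ℝ) = ∏ i, √(if χ i = 1 then 1 else (N i : ℝ)) := by
    rw [charCond_eq_prod]
    push_cast
    exact Real.sqrt_prod _ fun i _ => by split_ifs <;> positivity
  rw [hs, ← prod_div_distrib]
  refine prod_le_prod (fun i _ => by have := hpos i; split_ifs <;> positivity) fun i _ => ?_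
  split_ifs with h
  · simp
  · have h1 := hpos i
    have h2 : C ≤ √(N i : ℝ) := Real.le_sqrt_of_sq_le (hCN i)
    have h3 : 0 < √(N i : ℝ) := Real.sqrt_pos.2 h1
    rw [zero_add, div_le_div_iff₀ h1 h3]
    have h4 : √(N i : ℝ) * √(N i : ℝ) = N i := Real.mul_self_sqrt h1.le
    have h5 : C * √(N i : ℝ) ≤ N i := by nlinarith
    have h6 : (1 + C / N i) * N i = N i + C := by field_simp
    linarith

end conductor

end

section

open Finset Filter Topology
open scoped ArithmeticFunction.vonMangoldt Nat

section characterSums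

variable {Q : ℕ} [Nontrivial (ZMod Q)]

lemma factorial_succ_div_le (K : ℕ) {η : ℝ} (hη : 0 < η) :
    ((K + 1)! : ℝ) / (3 * η) ^ (K + 1) ≤ (K + 1) * Real.exp (-(K : ℕ)) * (K ! / η ^ (K + 1)) := by
  have h3 : Real.exp (K : ℕ) ≤ 3 ^ (K + 1) := by
    calc Real.exp (K : ℕ) = Real.exp 1 ^ K := by rw [← Real.exp_nat_mul, mul_one]
      _ ≤ 3 ^ K := by gcongr; linarith [Real.exp_one_lt_d9]
      _ ≤ 3 ^ (K + 1) := pow_le_pow_right₀ (by norm_num) (Nat.le_succ K)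
  rw [Nat.factorial_succ, mul_pow, Real.exp_neg]
  push_cast
  calc ((K : ℝ) + 1) * K ! / (3 ^ (K + 1) * η ^ (K + 1))
      = (K + 1) * (3 ^ (K + 1))⁻¹ * (K ! / η ^ (K + 1)) := by field_simp
    _ ≤ _ := by gcongr

/-- Prime sums twisted by characters of small conductor are small unless the modulus is divisible by
an exceptional number. -/
lemma eventually_norm_sum_twist_primeWindow_le (A B : ℕ) (hQ : 1 ≤ Q) : ∀ᶠ l : ℕ in atTop,
    ∃ p₁, 2 ≤ p₁ ∧ ∀ (ξ : DirichletCharacter ℂ Q) (S : Finset ℕ)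
      (c : ∀ p : ℕ, DirichletCharacter ℂ p), S.Nonempty → GoodSupport Q S → (∀ p ∈ S, c p ≠ 1) →
      ((∏ p ∈ S, p : ℕ) : ℝ) ≤ Real.exp (B * l) → p₁ ∉ S →
      ‖∑ m ∈ primeWindow (lowEnd l) (highEnd l),
        (logWeight (A * l) (decay A l) m : ℂ) * (Λ m * twist ξ S c m)‖ ≤
        2 * Real.exp l ^ 3 * Real.exp (-(A * l : ℕ)) * mainSize A l := by
  filter_upwards [eventually_exists_exceptional A B hQ, eventually_zero_free_params A B hQ,
    eventually_linear_le_exp A, eventually_norm_sum_primeWindow_sub_tsum_le A]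
    with l ⟨p₁, hp₁, hz⟩ ⟨h1, h2, _, h4⟩ hK htail
  refine ⟨p₁, hp₁, fun ξ S c hne hS hc hZ hpS => ?_⟩
  have hη : 0 < decay A l := decay_pos A l
  set N : ℝ := (Q * Real.exp (2 * (B + 1) * l) : ℝ) with hN
  have hf1 := norm_twist_le_one ξ S c
  have hsum : ∀ n, ‖∑ i ∈ Ioc 0 n, twist ξ S c i‖ ≤ N := by
    intro n
    obtain ⟨p, hp⟩ := hne
    refine (norm_sum_twist_le hQ hS ξ c ⟨p, hp, hc p hp⟩ n).trans ?_
    rw [Nat.cast_mul, hN]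
    refine mul_le_mul_of_nonneg_left (hZ.trans (Real.exp_le_exp.2 ?_)) (Nat.cast_nonneg Q)
    have : (0 : ℝ) ≤ B * l := by positivity
    have : (0 : ℝ) ≤ l := by positivity
    nlinarith
  have hL := norm_LSeries_log_pow_vonMangoldt_le hf1 h1 hsum hη h2 (hz ξ S c hne hS hc hZ hpS) (A * l)
  have hab := abscissaOfAbsConv_vonMangoldt_mul_le_one hf1
  have hT := htail (fun m => (Λ m : ℂ) * twist ξ S c m) (fun n => by
    rw [norm_mul, Complex.norm_real, Real.norm_of_nonneg ArithmeticFunction.vonMangoldt_nonneg]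
    exact mul_le_of_le_one_right ArithmeticFunction.vonMangoldt_nonneg (hf1 n))
    (summable_logWeight_mul hab _ hη)
  have hLS : LSeries (fun m => (Real.log m : ℂ) ^ (A * l) * ((Λ m : ℂ) * twist ξ S c m))
      ((1 + decay A l : ℝ) : ℂ) =
      ∑' m, (logWeight (A * l) (decay A l) m : ℂ) * ((Λ m : ℂ) * twist ξ S c m) :=
    tsum_congr fun m => LSeries_term_logWeight _ _ _ hη m
  rw [hLS] at hL
  have hm := mainSize_pos A l
  have hfac := factorial_succ_div_le (A * l) hη
  have hE := Real.exp_pos (-(A * l : ℕ) : ℝ)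
  have hel : 1 ≤ Real.exp l := Real.one_le_exp (Nat.cast_nonneg l)
  have hmain : ‖∑' m, (logWeight (A * l) (decay A l) m : ℂ) * ((Λ m : ℂ) * twist ξ S c m)‖ ≤
      Real.exp l ^ 3 * Real.exp (-(A * l : ℕ)) * mainSize A l := by
    refine hL.trans ?_
    rw [mul_div_right_comm]
    have hK' : ((A * l : ℕ) + 1 : ℝ) ≤ Real.exp l := by
      have : (0 : ℝ) ≤ (A * l : ℕ) := Nat.cast_nonneg _
      linarith
    calc _ ≤ (((A * l : ℕ) + 1) * Real.exp (-(A * l : ℕ)) * mainSize A l) * Real.exp l := by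
          refine mul_le_mul hfac h4 ?_ (by positivity)
          refine mul_nonneg (by norm_num) (Real.log_nonneg ?_)
          have h5 : decay A l ≤ 1 := by
            have h6 : 1 / (2 * Real.log N) ≤ 1 := by
              rw [div_le_one (by linarith)]; linarith
            linarith
          rw [one_le_div (by positivity)]
          have h7 : decay A l ^ 2 ≤ 1 := pow_le_one₀ hη.le h5
          have h8 := one_le_lConst
          have h9 : 1 ≤ lConst * Real.log N := by nlinarith
          linarith
      _ ≤ (Real.exp l * Real.exp (-(A * l : ℕ)) * mainSize A l) * Real.exp l := by gcongr
      _ = Real.exp l ^ 2 * Real.exp (-(A * l : ℕ)) * mainSize A l := by ring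
      _ ≤ _ := by gcongr; norm_num
  calc _ = ‖(∑ m ∈ primeWindow (lowEnd l) (highEnd l),
        (logWeight (A * l) (decay A l) m : ℂ) * (Λ m * twist ξ S c m) - 
        ∑' m, (logWeight (A * l) (decay A l) m : ℂ) * ((Λ m : ℂ) * twist ξ S c m)) +
        ∑' m, (logWeight (A * l) (decay A l) m : ℂ) * ((Λ m : ℂ) * twist ξ S c m)‖ := by
        rw [sub_add_cancel]
    _ ≤ _ := norm_add_le _ _
    _ ≤ _ := add_le_add hT hmain
    _ = _ := by ring

end characterSums

end

section

open Finset Filter Topology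
open scoped ArithmeticFunction.vonMangoldt Nat

section largeConductor

/-- The level of the sieve. -/
noncomputable def sieveLevel (l : ℕ) : ℕ := ⌊Real.exp (Real.exp l / 1000)⌋₊

lemma log_sieveLevel_le (l : ℕ) : Real.log (sieveLevel l) ≤ Real.exp l / 1000 := by
  have h1 : (1 : ℝ) ≤ Real.exp (Real.exp l / 1000) := Real.one_le_exp (by positivity)
  have h2 : 1 ≤ sieveLevel l := Nat.le_floor (by simpa using h1)
  refine (Real.log_le_iff_le_exp (by exact_mod_cast h2)).2 ?_
  exact Nat.floor_le (Real.exp_pos _).le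

lemma eventually_sieveLevel (n Q : ℕ) : ∀ᶠ l : ℕ in atTop, n ≤ sieveLevel l ∧
    Real.exp (3 * l) ≤ sieveLevel l ∧ (Q * sieveLevel l ^ 5) ^ 8 ≤ lowEnd l ∧
    2 ≤ lowEnd l ∧ Q + sieveLevel l + 1 ≤ lowEnd l := by
  filter_upwards [eventually_mul_pow_le_exp 4000 1, eventually_ge_atTop (2 * Q ^ 8 + n + 1),
    eventually_ge_atTop (2 * Q + 5)] with l h1 h2 h5
  have hl0 : (0 : ℝ) ≤ l := Nat.cast_nonneg l
  have h3 : (l : ℝ) + 1 ≤ Real.exp l := Real.add_one_le_exp _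
  have h2' : (2 * Q ^ 8 + n + 1 : ℝ) ≤ l := by exact_mod_cast h2
  have h5' : (2 * Q + 5 : ℝ) ≤ l := by exact_mod_cast h5
  rw [pow_one] at h1
  have hfl : Real.exp (Real.exp l / 1000) < sieveLevel l + 1 := Nat.lt_floor_add_one _
  have hfl' : (sieveLevel l : ℝ) ≤ Real.exp (Real.exp l / 1000) := Nat.floor_le (Real.exp_pos _).le
  have hlow : Real.exp (Real.exp l / 8) < lowEnd l + 1 := Nat.lt_floor_add_one _
  have h4 : Real.exp (3 * l) + 1 ≤ Real.exp (Real.exp l / 1000) := by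
    calc _ ≤ Real.exp (3 * l) * 2 := by
          have := Real.one_le_exp (by positivity : 0 ≤ 3 * (l : ℝ)); linarith
      _ ≤ Real.exp (3 * l) * Real.exp 1 := by
          gcongr; linarith [Real.exp_one_gt_d9]
      _ = Real.exp (3 * l + 1) := by rw [Real.exp_add]
      _ ≤ _ := Real.exp_le_exp.2 (by linarith)
  have h6 : Real.exp (3 * l) ≤ sieveLevel l := by linarith
  have h7 : (l : ℝ) + 1 ≤ Real.exp (3 * l) := by
    linarith [Real.add_one_le_exp (3 * (l : ℝ))]
  have h8 : (((Q * sieveLevel l ^ 5) ^ 8 : ℕ) : ℝ) + 1 ≤ Real.exp (Real.exp l / 8) := by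
    push_cast
    calc ((Q : ℝ) * (sieveLevel l : ℝ) ^ 5) ^ 8 + 1 = (Q : ℝ) ^ 8 * (sieveLevel l : ℝ) ^ 40 + 1 := by ring
      _ ≤ (Q : ℝ) ^ 8 * Real.exp (Real.exp l / 1000) ^ 40 + Real.exp (Real.exp l / 1000) ^ 40 := by
          gcongr; exact one_le_pow₀ (Real.one_le_exp (by positivity))
      _ = ((Q : ℝ) ^ 8 + 1) * Real.exp (Real.exp l / 25) := by
          rw [← Real.exp_nat_mul]; push_cast; ring_nf
      _ ≤ Real.exp l * Real.exp (Real.exp l / 25) := by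
          gcongr; have := pow_nonneg (Nat.cast_nonneg (α := ℝ) Q) 8; nlinarith
      _ = Real.exp (l + Real.exp l / 25) := by rw [Real.exp_add]
      _ ≤ _ := Real.exp_le_exp.2 (by linarith)
  have h9 : ((Q * sieveLevel l ^ 5) ^ 8 : ℕ) ≤ lowEnd l := by
    exact_mod_cast (by linarith : (((Q * sieveLevel l ^ 5) ^ 8 : ℕ) : ℝ) ≤ lowEnd l)
  have h10 : (Q : ℝ) + sieveLevel l + 2 ≤ Real.exp (Real.exp l / 8) := by
    calc (Q : ℝ) + sieveLevel l + 2 ≤ l * sieveLevel l := by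
          have h11 : (1 : ℝ) ≤ sieveLevel l := by linarith
          have : (2 * Q + 5 : ℝ) * sieveLevel l ≤ l * sieveLevel l := by gcongr
          nlinarith [Nat.cast_nonneg (α := ℝ) Q]
      _ ≤ Real.exp l * Real.exp (Real.exp l / 1000) := by gcongr; linarith
      _ = Real.exp (l + Real.exp l / 1000) := by rw [Real.exp_add]
      _ ≤ _ := Real.exp_le_exp.2 (by linarith)
  have h12 : Q + sieveLevel l + 1 ≤ lowEnd l := by
    exact_mod_cast (by linarith : (Q : ℝ) + sieveLevel l + 1 ≤ lowEnd l)
  have h13 : n ≤ sieveLevel l := by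
    have : (n : ℝ) ≤ sieveLevel l := by
      have := pow_nonneg (Nat.cast_nonneg (α := ℝ) Q) 8
      linarith
    exact_mod_cast this
  refine ⟨h13, h6, h9, ?_, h12⟩
  have : 1 ≤ sieveLevel l := by
    have : (1 : ℝ) ≤ sieveLevel l := by linarith
    exact_mod_cast this
  omega

variable {Q : ℕ} [Nontrivial (ZMod Q)]

lemma goodSupport_image {ι : Type*} [DecidableEq ι] {N : ι → ℕ} (hp : ∀ i, (N i).Prime)
    (hc : ∀ i, Q.Coprime (N i)) (U : Finset ι) : GoodSupport Q (U.image N) := by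
  intro p h
  obtain ⟨i, -, rfl⟩ := mem_image.1 h
  exact ⟨hp i, hc i⟩

/-- The average of prime sums twisted by characters of conductor at most the square of the level. -/
lemma eventually_sum_norm_twist_primeWindow_le (A : ℕ) (hQ : 1 ≤ Q) : ∀ᶠ l : ℕ in atTop,
    ∀ (ι : Type) [Fintype ι] [DecidableEq ι] (N : ι → ℕ) [∀ i, Fact (N i).Prime]
      [∀ i, DecidableEq (DirichletCharacter ℂ (N i))] [DecidableEq (DirichletCharacter ℂ Q)]
      (c : (∀ i, DirichletCharacter ℂ (N i)) → ∀ p : ℕ, DirichletCharacter ℂ p),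
      Function.Injective N → (∀ i, N i ≤ sieveLevel l) → (∀ i, Q.Coprime (N i)) →
      (∀ χ i, c χ (N i) = χ i) →
      ∑ ξ : DirichletCharacter ℂ Q, ∑ χ ∈ univ.filter (fun χ : ∀ i, DirichletCharacter ℂ (N i) =>
        χ ≠ 1 ∧ charCond χ ≤ sieveLevel l ^ 2),
        ‖∑ m ∈ primeWindow (lowEnd l) (highEnd l), (logWeight (A * l) (decay A l) m : ℂ) *
          (Λ m * twist ξ ((charSupp χ).image N) (c χ) m)‖ ≤ Real.exp l ^ 6 * mainSize A l := by
  obtain ⟨R₀, hR₀⟩ := exists_prod_one_add_div_le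
  filter_upwards [eventually_sum_norm_primeWindow_le A, eventually_sieveLevel (max 1 R₀) Q]
    with l hl ⟨hn, h3l, hD, h2, _⟩ ι _ _ N hprime _ _ c hN hNR hcop hc
  set R := sieveLevel l with hR
  have hp : ∀ i, (N i).Prime := fun i => (hprime i).out
  have hR1 : 1 ≤ R := (le_max_left _ _).trans hn
  set X := univ.filter (fun χ : ∀ i, DirichletCharacter ℂ (N i) => χ ≠ 1 ∧ charCond χ ≤ R ^ 2)
    with hX
  have : NeZero Q := ⟨by omega⟩
  have hgood : ∀ U : Finset ι, GoodSupport Q (U.image N) := goodSupport_image hp hcop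
  have hcond : ∀ χ : ∀ i, DirichletCharacter ℂ (N i),
      ∏ p ∈ (charSupp χ).image N, p = charCond χ := fun χ => prod_image_id hN _
  have hmem : ∀ (χ : ∀ i, DirichletCharacter ℂ (N i)) i, N i ∈ (charSupp χ).image N ↔ χ i ≠ 1 := by
    intro χ i
    rw [hN.mem_finset_image, mem_charSupp]
  have hcard : (Fintype.card (DirichletCharacter ℂ Q × X) : ℝ) ≤ (Q * R ^ 5 : ℕ) := by
    rw [Fintype.card_prod, Fintype.card_coe, ← Nat.card_eq_fintype_card,
      DirichletCharacter.card_eq_totient_of_hasEnoughRootsOfUnity]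
    have h1 : (X.card : ℝ) ≤ ((R : ℝ) ^ 2) ^ 2 * ∏ i, (1 + 1 / (N i : ℝ)) := by
      refine le_trans ?_ (card_charCond_le (N := N) (Z := (R : ℝ) ^ 2))
      refine Nat.cast_le.2 (card_le_card fun χ hχ => ?_)
      simp only [hX, mem_filter, mem_univ, true_and] at hχ ⊢
      exact_mod_cast hχ.2
    have h4 : ∏ i, (1 + 1 / (N i : ℝ)) ≤ R := by
      have h5 := hR₀ R ((le_max_right _ _).trans hn) ι N hN hp hNR 1
      simp only [Nat.cast_one, mul_one] at h5
      refine h5.trans (le_trans ?_ h3l)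
      have h6 : 2 * Real.log R ≤ Real.exp l := by
        have := log_sieveLevel_le l
        have := Real.exp_pos l
        linarith
      calc (2 * Real.log R) ^ 3 ≤ Real.exp l ^ 3 :=
            pow_le_pow_left₀ (mul_nonneg two_pos.le (Real.log_natCast_nonneg R)) h6 3
        _ = _ := by rw [← Real.exp_nat_mul]; norm_num
    push_cast
    have h7 : ((Q.totient : ℕ) : ℝ) ≤ Q := by exact_mod_cast Nat.totient_le Q
    calc (Q.totient : ℝ) * X.card ≤ Q * (((R : ℝ) ^ 2) ^ 2 * R) := by
          refine mul_le_mul h7 (h1.trans ?_) (Nat.cast_nonneg _) (Nat.cast_nonneg _)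
          gcongr
      _ = _ := by ring
  have hXR : ∀ χ : X, charCond χ.1 ≤ R ^ 2 := fun χ => (mem_filter.1 χ.2).2.2
  have key := hl (DirichletCharacter ℂ Q × X)
    (fun x => (twist x.1 ((charSupp x.2.1).image N) (c x.2.1) : ℕ →* ℂ)) (Q * R ^ 5)
    (fun x n => norm_twist_le_one _ _ _ n) (Nat.mul_pos hQ (pow_pos hR1 5)) (by exact_mod_cast hcard)
    ?_ ?_ hD
  · refine le_trans (le_of_eq ?_) key
    rw [Fintype.sum_prod_type]
    refine sum_congr rfl fun ξ _ => ?_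
    rw [← sum_coe_sort X]
    rfl
  · rintro ⟨ξ, χ⟩ y
    obtain ⟨i, hi⟩ := charSupp_nonempty (mem_filter.1 χ.2).2.1
    refine (norm_sum_twist_le hQ (hgood _) ξ (c χ.1)
      ⟨N i, mem_image_of_mem N hi, by rw [hc]; exact mem_charSupp.1 hi⟩ y).trans ?_
    rw [hcond]
    refine Nat.cast_le.2 (Nat.mul_le_mul le_rfl ((hXR χ).trans (pow_le_pow_right₀ hR1 (by norm_num))))
  · rintro ⟨ξ, χ⟩ ⟨ξ', χ'⟩ hne y
    have hconj : ∀ n : ℕ, starRingEnd ℂ (twist ξ' ((charSupp χ'.1).image N) (c χ'.1) n) = _ :=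
      conj_twist hQ (hgood _) ξ' (c χ'.1)
    have hsum := norm_sum_twist_mul_twist_le hQ (hgood (charSupp χ.1)) (hgood (charSupp χ'.1)) ξ ξ'⁻¹
      (c χ.1) (fun p => (c χ'.1 p)⁻¹) ?_ y
    · refine le_trans (le_of_eq (congrArg _ (sum_congr rfl fun n _ => ?_))) (hsum.trans ?_)
      · rw [← hconj n]; rfl
      · rw [hcond, hcond]
        refine Nat.cast_le.2 (Nat.mul_le_mul le_rfl ?_)
        calc _ ≤ R ^ 2 * R ^ 2 := Nat.mul_le_mul (hXR χ) (hXR χ')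
          _ = R ^ 4 := by ring
          _ ≤ _ := pow_le_pow_right₀ hR1 (by norm_num)
    · by_cases hξ : ξ = ξ'
      · right
        have hχ : χ.1 ≠ χ'.1 := fun h => hne (by rw [hξ, Subtype.ext h])
        obtain ⟨i, hi⟩ := Function.ne_iff.1 hχ
        by_cases h1 : χ.1 i = 1
        · right; left
          have h1' : χ'.1 i ≠ 1 := fun h => hi (h1.trans h.symm)
          exact ⟨N i, (hmem _ i).2 h1', fun h => (hmem _ i).1 h h1, by rw [hc]; exact inv_ne_one.2 h1'⟩
        · by_cases h2 : χ'.1 i = 1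
          · left
            exact ⟨N i, (hmem _ i).2 h1, fun h => (hmem _ i).1 h h2, by rw [hc]; exact h1⟩
          · right; right
            refine ⟨N i, (hmem _ i).2 h1, (hmem _ i).2 h2, ?_⟩
            rw [hc, hc]
            exact fun h => hi (mul_inv_eq_one.1 h)
      · left
        exact fun h => hξ (mul_inv_eq_one.1 h)

end largeConductor

end

section

open Finset Filter Topology
open scoped ArithmeticFunction.vonMangoldt Nat

section equidistribution

variable {Q : ℕ} [Nontrivial (ZMod Q)]

lemma twist_image_eq {ι : Type*} [Fintype ι] [DecidableEq ι] {N : ι → ℕ}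
    [hp : ∀ i, Fact (N i).Prime] [∀ i, DecidableEq (DirichletCharacter ℂ (N i))]
    (hN : Function.Injective N) (ξ : DirichletCharacter ℂ Q)
    (χ : ∀ i, DirichletCharacter ℂ (N i)) {c : ∀ p : ℕ, DirichletCharacter ℂ p}
    (hc : ∀ i, c (N i) = χ i) {m : ℕ} (hm : ∀ i, m.Coprime (N i)) :
    twist ξ ((charSupp χ).image N) c m = ξ m * ∏ i, χ i m := by
  rw [twist_apply, prod_image fun _ _ _ _ h => hN h]
  congr 1
  rw [← prod_subset (subset_univ (charSupp χ)) (f := fun i => χ i (m : ZMod (N i)))]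
  · exact prod_congr rfl fun i _ => by rw [hc]
  · intro i _ hi
    rw [mem_charSupp, not_not] at hi
    rw [hi, MulChar.one_apply ((ZMod.isUnit_iff_coprime _ _).2 (hm i))]

lemma sum_window_sieveSum_eq [NeZero Q] {ι : Type*} [Fintype ι] [DecidableEq ι] {N : ι → ℕ}
    [hp : ∀ i, Fact (N i).Prime] [∀ i, DecidableEq (DirichletCharacter ℂ (N i))]
    [DecidableEq (DirichletCharacter ℂ Q)]
    (hN : Function.Injective N) {k : ℕ} (pt : ∀ i, Fin k → ZMod (N i))
    (a : (ι → Option (Fin k)) → ℝ) (h₀ : ZMod Q → ℂ)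
    {c : (∀ i, DirichletCharacter ℂ (N i)) → ∀ p : ℕ, DirichletCharacter ℂ p}
    (hc : ∀ χ i, c χ (N i) = χ i) (W : Finset ℕ) (v w : ℕ → ℂ)
    (hW : ∀ m ∈ W, m.Coprime Q ∧ ∀ i, m.Coprime (N i)) :
    ∑ m ∈ W, v m * (w m * (h₀ m * ((sieveSum pt a m ^ 2 : ℝ) : ℂ))) =
      ∑ χ, squareCoeff pt a χ * ∑ ξ : DirichletCharacter ℂ Q, unitCoeff h₀ ξ *
        ∑ m ∈ W, v m * (w m * twist ξ ((charSupp χ).image N) (c χ) m) := by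
  have h1 : ∀ χ : ∀ i, DirichletCharacter ℂ (N i), ∑ ξ : DirichletCharacter ℂ Q, unitCoeff h₀ ξ *
      ∑ m ∈ W, v m * (w m * twist ξ ((charSupp χ).image N) (c χ) m) =
      ∑ m ∈ W, v m * (w m * (h₀ m * ∏ i, χ i m)) := by
    intro χ
    simp_rw [mul_sum]
    rw [sum_comm]
    refine sum_congr rfl fun m hm => ?_
    rw [← sum_unitCoeff_mul h₀ ((ZMod.isUnit_iff_coprime _ _).2 (hW m hm).1), sum_mul, mul_sum,
      mul_sum]
    refine sum_congr rfl fun ξ _ => ?_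
    rw [twist_image_eq hN ξ χ (hc χ) (hW m hm).2]
    ring
  simp_rw [h1, mul_sum]
  rw [sum_comm]
  refine sum_congr rfl fun m hm => ?_
  rw [← sum_squareCoeff_mul pt a (hW m hm).2, mul_sum, mul_sum, mul_sum]
  exact sum_congr rfl fun χ _ => by ring

lemma sum_window_one_eq [NeZero Q] {ι : Type*} [Fintype ι] [DecidableEq ι] {N : ι → ℕ}
    [∀ i, Fact (N i).Prime] [∀ i, DecidableEq (DirichletCharacter ℂ (N i))]
    (h₀ : ZMod Q → ℂ) (c : ∀ p : ℕ, DirichletCharacter ℂ p) (W : Finset ℕ) (v w : ℕ → ℂ)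
    (hW : ∀ m ∈ W, m.Coprime Q) :
    ∑ ξ : DirichletCharacter ℂ Q, unitCoeff h₀ ξ * ∑ m ∈ W, v m * (w m *
      twist ξ ((charSupp (1 : ∀ i, DirichletCharacter ℂ (N i))).image N) c m) =
      ∑ m ∈ W, v m * (w m * h₀ m) := by
  have h0 : charSupp (1 : ∀ i, DirichletCharacter ℂ (N i)) = ∅ := by simp [charSupp]
  simp_rw [h0, image_empty, twist_apply, prod_empty, mul_one, mul_sum]
  rw [sum_comm]
  refine sum_congr rfl fun m hm => ?_
  rw [← sum_unitCoeff_mul h₀ ((ZMod.isUnit_iff_coprime _ _).2 (hW m hm)), mul_sum, mul_sum]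
  exact sum_congr rfl fun ξ _ => by ring

/-- Combining a pointwise bound at small conductors and an averaged bound at all conductors. -/
lemma sum_mul_le_of_split {α β : Type*} [Fintype α] [Fintype β] (X Y S : Finset β)
    (f : β → ℝ) (t : α → β → ℝ) {c₁ c₂ δ M : ℝ} (ht : ∀ ξ χ, 0 ≤ t ξ χ)
    (hδ : 0 ≤ δ) (hc₁ : 0 ≤ c₁) (hc₂ : 0 ≤ c₂)
    (hf1 : ∀ χ, f χ ≤ c₁) (hf2 : ∀ χ ∈ X, χ ∉ S → f χ ≤ c₂) (hf3 : ∀ χ ∈ X, χ ∉ Y → f χ = 0)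
    (hYX : Y ⊆ X)
    (ht1 : ∀ ξ, ∀ χ ∈ X, χ ∈ S → t ξ χ ≤ δ) (ht2 : ∑ ξ, ∑ χ ∈ Y, t ξ χ ≤ M) :
    ∑ χ ∈ X, f χ * ∑ ξ, t ξ χ ≤ S.card * (Fintype.card α * (c₁ * δ)) + c₂ * M := by
  classical
  have h1 : ∀ χ ∈ X, f χ * ∑ ξ, t ξ χ ≤ (if χ ∈ S then Fintype.card α * (c₁ * δ) else 0) +
      if χ ∈ Y then c₂ * ∑ ξ, t ξ χ else 0 := by
    intro χ hχ
    have ht0 : 0 ≤ ∑ ξ, t ξ χ := sum_nonneg fun ξ _ => ht ξ χ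
    have h2 : 0 ≤ if χ ∈ Y then c₂ * ∑ ξ, t ξ χ else 0 := by
      split_ifs
      · exact mul_nonneg hc₂ ht0
      · exact le_rfl
    by_cases hS : χ ∈ S
    · rw [if_pos hS]
      have h3 : ∑ ξ, t ξ χ ≤ Fintype.card α * δ :=
        (sum_le_card_nsmul _ _ δ fun ξ _ => ht1 ξ χ hχ hS).trans (by simp)
      have h4 : f χ * ∑ ξ, t ξ χ ≤ c₁ * (Fintype.card α * δ) := mul_le_mul (hf1 χ) h3 ht0 hc₁
      linarith
    · rw [if_neg hS, zero_add]
      split_ifs with hY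
      · exact mul_le_mul_of_nonneg_right (hf2 χ hχ hS) ht0
      · rw [hf3 χ hχ hY, zero_mul]
  refine (sum_le_sum h1).trans ?_
  rw [sum_add_distrib]
  refine add_le_add ?_ ?_
  · rw [← sum_filter, sum_const, nsmul_eq_mul]
    refine mul_le_mul_of_nonneg_right (Nat.cast_le.2 (card_le_card fun χ hχ => (mem_filter.1 hχ).2)) ?_
    positivity
  · rw [← sum_filter, ← mul_sum, sum_comm]
    refine mul_le_mul_of_nonneg_left (le_trans (le_of_eq ?_) ht2) hc₂
    have : X.filter (fun χ => χ ∈ Y) = Y := by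
      ext χ; simp only [mem_filter]; exact ⟨fun h => h.2, fun h => ⟨hYX h, h⟩⟩
    rw [this, sum_comm]

/-- The squared sieve weight is well distributed over the primes, once an exceptional prime has been
removed from the moduli of the sieve. -/
theorem exists_equidistribution [NeZero Q] (k : ℕ) : ∃ A : ℕ, 4 ≤ A ∧ ∀ᶠ l : ℕ in atTop,
    ∃ p₁, 2 ≤ p₁ ∧ ∀ (ι : Type) [Fintype ι] [DecidableEq ι] (N : ι → ℕ)
      [∀ i, Fact (N i).Prime], Function.Injective N → (∀ i, N i ≤ sieveLevel l) →
      (∀ i, Q.Coprime (N i)) → (∀ i, N i ≠ p₁) → (∀ i, (6 * k ^ 2) ^ 2 ≤ N i) →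
      ∀ (a : (ι → Option (Fin k)) → ℝ),
      (∀ ρ, |a ρ| ≤ 2 ^ k * ∏ i, (ρ i).elim 1 fun _ => 1 / (N i : ℝ)) →
      (∀ ρ, a ρ ≠ 0 → ∏ i ∈ univ.filter (fun i => ρ i ≠ none), N i ≤ sieveLevel l) →
      ∀ (pt : ∀ i, Fin k → ZMod (N i)) (h₀ : ZMod Q → ℂ), (∀ t, ‖h₀ t‖ ≤ 1) →
      ‖∑ m ∈ primeWindow (lowEnd l) (highEnd l), (logWeight (A * l) (decay A l) m : ℂ) *
          (Λ m * (h₀ m * ((sieveSum pt a m ^ 2 : ℝ) : ℂ))) -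
        ((prodExpect (fun i => punctured (0 : ZMod (N i))) fun x =>
          localSum (fun i => sieveLocal (pt i)) a x * localSum (fun i => sieveLocal (pt i)) a x : ℝ) :
          ℂ) * ∑ m ∈ primeWindow (lowEnd l) (highEnd l), (logWeight (A * l) (decay A l) m : ℂ) *
          (Λ m * h₀ m)‖ ≤ mainSize A l * Real.exp (-l) := by
  classical
  obtain ⟨R₀, hR₀⟩ := exists_prod_one_add_div_le
  set C := 6 * k ^ 2 with hC
  set B := 2 * (3 * C + 8) with hB
  refine ⟨3 * C + 2 * B + 10, by omega, ?_⟩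
  set A := 3 * C + 2 * B + 10 with hA
  have hQ : 1 ≤ Q := NeZero.one_le
  have hc0 : (0 : ℝ) < 1 / (4 * 4 ^ k * Q) := by
    have : (0 : ℝ) < Q := by exact_mod_cast hQ
    positivity
  filter_upwards [eventually_norm_sum_twist_primeWindow_le A B hQ,
    eventually_sum_norm_twist_primeWindow_le A hQ, eventually_sieveLevel (max 1 R₀) Q,
    eventually_exp_neg_le hc0] with l ⟨p₁, hp₁, hsmall⟩ hlarge ⟨hn, h3l, hD, h2, hlow⟩ hl
  refine ⟨p₁, hp₁, fun ι _ _ N hprime hN hNR hcop hNp hNC a ha1 ha2 pt h₀ hh => ?_⟩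
  set R := sieveLevel l with hR
  have hp : ∀ i, (N i).Prime := fun i => (hprime i).out
  choose c hc using fun χ : ∀ i, DirichletCharacter ℂ (N i) =>
    exists_forall_extend_eq (β := fun n => DirichletCharacter ℂ n) hN χ
  have hmain := mainSize_pos A l
  have hW : ∀ m ∈ primeWindow (lowEnd l) (highEnd l), m.Coprime Q ∧ ∀ i, m.Coprime (N i) := by
    intro m hm
    obtain ⟨hm1, hm2⟩ := mem_filter.1 hm
    have hm3 := (mem_Ioc.1 hm1).1
    refine ⟨(Nat.Prime.coprime_iff_not_dvd hm2).2 fun h => ?_, fun i =>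
      (Nat.coprime_primes hm2 (hp i)).2 fun h => ?_⟩
    · have := Nat.le_of_dvd hQ h; omega
    · have := hNR i; omega
  have hgood : ∀ U : Finset ι, GoodSupport Q (U.image N) := goodSupport_image hp hcop
  set t : DirichletCharacter ℂ Q → (∀ i, DirichletCharacter ℂ (N i)) → ℝ := fun ξ χ =>
    ‖∑ m ∈ primeWindow (lowEnd l) (highEnd l), (logWeight (A * l) (decay A l) m : ℂ) *
      (Λ m * twist ξ ((charSupp χ).image N) (c χ) m)‖ with ht
  set X : Finset (∀ i, DirichletCharacter ℂ (N i)) := univ.erase 1 with hX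
  set Y := univ.filter (fun χ : ∀ i, DirichletCharacter ℂ (N i) => χ ≠ 1 ∧ charCond χ ≤ R ^ 2)
    with hY
  set S := univ.filter (fun χ : ∀ i, DirichletCharacter ℂ (N i) =>
    (charCond χ : ℝ) ≤ Real.exp (B * l)) with hS
  have hlog : 2 * Real.log R ≤ Real.exp l := by
    have := log_sieveLevel_le l
    have := Real.exp_pos l
    linarith
  have hT : ∀ c : ℕ, ∏ i, (1 + (c : ℝ) / N i) ≤ Real.exp l ^ (3 * c) := fun c =>
    (hR₀ R ((le_max_right _ _).trans hn) ι N hN hp hNR c).trans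
      (pow_le_pow_left₀ (mul_nonneg two_pos.le (Real.log_natCast_nonneg R)) hlog _)
  have hf : ∀ χ : ∀ i, DirichletCharacter ℂ (N i), ‖squareCoeff pt a χ‖ ≤
      4 ^ k * Real.exp l ^ (3 * C) / √(charCond χ) := by
    intro χ
    have h1 := norm_squareCoeff_le pt a (by positivity : (0 : ℝ) ≤ 2 ^ k) ha1 χ
    have hCC : 6 * (k : ℝ) ^ 2 = (C : ℕ) := by rw [hC]; push_cast; ring
    have h2 := prod_ite_add_div_le (Nat.cast_nonneg (α := ℝ) C)
      (fun i => by exact_mod_cast hNC i) χ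
    rw [hCC] at h1
    have h4 : ((2 : ℝ) ^ k) ^ 2 = 4 ^ k := by rw [← pow_mul, mul_comm, pow_mul]; norm_num
    rw [h4] at h1
    refine h1.trans ?_
    rw [mul_div_assoc]
    refine mul_le_mul_of_nonneg_left (h2.trans ?_) (by positivity)
    exact div_le_div_of_nonneg_right (hT C) (Real.sqrt_nonneg _)
  have hcond1 : ∀ χ : ∀ i, DirichletCharacter ℂ (N i), (1 : ℝ) ≤ charCond χ := fun χ => by
    exact_mod_cast one_le_charCond χ
  have hsplit := sum_mul_le_of_split X Y S (fun χ => ‖squareCoeff pt a χ‖) t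
    (c₁ := 4 ^ k * Real.exp l ^ (3 * C))
    (c₂ := 4 ^ k * Real.exp l ^ (3 * C) * Real.exp (-((3 * C + 8) * l)))
    (δ := 2 * Real.exp l ^ 3 * Real.exp (-(A * l : ℕ)) * mainSize A l)
    (M := Real.exp l ^ 6 * mainSize A l) (fun _ _ => norm_nonneg _)
    (by positivity) (by positivity) (by positivity)
    (fun χ => (hf χ).trans (div_le_self (by positivity) (Real.one_le_sqrt.2 (hcond1 χ))))
    (fun χ _ hχ => (hf χ).trans ?_) (fun χ hχ hχY => ?_) (fun χ hχ => ?_) (fun ξ χ hχ hχS => ?_)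
    (hlarge ι N c hN hNR hcop hc)
  rotate_left
  · rw [div_eq_mul_inv, Real.exp_neg]
    gcongr
    refine Real.le_sqrt_of_sq_le ?_
    simp only [hS, mem_filter, mem_univ, true_and, not_le] at hχ
    refine le_trans (le_of_eq ?_) hχ.le
    rw [← Real.exp_nat_mul, hB]
    push_cast
    ring_nf
  · simp only [hY, mem_filter, mem_univ, true_and, not_and, not_le] at hχY
    have h1 : squareCoeff pt a χ = 0 :=
      squareCoeff_eq_zero pt a (S := charSupp χ) ha2 (fun i hi => mem_charSupp.1 hi)
        (hχY (ne_of_mem_erase hχ))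
    simp only [h1, norm_zero]
  · exact mem_erase.2 ⟨(mem_filter.1 hχ).2.1, mem_univ _⟩
  · refine hsmall ξ _ (c χ) ((charSupp_nonempty (ne_of_mem_erase hχ)).image N) (hgood _) ?_ ?_ ?_
    · intro p h
      obtain ⟨i, hi, rfl⟩ := mem_image.1 h
      rw [hc]
      exact mem_charSupp.1 hi
    · rw [prod_image_id hN]
      exact (mem_filter.1 hχS).2
    · intro h
      obtain ⟨i, hi, h⟩ := mem_image.1 h
      exact hNp i h
  rw [sum_window_sieveSum_eq hN pt a h₀ hc _ _ _ hW, ← add_sum_erase univ _ (mem_univ 1),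
    sum_window_one_eq h₀ (c 1) _ _ _ fun m hm => (hW m hm).1, squareCoeff_one, add_sub_cancel_left]
  calc _ ≤ ∑ χ ∈ X, ‖squareCoeff pt a χ‖ * ∑ ξ, t ξ χ := by
        refine (norm_sum_le _ _).trans (sum_le_sum fun χ _ => ?_)
        rw [norm_mul]
        refine mul_le_mul_of_nonneg_left ((norm_sum_le _ _).trans (sum_le_sum fun ξ _ => ?_))
          (norm_nonneg _)
        rw [norm_mul]
        exact mul_le_of_le_one_left (norm_nonneg _) (norm_unitCoeff_le_one hh ξ)
    _ ≤ _ := hsplit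
    _ ≤ (Real.exp (B * l) ^ 2 * Real.exp l ^ 3) * (Q * (4 ^ k * Real.exp l ^ (3 * C) *
        (2 * Real.exp l ^ 3 * Real.exp (-(A * l : ℕ)) * mainSize A l))) +
        4 ^ k * Real.exp l ^ (3 * C) * Real.exp (-((3 * C + 8) * l)) *
        (Real.exp l ^ 6 * mainSize A l) := by
        gcongr
        · refine card_charCond_le.trans ?_
          have := hT 1
          simp only [Nat.cast_one, mul_one] at this
          gcongr
        · rw [← Nat.card_eq_fintype_card,
            DirichletCharacter.card_eq_totient_of_hasEnoughRootsOfUnity]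
          exact Nat.totient_le Q
    _ = (2 * Q * 4 ^ k * Real.exp (-l) ^ 3 + 4 ^ k * Real.exp (-l)) *
        (mainSize A l * Real.exp (-l)) := by
        have e1 : Real.exp (B * l) ^ 2 * Real.exp l ^ 3 * (Real.exp l ^ (3 * C) * (Real.exp l ^ 3 *
            Real.exp (-(A * l : ℕ)))) = Real.exp (-l) ^ 3 * Real.exp (-l) := by
          rw [← Real.exp_nat_mul, ← Real.exp_nat_mul, ← Real.exp_nat_mul, ← Real.exp_nat_mul,
            ← Real.exp_add, ← Real.exp_add, ← Real.exp_add, ← Real.exp_add, ← Real.exp_add]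
          congr 1
          rw [hA]
          push_cast
          ring
        have e2 : Real.exp l ^ (3 * C) * Real.exp (-((3 * C + 8) * l)) * Real.exp l ^ 6 =
            Real.exp (-l) * Real.exp (-l) := by
          rw [← Real.exp_nat_mul, ← Real.exp_nat_mul, ← Real.exp_add, ← Real.exp_add, ← Real.exp_add]
          congr 1
          push_cast
          ring
        linear_combination 2 * Q * 4 ^ k * mainSize A l * e1 + 4 ^ k * mainSize A l * e2
    _ ≤ 1 * (mainSize A l * Real.exp (-l)) := by
        refine mul_le_mul_of_nonneg_right ?_ (by positivity)
        have hQ' : (1 : ℝ) ≤ Q := by exact_mod_cast hQ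
        have h4k : (0 : ℝ) < 4 ^ k := by positivity
        have h1 : 4 * 4 ^ k * Q * Real.exp (-l) ≤ 1 := by
          rw [mul_comm]; exact (le_div_iff₀ (by positivity)).1 hl
        have h5 : Real.exp (-l : ℝ) ≤ 1 := Real.exp_le_one_iff.2 (by simp)
        have h6 := Real.exp_pos (-l : ℝ)
        have h7 : Real.exp (-l : ℝ) ^ 3 ≤ Real.exp (-l) := pow_le_of_le_one h6.le h5 (by norm_num)
        have h8 : 2 * Q * 4 ^ k * Real.exp (-l : ℝ) ^ 3 ≤ 2 * Q * 4 ^ k * Real.exp (-l : ℝ) := by gcongr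
        have h9 : 4 ^ k * Real.exp (-l : ℝ) ≤ Q * (4 ^ k * Real.exp (-l : ℝ)) :=
          le_mul_of_one_le_left (by positivity) hQ'
        linarith
    _ = _ := one_mul _

end equidistribution

end

section

open Finset Filter Topology
open scoped Nat

section unweighted

variable {ι : Type*} [Fintype ι] [DecidableEq ι] {N : ι → ℕ} [hN : ∀ i, Fact (N i).Prime] {k : ℕ}
  (pt : ∀ i, Fin k → ZMod (N i)) (a : (ι → Option (Fin k)) → ℝ)

lemma norm_sum_Ioc_sieveLocal_sub_le (hinj : Function.Injective N) {R : ℕ}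
    {ρ σ : ι → Option (Fin k)} (hρ : ∏ i ∈ univ.filter (fun i => ρ i ≠ none), N i ≤ R)
    (hσ : ∏ i ∈ univ.filter (fun i => σ i ≠ none), N i ≤ R) (y : ℕ) :
    ‖∑ n ∈ Ioc 0 y, (((∏ i, (sieveLocal (pt i) (ρ i) (n : ZMod (N i)) *
        sieveLocal (pt i) (σ i) (n : ZMod (N i))) : ℝ) : ℂ) -
      ((∏ i, ∑ t, 1 / (N i : ℝ) * (sieveLocal (pt i) (ρ i) t * sieveLocal (pt i) (σ i) t) : ℝ) : ℂ))‖
      ≤ 2 * (R : ℝ) ^ 6 := by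
  set U := univ.filter (fun i => ρ i ≠ none) with hU
  set V := univ.filter (fun i => σ i ≠ none) with hV
  have hpos : ∀ i, 0 < N i := fun i => (hN i).out.pos
  set q := ∏ i ∈ U ∪ V, N i with hq
  have hq0 : 0 < q := prod_pos fun i _ => hpos i
  have hqR : q ≤ R ^ 2 := by
    calc q ≤ q * ∏ i ∈ U ∩ V, N i := Nat.le_mul_of_pos_right _ (prod_pos fun i _ => hpos i)
      _ = (∏ i ∈ U, N i) * ∏ i ∈ V, N i := prod_union_inter
      _ ≤ R ^ 2 := by rw [sq]; exact Nat.mul_le_mul hρ hσ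
  have hnone : ∀ i ∉ U ∪ V, ρ i = none ∧ σ i = none := by
    intro i hi
    simp only [U, V, mem_union, mem_filter, mem_univ, true_and] at hi
    tauto
  let G : ι → ℕ → ℂ := fun i n => ((sieveLocal (pt i) (ρ i) (n : ZMod (N i)) *
    sieveLocal (pt i) (σ i) (n : ZMod (N i)) : ℝ) : ℂ)
  have hG : ∀ i ∈ U ∪ V, Function.Periodic (G i) (N i) := fun i _ n => by simp [G]
  have hone : Function.Periodic (fun _ : ℕ => (1 : ℂ)) 1 := fun _ => rfl
  have hper : Function.Periodic (fun n => ∏ i ∈ U ∪ V, G i n) q := by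
    have := prod_periodic (U ∪ V) N hone hG
    simpa using this
  have hcc : ∀ i ∈ U ∪ V, ∀ j ∈ U ∪ V, i ≠ j → (N i).Coprime (N j) := fun i _ j _ hij =>
    (Nat.coprime_primes (hN i).out (hN j).out).2 (hinj.ne hij)
  have hmean : (∑ n ∈ range q, ∏ i ∈ U ∪ V, G i n) / q =
      ((∏ i, ∑ t, 1 / (N i : ℝ) * (sieveLocal (pt i) (ρ i) t * sieveLocal (pt i) (σ i) t) : ℝ) : ℂ) := by
    have h1 := sum_range_prod_of_coprime (U ∪ V) N one_pos (fun i _ => hpos i)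
      (fun i _ => Nat.coprime_one_left _) hcc hone hG
    simp only [one_mul, range_one, sum_singleton] at h1
    rw [h1, hq, Nat.cast_prod, ← prod_div_distrib, Complex.ofReal_prod]
    rw [← prod_subset (subset_univ (U ∪ V))]
    · refine prod_congr rfl fun i _ => ?_
      have : ∑ n ∈ range (N i), G i n = ∑ t : ZMod (N i),
          ((sieveLocal (pt i) (ρ i) t * sieveLocal (pt i) (σ i) t : ℝ) : ℂ) := by
        have : NeZero (N i) := ⟨(hpos i).ne'⟩
        refine sum_bij' (fun n _ => (n : ZMod (N i))) (fun t _ => t.val) (fun _ _ => mem_univ _)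
          (fun t _ => mem_range.2 (ZMod.val_lt t)) (fun n hn => ZMod.val_cast_of_lt (mem_range.1 hn))
          (fun t _ => ZMod.natCast_zmod_val t) (fun n _ => rfl)
      rw [this, ← mul_sum]
      push_cast
      rw [div_eq_mul_one_div, mul_comm]
    · intro i _ hi
      obtain ⟨h2, h3⟩ := hnone i hi
      have : (N i : ℝ) ≠ 0 := by exact_mod_cast (hpos i).ne'
      simp [h2, h3, sieveLocal, ZMod.card, this]
  have hbd : ∀ n, ‖∏ i ∈ U ∪ V, G i n‖ ≤ (q : ℝ) ^ 2 := by
    intro n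
    rw [norm_prod, hq, Nat.cast_prod, ← prod_pow]
    refine prod_le_prod (fun _ _ => norm_nonneg _) fun i _ => ?_
    rw [Complex.norm_real, Real.norm_eq_abs, abs_mul, sq]
    exact mul_le_mul (abs_sieveLocal_le _ _ _) (abs_sieveLocal_le _ _ _) (abs_nonneg _)
      (Nat.cast_nonneg _)
  have h := norm_sum_Ioc_sub_mean_le hq0 hper hbd y
  rw [hmean] at h
  have hprod : ∀ n : ℕ, ((∏ i, (sieveLocal (pt i) (ρ i) (n : ZMod (N i)) *
        sieveLocal (pt i) (σ i) (n : ZMod (N i))) : ℝ) : ℂ) = ∏ i ∈ U ∪ V, G i n := by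
    intro n
    rw [Complex.ofReal_prod, ← prod_subset (subset_univ (U ∪ V))]
    intro i _ hi
    obtain ⟨h2, h3⟩ := hnone i hi
    simp [h2, h3, sieveLocal]
  simp only [hprod]
  refine h.trans ?_
  have : (q : ℝ) ≤ (R : ℝ) ^ 2 := by exact_mod_cast hqR
  calc (q : ℝ) * (2 * (q : ℝ) ^ 2) = 2 * (q : ℝ) ^ 3 := by ring
    _ ≤ 2 * ((R : ℝ) ^ 2) ^ 3 := by gcongr
    _ = _ := by ring

lemma sum_weight_sieveSum_sq_le (hinj : Function.Injective N) {R : ℕ}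
    (hR : ∀ ρ, a ρ ≠ 0 → ∏ i ∈ univ.filter (fun i => ρ i ≠ none), N i ≤ R) (w : ℕ → ℝ) {u M : ℕ}
    (hu : 1 ≤ u) (hw0 : ∀ n, 0 ≤ w n) (hw : ∀ n, u ≤ n → w (n + 1) ≤ w n) (huM : u ≤ M) :
    ∑ n ∈ Ioc u M, w n * sieveSum pt a n ^ 2 ≤
      (prodExpect (fun i _ => 1 / (N i : ℝ)) fun x =>
        localSum (fun i => sieveLocal (pt i)) a x * localSum (fun i => sieveLocal (pt i)) a x) *
        ∑ n ∈ Ioc u M, w n +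
      (∑ ρ, |a ρ|) ^ 2 * (2 * (R : ℝ) ^ 6 / u * (2 * (u * w u) + ∑ n ∈ Ioc u M, w n)) := by
  set E := 2 * (R : ℝ) ^ 6 / u * (2 * (u * w u) + ∑ n ∈ Ioc u M, w n) with hE
  have hu0 : (0 : ℝ) < u := by exact_mod_cast hu
  let F : (ι → Option (Fin k)) → (ι → Option (Fin k)) → ℕ → ℝ := fun ρ σ n =>
    ∏ i, (sieveLocal (pt i) (ρ i) (n : ZMod (N i)) * sieveLocal (pt i) (σ i) (n : ZMod (N i)))
  let c : (ι → Option (Fin k)) → (ι → Option (Fin k)) → ℝ := fun ρ σ =>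
    ∏ i, ∑ t, 1 / (N i : ℝ) * (sieveLocal (pt i) (ρ i) t * sieveLocal (pt i) (σ i) t)
  have hsq : ∀ n, sieveSum pt a n ^ 2 = ∑ ρ, ∑ σ, a ρ * a σ * F ρ σ n := by
    intro n
    simp_rw [sq, sieveSum, localSum, sum_mul_sum]
    exact sum_congr rfl fun ρ _ => sum_congr rfl fun σ _ => by
      simp only [F]; rw [prod_mul_distrib]; ring
  have hterm : ∀ ρ σ, a ρ * a σ * ∑ n ∈ Ioc u M, w n * (F ρ σ n - c ρ σ) ≤ |a ρ| * |a σ| * E := by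
    intro ρ σ
    by_cases h1 : a ρ = 0
    · simp [h1]
    by_cases h2 : a σ = 0
    · simp [h2]
    have h3 := sum_norm_sum_mul_le (ι := Unit) w (fun _ n => ((F ρ σ n : ℝ) : ℂ) - ((c ρ σ : ℝ) : ℂ))
      (ε := 2 * (R : ℝ) ^ 6 / u) hw0 hw huM (fun x hx _ => ?_)
    · simp only [univ_unique, sum_singleton] at h3
      have h4 : |∑ n ∈ Ioc u M, w n * (F ρ σ n - c ρ σ)| ≤ E := by
        rw [← Real.norm_eq_abs, ← Complex.norm_real]
        push_cast
        exact h3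
      calc _ ≤ |a ρ * a σ * ∑ n ∈ Ioc u M, w n * (F ρ σ n - c ρ σ)| := le_abs_self _
        _ = |a ρ| * |a σ| * |∑ n ∈ Ioc u M, w n * (F ρ σ n - c ρ σ)| := by rw [abs_mul, abs_mul]
        _ ≤ _ := by gcongr
    · simp only [univ_unique, sum_singleton]
      refine (norm_sum_Ioc_sieveLocal_sub_le pt hinj (hR ρ h1) (hR σ h2) x).trans ?_
      have : (u : ℝ) ≤ x := by exact_mod_cast hx
      rw [div_mul_eq_mul_div, le_div_iff₀ hu0]
      gcongr
  have hsum : ∑ n ∈ Ioc u M, w n * sieveSum pt a n ^ 2 =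
      (∑ ρ, ∑ σ, a ρ * a σ * c ρ σ) * ∑ n ∈ Ioc u M, w n +
        ∑ ρ, ∑ σ, a ρ * a σ * ∑ n ∈ Ioc u M, w n * (F ρ σ n - c ρ σ) := by
    have h5 : ∑ n ∈ Ioc u M, w n * ∑ ρ, ∑ σ, a ρ * a σ * F ρ σ n =
        ∑ ρ, ∑ σ, a ρ * a σ * ∑ n ∈ Ioc u M, w n * F ρ σ n := by
      simp_rw [mul_sum]
      rw [sum_comm]
      refine sum_congr rfl fun ρ _ => ?_
      rw [sum_comm]
      exact sum_congr rfl fun σ _ => sum_congr rfl fun n _ => by ring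
    have h6 : ∀ ρ σ, a ρ * a σ * ∑ n ∈ Ioc u M, w n * (F ρ σ n - c ρ σ) =
        a ρ * a σ * ∑ n ∈ Ioc u M, w n * F ρ σ n - a ρ * a σ * c ρ σ * ∑ n ∈ Ioc u M, w n := by
      intro ρ σ
      simp_rw [mul_sub, sum_sub_distrib, ← sum_mul]
      ring
    simp_rw [hsq]
    rw [h5]
    simp_rw [h6, sum_sub_distrib, ← sum_mul]
    ring
  rw [prodExpect_localSum_mul, hsum]
  refine add_le_add le_rfl ((sum_le_sum fun ρ _ => sum_le_sum fun σ _ => hterm ρ σ).trans_eq ?_)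
  rw [sq, sum_mul_sum]
  simp_rw [sum_mul]

end unweighted

end

section

open Finset Filter Topology
open scoped Nat

section eventual

lemma eventually_le_log_sieveLevel :
    ∀ᶠ l : ℕ in atTop, Real.exp l / 2000 ≤ Real.log (sieveLevel l) := by
  filter_upwards [eventually_mul_pow_le_exp 2000 1] with l h1
  have hl0 : (0 : ℝ) ≤ l := Nat.cast_nonneg l
  rw [pow_one] at h1
  have hfl : Real.exp (Real.exp l / 1000) < sieveLevel l + 1 := Nat.lt_floor_add_one _
  have h2 : (2 : ℝ) ≤ Real.exp (Real.exp l / 2000) := by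
    have := Real.add_one_le_exp (Real.exp l / 2000)
    linarith
  have h3 : Real.exp (Real.exp l / 1000) = Real.exp (Real.exp l / 2000) ^ 2 := by
    rw [← Real.exp_nat_mul]; push_cast; ring_nf
  have h4 : Real.exp (Real.exp l / 2000) ≤ sieveLevel l := by nlinarith
  exact (Real.le_log_iff_exp_le (by linarith)).2 h4

lemma eventually_exp_mul_le_sieveLevel (c : ℕ) :
    ∀ᶠ l : ℕ in atTop, Real.exp (c * l) ≤ sieveLevel l := by
  filter_upwards [eventually_le_log_sieveLevel, eventually_mul_pow_le_exp (2000 * c) 1,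
    eventually_sieveLevel 1 1] with l h1 h2 h3
  have h4 : (1 : ℝ) ≤ sieveLevel l := by exact_mod_cast h3.1
  refine (Real.le_log_iff_exp_le (by linarith)).1 (le_trans ?_ h1)
  rw [pow_one] at h2
  have := Nat.cast_nonneg (α := ℝ) c
  linarith

lemma mul_logWeight_le {K : ℕ} {η : ℝ} (hη : 0 ≤ η) {u : ℕ} (hu : 1 ≤ u) :
    u * logWeight K η u ≤ Real.log u ^ K := by
  have h := logWeight_le_div (K := K) hη u hu
  have hu0 : (0 : ℝ) < u := by exact_mod_cast hu
  rwa [le_div_iff₀ hu0, mul_comm] at h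

lemma sum_prod_elim_eq {ι : Type*} [Fintype ι] [DecidableEq ι] (N : ι → ℕ) {k : ℕ} :
    ∑ ρ : ι → Option (Fin k), ∏ i, ((ρ i).elim 1 fun _ => 1 / (N i : ℝ)) =
      ∏ i, (1 + (k : ℝ) / N i) := by
  rw [← Fintype.piFinset_univ, ← Finset.prod_univ_sum (fun _ => univ)
    (fun i (o : Option (Fin k)) => (o.elim 1 fun _ => 1 / (N i : ℝ)))]
  refine prod_congr rfl fun i _ => ?_
  rw [Fintype.sum_option]
  simp [div_eq_mul_inv]

theorem eventually_sum_sieveSum_sq_le (A k : ℕ) : ∀ᶠ l : ℕ in atTop,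
    ∀ (ι : Type) [Fintype ι] [DecidableEq ι] (N : ι → ℕ) [∀ i, Fact (N i).Prime],
      Function.Injective N → (∀ i, N i ≤ sieveLevel l) →
      ∀ a : (ι → Option (Fin k)) → ℝ,
      (∀ ρ, |a ρ| ≤ 2 ^ k * ∏ i, (ρ i).elim 1 fun _ => 1 / (N i : ℝ)) →
      (∀ ρ, a ρ ≠ 0 → ∏ i ∈ univ.filter (fun i => ρ i ≠ none), N i ≤ sieveLevel l) →
      ∀ pt : ∀ i, Fin k → ZMod (N i),
      ∑ n ∈ Ioc (sieveLevel l ^ 10) (highEnd l),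
          logWeight (A * l + 1) (decay A l) n * sieveSum pt a n ^ 2 ≤
        (prodExpect (fun i _ => 1 / (N i : ℝ)) fun x =>
          localSum (fun i => sieveLocal (pt i)) a x * localSum (fun i => sieveLocal (pt i)) a x) *
          (2 * (Real.exp l * mainSize A l)) + mainSize A l := by
  obtain ⟨R₀, hR₀⟩ := exists_prod_one_add_div_le
  filter_upwards [eventually_le_log_sieveLevel, eventually_exp_mul_le_sieveLevel (8 * k + 8),
    eventually_linear_le_exp A, eventually_sieveLevel (max 2 R₀) 1, eventually_ge_atTop 1,
    eventually_tsum_logWeight_le A, eventually_div_exp_pow_le_mainSize A]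
    with l hlog hexp hlin hlev hl1 hts hms ι _ _ N hprime hinj hNR a ha hR pt
  have hT0 := Real.exp_pos (l : ℝ)
  have hlogu := log_sieveLevel_le l
  obtain ⟨hnR, -, hD, -, -⟩ := hlev
  obtain ⟨-, ⟨hsum, hts⟩, -⟩ := hts
  obtain ⟨hlow2, hlh, -⟩ := window_bounds (l := l) (K := (A * l : ℕ)) (Nat.cast_nonneg _) hlin
  have hd := (decay_pos A l).le
  set T := Real.exp l with hT
  set R := sieveLevel l with hRdef
  set S := mainSize A l with hS
  have hS0 : 0 < S := mainSize_pos A l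
  have hR2 : 2 ≤ R := (le_max_left _ _).trans hnR
  have hR2' : (2 : ℝ) ≤ R := by exact_mod_cast hR2
  have hu1 : 2 ≤ R ^ 10 := hR2.trans (Nat.le_self_pow (by norm_num) R)
  have hlogpow : Real.log ((R ^ 10 : ℕ) : ℝ) = 10 * Real.log R := by
    push_cast; rw [Real.log_pow]; norm_num
  have huM : R ^ 10 ≤ highEnd l := by
    refine le_trans ?_ (hD.trans hlh)
    rw [one_mul, ← pow_mul]
    exact Nat.pow_le_pow_right (by omega) (by norm_num)
  set w := logWeight (A * l + 1) (decay A l) with hw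
  have hw0 : ∀ n, 0 ≤ w n := fun n => logWeight_nonneg _ _ n
  have hmono : ∀ n, R ^ 10 ≤ n → w (n + 1) ≤ w n := by
    intro n hn
    refine logWeight_le_of_le hd ?_ (hu1.trans hn) (Nat.le_succ n)
    have h1 : Real.log ((R ^ 10 : ℕ) : ℝ) ≤ Real.log n :=
      Real.log_le_log (by positivity) (by exact_mod_cast hn)
    rw [hlogpow] at h1
    push_cast at hlin ⊢
    linarith
  have hW : ∑ n ∈ Ioc (R ^ 10) (highEnd l), w n ≤ 2 * (T * S) :=
    (hsum.sum_le_tsum _ fun n _ => hw0 n).trans hts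
  have hP : 0 ≤ prodExpect (fun i _ => 1 / (N i : ℝ)) fun x =>
      localSum (fun i => sieveLocal (pt i)) a x * localSum (fun i => sieveLocal (pt i)) a x :=
    sum_nonneg fun x _ => mul_nonneg (prod_nonneg fun i _ => by positivity) (mul_self_nonneg _)
  have huw : (R ^ 10 : ℕ) * w (R ^ 10) ≤ T * S := by
    refine (mul_logWeight_le hd (by omega)).trans ?_
    have h0 : 0 ≤ Real.log R := Real.log_natCast_nonneg R
    have he : Real.exp 1 ≤ 100 := by linarith [Real.exp_one_lt_d9]
    have hle : 10 * Real.log R ≤ T / Real.exp 1 := by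
      rw [le_div_iff₀ (Real.exp_pos 1)]
      nlinarith [Real.exp_pos 1]
    rw [hlogpow, pow_succ, mul_comm T]
    refine mul_le_mul ((pow_le_pow_left₀ (by positivity) hle _).trans hms) (by linarith)
      (by positivity) hS0.le
  have hsa : ∑ ρ, |a ρ| ≤ Real.exp ((4 * k : ℕ) * l) := by
    refine (sum_le_sum fun ρ _ => ha ρ).trans ?_
    rw [← mul_sum, sum_prod_elim_eq]
    have h1 := hR₀ R ((le_max_right _ _).trans hnR) ι N hinj (fun i => (hprime i).out) hNR k
    have h2 : 2 * Real.log R ≤ T := by linarith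
    have h3 : (2 * Real.log R) ^ (3 * k) ≤ T ^ (3 * k) :=
      pow_le_pow_left₀ (mul_nonneg two_pos.le (Real.log_natCast_nonneg R)) h2 _
    have h4 : (2 : ℝ) ≤ T := by
      have := Real.add_one_le_exp (l : ℝ)
      have : (1 : ℝ) ≤ l := by exact_mod_cast hl1
      linarith
    calc (2 : ℝ) ^ k * ∏ i, (1 + (k : ℝ) / N i) ≤ T ^ k * T ^ (3 * k) :=
          mul_le_mul (pow_le_pow_left₀ two_pos.le h4 k) (h1.trans h3)
            (prod_nonneg fun i _ => by positivity) (by positivity)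
      _ = T ^ (4 * k) := by ring
      _ = _ := by rw [hT, ← Real.exp_nat_mul]
  have herr : (∑ ρ, |a ρ|) ^ 2 * (2 * (R : ℝ) ^ 6 / (R ^ 10 : ℕ) *
      (2 * ((R ^ 10 : ℕ) * w (R ^ 10)) + ∑ n ∈ Ioc (R ^ 10) (highEnd l), w n)) ≤ S := by
    have hb : Real.exp ((4 * k : ℕ) * l) ^ 2 * (8 * T) ≤ (R : ℝ) ^ 4 := by
      have h1 : (1 : ℝ) ≤ l := by exact_mod_cast hl1
      have h8 : (8 : ℝ) ≤ Real.exp (7 * l) := by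
        have := Real.add_one_le_exp (7 * (l : ℝ)); linarith
      calc _ ≤ Real.exp ((4 * k : ℕ) * l) ^ 2 * (Real.exp (7 * l) * Real.exp l) := by gcongr
        _ = Real.exp ((8 * k + 8 : ℕ) * l) := by
          rw [← Real.exp_nat_mul, ← Real.exp_add, ← Real.exp_add]; push_cast; ring_nf
        _ ≤ R := hexp
        _ ≤ _ := le_self_pow₀ (by linarith) (by norm_num)
    have hR0 : (0 : ℝ) < R := by linarith
    calc _ ≤ Real.exp ((4 * k : ℕ) * l) ^ 2 * (2 * (R : ℝ) ^ 6 / (R ^ 10 : ℕ) *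
          (2 * (T * S) + 2 * (T * S))) := by
          have := sum_nonneg fun n (_ : n ∈ Ioc (R ^ 10) (highEnd l)) => hw0 n
          have := hw0 (R ^ 10)
          gcongr
      _ = Real.exp ((4 * k : ℕ) * l) ^ 2 * (8 * T) / (R : ℝ) ^ 4 * S := by
          push_cast; field_simp; ring
      _ ≤ 1 * S := by
          gcongr
          exact div_le_one_of_le₀ hb (by positivity)
      _ = S := one_mul S
  refine (sum_weight_sieveSum_sq_le pt a hinj hR w (by omega) hw0 hmono huM).trans
    (add_le_add (mul_le_mul_of_nonneg_left hW hP) herr)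

end eventual

end

section

open Finset Filter Topology
open scoped ArithmeticFunction.vonMangoldt

section transfer

lemma logWeight_mul_log_le {K : ℕ} {η x : ℝ} (hη : 0 ≤ η) {W n : ℕ} (hW : 1 ≤ W) (hn : 2 ≤ n)
    (hx : Real.log (W + 1) ≤ x * Real.log n) (hxK : (K + 1) * x ≤ 1 / 2) (hx0 : 0 ≤ x) :
    logWeight K η (W * n + 1) * Real.log (W * n + 1 : ℕ) ≤ 2 / W * logWeight (K + 1) η n := by
  have hn0 : (0 : ℝ) < n := by positivity
  have hW0 : (1 : ℝ) ≤ W := by exact_mod_cast hW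
  have hl0 : 0 ≤ Real.log n := Real.log_natCast_nonneg n
  have h1 : Real.log (W * n + 1 : ℕ) ≤ (1 + x) * Real.log n := by
    calc Real.log (W * n + 1 : ℕ) ≤ Real.log ((W + 1) * n) := by
          refine Real.log_le_log (by positivity) ?_
          have : (1 : ℝ) ≤ n := by exact_mod_cast (by omega : 1 ≤ n)
          push_cast; linarith
      _ = Real.log (W + 1) + Real.log n := Real.log_mul (by positivity) hn0.ne'
      _ ≤ _ := by linarith
  have h2 : Real.log (W * n + 1 : ℕ) ^ (K + 1) ≤ 2 * Real.log n ^ (K + 1) := by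
    calc _ ≤ ((1 + x) * Real.log n) ^ (K + 1) :=
          pow_le_pow_left₀ (Real.log_natCast_nonneg _) h1 _
      _ = (1 + x) ^ (K + 1) * Real.log n ^ (K + 1) := mul_pow _ _ _
      _ ≤ Real.exp x ^ (K + 1) * Real.log n ^ (K + 1) := by
          gcongr; linarith [Real.add_one_le_exp x]
      _ ≤ 2 * Real.log n ^ (K + 1) := by
          gcongr
          rw [← Real.exp_nat_mul]
          push_cast
          refine (Real.exp_le_exp.2 hxK).trans ?_
          refine (Real.le_log_iff_exp_le two_pos).1 ?_
          linarith [Real.log_two_gt_d9]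
  have h3 : (W : ℝ) * (n : ℝ) ^ (1 + η) ≤ ((W * n + 1 : ℕ) : ℝ) ^ (1 + η) := by
    calc (W : ℝ) * (n : ℝ) ^ (1 + η) ≤ (W : ℝ) ^ (1 + η) * (n : ℝ) ^ (1 + η) := by
          gcongr; exact Real.self_le_rpow_of_one_le hW0 (by linarith)
      _ = ((W : ℝ) * n) ^ (1 + η) := (Real.mul_rpow (by positivity) (by positivity)).symm
      _ ≤ _ := by
          refine Real.rpow_le_rpow (by positivity) ?_ (by linarith)
          push_cast; linarith
  rw [logWeight, logWeight, div_mul_eq_mul_div, ← pow_succ, div_mul_div_comm]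
  exact div_le_div₀ (by positivity) h2 (by positivity) h3

lemma eventually_sum_primeWindow_le (A Q : ℕ) : ∀ᶠ l : ℕ in atTop, ∀ W : ℕ, 1 ≤ W → W ≤ Q →
    ∀ F : ℕ → ℝ, (∀ m, 0 ≤ F m) →
    ∑ m ∈ primeWindow (lowEnd l) (highEnd l), logWeight (A * l) (decay A l) m *
        (Λ m * ((if (m : ZMod W) = 1 then 1 else 0) * F m)) ≤
      2 / W * ∑ n ∈ Ioc (sieveLevel l ^ 10) (highEnd l), logWeight (A * l + 1) (decay A l) n *
        ((if (W * n + 1).Prime then 1 else 0) * F (W * n + 1)) := by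
  filter_upwards [eventually_sieveLevel 2 Q, eventually_le_log_sieveLevel,
    eventually_mul_pow_le_exp (400 * ((Q + 1) * (A + 1))) 1] with l ⟨hR, _, hlow, _⟩ hlog hexp W hW hWQ F hF
  set R := sieveLevel l
  set T : ℝ := Real.exp l with hT
  have hT0 : 0 < T := Real.exp_pos _
  have hd := (decay_pos A l).le
  have hQ : 1 ≤ Q := hW.trans hWQ
  have hlow' : W * (R ^ 10 + 1) ≤ lowEnd l := by
    refine le_trans ?_ hlow
    calc W * (R ^ 10 + 1) ≤ Q * (R ^ 10 + R ^ 10) :=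
          Nat.mul_le_mul hWQ (Nat.add_le_add_left (Nat.one_le_pow _ _ (by omega)) _)
      _ = Q * (2 * R ^ 10) := by ring
      _ ≤ Q ^ 8 * (R ^ 30 * R ^ 10) := Nat.mul_le_mul (Nat.le_self_pow (by norm_num) Q)
          (Nat.mul_le_mul (hR.trans (Nat.le_self_pow (by norm_num) R)) le_rfl)
      _ = _ := by ring
  set g : ℕ → ℝ := fun n => logWeight (A * l + 1) (decay A l) n *
        ((if (W * n + 1).Prime then 1 else 0) * F (W * n + 1)) with hg
  have hg0 : ∀ n, 0 ≤ g n := fun n => mul_nonneg (logWeight_nonneg _ _ _)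
    (mul_nonneg (by split_ifs <;> norm_num) (hF _))
  set P := (primeWindow (lowEnd l) (highEnd l)).filter fun m : ℕ => (m : ZMod W) = 1 with hP
  have hmem : ∀ m ∈ P, W * ((m - 1) / W) + 1 = m ∧ m.Prime ∧ R ^ 10 < (m - 1) / W ∧
      (m - 1) / W ≤ highEnd l := by
    intro m hm
    simp only [hP, primeWindow, mem_filter, mem_Ioc] at hm
    obtain ⟨⟨⟨h1, h2⟩, h3⟩, h4⟩ := hm
    have h5 : W ∣ m - 1 := by
      rw [← Nat.cast_one, ZMod.natCast_eq_natCast_iff] at h4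
      exact (Nat.modEq_iff_dvd' h3.one_le).1 h4.symm
    refine ⟨by rw [Nat.mul_div_cancel' h5]; have := h3.one_le; omega, h3, ?_,
      (Nat.div_le_self _ _).trans (by omega)⟩
    rw [Nat.lt_iff_add_one_le, Nat.le_div_iff_mul_le hW, mul_comm]
    omega
  have hterm : ∀ m ∈ P, logWeight (A * l) (decay A l) m * (Λ m * F m) ≤
      2 / W * g ((m - 1) / W) := by
    intro m hm
    obtain ⟨h1, h2, h3, -⟩ := hmem m hm
    set n := (m - 1) / W
    have hlogn : T / 200 ≤ Real.log n := by
      have h5 : Real.log ((R ^ 10 : ℕ) : ℝ) ≤ Real.log n :=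
        Real.log_le_log (by positivity) (by exact_mod_cast h3.le)
      push_cast at h5
      rw [Real.log_pow] at h5
      push_cast at h5
      linarith
    have h6 : Real.log (W + 1) ≤ Q := by
      have := Real.log_le_sub_one_of_pos (by positivity : (0 : ℝ) < W + 1)
      have : (W : ℝ) ≤ Q := by exact_mod_cast hWQ
      linarith
    have hn2 : 2 ≤ n := by
      have : 1 ≤ R ^ 10 := Nat.one_le_pow _ _ (by omega)
      omega
    have h7 := logWeight_mul_log_le (K := A * l) hd (x := 200 * Q / T) hW hn2
      (h6.trans ?_) ?_ (by positivity)
    · rw [ArithmeticFunction.vonMangoldt_apply_prime h2]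
      simp only [hg, h1, h2, if_true, one_mul]
      rw [h1] at h7
      calc _ = logWeight (A * l) (decay A l) m * Real.log m * F m := by ring
        _ ≤ 2 / W * logWeight (A * l + 1) (decay A l) n * F m :=
          mul_le_mul_of_nonneg_right h7 (hF m)
        _ = _ := by ring
    · calc (Q : ℝ) = 200 * Q / T * (T / 200) := by field_simp
        _ ≤ _ := by gcongr
    · rw [mul_div_assoc', div_le_iff₀ hT0]
      have hl0 : (0 : ℝ) ≤ l := Nat.cast_nonneg l
      have hA0 : (0 : ℝ) ≤ A := Nat.cast_nonneg A
      have hQ0 : (0 : ℝ) ≤ Q := Nat.cast_nonneg Q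
      have h8 : ((A : ℝ) * l + 1) * Q ≤ (Q + 1) * (A + 1) * (l + 1) := by
        have : (A : ℝ) * l + 1 ≤ (A + 1) * (l + 1) := by nlinarith
        calc ((A : ℝ) * l + 1) * Q ≤ ((A + 1) * (l + 1)) * (Q + 1) :=
              mul_le_mul this (by linarith) hQ0 (by positivity)
          _ = _ := by ring
      push_cast
      rw [pow_one] at hexp
      linarith
  have hinj : Set.InjOn (fun m : ℕ => (m - 1) / W) P := by
    intro m hm m' hm' h
    rw [← (hmem m hm).1, ← (hmem m' hm').1]
    simp only at h
    rw [h]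
  calc _ = ∑ m ∈ P, logWeight (A * l) (decay A l) m * (Λ m * F m) := by
        rw [hP, sum_filter]
        refine sum_congr rfl fun m _ => ?_
        split_ifs <;> simp
    _ ≤ ∑ m ∈ P, 2 / W * g ((m - 1) / W) := sum_le_sum hterm
    _ = 2 / W * ∑ n ∈ P.image (fun m => (m - 1) / W), g n := by
        rw [← mul_sum, sum_image hinj]
    _ ≤ _ := by
        refine mul_le_mul_of_nonneg_left (sum_le_sum_of_subset_of_nonneg ?_ fun n _ _ => hg0 n)
          (by positivity)
        intro n hn
        obtain ⟨m, hm, rfl⟩ := mem_image.1 hn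
        exact mem_Ioc.2 (hmem m hm).2.2

end transfer

end

section

open Finset Filter Topology
open scoped ArithmeticFunction.vonMangoldt

section affine

variable {k : ℕ}

lemma sieveLocal_affine {p : ℕ} [Fact p.Prime] {W : ZMod p} (hW : W ≠ 0) (pt : Fin k → ZMod p)
    (o : Option (Fin k)) (t : ZMod p) :
    sieveLocal (fun c => W * pt c + 1) o (W * t + 1) = sieveLocal pt o t := by
  rcases o with _ | c
  · rfl
  · simp [sieveLocal, hW]

lemma sieveSum_affine {ι : Type*} [Fintype ι] [DecidableEq ι] {N : ι → ℕ} [∀ i, Fact (N i).Prime]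
    {W : ℕ} (hW : ∀ i, (W : ZMod (N i)) ≠ 0) (pt : ∀ i, Fin k → ZMod (N i))
    (a : (ι → Option (Fin k)) → ℝ) (n : ℕ) :
    sieveSum (fun i c => (W : ZMod (N i)) * pt i c + 1) a (W * n + 1) = sieveSum pt a n := by
  unfold sieveSum localSum
  refine sum_congr rfl fun ρ _ => ?_
  congr 1
  refine prod_congr rfl fun i _ => ?_
  push_cast
  exact sieveLocal_affine (hW i) _ _ _

end affine

theorem exists_sum_prime_sieveSum_ge {Q : ℕ} [Nontrivial (ZMod Q)] [NeZero Q] (k : ℕ) :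
    ∃ A : ℕ, ∀ᶠ l : ℕ in atTop, ∃ p₁, 2 ≤ p₁ ∧
      ∀ (ι : Type) [Fintype ι] [DecidableEq ι] (N : ι → ℕ) [∀ i, Fact (N i).Prime],
      Function.Injective N → (∀ i, N i ≤ sieveLevel l) →
      (∀ i, Q.Coprime (N i)) → (∀ i, N i ≠ p₁) → (∀ i, (6 * k ^ 2) ^ 2 ≤ N i) →
      ∀ a : (ι → Option (Fin k)) → ℝ,
      (∀ ρ, |a ρ| ≤ 2 ^ k * ∏ i, (ρ i).elim 1 fun _ => 1 / (N i : ℝ)) →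
      (∀ ρ, a ρ ≠ 0 → ∏ i ∈ univ.filter (fun i => ρ i ≠ none), N i ≤ sieveLevel l) →
      ∀ (pt : ∀ i, Fin k → ZMod (N i)) (W : ℕ), W ∣ Q →
      mainSize A l * (W / (8 * W.totient) *
        (prodExpect (fun i => punctured (0 : ZMod (N i))) fun x =>
          localSum (fun i => sieveLocal fun c => W * pt i c + 1) a x *
            localSum (fun i => sieveLocal fun c => W * pt i c + 1) a x) - Q * Real.exp (-l)) ≤
        ∑ n ∈ Ioc (sieveLevel l ^ 10) (highEnd l), logWeight (A * l + 1) (decay A l) n *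
          ((if (W * n + 1).Prime then 1 else 0) * sieveSum pt a n ^ 2) := by
  obtain ⟨A, hA, hev⟩ := exists_equidistribution (Q := Q) k
  refine ⟨A, ?_⟩
  have hQ0 : Q ≠ 0 := NeZero.ne Q
  have hpnt : ∀ᶠ l : ℕ in atTop, ∀ W ∈ Q.divisors, mainSize A l / (4 * W.totient) ≤
      ∑ m ∈ primeWindow (lowEnd l) (highEnd l), logWeight (A * l) (decay A l) m *
        ArithmeticFunction.vonMangoldt.residueClass (1 : ZMod W) m := by
    rw [Filter.eventually_all_finset]
    intro W hW
    have : NeZero W := ⟨(Nat.pos_of_mem_divisors hW).ne'⟩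
    exact eventually_mainSize_le_sum_primeWindow hA W
  filter_upwards [hev, hpnt, eventually_sum_primeWindow_le A Q] with l ⟨p₁, hp₁, h⟩ hpnt htr
  refine ⟨p₁, hp₁, fun ι _ _ N _ hinj hNR hcop hNp hN6 a ha hR pt W hWQ => ?_⟩
  have hW1 : 1 ≤ W := Nat.pos_of_dvd_of_pos hWQ (Nat.pos_of_ne_zero hQ0)
  have hWle : W ≤ Q := Nat.le_of_dvd (Nat.pos_of_ne_zero hQ0) hWQ
  have hWN : ∀ i, (W : ZMod (N i)) ≠ 0 := fun i =>
    ((ZMod.isUnit_iff_coprime W (N i)).2 (Nat.Coprime.coprime_dvd_left hWQ (hcop i))).ne_zero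
  set pt' : ∀ i, Fin k → ZMod (N i) := fun i c => W * pt i c + 1 with hpt'
  set E := prodExpect (fun i => punctured (0 : ZMod (N i))) fun x =>
    localSum (fun i => sieveLocal (pt' i)) a x * localSum (fun i => sieveLocal (pt' i)) a x with hE
  have hE0 : 0 ≤ E := sum_nonneg fun x _ =>
    mul_nonneg (prod_nonneg fun i _ => punctured_nonneg _ _) (mul_self_nonneg _)
  set h₀ : ZMod Q → ℂ := fun t => if ZMod.castHom hWQ (ZMod W) t = 1 then 1 else 0 with hh₀
  have h1 := h ι N hinj hNR hcop hNp hN6 a ha hR pt' h₀ fun t => by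
    simp only [hh₀]; split_ifs <;> simp
  have hh₀' : ∀ m : ℕ, h₀ m = ((if (m : ZMod W) = 1 then 1 else 0 : ℝ) : ℂ) := by
    intro m
    simp only [hh₀, map_natCast]
    split_ifs <;> simp
  set X := ∑ m ∈ primeWindow (lowEnd l) (highEnd l), logWeight (A * l) (decay A l) m *
    (Λ m * ((if (m : ZMod W) = 1 then 1 else 0) * sieveSum pt' a m ^ 2)) with hX
  set Y := ∑ m ∈ primeWindow (lowEnd l) (highEnd l), logWeight (A * l) (decay A l) m *
    (Λ m * (if (m : ZMod W) = 1 then 1 else 0)) with hY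
  have h2 : |X - E * Y| ≤ mainSize A l * Real.exp (-l) := by
    rw [← Real.norm_eq_abs, ← Complex.norm_real]
    refine le_trans (le_of_eq ?_) h1
    simp only [hh₀', hX, hY]
    push_cast
    rfl
  have hY' : mainSize A l / (4 * W.totient) ≤ Y := by
    refine (hpnt W (Nat.mem_divisors.2 ⟨hWQ, hQ0⟩)).trans_eq (sum_congr rfl fun m _ => ?_)
    rw [ArithmeticFunction.vonMangoldt.residueClass, Set.indicator_apply]
    congr 1
    simp
  have hW0 : (0 : ℝ) < W := by exact_mod_cast hW1
  have h3 := htr W hW1 hWle (fun m => sieveSum pt' a m ^ 2) fun m => sq_nonneg _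
  simp only [hpt', sieveSum_affine hWN] at h3
  set Z := ∑ n ∈ Ioc (sieveLevel l ^ 10) (highEnd l), logWeight (A * l + 1) (decay A l) n *
          ((if (W * n + 1).Prime then 1 else 0) * sieveSum pt a n ^ 2) with hZ
  have h4 : E * (mainSize A l / (4 * W.totient)) ≤ E * Y := mul_le_mul_of_nonneg_left hY' hE0
  have h5 := (abs_le.1 h2).1
  have h6 : E * (mainSize A l / (4 * W.totient)) - mainSize A l * Real.exp (-l) ≤ 2 / W * Z := by
    refine le_trans ?_ h3
    change _ ≤ X
    linarith
  rw [div_mul_eq_mul_div, le_div_iff₀ hW0] at h6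
  have h7 : (W : ℝ) ≤ Q := by exact_mod_cast hWle
  have hS : 0 < mainSize A l * Real.exp (-l) := mul_pos (mainSize_pos A l) (Real.exp_pos _)
  have h8 : mainSize A l * Real.exp (-l) * W ≤ mainSize A l * Real.exp (-l) * Q := by gcongr
  have h9 : mainSize A l * (W / (8 * W.totient) * E) =
      E * (mainSize A l / (4 * W.totient)) * W / 2 := by ring
  rw [mul_sub, h9]
  nlinarith

end

section

open Finset Filter Topology

section assembly

lemma totient_mul_le_mul (a b : ℕ) (ha : a ≠ 0) (hb : b ≠ 0) :
    (a * b).totient ≤ a * b.totient := by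
  have h1 := Nat.totient_eq_mul_prod_factors (a * b)
  have h2 := Nat.totient_eq_mul_prod_factors b
  have hf : ∀ p ∈ (a * b).primeFactors, (0 : ℚ) ≤ 1 - (p : ℚ)⁻¹ ∧ 1 - (p : ℚ)⁻¹ ≤ 1 := by
    intro p hp
    have h3 : (1 : ℚ) ≤ p := by exact_mod_cast (Nat.prime_of_mem_primeFactors hp).one_le
    have h4 := inv_le_one_of_one_le₀ h3
    have h5 : (0 : ℚ) ≤ (p : ℚ)⁻¹ := by positivity
    constructor <;> linarith
  have hsub : b.primeFactors ⊆ (a * b).primeFactors :=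
    Nat.primeFactors_mono (dvd_mul_left b a) (mul_ne_zero ha hb)
  have h6 : ∏ p ∈ (a * b).primeFactors, (1 - (p : ℚ)⁻¹) ≤ ∏ p ∈ b.primeFactors, (1 - (p : ℚ)⁻¹) := by
    rw [← prod_sdiff hsub]
    refine mul_le_of_le_one_left (prod_nonneg fun p hp => (hf p (hsub hp)).1)
      (prod_le_one (fun p hp => (hf p (sdiff_subset hp)).1) fun p hp => (hf p (sdiff_subset hp)).2)
  have h7 : (((a * b).totient : ℕ) : ℚ) ≤ ((a * b.totient : ℕ) : ℚ) := by
    rw [h1, Nat.cast_mul a b.totient, h2, ← mul_assoc, ← Nat.cast_mul]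
    gcongr
  exact_mod_cast h7

lemma not_weighted_count_le {S T q m J : ℝ} (hS : 0 < S) (hT : 1 ≤ T) (hq : 1 ≤ q) (hm : 1 ≤ m)
    (hJ : 200000000000 * m ≤ J + 1)
    (h : S * (T * (J + 1) * q / 26214400000 - 1) ≤ m * (2 * q * (2 * (T * S)) + S)) : False := by
  have h1 : 1 ≤ T * q := one_le_mul_of_one_le_of_one_le hT hq
  have h2 : m ≤ m * (T * q) := le_mul_of_one_le_right (by linarith) h1
  have h3 : 200000000000 * m * (T * q) ≤ (J + 1) * (T * q) := by gcongr
  have h4 : S * (T * (J + 1) * q / 26214400000 - 1) ≤ S * (4 * (m * (T * q)) + m) := by linarith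
  have h5 := le_of_mul_le_mul_left h4 hS
  linarith

theorem eventually_exists_many_primes (a b m : ℕ) (ha : 2 ≤ a) (hm : 1 ≤ m) :
    ∃ k D : ℕ, ∀ᶠ l : ℕ in atTop, ∃ n, sieveLevel l ^ 10 < n ∧
      m ≤ (univ.filter fun c : Fin k => (a ^ (b + (c + 1)) * D.factorial * n + 1).Prime).card := by
  obtain ⟨J, hJ⟩ : ∃ J : ℕ, 200000000000 * (m : ℝ) ≤ J + 1 := by
    obtain ⟨J, hJ⟩ := exists_nat_ge (200000000000 * (m : ℝ))
    exact ⟨J, by linarith⟩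
  obtain ⟨k, hk⟩ : ∃ k, k = 2 ^ J := ⟨_, rfl⟩
  have hk1 : 1 ≤ k := hk ▸ Nat.one_le_two_pow
  obtain ⟨D, hD⟩ : ∃ D, D = a ^ k + a + (6 * k ^ 2) ^ 2 + 12 * k ^ 2 + 2 * k + 3 := ⟨_, rfl⟩
  refine ⟨k, D, ?_⟩
  obtain ⟨V, hV⟩ : ∃ V, V = D.factorial := ⟨_, rfl⟩
  rw [← hV]
  have hV0 : 0 < V := hV ▸ Nat.factorial_pos D
  let W : Fin k → ℕ := fun c => a ^ (b + (c + 1)) * V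
  obtain ⟨Q, hQ⟩ : ∃ Q, Q = a ^ (b + k) * V := ⟨_, rfl⟩
  have hWQ : ∀ c, W c ∣ Q := fun c => by
    rw [hQ]
    exact mul_dvd_mul_right (pow_dvd_pow a (by have := c.2; omega)) V
  have hW0 : ∀ c, 0 < W c := fun c => Nat.mul_pos (pow_pos (by omega) _) hV0
  have hQ1 : 2 ≤ Q := by
    rw [hQ]
    calc 2 ≤ a := ha
      _ ≤ a ^ (b + k) := Nat.le_self_pow (by omega) a
      _ ≤ _ := Nat.le_mul_of_pos_right _ hV0
  have : Fact (1 < Q) := ⟨hQ1⟩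
  have : NeZero Q := ⟨by omega⟩
  obtain ⟨A, hA⟩ := exists_sum_prime_sieveSum_ge (Q := Q) k
  obtain ⟨L₀, hL₀, hrec⟩ := exists_recipSum_bounds D
  rw [← hV] at hrec
  obtain ⟨κ, hκ⟩ : ∃ κ, κ = (V.totient : ℝ) / V := ⟨_, rfl⟩
  rw [← hκ] at hrec
  have hφ0 : (0 : ℝ) < V.totient := by exact_mod_cast Nat.totient_pos.2 hV0
  have hV0' : (0 : ℝ) < V := by exact_mod_cast hV0
  have hκ0 : 0 < κ := by rw [hκ]; positivity
  have hWκ : ∀ c, 1 ≤ W c / ((W c).totient : ℝ) * κ := by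
    intro c
    have h1 : ((W c).totient : ℝ) ≤ (a : ℝ) ^ (b + (c + 1 : ℕ)) * V.totient := by
      exact_mod_cast totient_mul_le_mul (a ^ (b + (c + 1 : ℕ))) V (pow_ne_zero _ (by omega)) hV0.ne'
    have h2 : (0 : ℝ) < (W c).totient := by exact_mod_cast Nat.totient_pos.2 (hW0 c)
    have h3 : (W c : ℝ) = (a : ℝ) ^ (b + (c + 1 : ℕ)) * V := by simp [W]
    rw [hκ, h3, div_mul_div_comm, le_div_iff₀ (by positivity), one_mul]
    calc _ ≤ (a : ℝ) ^ (b + (c + 1 : ℕ)) * V.totient * V := by gcongr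
      _ = _ := by ring
  have hk0 : (0 : ℝ) < k := by exact_mod_cast hk1
  have hQ0 : (0 : ℝ) < Q := by positivity
  filter_upwards [hA, eventually_sum_sieveSum_sq_le A k, eventually_le_log_sieveLevel,
    eventually_sieveLevel (max 2 D) 1, eventually_mul_pow_le_exp (800000 * k * (J + 1) * L₀) 1,
    eventually_exp_neg_le (c := 1 / (k * Q)) (by positivity)] with l ⟨p₁, hp₁, hprimes⟩ hsq hlog hlev hL hexp
  have hR2 : 2 ≤ sieveLevel l := (le_max_left _ _).trans hlev.1
  have hDR : D ≤ sieveLevel l := (le_max_right _ _).trans hlev.1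
  clear hlev
  by_contra! hcon
  have hT1 : 1 ≤ Real.exp l := Real.one_le_exp (Nat.cast_nonneg l)
  set T := Real.exp l with hT
  set R := sieveLevel l with hR
  have hS0 := mainSize_pos A l
  set S := mainSize A l with hS
  obtain ⟨P, hP⟩ : ∃ P, P = ((Ioc D R).filter Nat.Prime).erase p₁ := ⟨_, rfl⟩
  have hmem' : ∀ i ∈ P, i ≠ p₁ ∧ (D < i ∧ i ≤ R) ∧ i.Prime := by
    intro i hi
    rwa [hP, mem_erase, mem_filter, mem_Ioc] at hi
  have hmem : ∀ i : P, (i : ℕ) ≠ p₁ ∧ (D < i ∧ (i : ℕ) ≤ R) ∧ (i : ℕ).Prime := fun i => hmem' i i.2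
  let N : P → ℕ := fun i => i
  have hprime : ∀ i : P, Fact (N i).Prime := fun i => ⟨(hmem i).2.2⟩
  have hinj : Function.Injective N := Subtype.val_injective
  have hND : ∀ i, D < N i := fun i => (hmem i).2.1.1
  have hak0 : 0 < a ^ k := pow_pos (by omega) k
  have hcopa : ∀ i, Nat.Coprime a (N i) := fun i =>
    ((hmem i).2.2.coprime_iff_not_dvd.2 (Nat.not_dvd_of_pos_of_lt (by omega)
      (by have : D < (i : ℕ) := hND i; omega))).symm
  have hcopV : ∀ i, V.Coprime (N i) := by
    intro i
    rw [hV]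
    refine ((hmem i).2.2.coprime_iff_not_dvd.2 fun h => ?_).symm
    exact absurd ((hmem i).2.2.dvd_factorial.1 h) (not_le.2 (hND i))
  have hcop : ∀ i, Q.Coprime (N i) := by
    intro i
    rw [hQ]
    exact Nat.Coprime.mul_left (Nat.Coprime.pow_left _ (hcopa i)) (hcopV i)
  have hWN : ∀ i c, (W c : ZMod (N i)) ≠ 0 := fun i c =>
    ((ZMod.isUnit_iff_coprime (W c) (N i)).2 (Nat.Coprime.coprime_dvd_left (hWQ c) (hcop i))).ne_zero
  let pt : ∀ i, Fin k → ZMod (N i) := fun i c => -(W c : ZMod (N i))⁻¹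
  have hpt : ∀ i, Function.Injective (pt i) := by
    intro i c c' h
    have h1 : (W c : ZMod (N i)) = W c' := inv_injective (neg_injective h)
    have h2 : ∀ d, W d = a ^ (b + 1) * V * a ^ (d : ℕ) := fun d => by
      simp only [W]; ring
    have h3 : ((a ^ (b + 1) * V : ℕ) : ZMod (N i)) ≠ 0 :=
      ((ZMod.isUnit_iff_coprime _ (N i)).2
        (Nat.Coprime.mul_left (Nat.Coprime.pow_left _ (hcopa i)) (hcopV i))).ne_zero
    rw [h2, h2, Nat.cast_mul, Nat.cast_mul _ (a ^ (c' : ℕ))] at h1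
    have h4 := mul_left_cancel₀ h3 h1
    rw [ZMod.natCast_eq_natCast_iff', Nat.mod_eq_of_lt, Nat.mod_eq_of_lt] at h4
    · exact Fin.ext (Nat.pow_right_injective ha h4)
    · have : a ^ (c' : ℕ) ≤ a ^ k := Nat.pow_le_pow_right (by omega) c'.2.le
      have := hND i
      omega
    · have : a ^ (c : ℕ) ≤ a ^ k := Nat.pow_le_pow_right (by omega) c.2.le
      have := hND i
      omega
  obtain ⟨ls, hls⟩ : ∃ ls, ls = Real.log R / (400 * k * (J + 1)) := ⟨_, rfl⟩
  have hlR : 400 * k * (J + 1) * ls = Real.log R := by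
    rw [hls]; field_simp
  have hlsT : T / (800000 * k * (J + 1)) ≤ ls := by
    rw [hls, div_le_div_iff₀ (by positivity) (by positivity)]
    have : 0 ≤ 400 * (k : ℝ) * (J + 1) := by positivity
    nlinarith
  have hlsL : L₀ ≤ ls := by
    refine le_trans ?_ hlsT
    rw [le_div_iff₀ (by positivity)]
    have : (0 : ℝ) ≤ l := Nat.cast_nonneg l
    have : (0 : ℝ) ≤ 800000 * k * (J + 1) * L₀ := by positivity
    rw [pow_one] at hL
    nlinarith
  have hls0 : 0 < ls := by linarith
  have hLj : ∀ j, L₀ ≤ 2 ^ j * ls := fun j =>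
    hlsL.trans (le_mul_of_one_le_left hls0.le (one_le_pow₀ one_le_two))
  have hlsR : ∀ j ≤ J, Real.exp (2 ^ j * ls) ≤ R := by
    intro j hj
    refine (Real.le_log_iff_exp_le (by positivity)).1 ?_
    have h1 : (2 : ℝ) ^ j ≤ k := by
      rw [hk]; push_cast; exact pow_le_pow_right₀ one_le_two hj
    have h2 : (1 : ℝ) ≤ 400 * (J + 1) := by have := Nat.cast_nonneg (α := ℝ) J; linarith
    calc 2 ^ j * ls ≤ k * ls * 1 := by rw [mul_one]; gcongr
      _ ≤ k * ls * (400 * (J + 1)) := by gcongr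
      _ = _ := by rw [← hlR]; ring
  have hSum : 3 * (k : ℝ) ^ 2 * ∑ i, 1 / (N i : ℝ) ^ 2 ≤ 1 / 4 := by
    have hD0 : D ≠ 0 := by omega
    have h1 : ∑ i, 1 / (N i : ℝ) ^ 2 ≤ (D : ℝ)⁻¹ := by
      calc ∑ i, 1 / (N i : ℝ) ^ 2 = ∑ p ∈ P, ((p : ℝ) ^ 2)⁻¹ := by
            rw [← sum_coe_sort P]; simp [N]
        _ ≤ ∑ p ∈ Ioc D R, ((p : ℝ) ^ 2)⁻¹ := by
            refine sum_le_sum_of_subset_of_nonneg ?_ fun _ _ _ => by positivity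
            rw [hP]
            exact (erase_subset _ _).trans (filter_subset _ _)
        _ ≤ (D : ℝ)⁻¹ - (R : ℝ)⁻¹ := sum_Ioc_inv_sq_le_sub hD0 hDR
        _ ≤ _ := by have : (0 : ℝ) ≤ (R : ℝ)⁻¹ := by positivity
                    linarith
    have h2 : 12 * (k : ℝ) ^ 2 ≤ D := by
      exact_mod_cast (by omega : 12 * k ^ 2 ≤ D)
    calc _ ≤ 3 * (k : ℝ) ^ 2 * (D : ℝ)⁻¹ := by gcongr
      _ ≤ _ := by
        rw [← div_eq_mul_inv, div_le_iff₀ (by positivity)]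
        linarith
  obtain ⟨q, hq1, hup, hlow⟩ := exists_sieve_bounds (Ω := fun i => ZMod (N i)) (N := N) (k := k)
    (J := J) (R := R) (l := ls) (B := κ) (fun i => ZMod.card (N i))
    (fun i => by have := hND i; omega) (fun i => by have := hND i; omega) hk1 hk.ge hκ0 hls0
    hlR.le hSum (fun j hj => (hrec R p₁ P hp₁ hP _ (hLj j)).2 (hlsR j hj))
    (fun j hj => (hrec R p₁ P hp₁ hP _ (hLj j)).1)
  set co := sieveCoeff N k (stepProfile J ls) R with hco
  have hco1 : ∀ ρ, |co ρ| ≤ 2 ^ k * ∏ i, (ρ i).elim 1 fun _ => 1 / (N i : ℝ) :=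
    abs_sieveCoeff_le (fun n => by
      rw [abs_of_nonneg (stepProfile_nonneg n)]; exact stepProfile_le_two n)
      fun i => (hprime i).out.one_le
  have hco2 : ∀ ρ, co ρ ≠ 0 → ∏ i ∈ univ.filter (fun i => ρ i ≠ none), N i ≤ R :=
    fun ρ h => prod_le_of_sieveCoeff_ne_zero h
  have h1 := hsq P N hinj (fun i => (hmem i).2.1.2) co hco1 hco2 pt
  have h1' := h1.trans (add_le_add_left (mul_le_mul_of_nonneg_right (hup pt hpt) (by positivity)) _)
  have h2 := hprimes P N hinj (fun i => (hmem i).2.1.2) hcop (fun i => (hmem i).1)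
    (fun i => by have := hND i; omega) co hco1 hco2 pt
  have h3 : ∀ c, S * (T * (J + 1) * q / (26214400000 * k) - 1 / k) ≤
      ∑ n ∈ Ioc (R ^ 10) (highEnd l), logWeight (A * l + 1) (decay A l) n *
        ((if (W c * n + 1).Prime then 1 else 0) * sieveSum pt co n ^ 2) := by
    intro c
    refine le_trans (mul_le_mul_of_nonneg_left (sub_le_sub ?_ ?_) hS0.le) (h2 (W c) (hWQ c))
    · have h4 := hlow (fun i d => W c * pt i d + 1)
        (fun i d d' h => hpt i (mul_left_cancel₀ (hWN i c) (add_right_cancel h))) c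
      have h5 : ∀ i, (W c * pt i c + 1 : ZMod (N i)) = 0 := fun i => by
        simp [pt, hWN i c]
      simp only [h5] at h4
      refine le_trans ?_ (mul_le_mul_of_nonneg_left h4 (by positivity))
      calc T * (J + 1) * q / (26214400000 * k) =
            1 * (T / (800000 * k * (J + 1)) * (J + 1) ^ 2 / 32768 * q) := by
            field_simp; norm_num
        _ ≤ W c / ((W c).totient : ℝ) * κ * (ls * (J + 1) ^ 2 / 32768 * q) := by
            gcongr
            exact hWκ c
        _ = _ := by ring
    · calc Q * Real.exp (-l) ≤ Q * (1 / (k * Q)) := by gcongr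
        _ = 1 / k := by field_simp
  have h4 := sum_le_sum fun c (_ : c ∈ (univ : Finset (Fin k))) => h3 c
  rw [sum_const, card_univ, Fintype.card_fin, nsmul_eq_mul, sum_comm] at h4
  have h5 : ∑ n ∈ Ioc (R ^ 10) (highEnd l), ∑ c, logWeight (A * l + 1) (decay A l) n *
        ((if (W c * n + 1).Prime then 1 else 0) * sieveSum pt co n ^ 2) ≤
      m * ∑ n ∈ Ioc (R ^ 10) (highEnd l), logWeight (A * l + 1) (decay A l) n *
        sieveSum pt co n ^ 2 := by
    rw [mul_sum]
    refine sum_le_sum fun n hn => ?_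
    have h6 : (∑ c, if (W c * n + 1).Prime then (1 : ℝ) else 0) ≤ m := by
      rw [sum_boole]
      exact_mod_cast (hcon n (mem_Ioc.1 hn).1).le
    rw [← mul_sum, ← sum_mul, mul_left_comm]
    have := logWeight_nonneg (A * l + 1) (decay A l) n
    exact mul_le_mul_of_nonneg_right h6 (by positivity)
  refine not_weighted_count_le hS0 hT1 hq1 (by exact_mod_cast hm) hJ
    ((le_of_eq ?_).trans (h4.trans (h5.trans (mul_le_mul_of_nonneg_left h1' (Nat.cast_nonneg m)))))
  field_simp

end assembly

end

/-- Maynard–Tao, tuple form: for all `a ≥ 2`, `b ≥ 0`, `m ≥ 1`, there exists `s`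
such that for infinitely many `n`, at least `m` of the numbers
`a ^ (b + 1) * n + 1, …, a ^ (b + s) * n + 1` are prime. -/
theorem maynard_tao_tuple (a b m : ℕ) (ha : 2 ≤ a) (hm : 1 ≤ m) :
    ∃ s : ℕ, {n : ℕ |
      m ≤ ((Finset.Icc 1 s).filter fun j => Nat.Prime (a ^ (b + j) * n + 1)).card}.Infinite := by
  obtain ⟨k, D, h⟩ := eventually_exists_many_primes a b m ha hm
  refine ⟨k, Set.infinite_of_forall_exists_gt fun x => ?_⟩
  obtain ⟨l, ⟨n, hn, hcard⟩, hx, -⟩ := (h.and (eventually_sieveLevel (x + 1) 1)).exists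
  refine ⟨D.factorial * n, hcard.trans ?_, ?_⟩
  · refine Finset.card_le_card_of_injOn (fun c => (c : ℕ) + 1) (fun c hc => ?_) fun c _ d _ hcd => ?_
    · have hc' := (Finset.mem_filter.1 hc).2
      rw [mul_assoc] at hc'
      exact Finset.mem_filter.2 ⟨Finset.mem_Icc.2 ⟨by simp, c.2⟩, hc'⟩
    · exact Fin.ext (Nat.succ_injective hcd)
  · calc x < sieveLevel l := hx
      _ ≤ sieveLevel l ^ 10 := Nat.le_self_pow (by norm_num) _
      _ ≤ n := hn.le
      _ ≤ D.factorial * n := Nat.le_mul_of_pos_left n D.factorial_pos
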